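/- Let f ∈ K(z) be a rational function of degree d > 1 having no potentially good reductions and let g ∈ K(z) be a rational function of degree > 0. Then there exists a Radon probability measure μ_f on P^1_Berk(K) (the equilibrium measure of f) such that: (i) for every a ∈ P^1(K) \ E(f), the probability measures d^{-m}·(f^m)^*δ_a converge weakly to μ_f on P^1_Berk(K) as m → ∞; and (ii) the probability measures [f^n = g]/(d^n + deg g) converge weakly to μ_f on P^1_Berk(K) as n → ∞. -/

import Mathlib

open scoped Classical

open Polynomial Filter MeasureTheory Topology

variable (K : Type*) [NontriviallyNormedField K] [IsAlgClosed K] [CompleteSpace K]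
  [IsUltrametricDist K]

/-- The degree of a rational function: max of degrees of numerator and denominator. -/
noncomputable def rdeg (h : RatFunc K) : ℕ := max h.num.natDegree h.denom.natDegree

/-- Canonical homogeneous coordinates of a point of `P^1(K) = K ∪ {∞}`. -/
noncomputable def homCoord : OnePoint K → K × K :=
  OnePoint.rec (1, 0) (fun a => (a, 1))

/-- The (normalized) chordal metric on `P^1(K)`:
`[z,w] = |z0*w1 - z1*w0| / (max(|z0|,|z1|) * max(|w0|,|w1|))`. -/
noncomputable def chordal (x y : OnePoint K) : ℝ :=
  ‖(homCoord K x).1 * (homCoord K y).2 - (homCoord K x).2 * (homCoord K y).1‖ /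
    (max ‖(homCoord K x).1‖ ‖(homCoord K x).2‖ * max ‖(homCoord K y).1‖ ‖(homCoord K y).2‖)

/-- The action of a rational function on the projective line `P^1(K) = K ∪ {∞}`. -/
noncomputable def evalP1 (h : RatFunc K) : OnePoint K → OnePoint K :=
  OnePoint.rec
    (if h.denom.natDegree < h.num.natDegree then OnePoint.infty
      else ((h.num.coeff h.denom.natDegree / h.denom.leadingCoeff : K) : OnePoint K))
    (fun a => if h.denom.eval a = 0 then OnePoint.infty
      else ((h.num.eval a / h.denom.eval a : K) : OnePoint K))

/-- Composition of rational functions. -/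
noncomputable def rcomp (f g : RatFunc K) : RatFunc K :=
  RatFunc.eval (algebraMap K (RatFunc K)) g f

/-- Iterates of a rational function, as rational functions. -/
noncomputable def riter (f : RatFunc K) : ℕ → RatFunc K
  | 0 => RatFunc.X
  | n + 1 => rcomp K f (riter f n)

/-- The ring of `K`-integers. -/
noncomputable def intRing : Subring K where
  carrier := {x : K | ‖x‖ ≤ 1}
  mul_mem' := by
    intro a b ha hb
    simp only [Set.mem_setOf_eq, norm_mul] at *
    exact mul_le_one₀ ha (norm_nonneg _) hb
  one_mem' := by simp
  add_mem' := by
    intro a b ha hb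
    exact le_trans (IsUltrametricDist.norm_add_le_max a b) (max_le ha hb)
  zero_mem' := by simp
  neg_mem' := by
    intro a ha
    simpa using ha

/-- The maximal ideal `m_K = {x : ‖x‖ < 1}` of the ring of `K`-integers. -/
noncomputable def maxIdeal : Ideal (intRing K) where
  carrier := {x | ‖(x : K)‖ < 1}
  add_mem' := by
    intro a b ha hb
    exact lt_of_le_of_lt (IsUltrametricDist.norm_add_le_max (a : K) (b : K)) (max_lt ha hb)
  zero_mem' := by simp
  smul_mem' := by
    intro c x hx
    simp only [Set.mem_setOf_eq, smul_eq_mul, Subring.coe_mul, norm_mul] at *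
    calc ‖(c : K)‖ * ‖(x : K)‖ ≤ 1 * ‖(x : K)‖ :=
          mul_le_mul_of_nonneg_right c.2 (norm_nonneg _)
      _ = ‖(x : K)‖ := one_mul _
      _ < 1 := hx

/-- The residue field `k = O_K / m_K` (as a quotient ring). -/
noncomputable abbrev residueRing := intRing K ⧸ maxIdeal K

/-- A polynomial with `K`-integral coefficients, viewed as a polynomial over `K`. -/
noncomputable def toK : Polynomial (intRing K) → Polynomial K :=
  Polynomial.map (intRing K).subtype

/-- Reduction of a polynomial with `K`-integral coefficients modulo the maximal ideal. -/
noncomputable def redPoly : Polynomial (intRing K) → Polynomial (residueRing K) :=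
  Polynomial.map (Ideal.Quotient.mk (maxIdeal K))

/-- `(P, Q)` is a normalized (non-degenerate homogeneous) lift of the rational function `h`:
all coefficients are `K`-integers, at least one coefficient has absolute value `1`,
`h = P/Q`, `P` and `Q` are coprime, and `max (deg P) (deg Q) = deg h`. -/
def IsNormalizedLift (h : RatFunc K) (P Q : Polynomial (intRing K)) : Prop :=
  toK K Q ≠ 0 ∧ IsCoprime (toK K P) (toK K Q) ∧
    max (toK K P).natDegree (toK K Q).natDegree = rdeg K h ∧
    h * algebraMap (Polynomial K) (RatFunc K) (toK K Q) =
      algebraMap (Polynomial K) (RatFunc K) (toK K P) ∧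
    ∃ i : ℕ, ‖(P.coeff i : K)‖ = 1 ∨ ‖(Q.coeff i : K)‖ = 1

/-- The reduction modulo `m_K` of the (normalized lift `(P,Q)` of a) rational function of
degree `d` has degree `< d`: after reducing the pair of coefficients, either the reduced
pair has a common factor, or both reduced degrees drop (a common factor at infinity). -/
def ReductionDegreeDrops (P Q : Polynomial (intRing K)) (d : ℕ) : Prop :=
  ¬ IsCoprime (redPoly K P) (redPoly K Q) ∨
    ((redPoly K P).natDegree < d ∧ (redPoly K Q).natDegree < d)

/-- `f` has no potentially good reductions: for every Möbius conjugation
`φ ∘ f ∘ φ⁻¹` of `f`, the degree of the reduction modulo `m_K` drops below `deg f`. -/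
def NoPotentiallyGoodReductions (f : RatFunc K) : Prop :=
  ∀ φ ψ : RatFunc K, rdeg K φ = 1 → rdeg K ψ = 1 → rcomp K φ ψ = RatFunc.X →
    ∀ P Q : Polynomial (intRing K),
      IsNormalizedLift K (rcomp K (rcomp K φ f) ψ) P Q →
        ReductionDegreeDrops K P Q (rdeg K f)

/-- The exceptional set `E(f) = {a : ⋃_{n ≥ 0} f⁻ⁿ(a) is finite}`. -/
def exceptionalSet (f : RatFunc K) : Set (OnePoint K) :=
  {a | Set.Finite {b : OnePoint K | ∃ n : ℕ, (evalP1 K f)^[n] b = a}}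

/-- The Berkovich affine line `A^1(K)`: multiplicative seminorms on `K[z]`
whose restriction to `K` is the absolute value of `K`. -/
structure BerkA1 where
  /-- the seminorm, as a function on polynomials -/
  toFun : Polynomial K → ℝ
  nonneg' : ∀ p, 0 ≤ toFun p
  map_mul' : ∀ p q, toFun (p * q) = toFun p * toFun q
  add_le' : ∀ p q, toFun (p + q) ≤ toFun p + toFun q
  restricts' : ∀ c : K, toFun (Polynomial.C c) = ‖c‖

/-- The topology of pointwise convergence on the Berkovich affine line. -/
instance : TopologicalSpace (BerkA1 K) :=
  TopologicalSpace.induced BerkA1.toFun Pi.topologicalSpace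

/-- The Berkovich projective line `P^1_Berk(K)`, the one-point compactification of the
Berkovich affine line. -/
abbrev BerkP1 := OnePoint (BerkA1 K)

/-- The evaluation seminorm `p ↦ ‖p(a)‖` attached to a classical point `a ∈ K`. -/
noncomputable def evalSeminorm (a : K) : BerkA1 K where
  toFun p := ‖p.eval a‖
  nonneg' p := norm_nonneg _
  map_mul' p q := by simp [norm_mul]
  add_le' p q := by simpa using norm_add_le (p.eval a) (q.eval a)
  restricts' c := by simp

/-- The canonical embedding of the classical projective line `P^1(K) = K ∪ {∞}`
into the Berkovich projective line. -/
noncomputable def iota : OnePoint K → BerkP1 K :=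
  OnePoint.map (evalSeminorm K)

noncomputable instance : MeasurableSpace (BerkP1 K) := borel _

instance : BorelSpace (BerkP1 K) := ⟨rfl⟩

/-- The support of a measure: points all of whose open neighborhoods have positive measure. -/
def msupport (μ : Measure (BerkP1 K)) : Set (BerkP1 K) :=
  {x | ∀ U : Set (BerkP1 K), IsOpen U → x ∈ U → 0 < μ U}

/-- Weak convergence of a sequence of measures on the Berkovich projective line:
integrals of every continuous real-valued function converge. -/
def WeakTendsto (μs : ℕ → Measure (BerkP1 K)) (μ : Measure (BerkP1 K)) : Prop :=
  ∀ φ : C(BerkP1 K, ℝ),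
    Tendsto (fun n => ∫ x, φ x ∂(μs n)) atTop (𝓝 (∫ x, φ x ∂μ))

/-- resultant-style polynomial whose roots (in the affine chart) are the solutions of `f = g`. -/
noncomputable def eqPoly (f g : RatFunc K) : Polynomial K :=
  f.num * g.denom - g.num * f.denom

/-- The multiplicity `ord_a [f = g]` of `a ∈ P^1(K)` as a root of the equation `f = g`;
at `∞` it is the degree deficiency `(deg f + deg g) - deg (eqPoly f g)`. -/
noncomputable def ordEq (f g : RatFunc K) : OnePoint K → ℕ :=
  OnePoint.rec ((rdeg K f + rdeg K g) - (eqPoly K f g).natDegree)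
    (fun a => (eqPoly K f g).rootMultiplicity a)

/-- The multiplicity `deg_b(f)` of `b` as a solution of the equation `f(z) = a`. -/
noncomputable def ordPull (f : RatFunc K) : OnePoint K → OnePoint K → ℕ :=
  OnePoint.rec
    (OnePoint.rec (rdeg K f - f.denom.natDegree) (fun b => f.denom.rootMultiplicity b))
    (fun x => ordEq K f (RatFunc.C x))

/-- The measure `[f = g] = Σ_a ord_a[f = g]·δ_a` on the Berkovich projective line. -/
noncomputable def eqMeasure (f g : RatFunc K) : Measure (BerkP1 K) :=
  Measure.sum fun a : OnePoint K => (ordEq K f g a : ENNReal) • Measure.dirac (iota K a)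

/-- The pullback measure `f^*δ_a = Σ_b deg_b(f)·δ_b` on the Berkovich projective line. -/
noncomputable def pullMeasure (f : RatFunc K) (a : OnePoint K) : Measure (BerkP1 K) :=
  Measure.sum fun b : OnePoint K => (ordPull K f a b : ENNReal) • Measure.dirac (iota K b)

set_option linter.all false

/-! ## Gauss norms -/
namespace EQ

section Gauss
variable {𝕜 : Type*} [NontriviallyNormedField 𝕜] [IsUltrametricDist 𝕜]

variable (𝕜) in
noncomputable def nv : AbsoluteValue 𝕜 ℝ := NormedField.toAbsoluteValue 𝕜

@[simp] theorem nv_apply (x : 𝕜) : nv 𝕜 x = ‖x‖ := rfl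

theorem nv_na : IsNonarchimedean (nv 𝕜) := fun x y => IsUltrametricDist.norm_add_le_max x y

/-- Gauss norm on the closed disc `D(a,s)`. -/
noncomputable def gn (a : 𝕜) (s : ℝ) (P : 𝕜[X]) : ℝ := gaussNorm (nv 𝕜) s (taylor a P)

theorem gn_nonneg (a : 𝕜) {s : ℝ} (hs : 0 < s) (P : 𝕜[X]) : 0 ≤ gn a s P :=
  gaussNorm_nonneg _ _ hs.le

theorem gn_mul (a : 𝕜) {s : ℝ} (hs : 0 < s) (P Q : 𝕜[X]) :
    gn a s (P * Q) = gn a s P * gn a s Q := by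
  rw [gn, taylor_mul, gaussNorm_mul nv_na hs]; rfl

theorem gn_eq_zero (a : 𝕜) {s : ℝ} (hs : 0 < s) {P : 𝕜[X]} : gn a s P = 0 ↔ P = 0 := by
  rw [gn, gaussNorm_eq_zero_iff _ _ (fun x hx => (AbsoluteValue.eq_zero _).mp hx) hs]
  exact map_eq_zero_iff _ (taylor_injective a)

theorem gn_pos (a : 𝕜) {s : ℝ} (hs : 0 < s) {P : 𝕜[X]} (hP : P ≠ 0) : 0 < gn a s P :=
  lt_of_le_of_ne (gn_nonneg a hs P) (fun h => hP ((gn_eq_zero a hs).1 h.symm))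

theorem gn_add_le (a : 𝕜) {s : ℝ} (hs : 0 < s) (P Q : 𝕜[X]) :
    gn a s (P + Q) ≤ max (gn a s P) (gn a s Q) := by
  rw [gn, map_add]; exact isNonarchimedean_gaussNorm _ nv_na hs.le _ _

@[simp] theorem gn_C (a : 𝕜) (s : ℝ) (c : 𝕜) : gn a s (C c) = ‖c‖ := by
  simp [gn]

@[simp] theorem gn_one (a : 𝕜) (s : ℝ) : gn a s (1 : 𝕜[X]) = 1 := by
  simpa using gn_C a s 1

@[simp] theorem gn_zero (a : 𝕜) (s : ℝ) : gn a s (0 : 𝕜[X]) = 0 := by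
  simp [gn]

theorem gn_neg (a : 𝕜) {s : ℝ} (hs : 0 < s) (P : 𝕜[X]) : gn a s (-P) = gn a s P := by
  have : -P = C (-1) * P := by simp
  rw [this, gn_mul a hs, gn_C]; simp

theorem gn_sub_le (a : 𝕜) {s : ℝ} (hs : 0 < s) (P Q : 𝕜[X]) :
    gn a s (P - Q) ≤ max (gn a s P) (gn a s Q) := by
  rw [sub_eq_add_neg, ← gn_neg a hs Q]; exact gn_add_le a hs _ _

theorem gn_pow (a : 𝕜) {s : ℝ} (hs : 0 < s) (P : 𝕜[X]) (n : ℕ) :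
    gn a s (P ^ n) = gn a s P ^ n := by
  induction n with
  | zero => simp
  | succ n ih => rw [pow_succ, gn_mul a hs, ih, pow_succ]

theorem le_gn (a : 𝕜) {s : ℝ} (hs : 0 < s) (P : 𝕜[X]) (i : ℕ) :
    ‖(taylor a P).coeff i‖ * s ^ i ≤ gn a s P :=
  le_gaussNorm (nv 𝕜) _ hs.le i

theorem exists_gn (a : 𝕜) (s : ℝ) (P : 𝕜[X]) :
    ∃ i, gn a s P = ‖(taylor a P).coeff i‖ * s ^ i :=
  exists_eq_gaussNorm (nv 𝕜) s (taylor a P)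

theorem gn_X_sub_C (a : 𝕜) {s : ℝ} (hs : 0 < s) (r : 𝕜) :
    gn a s (X - C r) = max ‖a - r‖ s := by
  have ht : taylor a (X - C r) = X + C (a - r) := by
    simp [taylor_X]; ring
  apply le_antisymm
  · have h := gn_add_le a hs (X - C a) (C (a - r))
    have e : (X - C a) + C (a - r) = X - C r := by simp
    rw [e] at h
    refine h.trans (max_le ?_ (by rw [gn_C]; exact le_max_left _ _))
    refine le_max_of_le_right ?_
    have : taylor a (X - C a) = monomial 1 1 := by simp [taylor_X, monomial_one_one_eq_X]
    rw [gn, this, gaussNorm_monomial]; simp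
  · refine max_le ?_ ?_
    · have := le_gn a hs (X - C r) 0
      rw [ht] at this; simpa using this
    · have := le_gn a hs (X - C r) 1
      rw [ht] at this
      simpa [coeff_C] using this

theorem gn_multiset_prod (a : 𝕜) {s : ℝ} (hs : 0 < s) (m : Multiset 𝕜[X]) :
    gn a s m.prod = (m.map (gn a s)).prod := by
  induction m using Multiset.induction_on with
  | empty => simp
  | cons p m ih => simp [gn_mul a hs, ih]

/-- A product formula for the Gauss norm. -/
theorem gn_eq_prod [IsAlgClosed 𝕜] (a : 𝕜) {s : ℝ} (hs : 0 < s) (P : 𝕜[X]) :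
    gn a s P = ‖P.leadingCoeff‖ * (P.roots.map fun r => max ‖a - r‖ s).prod := by
  conv_lhs => rw [(IsAlgClosed.splits P).eq_prod_roots]
  rw [gn_mul a hs, gn_C, gn_multiset_prod a hs, Multiset.map_map]
  congr 2
  refine Multiset.map_congr rfl fun r _ => ?_
  exact gn_X_sub_C a hs r

theorem gn_center {a b : 𝕜} {s : ℝ} (hs : 0 < s) (h : ‖a - b‖ ≤ s) (P : 𝕜[X]) [IsAlgClosed 𝕜] :
    gn a s P = gn b s P := by
  rw [gn_eq_prod a hs, gn_eq_prod b hs]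
  congr 2
  refine Multiset.map_congr rfl fun r _ => ?_
  have h1 : ‖a - r‖ ≤ max ‖a - b‖ ‖b - r‖ := by
    simpa using IsUltrametricDist.norm_add_le_max (a - b) (b - r)
  have h2 : ‖b - r‖ ≤ max ‖a - b‖ ‖a - r‖ := by
    have := IsUltrametricDist.norm_add_le_max (b - a) (a - r)
    rw [norm_sub_rev b a] at this; simpa using this
  apply le_antisymm
  · exact max_le (h1.trans (max_le (h.trans (le_max_right _ _)) (le_max_left _ _))) (le_max_right _ _)
  · exact max_le (h2.trans (max_le (h.trans (le_max_right _ _)) (le_max_left _ _))) (le_max_right _ _)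

/-- the Gauss norm dominates values on the disc. -/
theorem eval_le_gn (a : 𝕜) {s : ℝ} (hs : 0 < s) (P : 𝕜[X]) [IsAlgClosed 𝕜] {z : 𝕜}
    (hz : ‖a - z‖ ≤ s) : ‖P.eval z‖ ≤ gn a s P := by
  rw [gn_center hs hz]
  have := le_gn z hs P 0
  simpa [taylor_coeff_zero] using this

theorem gn_mono (a : 𝕜) {s t : ℝ} (hs : 0 < s) (hst : s ≤ t) (P : 𝕜[X]) : gn a s P ≤ gn a t P := by
  obtain ⟨i, hi⟩ := exists_gn a s P
  rw [hi]
  refine le_trans ?_ (le_gn a (hs.trans_le hst) P i)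
  gcongr

theorem gn_le_mul (a : 𝕜) {s t : ℝ} (hs : 0 < s) (hst : s ≤ t) (P : 𝕜[X]) {D : ℕ}
    (hD : P.natDegree ≤ D) : gn a t P ≤ (t / s) ^ D * gn a s P := by
  obtain ⟨i, hi⟩ := exists_gn a t P
  have ht := hs.trans_le hst
  by_cases h0 : (taylor a P).coeff i = 0
  · rw [hi, h0]; simp; have := gn_nonneg a hs P; positivity
  have hiD : i ≤ D := by
    refine le_trans ?_ hD
    rw [← natDegree_taylor P a]
    exact le_natDegree_of_ne_zero h0
  have h1 : (1:ℝ) ≤ t / s := by rw [one_le_div hs]; exact hst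
  calc gn a t P = (t / s) ^ i * (‖(taylor a P).coeff i‖ * s ^ i) := by
        rw [hi, div_pow]; field_simp
    _ ≤ (t / s) ^ D * gn a s P := by
        have := le_gn a hs P i
        have := pow_le_pow_right₀ h1 hiD
        gcongr

end Gauss

/-! ## Norms on rational functions -/
section Rat
variable {𝕜 : Type*} [NontriviallyNormedField 𝕜] [IsUltrametricDist 𝕜]

/-- Gauss norm on rational functions. -/
noncomputable def GN (a : 𝕜) (s : ℝ) (h : RatFunc 𝕜) : ℝ := gn a s h.num / gn a s h.denom

theorem GN_div (a : 𝕜) {s : ℝ} (hs : 0 < s) (p : 𝕜[X]) {q : 𝕜[X]} (hq : q ≠ 0) :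
    GN a s (algebraMap _ (RatFunc 𝕜) p / algebraMap _ (RatFunc 𝕜) q) = gn a s p / gn a s q := by
  set x := algebraMap _ (RatFunc 𝕜) p / algebraMap _ (RatFunc 𝕜) q with hx
  have h := (RatFunc.num_mul_eq_mul_denom_iff hq (x := x)).2 hx
  rw [GN, div_eq_div_iff (gn_pos a hs x.denom_ne_zero).ne' (gn_pos a hs hq).ne',
    ← gn_mul a hs, ← gn_mul a hs, h]

theorem GN_alg (a : 𝕜) {s : ℝ} (hs : 0 < s) (p : 𝕜[X]) :
    GN a s (algebraMap _ (RatFunc 𝕜) p) = gn a s p := by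
  have := GN_div a hs p (one_ne_zero)
  simpa using this

/-- A non-archimedean absolute value on `𝕜(z)` extending that of `𝕜`, with attained distances
to constants. -/
structure NAbs (N : RatFunc 𝕜 → ℝ) : Prop where
  nonneg : ∀ x, 0 ≤ N x
  map_mul : ∀ x y, N (x * y) = N x * N y
  add_le : ∀ x y, N (x + y) ≤ max (N x) (N y)
  map_C : ∀ c : 𝕜, N (RatFunc.C c) = ‖c‖
  eq_zero : ∀ x, N x = 0 → x = 0
  att : ∀ x, ∃ c₀ : 𝕜, ∀ c : 𝕜, N (x - RatFunc.C c₀) ≤ N (x - RatFunc.C c)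

theorem GN_mul (a : 𝕜) {s : ℝ} (hs : 0 < s) (x y : RatFunc 𝕜) :
    GN a s (x * y) = GN a s x * GN a s y := by
  conv_lhs => rw [← RatFunc.num_div_denom x, ← RatFunc.num_div_denom y, div_mul_div_comm,
    ← map_mul, ← map_mul, GN_div a hs _ (mul_ne_zero x.denom_ne_zero y.denom_ne_zero),
    gn_mul a hs, gn_mul a hs]
  rw [GN, GN, div_mul_div_comm]

theorem GN_nonneg (a : 𝕜) {s : ℝ} (hs : 0 < s) (x : RatFunc 𝕜) : 0 ≤ GN a s x :=
  div_nonneg (gn_nonneg a hs _) (gn_nonneg a hs _)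

theorem GN_add_le (a : 𝕜) {s : ℝ} (hs : 0 < s) (x y : RatFunc 𝕜) :
    GN a s (x + y) ≤ max (GN a s x) (GN a s y) := by
  have hx := x.denom_ne_zero
  have hy := y.denom_ne_zero
  have hx' := gn_pos a hs hx
  have hy' := gn_pos a hs hy
  have e : x + y = algebraMap _ (RatFunc 𝕜) (x.num * y.denom + x.denom * y.num) /
      algebraMap _ (RatFunc 𝕜) (x.denom * y.denom) := by
    conv_lhs => rw [← RatFunc.num_div_denom x, ← RatFunc.num_div_denom y]
    rw [div_add_div _ _ (by simpa using hx) (by simpa using hy)]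
    simp
  rw [e, GN_div a hs _ (mul_ne_zero hx hy), gn_mul a hs, div_le_iff₀ (by positivity)]
  refine (gn_add_le a hs _ _).trans (max_le ?_ ?_)
  · rw [gn_mul a hs]
    have : gn a s x.num = GN a s x * gn a s x.denom := by rw [GN, div_mul_cancel₀ _ hx'.ne']
    rw [this, mul_assoc]
    gcongr; exact le_max_left _ _
  · rw [gn_mul a hs]
    have : gn a s y.num = GN a s y * gn a s y.denom := by rw [GN, div_mul_cancel₀ _ hy'.ne']
    rw [this, mul_left_comm]
    gcongr; exact le_max_right _ _

/-- (ATT) orthogonality: the leading Gauss coefficient of `B` gives a best approximation. -/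
theorem gn_att (a : 𝕜) {s : ℝ} (hs : 0 < s) (A : 𝕜[X]) {B : 𝕜[X]} (hB : B ≠ 0) :
    ∃ c₀ : 𝕜, ∀ c : 𝕜, ‖c₀ - c‖ * gn a s B ≤ gn a s (A - C c * B) := by
  obtain ⟨i, hi⟩ := exists_gn a s B
  have hpos := gn_pos a hs hB
  have hne : (taylor a B).coeff i ≠ 0 := by
    intro h; rw [hi, h] at hpos; simp at hpos
  refine ⟨(taylor a A).coeff i / (taylor a B).coeff i, fun c => ?_⟩
  refine le_trans (le_of_eq ?_) (le_gn a hs _ i)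
  rw [hi, map_sub, taylor_mul, taylor_C, coeff_sub, coeff_C_mul, ← mul_assoc, ← norm_mul]
  congr 2
  field_simp

theorem gn_att' (a : 𝕜) {s : ℝ} (hs : 0 < s) (A : 𝕜[X]) {B : 𝕜[X]} (hB : B ≠ 0) :
    ∃ c₀ : 𝕜, ∀ c : 𝕜, gn a s (A - C c * B) = max (gn a s (A - C c₀ * B)) (‖c₀ - c‖ * gn a s B) := by
  obtain ⟨c₀, h⟩ := gn_att a hs A hB
  refine ⟨c₀, fun c => ?_⟩
  have e : A - C c * B = (A - C c₀ * B) + C (c₀ - c) * B := by rw [C_sub]; ring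
  have e' : A - C c₀ * B = (A - C c * B) - C (c₀ - c) * B := by rw [C_sub]; ring
  have h2 : gn a s (C (c₀ - c) * B) = ‖c₀ - c‖ * gn a s B := by rw [gn_mul a hs, gn_C]
  apply le_antisymm
  · conv_lhs => rw [e]
    rw [← h2]; exact gn_add_le a hs _ _
  · refine max_le ?_ (h c)
    conv_lhs => rw [e']
    refine (gn_sub_le a hs _ _).trans (max_le le_rfl ?_)
    rw [h2]; exact h c

theorem sub_C_eq (x : RatFunc 𝕜) (c : 𝕜) : x - RatFunc.C c =
    algebraMap _ (RatFunc 𝕜) (x.num - C c * x.denom) / algebraMap _ (RatFunc 𝕜) x.denom := by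
  have hx : algebraMap _ (RatFunc 𝕜) x.denom ≠ 0 := by simpa using x.denom_ne_zero
  rw [map_sub, map_mul, sub_div, mul_div_assoc, div_self hx, RatFunc.num_div_denom, RatFunc.algebraMap_C,
    mul_one]

theorem GN_sub_C (a : 𝕜) {s : ℝ} (hs : 0 < s) (x : RatFunc 𝕜) (c : 𝕜) :
    GN a s (x - RatFunc.C c) = gn a s (x.num - C c * x.denom) / gn a s x.denom := by
  rw [sub_C_eq, GN_div a hs _ x.denom_ne_zero]

theorem GN_C (a : 𝕜) {s : ℝ} (hs : 0 < s) (c : 𝕜) : GN a s (RatFunc.C c) = ‖c‖ := by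
  rw [← RatFunc.algebraMap_C, GN_alg a hs, gn_C]

theorem GN_nabs (a : 𝕜) {s : ℝ} (hs : 0 < s) : NAbs (GN a s) where
  nonneg := GN_nonneg a hs
  map_mul := GN_mul a hs
  add_le := GN_add_le a hs
  map_C := GN_C a hs
  eq_zero x h := by
    rw [GN, div_eq_zero_iff] at h
    rcases h with h | h
    · exact RatFunc.num_eq_zero_iff.1 ((gn_eq_zero a hs).1 h)
    · exact absurd ((gn_eq_zero a hs).1 h) x.denom_ne_zero
  att x := by
    obtain ⟨c₀, h⟩ := gn_att' a hs x.num x.denom_ne_zero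
    refine ⟨c₀, fun c => ?_⟩
    rw [GN_sub_C a hs, GN_sub_C a hs, h c]
    gcongr
    · exact gn_nonneg a hs _
    · exact le_max_left _ _

end Rat
end EQ

/-! ## Substitution and the closeness relation -/
namespace EQ

section Ev
variable {𝕜 : Type*} [Field 𝕜]

/-- composition of rational functions -/
noncomputable def ev (h α : RatFunc 𝕜) : RatFunc 𝕜 := RatFunc.eval (algebraMap 𝕜 (RatFunc 𝕜)) α h

/-- polynomial substitution -/
noncomputable def pev (p : 𝕜[X]) (α : RatFunc 𝕜) : RatFunc 𝕜 := p.eval₂ (algebraMap 𝕜 (RatFunc 𝕜)) α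

/-- nonconstant -/
def NC (α : RatFunc 𝕜) : Prop := ∀ c : 𝕜, α ≠ RatFunc.C c

theorem ev_def (h α : RatFunc 𝕜) : ev h α = pev h.num α / pev h.denom α := rfl

theorem pev_mul (p q : 𝕜[X]) (α : RatFunc 𝕜) : pev (p * q) α = pev p α * pev q α := eval₂_mul _ _
theorem pev_C (c : 𝕜) (α : RatFunc 𝕜) : pev (C c) α = RatFunc.C c := by
  rw [pev, eval₂_C, RatFunc.algebraMap_eq_C]
theorem pev_X_sub_C (c : 𝕜) (α : RatFunc 𝕜) : pev (X - C c) α = α - RatFunc.C c := by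
  rw [pev, eval₂_sub, eval₂_C, eval₂_X, RatFunc.algebraMap_eq_C]

theorem pev_multiset_prod (m : Multiset 𝕜[X]) (α : RatFunc 𝕜) :
    pev m.prod α = (m.map fun p => pev p α).prod := by
  induction m using Multiset.induction_on with
  | empty => simp [pev]
  | cons p m ih => simp [pev_mul, ih]

theorem pev_eq_prod [IsAlgClosed 𝕜] (p : 𝕜[X]) (α : RatFunc 𝕜) :
    pev p α = RatFunc.C p.leadingCoeff * (p.roots.map fun r => α - RatFunc.C r).prod := by
  conv_lhs => rw [(IsAlgClosed.splits p).eq_prod_roots]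
  rw [pev_mul, pev_C, pev_multiset_prod, Multiset.map_map]
  congr 2
  refine Multiset.map_congr rfl fun r _ => ?_
  simp [pev_X_sub_C]

theorem pev_ne_zero [IsAlgClosed 𝕜] {p : 𝕜[X]} (hp : p ≠ 0) {α : RatFunc 𝕜} (hα : NC α) :
    pev p α ≠ 0 := by
  rw [pev_eq_prod]
  refine mul_ne_zero (by simpa using hp) ?_
  rw [Ne, Multiset.prod_eq_zero_iff, Multiset.mem_map]
  rintro ⟨r, -, h⟩
  exact hα r (sub_eq_zero.1 h)

variable [IsAlgClosed 𝕜]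

noncomputable def evHom (α : RatFunc 𝕜) (hα : NC α) : RatFunc 𝕜 →+* RatFunc 𝕜 where
  toFun h := ev h α
  map_one' := by simp [ev]
  map_zero' := by simp [ev]
  map_add' x y := RatFunc.eval_add _ _ (pev_ne_zero x.denom_ne_zero hα) (pev_ne_zero y.denom_ne_zero hα)
  map_mul' x y := RatFunc.eval_mul _ _ (pev_ne_zero x.denom_ne_zero hα) (pev_ne_zero y.denom_ne_zero hα)

theorem evHom_apply (α : RatFunc 𝕜) (hα : NC α) (h : RatFunc 𝕜) : evHom α hα h = ev h α := rfl

theorem ev_C (c : 𝕜) (α : RatFunc 𝕜) : ev (RatFunc.C c) α = RatFunc.C c := by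
  simp [ev, RatFunc.algebraMap_eq_C]

theorem ev_X (α : RatFunc 𝕜) : ev RatFunc.X α = α := by
  simp [ev]

theorem ev_alg (p : 𝕜[X]) (α : RatFunc 𝕜) : ev (algebraMap _ _ p) α = pev p α := by
  rw [ev, RatFunc.eval_algebraMap]; rfl

theorem ev_sub {α : RatFunc 𝕜} (hα : NC α) (x y : RatFunc 𝕜) : ev (x - y) α = ev x α - ev y α :=
  map_sub (evHom α hα) x y

theorem ev_sub_C {α : RatFunc 𝕜} (hα : NC α) (x : RatFunc 𝕜) (c : 𝕜) :
    ev (x - RatFunc.C c) α = ev x α - RatFunc.C c := by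
  rw [ev_sub hα, ev_C]

theorem ev_mul {α : RatFunc 𝕜} (hα : NC α) (x y : RatFunc 𝕜) : ev (x * y) α = ev x α * ev y α :=
  map_mul (evHom α hα) x y

theorem ev_div {α : RatFunc 𝕜} (hα : NC α) (x y : RatFunc 𝕜) : ev (x / y) α = ev x α / ev y α :=
  map_div₀ (evHom α hα) x y

theorem ev_NC {h α : RatFunc 𝕜} (hh : NC h) (hα : NC α) : NC (ev h α) := by
  intro c hc
  have h1 : evHom α hα (h - RatFunc.C c) = 0 := by
    rw [evHom_apply, ev_sub_C hα, hc, sub_self]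
  rw [map_eq_zero] at h1
  exact hh c (sub_eq_zero.1 h1)

theorem ev_inj {h h' α : RatFunc 𝕜} (hα : NC α) (e : ev h α = ev h' α) : h = h' :=
  (evHom α hα).injective e

theorem pev_ev (p : 𝕜[X]) (h : RatFunc 𝕜) {α : RatFunc 𝕜} (hα : NC α) :
    ev (pev p h) α = pev p (ev h α) := by
  change evHom α hα (pev p h) = _
  rw [pev, hom_eval₂]
  rw [pev]
  congr 1
  ext c
  simp only [RingHom.comp_apply, RatFunc.algebraMap_eq_C]
  exact ev_C c α

theorem ev_assoc (h k : RatFunc 𝕜) {α : RatFunc 𝕜} (hα : NC α) :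
    ev (ev h k) α = ev h (ev k α) := by
  rw [ev_def h k, ev_div hα, pev_ev _ _ hα, pev_ev _ _ hα]; rfl

theorem NC_X : NC (RatFunc.X : RatFunc 𝕜) := by
  intro c h
  rw [← RatFunc.algebraMap_X, ← RatFunc.algebraMap_C] at h
  exact X_ne_C c (RatFunc.algebraMap_injective 𝕜 h)

end Ev

section Rel
variable {𝕜 : Type*} [NontriviallyNormedField 𝕜] [IsUltrametricDist 𝕜]
variable {N : RatFunc 𝕜 → ℝ}

namespace NAbs

theorem map_one (hN : NAbs N) : N 1 = 1 := by
  have := hN.map_C 1; simpa using this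

theorem map_zero (hN : NAbs N) : N 0 = 0 := by
  have := hN.map_C 0; simpa using this

theorem map_neg (hN : NAbs N) (x : RatFunc 𝕜) : N (-x) = N x := by
  have h : -x = RatFunc.C (-1) * x := by simp
  rw [h, hN.map_mul, hN.map_C]; simp

theorem sub_le (hN : NAbs N) (x y : RatFunc 𝕜) : N (x - y) ≤ max (N x) (N y) := by
  rw [sub_eq_add_neg, ← hN.map_neg y]; exact hN.add_le _ _

theorem sub_rev (hN : NAbs N) (x y : RatFunc 𝕜) : N (x - y) = N (y - x) := by
  rw [← hN.map_neg, neg_sub]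

theorem pos (hN : NAbs N) {x : RatFunc 𝕜} (hx : x ≠ 0) : 0 < N x :=
  lt_of_le_of_ne (hN.nonneg x) (fun h => hx (hN.eq_zero x h.symm))

theorem map_div (hN : NAbs N) (x y : RatFunc 𝕜) : N (x / y) = N x / N y := by
  by_cases hy : y = 0
  · simp [hy, hN.map_zero]
  rw [eq_div_iff (hN.pos hy).ne', ← hN.map_mul, div_mul_cancel₀ _ hy]

/-- triangle inequality through a middle point -/
theorem tri (hN : NAbs N) (x y z : RatFunc 𝕜) : N (x - z) ≤ max (N (x - y)) (N (y - z)) := by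
  have := hN.add_le (x - y) (y - z)
  simpa using this

theorem eq_of_lt (hN : NAbs N) {x y : RatFunc 𝕜} (h : N (x - y) < N y) : N x = N y := by
  apply le_antisymm
  · have := hN.add_le (x - y) y
    rw [sub_add_cancel, max_eq_right h.le] at this; exact this
  · by_contra hc
    push Not at hc
    have := hN.sub_le x (x - y)
    rw [sub_sub_cancel] at this
    exact absurd this (not_le.2 (max_lt hc h))

end NAbs

/-- distance to the constants -/
noncomputable def dm (N : RatFunc 𝕜 → ℝ) (α : RatFunc 𝕜) : ℝ := ⨅ c : 𝕜, N (α - RatFunc.C c)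

theorem dm_le (hN : NAbs N) (α : RatFunc 𝕜) (c : 𝕜) : dm N α ≤ N (α - RatFunc.C c) :=
  ciInf_le ⟨0, by rintro _ ⟨c, rfl⟩; exact hN.nonneg _⟩ c

theorem exists_dm (hN : NAbs N) (α : RatFunc 𝕜) : ∃ c : 𝕜, dm N α = N (α - RatFunc.C c) := by
  obtain ⟨c₀, h⟩ := hN.att α
  exact ⟨c₀, le_antisymm (dm_le hN α c₀) (le_ciInf h)⟩

theorem dm_pos (hN : NAbs N) {α : RatFunc 𝕜} (hα : NC α) : 0 < dm N α := by
  obtain ⟨c, h⟩ := exists_dm hN α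
  rw [h]; exact hN.pos (sub_ne_zero.2 (hα c))

theorem dm_nonneg (hN : NAbs N) (α : RatFunc 𝕜) : 0 ≤ dm N α := by
  obtain ⟨c, h⟩ := exists_dm hN α
  rw [h]; exact hN.nonneg _

/-- the closeness relation -/
def Rel (N : RatFunc 𝕜 → ℝ) (α β : RatFunc 𝕜) : Prop := N (α - β) < dm N β

theorem Rel.eq (hN : NAbs N) {α β : RatFunc 𝕜} (h : Rel N α β) (c : 𝕜) :
    N (α - RatFunc.C c) = N (β - RatFunc.C c) := by
  apply hN.eq_of_lt
  rw [sub_sub_sub_cancel_right]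
  exact lt_of_lt_of_le h (dm_le hN β c)

theorem Rel.dm_eq (hN : NAbs N) {α β : RatFunc 𝕜} (h : Rel N α β) : dm N α = dm N β := by
  unfold dm; exact iInf_congr fun c => h.eq hN c

theorem Rel.symm (hN : NAbs N) {α β : RatFunc 𝕜} (h : Rel N α β) : Rel N β α := by
  rw [Rel, hN.sub_rev, h.dm_eq hN]; exact h

theorem Rel.trans (hN : NAbs N) {α β γ : RatFunc 𝕜} (h : Rel N α β) (h' : Rel N β γ) :
    Rel N α γ := by
  refine lt_of_le_of_lt (hN.tri α β γ) (max_lt ?_ h')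
  have := h
  rw [Rel, h'.dm_eq hN] at this; exact this

theorem Rel.refl (hN : NAbs N) {α : RatFunc 𝕜} (hα : NC α) : Rel N α α := by
  rw [Rel, sub_self, hN.map_zero]; exact dm_pos hN hα

theorem Rel.nc (hN : NAbs N) {α β : RatFunc 𝕜} (h : Rel N α β) : NC β := by
  intro c hc
  have := dm_le hN β c
  rw [hc, sub_self, hN.map_zero] at this
  have h' := lt_of_lt_of_le h (hc ▸ this)
  exact absurd (hN.nonneg _) (not_le.2 h')

variable [IsAlgClosed 𝕜]

/-- multiplicative closeness for polynomials -/
theorem pev_close (hN : NAbs N) {α β : RatFunc 𝕜} {t : ℝ} (ht0 : 0 ≤ t) (ht : t < 1)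
    (h : ∀ c : 𝕜, N (α - β) ≤ t * N (β - RatFunc.C c)) (p : 𝕜[X]) :
    N (pev p α - pev p β) ≤ t * N (pev p β) := by
  rw [pev_eq_prod, pev_eq_prod, ← mul_sub, hN.map_mul, hN.map_mul]
  have key : ∀ m : Multiset 𝕜, N ((m.map fun r => α - RatFunc.C r).prod -
      (m.map fun r => β - RatFunc.C r).prod) ≤ t * N ((m.map fun r => β - RatFunc.C r).prod) := by
    intro m
    induction m using Multiset.induction_on with
    | empty => simp [hN.map_zero, hN.map_one, ht0]
    | cons r m ih =>
      rw [Multiset.map_cons, Multiset.map_cons, Multiset.prod_cons, Multiset.prod_cons]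
      set x := (m.map fun r => α - RatFunc.C r).prod
      set y := (m.map fun r => β - RatFunc.C r).prod
      have e : (α - RatFunc.C r) * x - (β - RatFunc.C r) * y =
        (α - β) * x + (β - RatFunc.C r) * (x - y) := by ring
      have hx : N x ≤ N y := by
        have := hN.add_le (x - y) y
        rw [sub_add_cancel] at this
        refine this.trans (max_le (ih.trans ?_) le_rfl)
        have := hN.nonneg y; nlinarith
      rw [e, hN.map_mul (β - RatFunc.C r) y]
      refine (hN.add_le _ _).trans (max_le ?_ ?_)
      · rw [hN.map_mul, ← mul_assoc]
        exact mul_le_mul (h r) hx (hN.nonneg _) (mul_nonneg ht0 (hN.nonneg _))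
      · rw [hN.map_mul, mul_left_comm]
        exact mul_le_mul_of_nonneg_left ih (hN.nonneg _)
  calc _ ≤ N (RatFunc.C p.leadingCoeff) * (t * N ((p.roots.map fun r => β - RatFunc.C r).prod)) :=
        mul_le_mul_of_nonneg_left (key _) (hN.nonneg _)
    _ = _ := by ring

theorem ev_close (hN : NAbs N) {α β : RatFunc 𝕜} (hα : NC α) (hβ : NC β) {t : ℝ} (ht0 : 0 ≤ t)
    (ht : t < 1) (h : ∀ c : 𝕜, N (α - β) ≤ t * N (β - RatFunc.C c)) (R : RatFunc 𝕜) :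
    N (ev R α - ev R β) ≤ t * N (ev R β) := by
  rw [ev_def, ev_def]
  have h1 := pev_close hN ht0 ht h R.num
  have h2 := pev_close hN ht0 ht h R.denom
  set u := pev R.num α
  set u₀ := pev R.num β
  have hv : pev R.denom α ≠ 0 := pev_ne_zero R.denom_ne_zero hα
  have hv0 : pev R.denom β ≠ 0 := pev_ne_zero R.denom_ne_zero hβ
  set v := pev R.denom α
  set v₀ := pev R.denom β
  have hv0p := hN.pos hv0
  have hNv : N v = N v₀ := hN.eq_of_lt (lt_of_le_of_lt h2 (by nlinarith))
  have e : u / v - u₀ / v₀ = ((u - u₀) * v₀ - u₀ * (v - v₀)) / (v * v₀) := by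
    field_simp; ring
  rw [e, hN.map_div, hN.map_mul, hN.map_div, hNv, div_le_iff₀ (by positivity)]
  refine (hN.sub_le _ _).trans (max_le ?_ ?_)
  · rw [hN.map_mul]
    calc _ ≤ t * N u₀ * N v₀ := mul_le_mul_of_nonneg_right h1 hv0p.le
      _ = _ := by field_simp
  · rw [hN.map_mul]
    calc _ ≤ N u₀ * (t * N v₀) := mul_le_mul_of_nonneg_left h2 (hN.nonneg _)
      _ = _ := by field_simp

theorem Rel.ev_le (hN : NAbs N) {α β : RatFunc 𝕜} (h : Rel N α β) (R : RatFunc 𝕜) :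
    N (ev R α - ev R β) * dm N β ≤ N (α - β) * N (ev R β) := by
  have hβ := h.nc hN
  have hα := (h.symm hN).nc hN
  have hd := dm_pos hN hβ
  have := ev_close hN hα hβ (t := N (α - β) / dm N β) (div_nonneg (hN.nonneg _) hd.le)
    ((div_lt_one hd).2 h) (fun c => by
      rw [div_mul_eq_mul_div, le_div_iff₀ hd]
      exact mul_le_mul_of_nonneg_left (dm_le hN β c) (hN.nonneg _)) R
  rwa [div_mul_eq_mul_div, le_div_iff₀ hd] at this

/-- (L2) -/
theorem Rel.ratio_le (hN : NAbs N) {α β : RatFunc 𝕜} (h : Rel N α β) (R : RatFunc 𝕜) :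
    N (ev R α - ev R β) * dm N β ≤ N (α - β) * dm N (ev R β) := by
  have hβ := h.nc hN
  have hα := (h.symm hN).nc hN
  obtain ⟨c, hc⟩ := exists_dm hN (ev R β)
  have := h.ev_le hN (R - RatFunc.C c)
  rwa [ev_sub_C hα, ev_sub_C hβ, sub_sub_sub_cancel_right, ← hc] at this

theorem Rel.ev (hN : NAbs N) {α β : RatFunc 𝕜} (h : Rel N α β) {R : RatFunc 𝕜} (hR : NC R) :
    Rel N (ev R α) (ev R β) := by
  have h1 := h.ratio_le hN R
  have h2 := dm_pos hN (h.nc hN)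
  have h3 := dm_pos hN (ev_NC hR (h.nc hN))
  have h4 : N (α - β) * dm N (EQ.ev R β) < dm N β * dm N (EQ.ev R β) := by
    have : N (α - β) < dm N β := h
    gcongr
  rw [Rel]
  nlinarith

/-- (L3) -/
theorem Rel.iso (hN : NAbs N) {α β φ : RatFunc 𝕜} (h : Rel N α β) (hφ : Rel N (EQ.ev φ β) β) :
    N (EQ.ev φ α - EQ.ev φ β) = N (α - β) := by
  have hβ := h.nc hN
  have hα := (h.symm hN).nc hN
  by_cases hab : α = β
  · subst hab; simp
  have h1 := h.ev_le hN (φ - RatFunc.X)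
  rw [ev_sub hα, ev_sub hβ, ev_X, ev_X] at h1
  have hd := dm_pos hN hβ
  have hp := hN.pos (sub_ne_zero.2 hab)
  apply hN.eq_of_lt
  have e : EQ.ev φ α - EQ.ev φ β - (α - β) = EQ.ev φ α - α - (EQ.ev φ β - β) := by ring
  rw [e]
  have h2 : N (EQ.ev φ β - β) < dm N β := hφ
  have : N (α - β) * N (EQ.ev φ β - β) < N (α - β) * dm N β := by gcongr
  exact lt_of_mul_lt_mul_right (lt_of_le_of_lt h1 this) hd.le

/-- (L4) -/
theorem Rel.le_ratio (hN : NAbs N) {α β h ψ : RatFunc 𝕜} (hr : Rel N α β) (hh : NC h)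
    (hφ : Rel N (EQ.ev ψ (EQ.ev h β)) β) :
    N (α - β) * dm N (EQ.ev h β) ≤ N (EQ.ev h α - EQ.ev h β) * dm N β := by
  have hβ := hr.nc hN
  have hα := (hr.symm hN).nc hN
  have h1 := hr.iso hN (φ := EQ.ev ψ h) (by rw [ev_assoc _ _ hβ]; exact hφ)
  rw [ev_assoc _ _ hβ, ev_assoc _ _ hα] at h1
  have h2 := (hr.ev hN hh).ratio_le hN ψ
  rw [h1, hφ.dm_eq hN] at h2
  exact h2

theorem pev_norm (hN : NAbs N) (p : 𝕜[X]) (α : RatFunc 𝕜) :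
    N (pev p α) = ‖p.leadingCoeff‖ * (p.roots.map fun r => N (α - RatFunc.C r)).prod := by
  rw [pev_eq_prod, hN.map_mul, hN.map_C]
  congr 1
  generalize p.roots = m
  induction m using Multiset.induction_on with
  | empty => simp [hN.map_one]
  | cons r m ih => simp [hN.map_mul, ih]

/-- (L5) -/
theorem ev_norm_congr {N' : RatFunc 𝕜 → ℝ} (hN : NAbs N) (hN' : NAbs N') {α β : RatFunc 𝕜}
    (h : ∀ c : 𝕜, N (α - RatFunc.C c) = N' (β - RatFunc.C c)) (R : RatFunc 𝕜) :
    N (EQ.ev R α) = N' (EQ.ev R β) := by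
  rw [ev_def, ev_def, hN.map_div, hN'.map_div, pev_norm hN, pev_norm hN, pev_norm hN', pev_norm hN']
  simp_rw [h]

end Rel
end EQ

/-! ## Homogeneous pairs -/
namespace EQ

section Pairs
variable {𝕜 : Type*} [Field 𝕜] [IsAlgClosed 𝕜]

/-- homogenised substitution -/
noncomputable def hm (d : ℕ) (R A B : 𝕜[X]) : 𝕜[X] :=
  ∑ i ∈ Finset.range (d + 1), C (R.coeff i) * A ^ i * B ^ (d - i)

theorem hm_alg {d : ℕ} {R : 𝕜[X]} (hR : R.natDegree ≤ d) (A : 𝕜[X]) {B : 𝕜[X]} (hB : B ≠ 0) :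
    algebraMap _ (RatFunc 𝕜) (hm d R A B) = algebraMap _ (RatFunc 𝕜) B ^ d *
      pev R (algebraMap _ (RatFunc 𝕜) A / algebraMap _ (RatFunc 𝕜) B) := by
  have hb : algebraMap _ (RatFunc 𝕜) B ≠ 0 := by simpa using hB
  rw [hm, pev, eval₂_eq_sum_range' _ (Nat.lt_succ_of_le hR), Finset.mul_sum, map_sum]
  refine Finset.sum_congr rfl fun i hi => ?_
  have hi' : i ≤ d := Nat.lt_succ_iff.1 (Finset.mem_range.1 hi)
  obtain ⟨k, rfl⟩ := Nat.exists_eq_add_of_le hi'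
  simp only [map_mul, map_pow, RatFunc.algebraMap_C, RatFunc.algebraMap_eq_C, Nat.add_sub_cancel_left, div_pow]
  field_simp
  ring

/-- the linear form attached to a target -/
noncomputable def lin (c : 𝕜 × 𝕜) (A B : 𝕜[X]) : 𝕜[X] := C c.2 * A - C c.1 * B

/-- coordinates of a point of the projective line -/
noncomputable def hc : OnePoint 𝕜 → 𝕜 × 𝕜 := OnePoint.rec (1, 0) (fun a => (a, 1))

@[simp] theorem hc_infty : hc (OnePoint.infty : OnePoint 𝕜) = (1, 0) := rfl
@[simp] theorem hc_coe (a : 𝕜) : hc (a : OnePoint 𝕜) = (a, 1) := rfl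

theorem lin_infty (A B : 𝕜[X]) : lin (hc OnePoint.infty) A B = - B := by simp [lin]
theorem lin_coe (a : 𝕜) (A B : 𝕜[X]) : lin (hc (a : OnePoint 𝕜)) A B = A - C a * B := by
  simp [lin]

theorem hm_lin (d : ℕ) (c : 𝕜 × 𝕜) (P Q A B : 𝕜[X]) :
    lin c (hm d P A B) (hm d Q A B) = hm d (lin c P Q) A B := by
  simp only [lin, hm, Finset.mul_sum, ← Finset.sum_sub_distrib]
  refine Finset.sum_congr rfl fun i _ => ?_
  simp only [coeff_sub, coeff_C_mul, C_sub, C_mul]; ring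

/-- multiset of projective roots of a form of degree `d` -/
noncomputable def proots (d : ℕ) (R : 𝕜[X]) : Multiset (OnePoint 𝕜) :=
  R.roots.map (fun a : 𝕜 => (a : OnePoint 𝕜)) + Multiset.replicate (d - R.natDegree) OnePoint.infty

theorem card_proots {d : ℕ} {R : 𝕜[X]} (hR : R.natDegree ≤ d) : (proots d R).card = d := by
  rw [proots, Multiset.card_add, Multiset.card_map, Multiset.card_replicate,
    ← (IsAlgClosed.splits R).natDegree_eq_card_roots]
  omega

theorem hm_eq_prod {d : ℕ} {R : 𝕜[X]} (hR : R.natDegree ≤ d) (A : 𝕜[X]) {B : 𝕜[X]} (hB : B ≠ 0) :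
    hm d R A B = C (R.leadingCoeff * (-1) ^ (d - R.natDegree)) *
      ((proots d R).map fun q => lin (hc q) A B).prod := by
  apply RatFunc.algebraMap_injective 𝕜
  have hb : algebraMap _ (RatFunc 𝕜) B ≠ 0 := by simpa using hB
  rw [hm_alg hR A hB, pev_eq_prod, proots, Multiset.map_add, Multiset.prod_add,
    Multiset.map_replicate, Multiset.prod_replicate, Multiset.map_map, lin_infty]
  have e : ∀ m : Multiset 𝕜, algebraMap _ (RatFunc 𝕜)
      ((m.map ((fun q => lin (hc q) A B) ∘ fun a : 𝕜 => (a : OnePoint 𝕜))).prod) =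
      algebraMap _ (RatFunc 𝕜) B ^ m.card *
      (m.map fun r => algebraMap _ (RatFunc 𝕜) A / algebraMap _ (RatFunc 𝕜) B - RatFunc.C r).prod := by
    intro m
    induction m using Multiset.induction_on with
    | empty => simp
    | cons r m ih =>
      rw [Multiset.map_cons, Multiset.prod_cons, map_mul, ih, Multiset.map_cons, Multiset.prod_cons,
        Multiset.card_cons]
      generalize (Multiset.map (fun r => algebraMap _ (RatFunc 𝕜) A / algebraMap _ (RatFunc 𝕜) B - RatFunc.C r) m).prod = T
      simp only [Function.comp, lin_coe, map_sub, map_mul, RatFunc.algebraMap_C]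
      field_simp
      ring
  rw [map_mul (algebraMap 𝕜[X] (RatFunc 𝕜)) (C _), map_mul (algebraMap 𝕜[X] (RatFunc 𝕜)) (Multiset.prod _), e, map_pow, map_neg, RatFunc.algebraMap_C,
    ← (IsAlgClosed.splits R).natDegree_eq_card_roots]
  have h2 : algebraMap _ (RatFunc 𝕜) B ^ d = algebraMap _ (RatFunc 𝕜) B ^ R.natDegree *
      algebraMap _ (RatFunc 𝕜) B ^ (d - R.natDegree) := by
    rw [← pow_add]; congr 1; omega
  rw [h2, map_mul, map_pow, map_neg, map_one, neg_pow (algebraMap _ (RatFunc 𝕜) B)]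
  have h3 : ((-1 : RatFunc 𝕜) ^ (d - R.natDegree)) * (-1) ^ (d - R.natDegree) = 1 := by
    rw [← mul_pow]; simp
  linear_combination (-(RatFunc.C R.leadingCoeff) * algebraMap _ (RatFunc 𝕜) B ^ R.natDegree *
      algebraMap _ (RatFunc 𝕜) B ^ (d - R.natDegree) *
      (Multiset.map (fun r => algebraMap _ (RatFunc 𝕜) A / algebraMap _ (RatFunc 𝕜) B - RatFunc.C r) R.roots).prod) * h3

theorem hm_eval (d : ℕ) (R A B : 𝕜[X]) (z : 𝕜) : (hm d R A B).eval z =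
    ∑ i ∈ Finset.range (d + 1), R.coeff i * A.eval z ^ i * B.eval z ^ (d - i) := by
  simp [hm, eval_finset_sum]

/-- The value of a homogeneous form. -/
noncomputable def hv (d : ℕ) (R : 𝕜[X]) (v : 𝕜 × 𝕜) : 𝕜 :=
  ∑ i ∈ Finset.range (d + 1), R.coeff i * v.1 ^ i * v.2 ^ (d - i)

theorem hv_of_ne {d : ℕ} {R : 𝕜[X]} (hR : R.natDegree ≤ d) {v : 𝕜 × 𝕜} (hv2 : v.2 ≠ 0) :
    hv d R v = v.2 ^ d * R.eval (v.1 / v.2) := by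
  rw [hv, eval_eq_sum_range' (Nat.lt_succ_of_le hR), Finset.mul_sum]
  refine Finset.sum_congr rfl fun i hi => ?_
  have hi' : i ≤ d := Nat.lt_succ_iff.1 (Finset.mem_range.1 hi)
  obtain ⟨k, rfl⟩ := Nat.exists_eq_add_of_le hi'
  simp only [Nat.add_sub_cancel_left, div_pow, pow_add]
  field_simp

theorem hv_of_eq (d : ℕ) (R : 𝕜[X]) {v : 𝕜 × 𝕜} (hv2 : v.2 = 0) :
    hv d R v = R.coeff d * v.1 ^ d := by
  rw [hv, Finset.sum_range_succ, Finset.sum_eq_zero, zero_add, Nat.sub_self, pow_zero, mul_one]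
  intro i hi
  have : d - i ≠ 0 := by have := Finset.mem_range.1 hi; omega
  rw [hv2, zero_pow this, mul_zero]

theorem hv_ne_zero {P Q : 𝕜[X]} (hcp : IsCoprime P Q) {d : ℕ} (hd : max P.natDegree Q.natDegree = d)
    {v : 𝕜 × 𝕜} (hv0 : v ≠ 0) (h1 : hv d P v = 0) (h2 : hv d Q v = 0) : False := by
  have hP : P.natDegree ≤ d := hd ▸ le_max_left _ _
  have hQ : Q.natDegree ≤ d := hd ▸ le_max_right _ _
  by_cases hb : v.2 = 0
  · have ha : v.1 ≠ 0 := fun h => hv0 (Prod.ext h hb)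
    rw [hv_of_eq _ _ hb] at h1 h2
    have h1' : P.coeff d = 0 := by simpa [ha] using h1
    have h2' : Q.coeff d = 0 := by simpa [ha] using h2
    rcases max_choice P.natDegree Q.natDegree with h | h
    · rw [h] at hd
      rw [← hd, coeff_natDegree, leadingCoeff_eq_zero] at h1'
      have hd0 : d = 0 := by rw [← hd, h1']; simp
      have : Q.natDegree = 0 := by omega
      rw [hd0] at h2'
      have : Q = 0 := by rw [eq_C_of_natDegree_eq_zero this, h2', C_0]
      rw [h1', this] at hcp
      exact absurd hcp (by rw [isCoprime_zero_left]; exact not_isUnit_zero)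
    · rw [h] at hd
      rw [← hd, coeff_natDegree, leadingCoeff_eq_zero] at h2'
      have hd0 : d = 0 := by rw [← hd, h2']; simp
      have : P.natDegree = 0 := by omega
      rw [hd0] at h1'
      have : P = 0 := by rw [eq_C_of_natDegree_eq_zero this, h1', C_0]
      rw [h2', this] at hcp
      exact absurd hcp (by rw [isCoprime_zero_left]; exact not_isUnit_zero)
  · rw [hv_of_ne hP hb] at h1
    rw [hv_of_ne hQ hb] at h2
    have h1' : P.eval (v.1 / v.2) = 0 := by simpa [hb] using h1
    have h2' : Q.eval (v.1 / v.2) = 0 := by simpa [hb] using h2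
    obtain ⟨u, w, huw⟩ := hcp
    have := congrArg (eval (v.1 / v.2)) huw
    simp [h1', h2'] at this

variable (𝕜) in
/-- A coprime pair of polynomials representing a nonconstant rational function. -/
structure Pr where
  A : 𝕜[X]
  B : 𝕜[X]
  cop : IsCoprime A B
  hB : B ≠ 0
  nc : NC (algebraMap _ (RatFunc 𝕜) A / algebraMap _ (RatFunc 𝕜) B)

namespace Pr

/-- the rational function -/
noncomputable def rat (x : Pr 𝕜) : RatFunc 𝕜 := algebraMap _ (RatFunc 𝕜) x.A / algebraMap _ (RatFunc 𝕜) x.B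
/-- the degree -/
noncomputable def deg (x : Pr 𝕜) : ℕ := max x.A.natDegree x.B.natDegree
/-- linear form of a target -/
noncomputable def l (x : Pr 𝕜) (c : 𝕜 × 𝕜) : 𝕜[X] := lin c x.A x.B

theorem hb (x : Pr 𝕜) : algebraMap _ (RatFunc 𝕜) x.B ≠ 0 := by simpa using x.hB

theorem l_ne_zero (x : Pr 𝕜) {c : 𝕜 × 𝕜} (hc : c ≠ 0) : x.l c ≠ 0 := by
  intro h
  rw [l, lin, sub_eq_zero] at h
  have h' := congrArg (algebraMap _ (RatFunc 𝕜)) h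
  simp only [map_mul, RatFunc.algebraMap_C] at h'
  by_cases h2 : c.2 = 0
  · have h1 : c.1 ≠ 0 := fun h1 => hc (Prod.ext h1 h2)
    rw [h2] at h
    simp at h
    rcases h with h | h
    · exact h1 h
    · exact x.hB h
  · apply x.nc (c.1 / c.2)
    have : RatFunc.C c.2 ≠ (0 : RatFunc 𝕜) := by simpa using h2
    have hb := x.hb
    rw [map_div₀]
    field_simp
    linear_combination h'

theorem hc_ne_zero (q : OnePoint 𝕜) : hc q ≠ 0 := by
  induction q using OnePoint.rec with
  | infty => intro h; simpa using congrArg Prod.fst h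
  | coe a => intro h; simpa using congrArg Prod.snd h

theorem natDegree_l_le (x : Pr 𝕜) (c : 𝕜 × 𝕜) : (x.l c).natDegree ≤ x.deg := by
  refine (natDegree_sub_le _ _).trans (max_le ?_ ?_)
  · exact (natDegree_C_mul_le _ _).trans (le_max_left _ _)
  · exact (natDegree_C_mul_le _ _).trans (le_max_right _ _)

/-- preimages of a target under a pair -/
noncomputable def pull (f : Pr 𝕜) (c : 𝕜 × 𝕜) : Multiset (OnePoint 𝕜) := proots f.deg (f.l c)

theorem card_pull (f : Pr 𝕜) (c : 𝕜 × 𝕜) : (f.pull c).card = f.deg :=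
  card_proots (f.natDegree_l_le c)

/-- values -/
noncomputable def val (f : Pr 𝕜) (v : 𝕜 × 𝕜) : 𝕜 × 𝕜 := (hv f.deg f.A v, hv f.deg f.B v)

theorem val_ne_zero (f : Pr 𝕜) {v : 𝕜 × 𝕜} (h : v ≠ 0) : f.val v ≠ 0 := by
  intro h0
  exact hv_ne_zero f.cop rfl h (congrArg Prod.fst h0) (congrArg Prod.snd h0)

theorem hm_A_alg (f x : Pr 𝕜) : algebraMap _ (RatFunc 𝕜) (hm f.deg f.A x.A x.B) =
    algebraMap _ (RatFunc 𝕜) x.B ^ f.deg * pev f.A x.rat := hm_alg (le_max_left _ _) _ x.hB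

theorem hm_B_alg (f x : Pr 𝕜) : algebraMap _ (RatFunc 𝕜) (hm f.deg f.B x.A x.B) =
    algebraMap _ (RatFunc 𝕜) x.B ^ f.deg * pev f.B x.rat := hm_alg (le_max_right _ _) _ x.hB

theorem hm_rat (f x : Pr 𝕜) : algebraMap _ (RatFunc 𝕜) (hm f.deg f.A x.A x.B) /
    algebraMap _ (RatFunc 𝕜) (hm f.deg f.B x.A x.B) = ev f.rat x.rat := by
  have h1 := f.hm_A_alg x
  have h2 := f.hm_B_alg x
  have h4 : algebraMap _ (RatFunc 𝕜) x.B ^ f.deg ≠ 0 := pow_ne_zero _ x.hb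
  have h5 : ev f.rat x.rat = pev f.A x.rat / pev f.B x.rat := by
    show ev (_ / _) x.rat = _
    rw [ev_div (show NC x.rat from x.nc), ev_alg, ev_alg]
  rw [h1, h2, h5, mul_div_mul_left _ _ h4]

/-- composition of pairs -/
noncomputable def comp (f x : Pr 𝕜) : Pr 𝕜 where
  A := hm f.deg f.A x.A x.B
  B := hm f.deg f.B x.A x.B
  cop := by
    rw [Polynomial.isCoprime_iff_aeval_ne_zero_of_isAlgClosed 𝕜 𝕜]
    intro z
    by_contra hcon
    push Not at hcon
    obtain ⟨h1, h2⟩ := hcon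
    rw [coe_aeval_eq_eval, hm_eval] at h1 h2
    refine f.val_ne_zero (v := (x.A.eval z, x.B.eval z)) ?_ (Prod.ext h1 h2)
    intro h0
    obtain ⟨u, w, huw⟩ := x.cop
    have := congrArg (eval z) huw
    have ha : x.A.eval z = 0 := congrArg Prod.fst h0
    have hb : x.B.eval z = 0 := congrArg Prod.snd h0
    simp [ha, hb] at this
  hB := by
    intro h
    have h2 := f.hm_B_alg x
    rw [h, map_zero] at h2
    exact mul_ne_zero (pow_ne_zero _ x.hb) (pev_ne_zero f.hB x.nc) h2.symm
  nc := by
    have := ev_NC f.nc x.nc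
    have e := hm_rat f x
    rw [e]; exact this

theorem comp_rat (f x : Pr 𝕜) : (f.comp x).rat = ev f.rat x.rat := hm_rat f x

/-- (PULL) -/
theorem comp_l (f : Pr 𝕜) {c : 𝕜 × 𝕜} (hc0 : c ≠ 0) : ∃ k : 𝕜, k ≠ 0 ∧ ∀ x : Pr 𝕜,
    (f.comp x).l c = C k * ((f.pull c).map fun q => x.l (hc q)).prod := by
  refine ⟨(f.l c).leadingCoeff * (-1) ^ (f.deg - (f.l c).natDegree), ?_, fun x => ?_⟩
  · have := f.l_ne_zero hc0
    simp [this]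
  · have := hm_eq_prod (f.natDegree_l_le c) x.A x.hB
    rw [l, comp, hm_lin]
    exact this

/-- leading vector -/
noncomputable def lead (x : Pr 𝕜) : 𝕜 × 𝕜 := (x.A.coeff x.deg, x.B.coeff x.deg)

theorem lead_ne_zero (x : Pr 𝕜) : x.lead ≠ 0 := by
  intro h
  have h1 : x.val (1, 0) = 0 := by
    have a : x.A.coeff x.deg = 0 := congrArg Prod.fst h
    have b : x.B.coeff x.deg = 0 := congrArg Prod.snd h
    simp [val, hv_of_eq, a, b]
  exact x.val_ne_zero (v := (1,0)) (by intro h; simpa using congrArg Prod.fst h) h1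

theorem natDegree_hm_le {d D : ℕ} (R : 𝕜[X]) {A B : 𝕜[X]} (hA : A.natDegree ≤ D) (hB : B.natDegree ≤ D) :
    (hm d R A B).natDegree ≤ d * D := by
  refine natDegree_sum_le_of_forall_le _ _ fun i hi => ?_
  have hi' : i ≤ d := Nat.lt_succ_iff.1 (Finset.mem_range.1 hi)
  have h1 := natDegree_pow_le_of_le i hA
  have h2 := natDegree_pow_le_of_le (d - i) hB
  have h3 : (C (R.coeff i) * A ^ i).natDegree ≤ i * D := (natDegree_C_mul_le _ _).trans h1
  refine (natDegree_mul_le_of_le h3 h2).trans ?_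
  rw [← add_mul]; apply Nat.mul_le_mul_right; omega

theorem coeff_hm {d D : ℕ} (R : 𝕜[X]) {A B : 𝕜[X]} (hA : A.natDegree ≤ D) (hB : B.natDegree ≤ D) :
    (hm d R A B).coeff (d * D) = hv d R (A.coeff D, B.coeff D) := by
  rw [hm, finset_sum_coeff, hv]
  refine Finset.sum_congr rfl fun i hi => ?_
  have hi' : i ≤ d := Nat.lt_succ_iff.1 (Finset.mem_range.1 hi)
  have h1 := natDegree_pow_le_of_le i hA
  have h2 := natDegree_pow_le_of_le (d - i) hB
  have h3 : (C (R.coeff i) * A ^ i).natDegree ≤ i * D := (natDegree_C_mul_le _ _).trans h1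
  have e : d * D = i * D + (d - i) * D := by rw [← add_mul]; congr 1; omega
  rw [e, coeff_mul_add_eq_of_natDegree_le h3 h2, coeff_C_mul, coeff_pow_of_natDegree_le hA,
    coeff_pow_of_natDegree_le hB]

theorem comp_coeff (f x : Pr 𝕜) : ((f.comp x).A.coeff (f.deg * x.deg), (f.comp x).B.coeff (f.deg * x.deg))
    = f.val x.lead :=
  Prod.ext (coeff_hm _ (le_max_left _ _) (le_max_right _ _)) (coeff_hm _ (le_max_left _ _) (le_max_right _ _))

theorem comp_deg (f x : Pr 𝕜) : (f.comp x).deg = f.deg * x.deg := by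
  apply le_antisymm
  · exact max_le (natDegree_hm_le _ (le_max_left _ _) (le_max_right _ _))
      (natDegree_hm_le _ (le_max_left _ _) (le_max_right _ _))
  · have h := f.val_ne_zero x.lead_ne_zero
    rw [← comp_coeff] at h
    by_cases h1 : (f.comp x).A.coeff (f.deg * x.deg) = 0
    · have h2 : (f.comp x).B.coeff (f.deg * x.deg) ≠ 0 := fun h2 => h (Prod.ext h1 h2)
      exact (le_natDegree_of_ne_zero h2).trans (le_max_right _ _)
    · exact (le_natDegree_of_ne_zero h1).trans (le_max_left _ _)

theorem coeff_l (x : Pr 𝕜) (c : 𝕜 × 𝕜) : (x.l c).coeff x.deg = c.2 * x.lead.1 - c.1 * x.lead.2 := by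
  simp [l, lin, lead]

theorem comp_lead (f x : Pr 𝕜) : (f.comp x).lead = f.val x.lead := by
  rw [← comp_coeff, ← comp_deg]; rfl

theorem rat_NC (x : Pr 𝕜) : NC x.rat := x.nc

theorem deg_pos (x : Pr 𝕜) : 0 < x.deg := by
  by_contra h
  have h0 : x.deg = 0 := by omega
  have hA : x.A.natDegree = 0 := by have := le_max_left x.A.natDegree x.B.natDegree; rw [← deg] at this; omega
  have hB : x.B.natDegree = 0 := by have := le_max_right x.A.natDegree x.B.natDegree; rw [← deg] at this; omega
  apply x.nc (x.A.coeff 0 / x.B.coeff 0)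
  rw [eq_C_of_natDegree_eq_zero hA, eq_C_of_natDegree_eq_zero hB]
  simp

/-- the pair of a nonconstant rational function -/
noncomputable def of (h : RatFunc 𝕜) (hh : NC h) : Pr 𝕜 where
  A := h.num
  B := h.denom
  cop := h.isCoprime_num_denom
  hB := h.denom_ne_zero
  nc := by rw [RatFunc.num_div_denom]; exact hh

theorem of_rat (h : RatFunc 𝕜) (hh : NC h) : (of h hh).rat = h := RatFunc.num_div_denom h

/-- iterates -/
noncomputable def it (f x : Pr 𝕜) : ℕ → Pr 𝕜
  | 0 => x
  | n + 1 => f.comp (it f x n)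

@[simp] theorem it_zero (f x : Pr 𝕜) : it f x 0 = x := rfl
theorem it_succ (f x : Pr 𝕜) (n : ℕ) : it f x (n + 1) = f.comp (it f x n) := rfl

theorem it_deg (f x : Pr 𝕜) (n : ℕ) : (it f x n).deg = f.deg ^ n * x.deg := by
  induction n with
  | zero => simp
  | succ n ih => rw [it_succ, comp_deg, ih]; ring

/-- iterate as a rational function -/
noncomputable def itr (f : Pr 𝕜) : ℕ → RatFunc 𝕜
  | 0 => RatFunc.X
  | n + 1 => ev f.rat (itr f n)

theorem itr_NC (f : Pr 𝕜) (n : ℕ) : NC (itr f n) := by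
  induction n with
  | zero => exact NC_X
  | succ n ih => exact ev_NC f.rat_NC ih

theorem it_rat (f x : Pr 𝕜) (n : ℕ) : (it f x n).rat = ev (itr f n) x.rat := by
  induction n with
  | zero => simp [itr, ev_X]
  | succ n ih => rw [it_succ, comp_rat, ih, itr, ev_assoc _ _ x.rat_NC]

theorem itr_add (f : Pr 𝕜) (m n : ℕ) {γ : RatFunc 𝕜} (hγ : NC γ) :
    ev (itr f (m + n)) γ = ev (itr f m) (ev (itr f n) γ) := by
  induction m with
  | zero => simp [itr, ev_X]
  | succ m ih =>
    rw [Nat.succ_add, itr, ev_assoc _ _ hγ, ih, itr, ev_assoc _ _ (ev_NC (itr_NC f n) hγ)]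

theorem it_add_rat (f x : Pr 𝕜) (m n : ℕ) : (it f x (m + n)).rat = ev (itr f m) (it f x n).rat := by
  rw [it_rat, it_rat, itr_add _ _ _ x.rat_NC]

end Pr
end Pairs
end EQ

/-! ## Root counts and growth of Gauss norms -/
namespace EQ

section Counts
variable {𝕜 : Type*} [Field 𝕜]

/-- number of roots with a property -/
noncomputable def cnt (p : 𝕜 → Prop) (P : 𝕜[X]) : ℕ := P.roots.countP p

theorem cnt_mul (p : 𝕜 → Prop) {P Q : 𝕜[X]} (hP : P ≠ 0) (hQ : Q ≠ 0) :
    cnt p (P * Q) = cnt p P + cnt p Q := by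
  rw [cnt, roots_mul (mul_ne_zero hP hQ), Multiset.countP_add]; rfl

theorem cnt_C_mul (p : 𝕜 → Prop) {k : 𝕜} (hk : k ≠ 0) (P : 𝕜[X]) : cnt p (C k * P) = cnt p P := by
  rw [cnt, roots_C_mul _ hk]; rfl

theorem cnt_neg (p : 𝕜 → Prop) (P : 𝕜[X]) : cnt p (-P) = cnt p P := by
  rw [cnt, roots_neg]; rfl

theorem cnt_one (p : 𝕜 → Prop) : cnt p (1 : 𝕜[X]) = 0 := by simp [cnt]

theorem cnt_map_prod (p : 𝕜 → Prop) {ι : Type*} (m : Multiset ι) (F : ι → 𝕜[X]) (h : ∀ i ∈ m, F i ≠ 0) :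
    cnt p (m.map F).prod = (m.map fun i => cnt p (F i)).sum := by
  induction m using Multiset.induction_on with
  | empty => simp [cnt_one]
  | cons i m ih =>
    have h1 : F i ≠ 0 := h i (Multiset.mem_cons_self _ _)
    have h2 : ∀ j ∈ m, F j ≠ 0 := fun j hj => h j (Multiset.mem_cons_of_mem hj)
    have h3 : (m.map F).prod ≠ 0 := by
      intro h0
      rw [Multiset.prod_eq_zero_iff] at h0
      obtain ⟨j, hj, e⟩ := Multiset.mem_map.1 h0
      exact h2 j hj e
    simp only [Multiset.map_cons, Multiset.prod_cons, Multiset.sum_cons]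
    rw [cnt_mul p h1 h3, ih h2]

theorem cnt_le (p : 𝕜 → Prop) (P : 𝕜[X]) : cnt p P ≤ P.natDegree :=
  (Multiset.countP_le_card _ _).trans (card_roots' P)

theorem cnt_mono {p q : 𝕜 → Prop} (h : ∀ r, p r → q r) (P : 𝕜[X]) : cnt p P ≤ cnt q P := by
  unfold cnt
  generalize P.roots = m
  induction m using Multiset.induction_on with
  | empty => simp
  | cons a m ih =>
    simp only [Multiset.countP_cons]
    have := h a
    split_ifs <;> first | omega | (exfalso; tauto)

theorem cnt_congr {p q : 𝕜 → Prop} {P : 𝕜[X]} (h : ∀ r ∈ P.roots, p r ↔ q r) : cnt p P = cnt q P :=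
  Multiset.countP_congr rfl (by simpa using h)

theorem cnt_pos {p : 𝕜 → Prop} {P : 𝕜[X]} (hP : P ≠ 0) : 0 < cnt p P ↔ ∃ r, P.eval r = 0 ∧ p r := by
  rw [cnt, Multiset.countP_pos]
  simp [mem_roots hP, IsRoot]

theorem cnt_add_of_disjoint {p q r : 𝕜 → Prop} (h : ∀ z, p z → q z → False) (hp : ∀ z, p z → r z) (hq : ∀ z, q z → r z)
    (P : 𝕜[X]) : cnt p P + cnt q P ≤ cnt r P := by
  unfold cnt
  generalize P.roots = m
  induction m using Multiset.induction_on with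
  | empty => simp
  | cons a m ih =>
    simp only [Multiset.countP_cons]
    have := h a; have := hp a; have := hq a
    split_ifs <;> first | omega | (exfalso; tauto)

variable [IsAlgClosed 𝕜]

theorem Pr.cnt_comp (p : 𝕜 → Prop) (f x : Pr 𝕜) {c : 𝕜 × 𝕜} (hc0 : c ≠ 0) :
    cnt p ((f.comp x).l c) = ((f.pull c).map fun q => cnt p (x.l (hc q))).sum := by
  obtain ⟨k, hk, h⟩ := f.comp_l hc0
  rw [h x, cnt_C_mul p hk, cnt_map_prod]
  exact fun q _ => x.l_ne_zero (Pr.hc_ne_zero q)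

end Counts

section Growth
variable {𝕜 : Type*} [NontriviallyNormedField 𝕜] [IsUltrametricDist 𝕜] [IsAlgClosed 𝕜]

/-- closed disc -/
def cl (a : 𝕜) (s : ℝ) : 𝕜 → Prop := fun r => ‖a - r‖ ≤ s
/-- open disc -/
def op (a : 𝕜) (s : ℝ) : 𝕜 → Prop := fun r => ‖a - r‖ < s

theorem dist_tri (a b c : 𝕜) : ‖a - c‖ ≤ max ‖a - b‖ ‖b - c‖ := by
  simpa using IsUltrametricDist.norm_add_le_max (a - b) (b - c)

theorem cl_center {a b : 𝕜} {s : ℝ} (h : ‖a - b‖ ≤ s) : cl a s = cl b s := by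
  funext r
  apply propext
  constructor
  · intro h1
    exact (dist_tri b a r).trans (max_le (by rwa [norm_sub_rev]) h1)
  · intro h1
    exact (dist_tri a b r).trans (max_le h h1)

theorem op_center {a b : 𝕜} {s : ℝ} (h : ‖a - b‖ < s) : op a s = op b s := by
  funext r
  apply propext
  constructor
  · intro h1
    exact (dist_tri b a r).trans_lt (max_lt (by rwa [norm_sub_rev]) h1)
  · intro h1
    exact (dist_tri a b r).trans_lt (max_lt h h1)

theorem log_gn (a : 𝕜) {s : ℝ} (hs : 0 < s) {P : 𝕜[X]} (hP : P ≠ 0) :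
    Real.log (gn a s P) = Real.log ‖P.leadingCoeff‖ + (P.roots.map fun r => Real.log (max ‖a - r‖ s)).sum := by
  have h : ∀ m : Multiset 𝕜, 0 < (m.map fun r => max ‖a - r‖ s).prod ∧
      Real.log (m.map fun r => max ‖a - r‖ s).prod = (m.map fun r => Real.log (max ‖a - r‖ s)).sum := by
    intro m
    induction m using Multiset.induction_on with
    | empty => simp
    | cons r m ih =>
      have h1 : 0 < max ‖a - r‖ s := lt_max_of_lt_right hs
      simp only [Multiset.map_cons, Multiset.prod_cons, Multiset.sum_cons]
      exact ⟨mul_pos h1 ih.1, by rw [Real.log_mul h1.ne' ih.1.ne', ih.2]⟩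
  have hl : ‖P.leadingCoeff‖ ≠ 0 := by simpa using hP
  rw [gn_eq_prod a hs, Real.log_mul hl (h _).1.ne', (h _).2]

theorem log_gn_sub (a : 𝕜) {s t : ℝ} (hs : 0 < s) (ht : 0 < t) {P : 𝕜[X]} (hP : P ≠ 0) :
    Real.log (gn a t P) - Real.log (gn a s P) =
      (P.roots.map fun r => Real.log (max ‖a - r‖ t) - Real.log (max ‖a - r‖ s)).sum := by
  rw [log_gn a hs hP, log_gn a ht hP, Multiset.sum_map_sub]; ring

theorem sum_ite_countP (p : 𝕜 → Prop) (m : Multiset 𝕜) (x : ℝ) :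
    (m.map fun r => if p r then x else 0).sum = m.countP p * x := by
  induction m using Multiset.induction_on with
  | empty => simp
  | cons r m ih =>
    simp only [Multiset.map_cons, Multiset.sum_cons, ih, Multiset.countP_cons]
    split_ifs <;> push_cast <;> ring

theorem log_gn_ge (a : 𝕜) {s t : ℝ} (hs : 0 < s) (hst : s ≤ t) {P : 𝕜[X]} (hP : P ≠ 0) :
    cnt (cl a s) P * (Real.log t - Real.log s) ≤ Real.log (gn a t P) - Real.log (gn a s P) := by
  rw [log_gn_sub a hs (hs.trans_le hst) hP, cnt, ← sum_ite_countP]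
  refine Multiset.sum_map_le_sum_map _ _ fun r _ => ?_
  by_cases h : ‖a - r‖ ≤ s
  · rw [if_pos (show cl a s r from h), max_eq_right h, max_eq_right (h.trans hst)]
  · rw [if_neg (show ¬ cl a s r from h), sub_nonneg]
    refine Real.log_le_log (lt_max_of_lt_right hs) (max_le_max le_rfl hst)

theorem log_gn_le (a : 𝕜) {s t : ℝ} (hs : 0 < s) (hst : s ≤ t) {P : 𝕜[X]} (hP : P ≠ 0) :
    Real.log (gn a t P) - Real.log (gn a s P) ≤ cnt (op a t) P * (Real.log t - Real.log s) := by
  rw [log_gn_sub a hs (hs.trans_le hst) hP, cnt, ← sum_ite_countP]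
  refine Multiset.sum_map_le_sum_map _ _ fun r _ => ?_
  by_cases h : ‖a - r‖ < t
  · rw [if_pos (show op a t r from h), max_eq_right h.le]
    gcongr
    exact le_max_right _ _
  · rw [if_neg (show ¬ op a t r from h), max_eq_left (not_lt.1 h), max_eq_left (hst.trans (not_lt.1 h))]
    simp

/-- for radii slightly larger than `s` there are no further roots -/
theorem exists_gap (a : 𝕜) (s : ℝ) (P : 𝕜[X]) : ∀ᶠ t in 𝓝[>] s, ∀ r ∈ P.roots, ‖a - r‖ < t ↔ ‖a - r‖ ≤ s := by
  have h : ∀ m : Multiset 𝕜, ∀ᶠ t in 𝓝[>] s, ∀ r ∈ m, ‖a - r‖ < t ↔ ‖a - r‖ ≤ s := by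
    intro m
    induction m using Multiset.induction_on with
    | empty => simp
    | cons r m ih =>
      have h1 : ∀ᶠ t in 𝓝[>] s, ‖a - r‖ < t ↔ ‖a - r‖ ≤ s := by
        by_cases h : ‖a - r‖ ≤ s
        · filter_upwards [self_mem_nhdsWithin] with t ht
          exact ⟨fun _ => h, fun _ => lt_of_le_of_lt h ht⟩
        · have : ∀ᶠ t in 𝓝[>] s, t < ‖a - r‖ := nhdsWithin_le_nhds (Iio_mem_nhds (not_le.1 h))
          filter_upwards [this] with t ht
          exact ⟨fun h' => absurd h' (not_lt.2 ht.le), fun h' => absurd h' h⟩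
      filter_upwards [h1, ih] with t h1 h2 q hq
      rcases Multiset.mem_cons.1 hq with rfl | hq
      · exact h1
      · exact h2 q hq
  exact h _

theorem exists_gap_cnt (a : 𝕜) (s : ℝ) (P : 𝕜[X]) : ∀ᶠ t in 𝓝[>] s, cnt (op a t) P = cnt (cl a s) P := by
  filter_upwards [exists_gap a s P] with t ht
  exact cnt_congr ht

theorem exists_gap_cnt_cl (a : 𝕜) (s : ℝ) (P : 𝕜[X]) : ∀ᶠ t in 𝓝[>] s, cnt (cl a t) P = cnt (cl a s) P := by
  obtain ⟨t₀, ht₀, h⟩ := (((exists_gap_cnt a s P).and self_mem_nhdsWithin)).exists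
  have h0 : s < t₀ := h
  filter_upwards [Ioo_mem_nhdsGT h0] with t ht
  apply le_antisymm
  · rw [← ht₀]; exact cnt_mono (fun r hr => lt_of_le_of_lt hr ht.2) P
  · exact cnt_mono (fun r hr => le_trans hr ht.1.le) P

theorem log_gn_eq (a : 𝕜) {s t : ℝ} (hs : 0 < s) (hst : s ≤ t) {P : 𝕜[X]} (hP : P ≠ 0)
    (h : cnt (op a t) P = cnt (cl a s) P) :
    Real.log (gn a t P) - Real.log (gn a s P) = cnt (cl a s) P * (Real.log t - Real.log s) :=
  le_antisymm (h ▸ log_gn_le a hs hst hP) (log_gn_ge a hs hst hP)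

theorem gn_max_of_add {a : 𝕜} {s : ℝ} (hs : 0 < s) {U V W : 𝕜[X]} (h : U + V + W = 0)
    (hUV : gn a s U < gn a s V) (hWV : gn a s W < gn a s V) : False := by
  have e : V = -U - W := by linear_combination h
  have := gn_sub_le a hs (-U) W
  rw [← e, gn_neg a hs] at this
  exact absurd this (not_le.2 (max_lt hUV hWV))

theorem three_lines {l1 l2 l3 : ℝ} {k1 k2 k3 : ℕ} (h12 : k1 ≠ k2) (h13 : k1 ≠ k3) (h23 : k2 ≠ k3) {τ : ℝ} (hτ : 0 < τ) :
    ∃ x ∈ Set.Ioo 0 τ, l1 + k1 * x ≠ l2 + k2 * x ∧ l1 + k1 * x ≠ l3 + k3 * x ∧ l2 + k2 * x ≠ l3 + k3 * x := by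
  have fin : ∀ {l m : ℝ} {k j : ℕ}, k ≠ j → {x : ℝ | l + k * x = m + j * x}.Finite := by
    intro l m k j hkj
    refine Set.Subsingleton.finite fun x hx y hy => ?_
    simp only [Set.mem_setOf_eq] at hx hy
    have h0 : ((k : ℝ) - j) ≠ 0 := sub_ne_zero.2 (by exact_mod_cast hkj)
    have : ((k : ℝ) - j) * (x - y) = 0 := by linear_combination hx - hy
    rcases mul_eq_zero.1 this with h | h
    · exact absurd h h0
    · linarith
  have hinf : (Set.Ioo 0 τ).Infinite := Set.Ioo_infinite hτ
  obtain ⟨x, hx, hn⟩ := (hinf.diff ((fin (l := l1) (m := l2) h12).union ((fin (l := l1) (m := l3) h13).union (fin (l := l2) (m := l3) h23)))).nonempty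
  refine ⟨x, hx, ?_, ?_, ?_⟩ <;> intro h <;> apply hn
  · exact Or.inl h
  · exact Or.inr (Or.inl h)
  · exact Or.inr (Or.inr h)

/-- (TWO) -/
theorem two_counts (a : 𝕜) {s : ℝ} (hs : 0 < s) {U V W : 𝕜[X]} (hU : U ≠ 0) (hV : V ≠ 0) (hW : W ≠ 0)
    (h : U + V + W = 0) (h12 : cnt (cl a s) U ≠ cnt (cl a s) V) (h13 : cnt (cl a s) U ≠ cnt (cl a s) W)
    (h23 : cnt (cl a s) V ≠ cnt (cl a s) W) : False := by
  obtain ⟨t, ⟨⟨⟨h1, h2⟩, h3⟩, ht⟩⟩ := ((((exists_gap_cnt a s U).and (exists_gap_cnt a s V)).and (exists_gap_cnt a s W)).and self_mem_nhdsWithin).exists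
  have hst : s < t := ht
  have hτ : 0 < Real.log t - Real.log s := sub_pos.2 (Real.log_lt_log hs hst)
  obtain ⟨x, ⟨hx0, hx1⟩, n12, n13, n23⟩ := three_lines (l1 := Real.log (gn a s U)) (l2 := Real.log (gn a s V))
    (l3 := Real.log (gn a s W)) h12 h13 h23 hτ
  set τ := s * Real.exp x with hτd
  have hlog : Real.log τ - Real.log s = x := by
    rw [hτd, Real.log_mul hs.ne' (Real.exp_pos _).ne', Real.log_exp]; ring
  have hτ0 : 0 < τ := mul_pos hs (Real.exp_pos _)
  have hsτ : s ≤ τ := by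
    rw [hτd]; nlinarith [Real.one_le_exp hx0.le]
  have hτt : τ ≤ t := by
    rw [← Real.log_le_log_iff hτ0 (hs.trans hst)]; linarith
  have key : ∀ P : 𝕜[X], P ≠ 0 → cnt (op a t) P = cnt (cl a s) P →
      Real.log (gn a τ P) = Real.log (gn a s P) + cnt (cl a s) P * x := by
    intro P hP hc
    have : cnt (op a τ) P = cnt (cl a s) P := by
      apply le_antisymm
      · rw [← hc]; exact cnt_mono (fun r hr => lt_of_lt_of_le hr hτt) P
      · refine cnt_mono (fun r hr => lt_of_le_of_lt hr ?_) P
        rw [hτd]; nlinarith [Real.add_one_lt_exp hx0.ne']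
    have := log_gn_eq a hs hsτ hP this
    rw [hlog] at this; linarith
  rw [← key U hU h1, ← key V hV h2] at n12
  rw [← key U hU h1, ← key W hW h3] at n13
  rw [← key V hV h2, ← key W hW h3] at n23
  have m12 : gn a τ U ≠ gn a τ V := fun e => n12 (by rw [e])
  have m13 : gn a τ U ≠ gn a τ W := fun e => n13 (by rw [e])
  have m23 : gn a τ V ≠ gn a τ W := fun e => n23 (by rw [e])
  rcases lt_or_gt_of_ne m12 with q1 | q1
  · rcases lt_or_gt_of_ne m23 with q2 | q2
    · exact gn_max_of_add hτ0 (U := U) (V := W) (W := V) (by linear_combination h) (q1.trans q2) q2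
    · exact gn_max_of_add hτ0 h q1 q2
  · rcases lt_or_gt_of_ne m13 with q2 | q2
    · exact gn_max_of_add hτ0 (U := U) (V := W) (W := V) (by linear_combination h) q2 (q1.trans q2)
    · exact gn_max_of_add hτ0 (U := V) (V := U) (W := W) (by linear_combination h) q1 q2

/-- value group is dense -/
theorem exists_norm_between {s t : ℝ} (hs : 0 ≤ s) (hst : s < t) : ∃ z : 𝕜, s < ‖z‖ ∧ ‖z‖ < t := by
  obtain ⟨w, hw⟩ := NormedField.exists_one_lt_norm 𝕜
  -- an element of norm in (1, t/s')
  set s' := (s + t) / 2 with hs'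
  have h1 : s < s' := by rw [hs']; linarith
  have h2 : s' < t := by rw [hs']; linarith
  have hs'0 : 0 < s' := lt_of_le_of_lt hs h1
  have hq : 1 < t / s' := by rw [one_lt_div hs'0]; exact h2
  obtain ⟨n, hn⟩ := pow_unbounded_of_one_lt ‖w‖ hq
  have hn0 : n ≠ 0 := by rintro rfl; simp at hn; linarith
  obtain ⟨v, hv⟩ := IsAlgClosed.exists_pow_nat_eq w (Nat.pos_of_ne_zero hn0)
  have hv1 : 1 < ‖v‖ := by
    by_contra h
    have := pow_le_one₀ (n := n) (norm_nonneg v) (not_lt.1 h)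
    rw [← norm_pow, hv] at this; linarith
  have hv2 : ‖v‖ < t / s' := by
    by_contra h
    have := pow_le_pow_left₀ (by positivity) (not_lt.1 h) n
    rw [← norm_pow, hv] at this; linarith
  have hv0 : v ≠ 0 := by rintro rfl; simp at hv1; linarith
  obtain ⟨m, hm1, hm2⟩ := exists_mem_Ioc_zpow hs'0 hv1
  refine ⟨v ^ (m + 1), ?_, ?_⟩
  · rw [norm_zpow]; linarith
  · rw [norm_zpow, zpow_add_one₀ (by linarith : ‖v‖ ≠ 0)]
    calc ‖v‖ ^ m * ‖v‖ < s' * (t / s') := mul_lt_mul'' hm1 hv2 (by positivity) (by positivity)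
      _ = t := by field_simp

end Growth
end EQ

/-! ## Counting preimages in discs -/
namespace EQ
namespace Pr

section Field
variable {𝕜 : Type*} [Field 𝕜] [IsAlgClosed 𝕜]

/-- number of preimages of a target -/
noncomputable def Z (x : Pr 𝕜) (p : 𝕜 → Prop) (q : OnePoint 𝕜) : ℕ := cnt p (x.l (hc q))

theorem Z_le (x : Pr 𝕜) (p : 𝕜 → Prop) (q : OnePoint 𝕜) : x.Z p q ≤ x.deg :=
  (cnt_le _ _).trans (x.natDegree_l_le _)

theorem Z_comp (f x : Pr 𝕜) (p : 𝕜 → Prop) (c : OnePoint 𝕜) :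
    (f.comp x).Z p c = ((f.pull (hc c)).map fun q => x.Z p q).sum :=
  cnt_comp p f x (hc_ne_zero c)

theorem Z_it (f x : Pr 𝕜) (j k : ℕ) (c : OnePoint 𝕜) : ∃ m : Multiset (OnePoint 𝕜), m.card = f.deg ^ k ∧
    ∀ p : 𝕜 → Prop, (it f x (j + k)).Z p c = (m.map fun q => (it f x j).Z p q).sum := by
  induction k generalizing c with
  | zero => exact ⟨{c}, by simp, by simp⟩
  | succ k ih =>
    choose m hm1 hm2 using ih
    refine ⟨(f.pull (hc c)).bind m, ?_, fun p => ?_⟩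
    · rw [Multiset.card_bind]
      have : (Multiset.map (Multiset.card ∘ m) (f.pull (hc c))) = Multiset.map (fun _ => f.deg ^ k) (f.pull (hc c)) :=
        Multiset.map_congr rfl fun q _ => hm1 q
      rw [this, Multiset.map_const', Multiset.sum_replicate, card_pull, smul_eq_mul, pow_succ, mul_comm]
    · rw [← add_assoc, it_succ, Z_comp, Multiset.map_bind, Multiset.sum_bind]
      congr 1
      exact Multiset.map_congr rfl fun q _ => hm2 q p

theorem l_smul (x : Pr 𝕜) (k : 𝕜) (c : 𝕜 × 𝕜) : x.l (k • c) = C k * x.l c := by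
  simp [l, lin]; ring

theorem l_add (x : Pr 𝕜) (c c' : 𝕜 × 𝕜) : x.l (c + c') = x.l c + x.l c' := by
  simp [l, lin]; ring

theorem l_zero (x : Pr 𝕜) : x.l 0 = 0 := by simp [l, lin]

end Field

variable {𝕜 : Type*} [NontriviallyNormedField 𝕜] [IsUltrametricDist 𝕜] [IsAlgClosed 𝕜]

theorem GN_rat (x : Pr 𝕜) (a : 𝕜) {s : ℝ} (hs : 0 < s) (c : 𝕜) :
    GN a s (x.rat - RatFunc.C c) = gn a s (x.A - C c * x.B) / gn a s x.B := by
  rw [← GN_div a hs _ x.hB]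
  congr 1
  rw [map_sub, map_mul, sub_div, mul_div_assoc, div_self x.hb, RatFunc.algebraMap_C, mul_one]; rfl

theorem l_coe (x : Pr 𝕜) (c : 𝕜) : x.l (hc (c : OnePoint 𝕜)) = x.A - C c * x.B := lin_coe _ _ _
theorem l_infty (x : Pr 𝕜) : x.l (hc OnePoint.infty) = - x.B := lin_infty _ _

theorem l_coe_ne (x : Pr 𝕜) (c : 𝕜) : x.A - C c * x.B ≠ 0 := by
  rw [← l_coe]; exact x.l_ne_zero (hc_ne_zero _)

theorem Z_coe (x : Pr 𝕜) (p : 𝕜 → Prop) (c : 𝕜) : x.Z p (c : OnePoint 𝕜) = cnt p (x.A - C c * x.B) := by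
  rw [Z, l_coe]
theorem Z_infty (x : Pr 𝕜) (p : 𝕜 → Prop) : x.Z p OnePoint.infty = cnt p x.B := by
  rw [Z, l_infty, cnt_neg]

theorem hc_wedge {q q' : OnePoint 𝕜} (h : (hc q).1 * (hc q').2 - (hc q').1 * (hc q).2 = 0) : q = q' := by
  induction q using OnePoint.rec with
  | infty =>
    induction q' using OnePoint.rec with
    | infty => rfl
    | coe b => simp at h
  | coe a =>
    induction q' using OnePoint.rec with
    | infty => simp at h
    | coe b => simp at h; rw [sub_eq_zero.1 h]

theorem Z_two (x : Pr 𝕜) (a : 𝕜) {s : ℝ} (hs : 0 < s) {q1 q2 q3 : OnePoint 𝕜}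
    (h12 : x.Z (cl a s) q1 ≠ x.Z (cl a s) q2) (h13 : x.Z (cl a s) q1 ≠ x.Z (cl a s) q3)
    (h23 : x.Z (cl a s) q2 ≠ x.Z (cl a s) q3) : False := by
  have n12 : q1 ≠ q2 := fun h => h12 (by rw [h])
  have n13 : q1 ≠ q3 := fun h => h13 (by rw [h])
  have n23 : q2 ≠ q3 := fun h => h23 (by rw [h])
  have w12 := fun h => n12 (hc_wedge h)
  have w31 := fun h => n13.symm (hc_wedge h)
  have w23 := fun h => n23 (hc_wedge h)
  set k3 := (hc q1).1 * (hc q2).2 - (hc q2).1 * (hc q1).2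
  set k2 := (hc q3).1 * (hc q1).2 - (hc q1).1 * (hc q3).2
  set k1 := (hc q2).1 * (hc q3).2 - (hc q3).1 * (hc q2).2
  have e : k1 • hc q1 + k2 • hc q2 + k3 • hc q3 = 0 := by
    ext <;> simp [k1, k2, k3] <;> ring
  have e' := congrArg x.l e
  rw [l_add, l_add, l_smul, l_smul, l_smul, l_zero] at e'
  have nz : ∀ (k : 𝕜) (q : OnePoint 𝕜), k ≠ 0 → C k * x.l (hc q) ≠ 0 := fun k q hk =>
    mul_ne_zero (by simpa using hk) (x.l_ne_zero (hc_ne_zero q))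
  refine two_counts a hs (nz k1 q1 w23) (nz k2 q2 w31) (nz k3 q3 w12) e' ?_ ?_ ?_
  · rw [cnt_C_mul _ w23, cnt_C_mul _ w31]; exact h12
  · rw [cnt_C_mul _ w23, cnt_C_mul _ w12]; exact h13
  · rw [cnt_C_mul _ w31, cnt_C_mul _ w12]; exact h23

theorem log_GN_rat (x : Pr 𝕜) (a : 𝕜) {s : ℝ} (hs : 0 < s) (c : 𝕜) :
    Real.log (GN a s (x.rat - RatFunc.C c)) = Real.log (gn a s (x.A - C c * x.B)) - Real.log (gn a s x.B) := by
  rw [GN_rat x a hs, Real.log_div (gn_pos a hs (x.l_coe_ne c)).ne' (gn_pos a hs x.hB).ne']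

theorem GN_rat_pos (x : Pr 𝕜) (a : 𝕜) {s : ℝ} (hs : 0 < s) (c : 𝕜) : 0 < GN a s (x.rat - RatFunc.C c) := by
  rw [GN_rat x a hs]; exact div_pos (gn_pos a hs (x.l_coe_ne c)) (gn_pos a hs x.hB)

/-- right slopes -/
theorem slope (x : Pr 𝕜) (a : 𝕜) {s : ℝ} (hs : 0 < s) (c : 𝕜) : ∀ᶠ t in 𝓝[>] s,
    Real.log (GN a t (x.rat - RatFunc.C c)) - Real.log (GN a s (x.rat - RatFunc.C c)) =
      ((x.Z (cl a s) (c : OnePoint 𝕜) : ℝ) - x.Z (cl a s) OnePoint.infty) * (Real.log t - Real.log s) := by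
  filter_upwards [exists_gap_cnt a s (x.A - C c * x.B), exists_gap_cnt a s x.B, self_mem_nhdsWithin] with t h1 h2 ht
  have hst : s < t := ht
  rw [log_GN_rat x a hs, log_GN_rat x a (hs.trans hst)]
  have e1 := log_gn_eq a hs hst.le (x.l_coe_ne c) h1
  have e2 := log_gn_eq a hs hst.le x.hB h2
  rw [Z_coe, Z_infty]
  linear_combination e1 - e2

theorem Z_diff_eq (x y : Pr 𝕜) (a : 𝕜) {s : ℝ} (hs : 0 < s)
    (h : ∃ᶠ t in 𝓝[>] s, Rel (GN a t) x.rat y.rat) (h0 : Rel (GN a s) x.rat y.rat) (c : 𝕜) :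
    (x.Z (cl a s) (c : OnePoint 𝕜) : ℤ) - x.Z (cl a s) OnePoint.infty =
      y.Z (cl a s) (c : OnePoint 𝕜) - y.Z (cl a s) OnePoint.infty := by
  obtain ⟨t, ht, ⟨h1, h2⟩, h3⟩ := (h.and_eventually (((x.slope a hs c).and (y.slope a hs c)).and self_mem_nhdsWithin)).exists
  have hst : s < t := h3
  have hτ : 0 < Real.log t - Real.log s := sub_pos.2 (Real.log_lt_log hs hst)
  rw [ht.eq (GN_nabs a (hs.trans hst)) c, h0.eq (GN_nabs a hs) c, h2] at h1
  have := mul_right_cancel₀ hτ.ne' h1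
  have h4 : (((x.Z (cl a s) (c : OnePoint 𝕜) : ℤ) - x.Z (cl a s) OnePoint.infty : ℤ) : ℝ) =
      ((y.Z (cl a s) (c : OnePoint 𝕜) - y.Z (cl a s) OnePoint.infty : ℤ) : ℝ) := by
    push_cast; exact this.symm
  exact_mod_cast h4

/-- (NC) -/
theorem Z_nonconst (x : Pr 𝕜) (a : 𝕜) {s : ℝ} (hs : 0 < s) :
    ∃ c : 𝕜, x.Z (cl a s) (c : OnePoint 𝕜) ≠ x.Z (cl a s) OnePoint.infty := by
  by_contra hcon
  push Not at hcon
  have hN := GN_nabs (𝕜 := 𝕜) a hs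
  obtain ⟨c₀, hc₀⟩ := gn_att' a hs x.A x.hB
  -- gap
  obtain ⟨t, ⟨⟨g1, g2⟩, ht⟩⟩ := (((exists_gap_cnt a s (x.A - C c₀ * x.B)).and (exists_gap a s x.B)).and
    self_mem_nhdsWithin).exists
  have hst : s < t := ht
  have g2' : cnt (op a t) x.B = cnt (cl a s) x.B := cnt_congr g2
  have ht0 := hs.trans hst
  obtain ⟨w, hw1, hw2⟩ := exists_norm_between (𝕜 := 𝕜) hs.le hst
  set z := a + w
  have hz : ‖a - z‖ = ‖w‖ := by simp [z]
  have hzB : x.B.eval z ≠ 0 := by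
    intro h
    have := (g2 z (by rw [mem_roots x.hB]; exact h)).1 (by rw [hz]; exact hw2)
    rw [hz] at this; linarith
  set c := x.A.eval z / x.B.eval z
  have hroot : (x.A - C c * x.B).eval z = 0 := by
    simp [c]; field_simp; ring
  have e0 := log_gn_eq a hs hst.le (x.l_coe_ne c₀) g1
  have eB := log_gn_eq a hs hst.le x.hB g2'
  have hcc₀ := hcon c₀
  have hcc := hcon c
  rw [Z_coe, Z_infty] at hcc₀ hcc
  rw [hcc₀] at e0
  -- N_t(x - c0) = N_s(x - c0)
  have E0 : GN a t (x.rat - RatFunc.C c₀) = GN a s (x.rat - RatFunc.C c₀) := by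
    apply Real.log_injOn_pos (GN_rat_pos x a ht0 c₀) (GN_rat_pos x a hs c₀)
    rw [log_GN_rat x a hs, log_GN_rat x a ht0]; linarith
  have Es : GN a s (x.rat - RatFunc.C c₀) ≤ GN a s (x.rat - RatFunc.C c) := by
    rw [GN_rat x a hs, GN_rat x a hs, hc₀ c]
    exact div_le_div_of_nonneg_right (le_max_left _ _) (gn_pos a hs x.hB).le
  -- strict growth of x - c
  have hw0 : 0 < ‖w‖ := hs.trans hw1
  have s1 := log_gn_ge a hs hw1.le (x.l_coe_ne c)
  have s2 := log_gn_ge a hw0 hw2.le (x.l_coe_ne c)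
  have hcard : cnt (cl a s) (x.A - C c * x.B) + 1 ≤ cnt (cl a ‖w‖) (x.A - C c * x.B) := by
    have := cnt_add_of_disjoint (p := cl a s) (q := fun r => r = z) (r := cl a ‖w‖) (fun r h1 h2 => by
      subst h2
      have : ‖a - (a + w)‖ ≤ s := h1
      rw [hz] at this; linarith) (fun r h => le_trans h hw1.le) (fun r h => by
        subst h; exact hz.le) (x.A - C c * x.B)
    have h1 : 0 < cnt (fun r => r = z) (x.A - C c * x.B) := (cnt_pos (x.l_coe_ne c)).2 ⟨z, hroot, rfl⟩
    omega
  have hcard' : (cnt (cl a s) (x.A - C c * x.B) : ℝ) + 1 ≤ cnt (cl a ‖w‖) (x.A - C c * x.B) := by exact_mod_cast hcard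
  have hl1 : 0 < Real.log t - Real.log ‖w‖ := sub_pos.2 (Real.log_lt_log hw0 hw2)
  have strict : Real.log (GN a s (x.rat - RatFunc.C c)) < Real.log (GN a t (x.rat - RatFunc.C c)) := by
    rw [log_GN_rat x a hs, log_GN_rat x a ht0]
    rw [hcc] at s1 hcard'
    nlinarith
  have strict' := (Real.log_lt_log_iff (GN_rat_pos x a hs c) (GN_rat_pos x a ht0 c)).1 strict
  -- upper bound
  have hNt := GN_nabs (𝕜 := 𝕜) a ht0
  have ub : GN a t (x.rat - RatFunc.C c) ≤ max (GN a t (x.rat - RatFunc.C c₀)) ‖c₀ - c‖ := by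
    have := hNt.tri x.rat (RatFunc.C c₀) (RatFunc.C c)
    rwa [← map_sub, hNt.map_C] at this
  rw [E0] at ub
  have hlow : ‖c₀ - c‖ ≤ GN a s (x.rat - RatFunc.C c) := by
    rw [GN_rat x a hs, hc₀ c, le_div_iff₀ (gn_pos a hs x.hB)]; exact le_max_right _ _
  exact absurd (lt_of_lt_of_le strict' ub) (not_lt.2 (max_le Es hlow))

/-- (OSC) -/
theorem osc (f x y : Pr 𝕜) (a : 𝕜) {s : ℝ} (hs : 0 < s) {j n : ℕ} (hjn : j ≤ n)
    (h : ∃ᶠ t in 𝓝[>] s, Rel (GN a t) (it f x n).rat y.rat) (h0 : Rel (GN a s) (it f x n).rat y.rat)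
    (q q' : OnePoint 𝕜) : (it f x j).Z (cl a s) q ≤ (it f x j).Z (cl a s) q' + y.deg := by
  by_contra hcon
  push Not at hcon
  set v := (it f x j).Z (cl a s) q
  set v' := (it f x j).Z (cl a s) q'
  have two : ∀ r, (it f x j).Z (cl a s) r = v' ∨ (it f x j).Z (cl a s) r = v := by
    intro r
    by_contra hr
    push Not at hr
    exact Z_two (it f x j) a hs (q1 := q) (q2 := q') (q3 := r) (by show v ≠ v'; omega) (Ne.symm hr.2) (Ne.symm hr.1)
  obtain ⟨k, rfl⟩ := Nat.exists_eq_add_of_le hjn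
  have form : ∀ c, ∃ i : ℕ, (it f x (j + k)).Z (cl a s) c = f.deg ^ k * v' + i * (v - v') := by
    intro c
    obtain ⟨m, hm1, hm2⟩ := Z_it f x j k c
    rw [hm2, ← hm1]
    clear hm1 hm2
    induction m using Multiset.induction_on with
    | empty => exact ⟨0, by simp⟩
    | cons r m ih =>
      obtain ⟨i, hi⟩ := ih
      rcases two r with hr | hr
      · refine ⟨i, ?_⟩
        simp only [Multiset.map_cons, Multiset.sum_cons, Multiset.card_cons, hi, hr]; ring
      · refine ⟨i + 1, ?_⟩
        simp only [Multiset.map_cons, Multiset.sum_cons, Multiset.card_cons, hi, hr]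
        have : v = v' + (v - v') := by omega
        conv_lhs => rw [this]
        simp only [Nat.add_sub_cancel_left]
        ring
  obtain ⟨c, hc⟩ := y.Z_nonconst a hs
  have hd := Z_diff_eq _ y a hs h h0 c
  obtain ⟨i, hi⟩ := form c
  obtain ⟨i', hi'⟩ := form OnePoint.infty
  have b1 := y.Z_le (cl a s) c
  have b2 := y.Z_le (cl a s) OnePoint.infty
  rw [hi, hi'] at hd
  have hv : (y.deg : ℤ) + 1 ≤ ((v - v' : ℕ) : ℤ) := by
    have : y.deg + 1 ≤ v - v' := by omega
    exact_mod_cast this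
  push_cast only [Nat.cast_add, Nat.cast_mul] at hd
  have hne : (i : ℤ) ≠ i' := by
    intro e
    apply hc
    have : (y.Z (cl a s) c : ℤ) = y.Z (cl a s) OnePoint.infty := by
      rw [e] at hd; linarith
    exact_mod_cast this
  have hd' : ((i : ℤ) - i') * ((v - v' : ℕ) : ℤ) = y.Z (cl a s) c - y.Z (cl a s) OnePoint.infty := by linarith
  rcases lt_or_gt_of_ne hne with h1 | h1
  · have : ((i : ℤ) - i') ≤ -1 := by omega
    nlinarith
  · have : (1 : ℤ) ≤ ((i : ℤ) - i') := by omega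
    nlinarith

end Pr
end EQ

/-! ## Continuity in the radius, path lifting -/
namespace EQ

section Cont
variable {𝕜 : Type*} [NontriviallyNormedField 𝕜] [IsUltrametricDist 𝕜] [IsAlgClosed 𝕜]

theorem GN_center {a b : 𝕜} {s : ℝ} (hs : 0 < s) (h : ‖a - b‖ ≤ s) : GN a s = GN b s := by
  funext R; rw [GN, GN, gn_center hs h, gn_center hs h]

theorem continuousOn_gn (a : 𝕜) (P : 𝕜[X]) : ContinuousOn (fun s => gn a s P) (Set.Ioi 0) := by
  have h : Continuous fun s : ℝ => ‖P.leadingCoeff‖ * (P.roots.map fun r => max ‖a - r‖ s).prod := by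
    refine continuous_const.mul ?_
    generalize P.roots = m
    induction m using Multiset.induction_on with
    | empty => simp; exact continuous_const
    | cons r m ih =>
      simp only [Multiset.map_cons, Multiset.prod_cons]
      exact (continuous_const.max continuous_id).mul ih
  exact h.continuousOn.congr fun s hs => gn_eq_prod a hs P

theorem continuousOn_GN (a : 𝕜) (R : RatFunc 𝕜) : ContinuousOn (fun s => GN a s R) (Set.Ioi 0) :=
  (continuousOn_gn a _).div (continuousOn_gn a _) fun s hs => (gn_pos a hs R.denom_ne_zero).ne'

theorem continuousAt_GN (a : 𝕜) {s : ℝ} (hs : 0 < s) (R : RatFunc 𝕜) : ContinuousAt (fun s => GN a s R) s :=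
  (continuousOn_GN a R).continuousAt (Ioi_mem_nhds hs)

theorem GN_compare (a : 𝕜) {s t : ℝ} (hs : 0 < s) (ht : 0 < t) (x : Pr 𝕜) (c : 𝕜) :
    (min (s / t) (t / s)) ^ x.deg * GN a s (x.rat - RatFunc.C c) ≤ GN a t (x.rat - RatFunc.C c) := by
  rw [x.GN_rat a hs, x.GN_rat a ht]
  have hA := gn_pos a hs (x.l_coe_ne c)
  have hA' := gn_pos a ht (x.l_coe_ne c)
  have hB := gn_pos a hs x.hB
  have hB' := gn_pos a ht x.hB
  have dA : (x.A - C c * x.B).natDegree ≤ x.deg := by rw [← x.l_coe]; exact x.natDegree_l_le _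
  have dB : x.B.natDegree ≤ x.deg := le_max_right _ _
  have p1 : 0 < s / t := by positivity
  have p2 : 0 < t / s := by positivity
  rcases le_total s t with h | h
  · have h1 := gn_mono a hs h (x.A - C c * x.B)
    have h2 := gn_le_mul a hs h x.B dB
    have h3 : (min (s / t) (t / s)) ^ x.deg ≤ (s / t) ^ x.deg :=
      pow_le_pow_left₀ (le_min p1.le p2.le) (min_le_left _ _) _
    rw [mul_div_assoc', div_le_div_iff₀ hB hB']
    calc _ ≤ (s / t) ^ x.deg * gn a s (x.A - C c * x.B) * ((t / s) ^ x.deg * gn a s x.B) := by gcongr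
      _ = ((s / t) * (t / s)) ^ x.deg * (gn a s (x.A - C c * x.B) * gn a s x.B) := by rw [mul_pow]; ring
      _ = gn a s (x.A - C c * x.B) * gn a s x.B := by
        rw [show s / t * (t / s) = 1 by field_simp]; simp
      _ ≤ _ := by gcongr
  · have h1 := gn_mono a ht h x.B
    have h2 := gn_le_mul a ht h (x.A - C c * x.B) dA
    have h3 : (min (s / t) (t / s)) ^ x.deg ≤ (t / s) ^ x.deg :=
      pow_le_pow_left₀ (le_min p1.le p2.le) (min_le_right _ _) _
    rw [mul_div_assoc', div_le_div_iff₀ hB hB']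
    calc _ ≤ (t / s) ^ x.deg * ((s / t) ^ x.deg * gn a t (x.A - C c * x.B)) * gn a s x.B := by gcongr
      _ = ((s / t) * (t / s)) ^ x.deg * (gn a t (x.A - C c * x.B) * gn a s x.B) := by rw [mul_pow]; ring
      _ = gn a t (x.A - C c * x.B) * gn a s x.B := by
        rw [show s / t * (t / s) = 1 by field_simp]; simp

theorem dm_compare (a : 𝕜) {s t : ℝ} (hs : 0 < s) (ht : 0 < t) (x : Pr 𝕜) :
    (min (s / t) (t / s)) ^ x.deg * dm (GN a s) x.rat ≤ dm (GN a t) x.rat := by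
  refine le_ciInf fun c => le_trans ?_ (GN_compare a hs ht x c)
  have p1 : 0 < s / t := by positivity
  have p2 : 0 < t / s := by positivity
  have : 0 ≤ min (s / t) (t / s) := le_min p1.le p2.le
  gcongr
  exact dm_le (GN_nabs a hs) _ c

theorem continuousAt_dm (a : 𝕜) {s : ℝ} (hs : 0 < s) (β : RatFunc 𝕜) (hβ : NC β) :
    ContinuousAt (fun t => dm (GN a t) β) s := by
  obtain ⟨x, rfl⟩ : ∃ x : Pr 𝕜, x.rat = β := ⟨Pr.of β hβ, Pr.of_rat β hβ⟩
  have hk : ContinuousAt (fun t : ℝ => min (s / t) (t / s)) s :=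
    (continuousAt_const.div continuousAt_id hs.ne').min (continuousAt_id.div_const s)
  have hk1 : (fun t : ℝ => min (s / t) (t / s)) s = 1 := by simp [hs.ne']
  have hd := dm_pos (GN_nabs a hs) x.rat_NC
  have l1 : ContinuousAt (fun t : ℝ => (min (s / t) (t / s)) ^ x.deg * dm (GN a s) x.rat) s :=
    (hk.pow _).mul continuousAt_const
  have l2 : ContinuousAt (fun t : ℝ => dm (GN a s) x.rat / (min (s / t) (t / s)) ^ x.deg) s :=
    continuousAt_const.div (hk.pow _) (by show min (s/s) (s/s) ^ x.deg ≠ 0; simp [hs.ne'])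
  have e1 : (min (s / s) (s / s)) ^ x.deg * dm (GN a s) x.rat = dm (GN a s) x.rat := by
    simp [hs.ne']
  have e2 : dm (GN a s) x.rat / (min (s / s) (s / s)) ^ x.deg = dm (GN a s) x.rat := by
    simp [hs.ne']
  rw [ContinuousAt, e1] at l1
  rw [ContinuousAt, e2] at l2
  refine tendsto_of_tendsto_of_tendsto_of_le_of_le' l1 l2 ?_ ?_
  · filter_upwards [Ioi_mem_nhds hs] with t ht
    exact dm_compare a hs ht x
  · filter_upwards [Ioi_mem_nhds hs] with t ht
    have ht : 0 < t := ht
    have := dm_compare a ht hs x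
    rw [min_comm] at this
    have p1 : 0 < s / t := by positivity
    have p2 : 0 < t / s := by positivity
    rw [le_div_iff₀ (pow_pos (lt_min p1 p2) _)]; linarith

theorem Rel_nhds (a : 𝕜) {s : ℝ} (hs : 0 < s) {α β : RatFunc 𝕜} (h : Rel (GN a s) α β) :
    ∀ᶠ t in 𝓝 s, Rel (GN a t) α β := by
  have h1 := continuousAt_GN a hs (α - β)
  have h2 := continuousAt_dm a hs β (h.nc (GN_nabs a hs))
  exact h1.eventually_lt h2 h

/-- (PL) path lifting -/
theorem path_lift (a : 𝕜) {r t : ℝ} (hr : 0 < r) {α γ h ψ : RatFunc 𝕜} (hα : NC α) (hγ : NC γ) (hh : NC h)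
    (h1 : ∀ s ∈ Set.Icc r t, Rel (GN a s) (ev h α) (ev h γ))
    (h2 : ∀ s ∈ Set.Icc r t, Rel (GN a s) (ev ψ (ev h γ)) γ)
    {s₀ : ℝ} (hs₀ : s₀ ∈ Set.Icc r t) (h0 : Rel (GN a s₀) α γ) :
    ∀ s ∈ Set.Icc r t, Rel (GN a s) α γ := by
  intro s hs
  by_contra hn
  have pos : ∀ s ∈ Set.Icc r t, 0 < s := fun s hs => hr.trans_le hs.1
  have hγ' := ev_NC hh hγ
  -- F = GN(α-γ) dm(hγ) * 2 , G = (dm(hγ) + GN(hα-hγ)) dm γ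
  have cF : ContinuousOn (fun s => 2 * (GN a s (α - γ) * dm (GN a s) (ev h γ))) (Set.Icc r t) := fun s hs =>
    (continuousAt_const.mul ((continuousAt_GN a (pos s hs) _).mul (continuousAt_dm a (pos s hs) _ hγ'))).continuousWithinAt
  have cG : ContinuousOn (fun s => (dm (GN a s) (ev h γ) + GN a s (ev h α - ev h γ)) * dm (GN a s) γ) (Set.Icc r t) := fun s hs =>
    (((continuousAt_dm a (pos s hs) _ hγ').add (continuousAt_GN a (pos s hs) _)).mul (continuousAt_dm a (pos s hs) _ hγ)).continuousWithinAt
  have good : ∀ s ∈ Set.Icc r t, Rel (GN a s) α γ → 2 * (GN a s (α - γ) * dm (GN a s) (ev h γ)) <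
      (dm (GN a s) (ev h γ) + GN a s (ev h α - ev h γ)) * dm (GN a s) γ := by
    intro s hs hr
    have hN := GN_nabs a (pos s hs)
    have := hr.le_ratio hN hh (h2 s hs)
    have l1 : GN a s (ev h α - ev h γ) < dm (GN a s) (ev h γ) := h1 s hs
    have d1 := dm_pos hN hγ
    nlinarith
  have bad : ∀ s ∈ Set.Icc r t, ¬ Rel (GN a s) α γ → (dm (GN a s) (ev h γ) + GN a s (ev h α - ev h γ)) * dm (GN a s) γ <
      2 * (GN a s (α - γ) * dm (GN a s) (ev h γ)) := by
    intro s hs hr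
    have hN := GN_nabs a (pos s hs)
    have hr' := not_lt.1 hr
    have l1 : GN a s (ev h α - ev h γ) < dm (GN a s) (ev h γ) := h1 s hs
    have d1 := dm_pos hN hγ
    have d2 := dm_pos hN hγ'
    nlinarith [mul_le_mul_of_nonneg_right hr' d2.le]
  obtain ⟨w, hw, e⟩ := isPreconnected_Icc.intermediate_value₂ hs₀ hs cF cG (good _ hs₀ h0).le (bad s hs hn).le
  by_cases hr : Rel (GN a w) α γ
  · exact absurd e (good w hw hr).ne
  · exact absurd e (bad w hw hr).ne'

end Cont

section Ctx
variable (𝕜 : Type*) [NontriviallyNormedField 𝕜] [IsUltrametricDist 𝕜] [IsAlgClosed 𝕜]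

/-- The running assumptions. -/
structure Ctx where
  f : Pr 𝕜
  x : Pr 𝕜
  y : Pr 𝕜
  𝒰 : Ultrafilter ℕ
  le_top : (𝒰 : Filter ℕ) ≤ atTop
  a₀ : 𝕜
  s₀ : ℝ
  hs₀ : 0 < s₀
  top : ∀ᶠ n in (𝒰 : Filter ℕ), Rel (GN a₀ s₀) (Pr.it f x n).rat y.rat

variable {𝕜}
namespace Ctx
variable (X : Ctx 𝕜)

/-- the iterates -/
noncomputable def α (n : ℕ) : RatFunc 𝕜 := (Pr.it X.f X.x n).rat
/-- the target -/
noncomputable def β : RatFunc 𝕜 := X.y.rat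

theorem α_add (m n : ℕ) : X.α (m + n) = ev (X.f.itr m) (X.α n) := Pr.it_add_rat _ _ _ _
theorem α_NC (n : ℕ) : NC (X.α n) := Pr.rat_NC _
theorem β_NC : NC X.β := Pr.rat_NC _

/-- quasi-periodicity domain -/
def V (ξ : 𝕜) (s : ℝ) : Prop := ∀ᶠ n in (X.𝒰 : Filter ℕ), Rel (GN ξ s) (X.α n) X.β

theorem V_top {ξ : 𝕜} (h : ‖ξ - X.a₀‖ ≤ X.s₀) : X.V ξ X.s₀ := by
  rw [V, GN_center X.hs₀ h]; exact X.top

theorem V_center {ξ ξ' : 𝕜} {s : ℝ} (hs : 0 < s) (h : ‖ξ - ξ'‖ ≤ s) : X.V ξ s ↔ X.V ξ' s := by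
  rw [V, V, GN_center hs h]

theorem rel_pow (X : Ctx 𝕜) {N : RatFunc 𝕜 → ℝ} (hN : NAbs N) {k : ℕ} (h : Rel N (ev (X.f.itr k) X.β) X.β) (m : ℕ) :
    Rel N (ev (X.f.itr (m * k)) X.β) X.β := by
  induction m with
  | zero => simp only [zero_mul, Pr.itr, ev_X]; exact Rel.refl hN X.β_NC
  | succ m ih =>
    rw [Nat.succ_mul, Pr.itr_add _ _ _ X.β_NC]
    exact (h.ev hN (X.f.itr_NC _)).trans hN ih

theorem rel_diff {N : RatFunc 𝕜 → ℝ} (hN : NAbs N) {n k : ℕ} (h1 : Rel N (X.α n) X.β) (h2 : Rel N (X.α (k + n)) X.β) :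
    Rel N (ev (X.f.itr k) X.β) X.β := by
  have := (h1.ev hN (X.f.itr_NC k))
  rw [← X.α_add] at this
  exact (this.symm hN).trans hN h2

theorem exists_later {p : ℕ → Prop} (hp : ∀ᶠ n in (X.𝒰 : Filter ℕ), p n) (N : ℕ) : ∃ n, N < n ∧ p n := by
  have h1 : ∀ᶠ n in (X.𝒰 : Filter ℕ), N < n := X.le_top (eventually_gt_atTop N)
  exact (h1.and hp).exists

/-- (LOC) -/
theorem loc {ξ : 𝕜} {s : ℝ} (hs : 0 < s) (h : X.V ξ s) :
    ∃ O ∈ 𝓝 s, ∀ᶠ n in (X.𝒰 : Filter ℕ), ∀ t ∈ O, 0 < t ∧ Rel (GN ξ t) (X.α n) X.β := by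
  have hN := GN_nabs (𝕜 := 𝕜) ξ hs
  obtain ⟨n0, -, h0⟩ := X.exists_later h 0
  obtain ⟨n1, hn1, h1⟩ := X.exists_later h n0
  obtain ⟨k, rfl⟩ := Nat.exists_eq_add_of_lt hn1
  set k0 := k + 1
  have e1 : n0 + k + 1 = k0 + n0 := by omega
  rw [e1] at h1
  have hk := X.rel_diff hN h0 h1
  -- residue class
  have hres : ∃ i, ∀ᶠ n in (X.𝒰 : Filter ℕ), n % k0 = i := by
    have hfin : (Set.Iio k0).Finite := Set.finite_Iio k0
    have : (⋃ i ∈ Set.Iio k0, {n | n % k0 = i}) ∈ X.𝒰 := by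
      refine Filter.mem_of_superset Filter.univ_mem fun n _ => ?_
      simp only [Set.mem_iUnion]
      exact ⟨n % k0, Nat.mod_lt _ (by omega), rfl⟩
    rw [Ultrafilter.finite_biUnion_mem_iff hfin] at this
    obtain ⟨i, -, hi⟩ := this
    exact ⟨i, hi⟩
  obtain ⟨i, hi⟩ := hres
  obtain ⟨n2, -, hn2, hn2i⟩ := X.exists_later (h.and hi) 0
  have hpos : ∀ᶠ t in 𝓝 s, 0 < t := Ioi_mem_nhds hs
  refine ⟨_, (hpos.and ((Rel_nhds ξ hs hk).and (Rel_nhds ξ hs hn2))), ?_⟩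
  filter_upwards [hi, X.le_top (eventually_ge_atTop n2)] with n hni hn t ht
  obtain ⟨ht0, r1, r2⟩ := ht
  refine ⟨ht0, ?_⟩
  have hNt := GN_nabs (𝕜 := 𝕜) ξ ht0
  obtain ⟨m, hm⟩ : ∃ m, n = m * k0 + n2 := by
    have : k0 ∣ n - n2 := (Nat.modEq_iff_dvd' hn).1 (by rw [Nat.ModEq, hni, hn2i])
    obtain ⟨m, hm⟩ := this
    exact ⟨m, by rw [mul_comm]; omega⟩
  rw [hm, X.α_add]
  exact (r2.ev hNt (X.f.itr_NC _)).trans hNt (X.rel_pow hNt r1 m)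

/-- good radii -/
def good (ξ : 𝕜) (r : ℝ) : Prop := 0 < r ∧ r ≤ X.s₀ ∧ ∀ s ∈ Set.Icc r X.s₀, X.V ξ s

/-- uniformity on good paths -/
theorem good_unif {ξ : 𝕜} {r : ℝ} (h : X.good ξ r) :
    ∀ᶠ n in (X.𝒰 : Filter ℕ), ∀ s ∈ Set.Icc r X.s₀, Rel (GN ξ s) (X.α n) X.β := by
  obtain ⟨h0, -, h2⟩ := h
  refine isCompact_Icc.induction_on (s := Set.Icc r X.s₀) (p := fun S => ∀ᶠ n in (X.𝒰 : Filter ℕ), ∀ s ∈ S, Rel (GN ξ s) (X.α n) X.β) ?_ ?_ ?_ ?_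
  · simp
  · intro s t hst ht
    filter_upwards [ht] with n hn u hu using hn u (hst hu)
  · intro s t hs ht
    filter_upwards [hs, ht] with n h1 h2 u hu
    exact hu.elim (h1 u) (h2 u)
  · intro s hs
    obtain ⟨O, hO, h⟩ := X.loc (h0.trans_le hs.1) (h2 s hs)
    refine ⟨O, nhdsWithin_le_nhds hO, ?_⟩
    filter_upwards [h] with n hn u hu using (hn u hu).2

/-- leaf radius -/
noncomputable def rad (ξ : 𝕜) : ℝ := sInf {r | X.good ξ r}

theorem good_top {ξ : 𝕜} (h : ‖ξ - X.a₀‖ ≤ X.s₀) : X.good ξ X.s₀ :=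
  ⟨X.hs₀, le_rfl, fun s hs => by rw [Set.Icc_self, Set.mem_singleton_iff] at hs; rw [hs]; exact X.V_top h⟩

theorem bdd (ξ : 𝕜) : BddBelow {r | X.good ξ r} := ⟨0, fun r hr => hr.1.le⟩

theorem rad_nonneg {ξ : 𝕜} : 0 ≤ X.rad ξ := Real.sInf_nonneg fun r hr => hr.1.le

theorem good_of_rad_lt {ξ : 𝕜} (h : ‖ξ - X.a₀‖ ≤ X.s₀) {r : ℝ} (hr : X.rad ξ < r) (hr' : r ≤ X.s₀) : X.good ξ r := by
  obtain ⟨r1, h1, h2⟩ := (csInf_lt_iff (X.bdd ξ) ⟨_, X.good_top h⟩).1 hr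
  exact ⟨X.rad_nonneg.trans_lt hr, hr', fun s hs => h1.2.2 s ⟨h2.le.trans hs.1, hs.2⟩⟩

theorem rad_le {ξ : 𝕜} {r : ℝ} (h : X.good ξ r) : X.rad ξ ≤ r := csInf_le (X.bdd ξ) h

theorem good_extend {ξ : 𝕜} {r : ℝ} (h : X.good ξ r) : ∃ r', r' < r ∧ X.good ξ r' := by
  obtain ⟨O, hO, hn⟩ := X.loc h.1 (h.2.2 r ⟨le_rfl, h.2.1⟩)
  obtain ⟨l, u, hlu, hsub⟩ := mem_nhds_iff_exists_Ioo_subset.1 hO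
  obtain ⟨r', h1, h2⟩ := exists_between (max_lt hlu.1 h.1)
  refine ⟨r', h2, lt_of_le_of_lt (le_max_right _ _) h1, h2.le.trans h.2.1, fun s hs => ?_⟩
  rcases le_or_gt r s with hrs | hrs
  · exact h.2.2 s ⟨hrs, hs.2⟩
  · filter_upwards [hn] with n hn
    exact (hn s (hsub ⟨lt_of_lt_of_le (lt_of_le_of_lt (le_max_left _ _) h1) hs.1, hrs.trans hlu.2⟩)).2

theorem rad_lt_of_good {ξ : 𝕜} {r : ℝ} (h : X.good ξ r) : X.rad ξ < r := by
  obtain ⟨r', h1, h2⟩ := X.good_extend h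
  exact (X.rad_le h2).trans_lt h1

theorem rad_lt {ξ : 𝕜} (h : ‖ξ - X.a₀‖ ≤ X.s₀) : X.rad ξ < X.s₀ := X.rad_lt_of_good (X.good_top h)

theorem not_V_rad {ξ : 𝕜} (h : ‖ξ - X.a₀‖ ≤ X.s₀) (h0 : 0 < X.rad ξ) : ¬ X.V ξ (X.rad ξ) := by
  intro hV
  have : X.good ξ (X.rad ξ) := by
    refine ⟨h0, (X.rad_lt h).le, fun s hs => ?_⟩
    rcases eq_or_lt_of_le hs.1 with e | hlt
    · rw [← e]; exact hV
    · exact (X.good_of_rad_lt h hlt hs.2).2.2 s ⟨le_rfl, hs.2⟩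
  exact lt_irrefl _ (X.rad_lt_of_good this)

theorem good_center {ξ ξ' : 𝕜} {r : ℝ} (hd : ‖ξ - ξ'‖ ≤ r) (h : X.good ξ r) : X.good ξ' r :=
  ⟨h.1, h.2.1, fun s hs => (X.V_center (h.1.trans_le hs.1) (hd.trans hs.1)).1 (h.2.2 s hs)⟩

theorem mem_center {ξ ξ' : 𝕜} (h : ‖ξ - X.a₀‖ ≤ X.s₀) (hd : ‖ξ - ξ'‖ ≤ X.s₀) : ‖ξ' - X.a₀‖ ≤ X.s₀ :=
  (dist_tri ξ' ξ X.a₀).trans (max_le (by rwa [norm_sub_rev]) h)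

theorem rad_eq {ξ ξ' : 𝕜} (h : ‖ξ - X.a₀‖ ≤ X.s₀) (hd : ‖ξ - ξ'‖ ≤ X.rad ξ) : X.rad ξ' = X.rad ξ := by
  have h' : ‖ξ' - X.a₀‖ ≤ X.s₀ := X.mem_center h (hd.trans (X.rad_lt h).le)
  apply le_antisymm
  · refine le_csInf ⟨_, X.good_top h⟩ fun r hr => ?_
    exact X.rad_le (X.good_center (hd.trans (X.rad_le hr)) hr)
  · by_contra hlt
    push Not at hlt
    have := X.good_of_rad_lt h' hlt (X.rad_lt h).le
    have := X.good_center (by rwa [norm_sub_rev]) this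
    exact lt_irrefl _ (X.rad_lt_of_good this)

/-- (PSI) a common inverse branch -/
theorem exists_psi {M : ℕ} (hM : Rel (GN X.a₀ X.s₀) (X.α M) X.β) {x1 x2 : 𝕜} {r1 r2 : ℝ}
    (hx1 : ‖x1 - X.a₀‖ ≤ X.s₀) (hx2 : ‖x2 - X.a₀‖ ≤ X.s₀) (h1 : X.good x1 r1) (h2 : X.good x2 r2) :
    ∃ h ψ : RatFunc 𝕜, NC h ∧ NC ψ ∧
      (∀ s ∈ Set.Icc r1 X.s₀, Rel (GN x1 s) (ev h (ev ψ X.β)) X.β ∧ Rel (GN x1 s) (X.α M) (ev ψ X.β)) ∧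
      (∀ s ∈ Set.Icc r2 X.s₀, Rel (GN x2 s) (ev h (ev ψ X.β)) X.β ∧ Rel (GN x2 s) (X.α M) (ev ψ X.β)) := by
  have u1 := X.good_unif h1
  have u2 := X.good_unif h2
  obtain ⟨n, hnM, n1, n2⟩ := X.exists_later (u1.and u2) M
  obtain ⟨n', hn', n1', n2'⟩ := X.exists_later (u1.and u2) n
  obtain ⟨k, rfl⟩ : ∃ k, n' = k + n := ⟨n' - n, by omega⟩
  have hk0 : 0 < k := by omega
  obtain ⟨m, rfl⟩ : ∃ m, n = m + M := ⟨n - M, by omega⟩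
  -- k' = m * k - m
  set k' := m * k - m
  have hkk : m + k' = m * k := by
    have : m * 1 ≤ m * k := Nat.mul_le_mul_left m hk0
    omega
  have hev : ev (X.f.itr m) (ev (X.f.itr k') X.β) = ev (X.f.itr (m * k)) X.β := by
    rw [← hkk, Pr.itr_add _ _ _ X.β_NC]
  have hev' : ev (X.f.itr k') (ev (X.f.itr m) X.β) = ev (X.f.itr (m * k)) X.β := by
    rw [← hkk, add_comm, Pr.itr_add _ _ _ X.β_NC]
  have hNC := ev_NC (X.f.itr_NC k') X.β_NC
  have key : ∀ (ξ : 𝕜) (r : ℝ), ‖ξ - X.a₀‖ ≤ X.s₀ → X.good ξ r →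
      (∀ s ∈ Set.Icc r X.s₀, Rel (GN ξ s) (X.α (m + M)) X.β) →
      (∀ s ∈ Set.Icc r X.s₀, Rel (GN ξ s) (X.α (k + (m + M))) X.β) →
      ∀ s ∈ Set.Icc r X.s₀, Rel (GN ξ s) (ev (X.f.itr m) (ev (X.f.itr k') X.β)) X.β ∧
        Rel (GN ξ s) (X.α M) (ev (X.f.itr k') X.β) := by
    intro ξ r hξ hg g1 g2
    have hmem : X.s₀ ∈ Set.Icc r X.s₀ := ⟨hg.2.1, le_rfl⟩
    have per : ∀ s ∈ Set.Icc r X.s₀, Rel (GN ξ s) (ev (X.f.itr (m * k)) X.β) X.β := fun s hs =>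
      X.rel_pow (GN_nabs ξ (hg.1.trans_le hs.1)) (X.rel_diff (GN_nabs ξ (hg.1.trans_le hs.1)) (g1 s hs) (g2 s hs)) m
    have first : ∀ s ∈ Set.Icc r X.s₀, Rel (GN ξ s) (ev (X.f.itr m) (ev (X.f.itr k') X.β)) X.β := by
      intro s hs; rw [hev]; exact per s hs
    have hN0 := GN_nabs (𝕜 := 𝕜) ξ X.hs₀
    have hM' : Rel (GN ξ X.s₀) (X.α M) X.β := by rw [GN_center X.hs₀ hξ]; exact hM
    have topr : Rel (GN ξ X.s₀) (X.α M) (ev (X.f.itr k') X.β) := by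
      have a1 := X.rel_diff hN0 hM' (g1 _ hmem)
      have a2 := a1.ev hN0 (X.f.itr_NC k')
      rw [hev'] at a2
      exact hM'.trans hN0 (((per _ hmem).symm hN0).trans hN0 a2)
    have second := path_lift ξ hg.1 (t := X.s₀) (α := X.α M) (γ := ev (X.f.itr k') X.β) (h := X.f.itr m) (ψ := X.f.itr k')
      (X.α_NC M) hNC (X.f.itr_NC m) (fun s hs => by
        have hN := GN_nabs (𝕜 := 𝕜) ξ (hg.1.trans_le hs.1)
        rw [← X.α_add]
        exact (g1 s hs).trans hN ((first s hs).symm hN)) (fun s hs => by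
        have hN := GN_nabs (𝕜 := 𝕜) ξ (hg.1.trans_le hs.1)
        exact (first s hs).ev hN (X.f.itr_NC k')) hmem topr
    exact fun s hs => ⟨first s hs, second s hs⟩
  exact ⟨X.f.itr m, X.f.itr k', X.f.itr_NC m, X.f.itr_NC k', key x1 r1 hx1 h1 n1 n1', key x2 r2 hx2 h2 n2 n2'⟩

end Ctx
end Ctx
end EQ

/-! ## Uncovered preimages -/
namespace EQ

section Path
variable {𝕜 : Type*} [NontriviallyNormedField 𝕜] [IsUltrametricDist 𝕜] [IsAlgClosed 𝕜]

/-- path through a join point -/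
noncomputable def pth (x1 x2 : 𝕜) (S τ : ℝ) (R : RatFunc 𝕜) : ℝ :=
  if τ ≤ 0 then GN x1 (S * Real.exp τ) R else GN x2 (S * Real.exp (-τ)) R

theorem pth_of_le {x1 x2 : 𝕜} {S τ : ℝ} (h : τ ≤ 0) : pth x1 x2 S τ = GN x1 (S * Real.exp τ) := by
  funext R; rw [pth, if_pos h]

theorem pth_of_ge {x1 x2 : 𝕜} {S τ : ℝ} (hS : 0 < S) (hx : ‖x1 - x2‖ ≤ S) (h : 0 ≤ τ) :
    pth x1 x2 S τ = GN x2 (S * Real.exp (-τ)) := by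
  funext R
  rw [pth]
  split_ifs with h'
  · have : τ = 0 := le_antisymm h' h
    subst this
    simp only [neg_zero, Real.exp_zero, mul_one]
    rw [GN_center hS hx]
  · rfl

theorem pth_nabs (x1 x2 : 𝕜) {S : ℝ} (hS : 0 < S) (τ : ℝ) : NAbs (pth x1 x2 S τ) := by
  rcases le_or_gt τ 0 with h | h
  · rw [pth_of_le h]; exact GN_nabs _ (by positivity)
  · have : pth x1 x2 S τ = GN x2 (S * Real.exp (-τ)) := by funext R; rw [pth, if_neg (not_le.2 h)]
    rw [this]; exact GN_nabs _ (by positivity)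

theorem pth_cont {x1 x2 : 𝕜} {S : ℝ} (hS : 0 < S) (hx : ‖x1 - x2‖ ≤ S) (R : RatFunc 𝕜) :
    Continuous fun τ => pth x1 x2 S τ R := by
  unfold pth
  refine Continuous.if_le ?_ ?_ continuous_id continuous_const ?_
  · exact (continuousOn_GN x1 R).comp_continuous (by fun_prop) (fun τ => by
      show 0 < S * Real.exp τ; positivity)
  · exact (continuousOn_GN x2 R).comp_continuous (by fun_prop) (fun τ => by
      show 0 < S * Real.exp (-τ); positivity)
  · intro τ h
    have h : τ = 0 := h
    subst h
    simp [GN_center hS hx]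

/-- the on-axis criterion -/
theorem axis {N : ℝ → RatFunc 𝕜 → ℝ} (hN : ∀ τ, NAbs (N τ)) (hc : ∀ R, Continuous fun τ => N τ R)
    (γ : RatFunc 𝕜) (c : 𝕜) {τ : ℝ} (h : ∃ᶠ τ' in 𝓝 τ, N τ' (γ - RatFunc.C c) ≠ N τ (γ - RatFunc.C c)) (b : 𝕜) :
    N τ (γ - RatFunc.C b) = max ‖b - c‖ (N τ (γ - RatFunc.C c)) := by
  have tri1 : ∀ (τ : ℝ) (b c : 𝕜), N τ (γ - RatFunc.C b) ≤ max ‖b - c‖ (N τ (γ - RatFunc.C c)) := by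
    intro τ b c
    have := (hN τ).tri γ (RatFunc.C c) (RatFunc.C b)
    rw [← map_sub, (hN τ).map_C, norm_sub_rev] at this
    rwa [max_comm]
  have tri2 : ∀ (τ : ℝ) (b c : 𝕜), ‖b - c‖ ≤ max (N τ (γ - RatFunc.C b)) (N τ (γ - RatFunc.C c)) := by
    intro τ b c
    have := (hN τ).tri (RatFunc.C b) γ (RatFunc.C c)
    rwa [← map_sub, (hN τ).map_C, (hN τ).sub_rev] at this
  apply le_antisymm (tri1 τ b c)
  by_contra hlt
  push Not at hlt
  apply h
  have hb : N τ (γ - RatFunc.C b) < ‖b - c‖ := by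
    rcases lt_max_iff.1 hlt with h1 | h1
    · exact h1
    · have := tri1 τ c b
      rw [norm_sub_rev] at this
      rcases le_max_iff.1 this with h2 | h2
      · exact h1.trans_le h2
      · linarith
  have key : ∀ τ', N τ' (γ - RatFunc.C b) < ‖b - c‖ → N τ' (γ - RatFunc.C c) = ‖b - c‖ := by
    intro τ' hτ
    apply le_antisymm
    · have := tri1 τ' c b
      rw [norm_sub_rev, max_eq_left hτ.le] at this
      exact this
    · rcases le_max_iff.1 (tri2 τ' b c) with h2 | h2
      · linarith
      · exact h2
  filter_upwards [(hc (γ - RatFunc.C b)).continuousAt.eventually_lt continuousAt_const hb] with τ' hτ'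
  rw [not_not, key τ' hτ', key τ hb]

theorem first_hit {u : ℝ → ℝ} (hu : Continuous u) {a b t : ℝ} (hab : a ≤ b) (ha : u a < t) (hb : t ≤ u b) :
    ∃ τ ∈ Set.Ioc a b, u τ = t ∧ ∀ τ' ∈ Set.Ico a τ, u τ' ≠ t := by
  set S := {τ | τ ∈ Set.Icc a b ∧ u τ = t}
  have hS : IsCompact S := by
    have : S = Set.Icc a b ∩ u ⁻¹' {t} := by ext; simp [S]
    rw [this]; exact isCompact_Icc.inter_right (isClosed_singleton.preimage hu)
  have hne : S.Nonempty := by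
    obtain ⟨τ, h1, h2⟩ := intermediate_value_Icc hab hu.continuousOn ⟨ha.le, hb⟩
    exact ⟨τ, h1, h2⟩
  obtain ⟨τ, hτ, hmin⟩ := hS.exists_isLeast hne
  refine ⟨τ, ⟨lt_of_le_of_ne hτ.1.1 ?_, hτ.1.2⟩, hτ.2, fun τ' h' e => ?_⟩
  · rintro rfl
    exact ha.ne hτ.2
  · have := hmin ⟨⟨h'.1, h'.2.le.trans hτ.1.2⟩, e⟩
    exact absurd h'.2 (not_lt.2 this)

theorem axis_first {N : ℝ → RatFunc 𝕜 → ℝ} (hN : ∀ τ, NAbs (N τ)) (hc : ∀ R, Continuous fun τ => N τ R)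
    (γ : RatFunc 𝕜) (c : 𝕜) {a b t : ℝ} (hab : a ≤ b) (ha : N a (γ - RatFunc.C c) < t) (hb : t ≤ N b (γ - RatFunc.C c)) :
    ∃ τ ∈ Set.Ioc a b, ∀ b', N τ (γ - RatFunc.C b') = max ‖b' - c‖ t := by
  obtain ⟨τ, hτ, h1, h2⟩ := first_hit (hc (γ - RatFunc.C c)) hab ha hb
  refine ⟨τ, hτ, fun b' => ?_⟩
  rw [axis hN hc γ c _ b', h1]
  have : ∃ᶠ τ' in 𝓝[<] τ, N τ' (γ - RatFunc.C c) ≠ N τ (γ - RatFunc.C c) := by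
    apply Eventually.frequently
    filter_upwards [Ico_mem_nhdsLT hτ.1] with τ' hτ'
    rw [h1]; exact h2 τ' hτ'
  exact this.filter_mono nhdsWithin_le_nhds

theorem axis_last {N : ℝ → RatFunc 𝕜 → ℝ} (hN : ∀ τ, NAbs (N τ)) (hc : ∀ R, Continuous fun τ => N τ R)
    (γ : RatFunc 𝕜) (c : 𝕜) {a b t : ℝ} (hab : a ≤ b) (ha : t ≤ N a (γ - RatFunc.C c)) (hb : N b (γ - RatFunc.C c) < t) :
    ∃ τ ∈ Set.Ico a b, ∀ b', N τ (γ - RatFunc.C b') = max ‖b' - c‖ t := by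
  obtain ⟨τ, hτ, h⟩ := axis_first (N := fun τ => N (-τ)) (fun τ => hN _) (fun R => (hc R).comp continuous_neg) γ c
    (a := -b) (b := -a) (by linarith) (t := t) (by simpa using hb) (by simpa using ha)
  exact ⟨-τ, ⟨by linarith [hτ.2], by linarith [hτ.1]⟩, h⟩

theorem ev_id (R : RatFunc 𝕜) : ev R RatFunc.X = R := by
  rw [ev_def]
  have : ∀ p : 𝕜[X], pev p (RatFunc.X : RatFunc 𝕜) = algebraMap _ _ p := by
    intro p
    rw [pev, ← RatFunc.algebraMap_X, ← Polynomial.aeval_def, Polynomial.aeval_algebraMap_apply, Polynomial.aeval_X_left_apply]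
  rw [this, this, RatFunc.num_div_denom]

theorem GN_X (b : 𝕜) {s : ℝ} (hs : 0 < s) (b' : 𝕜) : GN b s (RatFunc.X - RatFunc.C b') = max ‖b - b'‖ s := by
  rw [← RatFunc.algebraMap_X, ← RatFunc.algebraMap_C, ← map_sub, GN_alg b hs, gn_X_sub_C b hs]

/-- transfer along the axis -/
theorem transfer {N : RatFunc 𝕜 → ℝ} (hN : NAbs N) {β : RatFunc 𝕜} {b : 𝕜} {s : ℝ} (hs : 0 < s)
    (h : ∀ b', N (β - RatFunc.C b') = max ‖b' - b‖ s) (R : RatFunc 𝕜) : N (ev R β) = GN b s R := by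
  have := ev_norm_congr hN (GN_nabs b hs) (α := β) (β := RatFunc.X) (fun c => by
    rw [h, GN_X b hs, norm_sub_rev]) R
  rwa [ev_id] at this

theorem transfer_rel {N : RatFunc 𝕜 → ℝ} (hN : NAbs N) {β : RatFunc 𝕜} (hβ : NC β) {b : 𝕜} {s : ℝ} (hs : 0 < s)
    (h : ∀ b', N (β - RatFunc.C b') = max ‖b' - b‖ s) {φ ψ : RatFunc 𝕜} (hψ : NC ψ) (hr : Rel N (ev φ (ev ψ β)) β) :
    Rel (GN b s) (ev φ ψ) RatFunc.X := by
  have e1 := transfer hN hs h (ev φ ψ - RatFunc.X)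
  rw [ev_sub hβ, ev_assoc _ _ hβ, ev_X] at e1
  have e2 : dm N β = dm (GN b s) RatFunc.X := by
    unfold dm
    congr 1
    funext c
    rw [h, GN_X b hs, norm_sub_rev]
  unfold Rel
  rw [← e1, ← e2]; exact hr

theorem transfer_val {N : RatFunc 𝕜 → ℝ} (hN : NAbs N) {α β : RatFunc 𝕜} (hβ : NC β) {b : 𝕜} {s : ℝ} (hs : 0 < s)
    (h : ∀ b', N (β - RatFunc.C b') = max ‖b' - b‖ s) {ψ : RatFunc 𝕜} (hr : Rel N α (ev ψ β)) (c : 𝕜) :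
    GN b s (ψ - RatFunc.C c) = N (α - RatFunc.C c) := by
  rw [hr.eq hN c, ← transfer hN hs h, ev_sub_C hβ]

/-- the downstairs contradiction -/
theorem down {b1 b2 : 𝕜} (hne : b1 ≠ b2) {L1 L2 : ℝ} {φ ψ : RatFunc 𝕜} (c : 𝕜)
    (hr : ∀ τ ∈ Set.Icc (-L1) L2, Rel (pth b1 b2 ‖b1 - b2‖ τ) (ev φ ψ) RatFunc.X) {τ₀ : ℝ} (h0 : τ₀ ∈ Set.Icc (-L1) L2)
    (h1 : pth b1 b2 ‖b1 - b2‖ (-L1) (ψ - RatFunc.C c) < pth b1 b2 ‖b1 - b2‖ τ₀ (ψ - RatFunc.C c))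
    (h2 : pth b1 b2 ‖b1 - b2‖ L2 (ψ - RatFunc.C c) < pth b1 b2 ‖b1 - b2‖ τ₀ (ψ - RatFunc.C c)) : False := by
  set S := ‖b1 - b2‖ with hSdef
  have hS : 0 < S := norm_pos_iff.2 (sub_ne_zero.2 hne)
  set N := pth b1 b2 S
  have hN : ∀ τ, NAbs (N τ) := pth_nabs b1 b2 hS
  have hc : ∀ R, Continuous fun τ => N τ R := pth_cont hS le_rfl
  obtain ⟨t, ht1, ht2⟩ := exists_between (max_lt h1 h2)
  obtain ⟨τ1, hτ1, e1⟩ := axis_first hN hc ψ c h0.1 ((le_max_left _ _).trans_lt ht1) ht2.le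
  obtain ⟨τ2, hτ2, e2⟩ := axis_last hN hc ψ c h0.2 ht2.le ((le_max_right _ _).trans_lt ht1)
  have m1 : τ1 ∈ Set.Icc (-L1) L2 := ⟨hτ1.1.le, hτ1.2.trans h0.2⟩
  have m2 : τ2 ∈ Set.Icc (-L1) L2 := ⟨h0.1.trans hτ2.1, hτ2.2.le⟩
  have ht0 : N τ₀ (ψ - RatFunc.C c) ≠ t := ht2.ne'
  have same : ∀ b, N τ1 (RatFunc.X - RatFunc.C b) = N τ2 (RatFunc.X - RatFunc.C b) := by
    intro b
    rw [← (hr τ1 m1).eq (hN τ1), ← (hr τ2 m2).eq (hN τ2)]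
    have hNC : NC ψ := by
      intro d hd
      have := hr τ1 m1
      rw [hd] at this
      have q := (this.symm (hN τ1)).nc (hN τ1)
      obtain ⟨d', hd'⟩ : ∃ d', ev φ (RatFunc.C d) = RatFunc.C d' := by
        have hp : ∀ p : 𝕜[X], pev p (RatFunc.C d : RatFunc 𝕜) = RatFunc.C (p.eval d) := by
          intro p
          rw [pev, RatFunc.algebraMap_eq_C, Polynomial.eval₂_at_apply]
        exact ⟨φ.num.eval d / φ.denom.eval d, by rw [ev_def, hp, hp, map_div₀]⟩
      exact q d' hd'
    rw [← ev_sub_C hNC]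
    exact ev_norm_congr (hN τ1) (hN τ2) (fun c' => by rw [e1, e2]) _
  have hlt : τ1 < τ2 := by
    refine lt_of_le_of_ne (hτ1.2.trans hτ2.1) fun e => ?_
    have : τ1 = τ₀ := le_antisymm hτ1.2 (by rw [e]; exact hτ2.1)
    apply ht0
    rw [← this, e1]
    simp only [sub_self, norm_zero]
    exact max_eq_right (((hN (-L1)).nonneg _).trans ((le_max_left _ _).trans ht1.le))
  have vF : ∀ τ, N τ (RatFunc.X - RatFunc.C b1) = S * Real.exp (min τ 0) := by
    intro τ
    rcases le_total τ 0 with h | h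
    · rw [show N τ = _ from pth_of_le h, GN_X _ (by positivity), min_eq_left h]; simp; positivity
    · rw [show N τ = _ from pth_of_ge hS le_rfl h, GN_X _ (by positivity), min_eq_right h, norm_sub_rev, ← hSdef]
      simp
      nlinarith [Real.exp_le_one_iff.2 (by linarith : -τ ≤ 0)]
  have vG : ∀ τ, N τ (RatFunc.X - RatFunc.C b2) = S * Real.exp (-max τ 0) := by
    intro τ
    rcases le_total τ 0 with h | h
    · rw [show N τ = _ from pth_of_le h, GN_X _ (by positivity), max_eq_right h, ← hSdef]
      simp
      nlinarith [Real.exp_le_one_iff.2 h]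
    · rw [show N τ = _ from pth_of_ge hS le_rfl h, GN_X _ (by positivity), max_eq_left h]; simp; positivity
  have a1 := same b1
  have a2 := same b2
  rw [vF, vF] at a1
  rw [vG, vG] at a2
  have a1' := Real.exp_injective (mul_left_cancel₀ hS.ne' a1)
  have a2' := Real.exp_injective (mul_left_cancel₀ hS.ne' a2)
  have := min_add_max τ1 0
  have := min_add_max τ2 0
  linarith

end Path
end EQ

/-! ## Uncovered preimages, two discs -/
namespace EQ

section Pf
variable {𝕜 : Type*} [NontriviallyNormedField 𝕜] [IsUltrametricDist 𝕜] [IsAlgClosed 𝕜]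

/-- no poles in the closed disc -/
def Pr.pf (x : Pr 𝕜) (a : 𝕜) (s : ℝ) : Prop := ∀ r, ‖a - r‖ ≤ s → x.B.eval r ≠ 0

/-- the value of a rational function -/
noncomputable def Pr.at' (x : Pr 𝕜) (a : 𝕜) : 𝕜 := x.A.eval a / x.B.eval a

namespace Pr

theorem pf.gn_B {x : Pr 𝕜} {a : 𝕜} {s : ℝ} (h : x.pf a s) (hs : 0 < s) : gn a s x.B = ‖x.B.eval a‖ := by
  rw [gn_eq_prod a hs]
  have := (IsAlgClosed.splits x.B).eval_eq_prod_roots a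
  rw [this, norm_mul]
  congr 1
  have hh : ‖(Multiset.map (fun x => a - x) x.B.roots).prod‖ = ((Multiset.map (fun x => a - x) x.B.roots).map (fun z => ‖z‖)).prod :=
    (Multiset.prod_hom _ (normHom : 𝕜 →*₀ ℝ)).symm
  rw [hh, Multiset.map_map]
  congr 1
  apply Multiset.map_congr rfl
  intro r hr
  simp only [Function.comp]
  apply max_eq_left
  by_contra hlt
  push Not at hlt
  exact h r hlt.le (by simpa using (Polynomial.mem_roots x.hB).1 hr)

theorem pf.center {x : Pr 𝕜} {a b : 𝕜} {s : ℝ} (h : x.pf a s) (hb : ‖a - b‖ ≤ s) : x.pf b s := by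
  intro r hr
  exact h r ((dist_tri a b r).trans (max_le hb hr))

theorem pf.le {x : Pr 𝕜} {a : 𝕜} {s t : ℝ} (h : x.pf a t) (hst : s ≤ t) : x.pf a s := fun r hr => h r (hr.trans hst)

theorem pf.Z {x : Pr 𝕜} {a : 𝕜} {s : ℝ} (h : x.pf a s) : x.Z (cl a s) OnePoint.infty = 0 := by
  by_contra h0
  rw [Pr.Z, Pr.l_infty, cnt_neg] at h0
  obtain ⟨r, h1, h2⟩ := (cnt_pos x.hB).1 (Nat.pos_of_ne_zero h0)
  exact h r h2 h1

theorem pf_of_Z {x : Pr 𝕜} {a : 𝕜} {s : ℝ} (h : x.Z (cl a s) OnePoint.infty = 0) : x.pf a s := by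
  intro r hr h0
  rw [Pr.Z, Pr.l_infty, cnt_neg] at h
  exact h.not_gt ((cnt_pos x.hB).2 ⟨r, h0, hr⟩)

theorem pf.at_le {x : Pr 𝕜} {a : 𝕜} {s : ℝ} (h : x.pf a s) (hs : 0 < s) {z : 𝕜} (hz : ‖a - z‖ ≤ s) (b : 𝕜) :
    ‖x.at' z - b‖ ≤ GN a s (x.rat - RatFunc.C b) := by
  rw [x.GN_rat a hs, gn_center hs hz x.B, (h.center hz).gn_B hs, at']
  have hne := h z hz
  have := eval_le_gn a hs (x.A - C b * x.B) hz
  rw [le_div_iff₀ (norm_pos_iff.2 hne), ← norm_mul, sub_mul, div_mul_cancel₀ _ hne]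
  simpa using this

theorem pf.on_axis {x : Pr 𝕜} {a : 𝕜} {s : ℝ} (h : x.pf a s) (hs : 0 < s) (b' : 𝕜) :
    GN a s (x.rat - RatFunc.C b') = max ‖b' - x.at' a‖ (GN a s (x.rat - RatFunc.C (x.at' a))) := by
  have hN := GN_nabs (𝕜 := 𝕜) a hs
  have h1 := hN.tri x.rat (RatFunc.C (x.at' a)) (RatFunc.C b')
  have h2 := hN.tri x.rat (RatFunc.C b') (RatFunc.C (x.at' a))
  have h3 := h.at_le hs (z := a) (by simpa using hs.le) b'
  rw [← map_sub, hN.map_C] at h1 h2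
  rw [norm_sub_rev] at h3
  apply le_antisymm
  · rw [max_comm, norm_sub_rev]; exact h1
  · exact max_le h3 (h2.trans (max_le le_rfl h3))

theorem pf.extend {x : Pr 𝕜} {a : 𝕜} {s : ℝ} (h : x.pf a s) : ∀ᶠ t in 𝓝[>] s, x.pf a t := by
  have := exists_gap_cnt_cl a s (x.l (hc OnePoint.infty))
  filter_upwards [this] with t ht
  apply pf_of_Z
  rw [Pr.Z, ht]
  exact h.Z

theorem pf.incr {x : Pr 𝕜} {a : 𝕜} {s : ℝ} (h : x.pf a s) (hs : 0 < s) {c : 𝕜}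
    (hc : ∃ z, ‖a - z‖ ≤ s ∧ x.A.eval z = c * x.B.eval z) : ∀ᶠ t in 𝓝[>] s,
    GN a s (x.rat - RatFunc.C c) < GN a t (x.rat - RatFunc.C c) := by
  filter_upwards [x.slope a hs c, self_mem_nhdsWithin] with t ht hst
  have hst : s < t := hst
  rw [h.Z] at ht
  have hZ : 0 < x.Z (cl a s) (c : OnePoint 𝕜) := by
    rw [Z_coe]
    obtain ⟨z, h1, h2⟩ := hc
    exact (cnt_pos (x.l_coe_ne c)).2 ⟨z, by simp [h2], h1⟩
  have hlog := Real.log_lt_log hs hst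
  have hZ' : (1 : ℝ) ≤ x.Z (cl a s) (c : OnePoint 𝕜) := by exact_mod_cast hZ
  rw [← Real.log_lt_log_iff (x.GN_rat_pos a hs c) (x.GN_rat_pos a (hs.trans hst) c)]
  have : 0 < (((x.Z (cl a s) (c : OnePoint 𝕜) : ℝ) - (0 : ℕ)) * (Real.log t - Real.log s)) := by
    apply mul_pos
    · push_cast; linarith
    · linarith
  linarith

end Pr

/-- every intermediate radius is matched upstairs -/
theorem half {α β φ ψ : RatFunc 𝕜} (hβ : NC β) (hψ : NC ψ) {x1 x2 : 𝕜} {r1 r2 : ℝ}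
    (hr1 : 0 < r1) (hr2 : 0 < r2) (h1 : r1 ≤ ‖x1 - x2‖) (h2 : r2 ≤ ‖x1 - x2‖)
    (R1 : ∀ s ∈ Set.Icc r1 ‖x1 - x2‖, Rel (GN x1 s) (ev φ (ev ψ β)) β)
    (R2 : ∀ s ∈ Set.Icc r2 ‖x1 - x2‖, Rel (GN x2 s) (ev φ (ev ψ β)) β)
    {b1 : 𝕜} {s : ℝ} (ax : ∀ b, GN x1 r1 (β - RatFunc.C b) = max ‖b - b1‖ (GN x1 r1 (β - RatFunc.C b1)))
    (hs1 : GN x1 r1 (β - RatFunc.C b1) ≤ s) (hs2 : s ≤ GN x2 r2 (β - RatFunc.C b1)) :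
    Rel (GN b1 s) (ev φ ψ) RatFunc.X := by
  set S := ‖x1 - x2‖
  have hS : 0 < S := hr1.trans_le h1
  have hpos : 0 < GN x1 r1 (β - RatFunc.C b1) := (GN_nabs x1 hr1).pos (sub_ne_zero.2 (hβ b1))
  rcases eq_or_lt_of_le hs1 with e | hlt
  · rw [← e]
    exact transfer_rel (GN_nabs x1 hr1) hβ hpos ax hψ (R1 r1 ⟨le_rfl, h1⟩)
  · have e1 : pth x1 x2 S (-Real.log (S / r1)) = GN x1 r1 := by
      rw [pth_of_le (by linarith [Real.log_nonneg ((one_le_div hr1).2 h1)]), Real.exp_neg, Real.exp_log (by positivity)]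
      congr 1; field_simp
    have e2 : pth x1 x2 S (Real.log (S / r2)) = GN x2 r2 := by
      rw [pth_of_ge hS le_rfl (Real.log_nonneg ((one_le_div hr2).2 h2)), Real.exp_neg, Real.exp_log (by positivity)]
      congr 1; field_simp
    obtain ⟨τ, hτ, h⟩ := axis_first (N := pth x1 x2 S) (pth_nabs x1 x2 hS) (pth_cont hS le_rfl) β b1
      (a := -Real.log (S / r1)) (b := Real.log (S / r2))
      (by linarith [Real.log_nonneg ((one_le_div hr1).2 h1), Real.log_nonneg ((one_le_div hr2).2 h2)])
      (by rw [e1]; exact hlt) (by rw [e2]; exact hs2)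
    refine transfer_rel (pth_nabs x1 x2 hS τ) hβ (hpos.trans hlt) h hψ ?_
    rcases le_total τ 0 with hτ0 | hτ0
    · rw [pth_of_le hτ0]
      apply R1
      constructor
      · have := Real.exp_le_exp.2 hτ.1.le
        rw [Real.exp_neg, Real.exp_log (by positivity), inv_div, div_le_iff₀ hS] at this
        linarith
      · have := Real.exp_le_one_iff.2 hτ0
        nlinarith
    · rw [pth_of_ge hS le_rfl hτ0]
      apply R2
      constructor
      · have := Real.exp_le_exp.2 (neg_le_neg hτ.2)
        rw [Real.exp_neg (Real.log _), Real.exp_log (by positivity), inv_div, div_le_iff₀ hS] at this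
        linarith
      · have := Real.exp_le_one_iff.2 (by linarith : -τ ≤ 0)
        nlinarith

namespace Ctx
variable (X : Ctx 𝕜)

theorem unc2_aux {M : ℕ} (hM : Rel (GN X.a₀ X.s₀) (X.α M) X.β) {c x1 x2 : 𝕜} {r1 r2 : ℝ}
    (hx1 : ‖x1 - X.a₀‖ ≤ X.s₀) (hx2 : ‖x2 - X.a₀‖ ≤ X.s₀) (g1 : X.good x1 r1) (g2 : X.good x2 r2)
    (p1 : (Pr.it X.f X.x M).pf x1 r1)
    (q1 : X.y.pf x1 r1) (q2 : X.y.pf x2 r2)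
    (e1 : (Pr.it X.f X.x M).A.eval x1 = c * (Pr.it X.f X.x M).B.eval x1)
    (hu : GN x2 r2 (X.α M - RatFunc.C c) ≤ GN x1 r1 (X.α M - RatFunc.C c))
    (h1 : GN x1 r1 (X.β - RatFunc.C (X.y.at' x1)) < ‖X.y.at' x1 - X.y.at' x2‖)
    (h2 : GN x2 r2 (X.β - RatFunc.C (X.y.at' x2)) < ‖X.y.at' x1 - X.y.at' x2‖) : False := by
  set b1 := X.y.at' x1 with hb1
  set b2 := X.y.at' x2 with hb2
  set S := ‖b1 - b2‖ with hSdef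
  have hβ := X.β_NC
  have hr1 := g1.1
  have hr2 := g2.1
  have ρ1pos : 0 < GN x1 r1 (X.β - RatFunc.C b1) := (GN_nabs x1 hr1).pos (sub_ne_zero.2 (hβ b1))
  have ρ2pos : 0 < GN x2 r2 (X.β - RatFunc.C b2) := (GN_nabs x2 hr2).pos (sub_ne_zero.2 (hβ b2))
  set ρ1 := GN x1 r1 (X.β - RatFunc.C b1) with hρ1
  set ρ2 := GN x2 r2 (X.β - RatFunc.C b2) with hρ2
  have hS : 0 < S := ρ1pos.trans h1
  have hne : b1 ≠ b2 := by rintro h; simp [hSdef, h] at hS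
  have ax1 : ∀ b, GN x1 r1 (X.β - RatFunc.C b) = max ‖b - b1‖ ρ1 := q1.on_axis hr1
  have ax2 : ∀ b, GN x2 r2 (X.β - RatFunc.C b) = max ‖b - b2‖ ρ2 := q2.on_axis hr2
  have hd1 : r1 < ‖x1 - x2‖ := by
    by_contra hcon
    push Not at hcon
    have := q1.at_le hr1 hcon b1
    rw [norm_sub_rev] at this
    exact absurd (this.trans_lt h1) (lt_irrefl _)
  have hd2 : r2 < ‖x1 - x2‖ := by
    by_contra hcon
    push Not at hcon
    have := q2.at_le hr2 (by rwa [norm_sub_rev]) b2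
    exact absurd (this.trans_lt h2) (lt_irrefl _)
  have hds : ‖x1 - x2‖ ≤ X.s₀ := (dist_tri x1 X.a₀ x2).trans (max_le hx1 (by rwa [norm_sub_rev]))
  obtain ⟨φ, ψ, hφ, hψ, P1, P2⟩ := X.exists_psi hM hx1 hx2 g1 g2
  have R1 : ∀ s ∈ Set.Icc r1 ‖x1 - x2‖, Rel (GN x1 s) (ev φ (ev ψ X.β)) X.β := fun s hs => (P1 s ⟨hs.1, hs.2.trans hds⟩).1
  have R2 : ∀ s ∈ Set.Icc r2 ‖x1 - x2‖, Rel (GN x2 s) (ev φ (ev ψ X.β)) X.β := fun s hs => (P2 s ⟨hs.1, hs.2.trans hds⟩).1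
  have H1 : ∀ s ∈ Set.Icc ρ1 S, Rel (GN b1 s) (ev φ ψ) RatFunc.X := fun s hs =>
    half (α := X.α M) hβ hψ hr1 hr2 hd1.le hd2.le R1 R2 ax1 hs.1 (hs.2.trans (by rw [ax2]; exact le_max_left _ _))
  have H2 : ∀ s ∈ Set.Icc ρ2 S, Rel (GN b2 s) (ev φ ψ) RatFunc.X := fun s hs =>
    half (α := X.α M) hβ hψ hr2 hr1 (by rw [norm_sub_rev]; exact hd2.le) (by rw [norm_sub_rev]; exact hd1.le)
      (by rw [norm_sub_rev]; exact R2) (by rw [norm_sub_rev]; exact R1) ax2 hs.1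
      (hs.2.trans (by rw [ax1, norm_sub_rev]; exact le_max_left _ _))
  -- values of `ψ` at the ends
  have V1 : GN b1 ρ1 (ψ - RatFunc.C c) = GN x1 r1 (X.α M - RatFunc.C c) :=
    transfer_val (GN_nabs x1 hr1) hβ ρ1pos ax1 (P1 r1 ⟨le_rfl, g1.2.1⟩).2 c
  have V2 : GN b2 ρ2 (ψ - RatFunc.C c) = GN x2 r2 (X.α M - RatFunc.C c) :=
    transfer_val (GN_nabs x2 hr2) hβ ρ2pos ax2 (P2 r2 ⟨le_rfl, g2.2.1⟩).2 c
  -- an interior point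
  obtain ⟨r, hr, hinc, hpf, hrs, hrS⟩ : ∃ r, r1 < r ∧ GN x1 r1 (X.α M - RatFunc.C c) < GN x1 r (X.α M - RatFunc.C c) ∧
      X.y.pf x1 r ∧ r ≤ X.s₀ ∧ GN x1 r (X.β - RatFunc.C b1) < S := by
    have a1 := p1.incr hr1 (c := c) ⟨x1, by simpa using hr1.le, e1⟩
    have a2 := q1.extend
    have a3 : ∀ᶠ t in 𝓝[>] r1, t < ‖x1 - x2‖ := nhdsWithin_le_nhds (Iio_mem_nhds hd1)
    have a4 : ∀ᶠ t in 𝓝[>] r1, GN x1 t (X.β - RatFunc.C b1) < S :=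
      nhdsWithin_le_nhds ((continuousAt_GN x1 hr1 _).eventually_lt continuousAt_const h1)
    have a5 : ∀ᶠ t in 𝓝[>] r1, r1 < t := self_mem_nhdsWithin
    obtain ⟨t, b1, b2, b3, b4, b5⟩ := (a1.and (a2.and (a3.and (a4.and a5)))).exists
    exact ⟨t, b5, b1, b2, b3.le.trans hds, b4⟩
  have hr0 : 0 < r := hr1.trans hr
  set ρ := GN x1 r (X.β - RatFunc.C b1) with hρ
  have ρpos : 0 < ρ := (GN_nabs x1 hr0).pos (sub_ne_zero.2 (hβ b1))
  have V : GN b1 ρ (ψ - RatFunc.C c) = GN x1 r (X.α M - RatFunc.C c) :=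
    transfer_val (GN_nabs x1 hr0) hβ ρpos (hpf.on_axis hr0) (P1 r ⟨hr.le, hrs⟩).2 c
  have hρ1ρ : ρ1 ≤ ρ := by
    have g1' := q1.gn_B hr1
    have g2' := hpf.gn_B hr0
    rw [hρ1, hρ, β, X.y.GN_rat x1 hr1, X.y.GN_rat x1 hr0, g1', g2']
    have := gn_mono x1 hr1 hr.le (X.y.A - C b1 * X.y.B)
    gcongr
  have E : ∀ t, 0 < t → t ≤ S → pth b1 b2 S (-Real.log (S / t)) = GN b1 t := by
    intro t ht htS
    rw [pth_of_le (by linarith [Real.log_nonneg ((one_le_div ht).2 htS)]), Real.exp_neg, Real.exp_log (by positivity)]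
    congr 1; field_simp
  have E2 : pth b1 b2 S (Real.log (S / ρ2)) = GN b2 ρ2 := by
    rw [pth_of_ge hS le_rfl (Real.log_nonneg ((one_le_div ρ2pos).2 h2.le)), Real.exp_neg, Real.exp_log (by positivity)]
    congr 1; field_simp
  refine down hne (L1 := Real.log (S / ρ1)) (L2 := Real.log (S / ρ2)) (φ := φ) (ψ := ψ) c ?_ (τ₀ := -Real.log (S / ρ)) ?_ ?_ ?_
  · intro τ hτ
    rcases le_total τ 0 with hτ0 | hτ0
    · rw [pth_of_le hτ0]
      apply H1
      constructor
      · have := Real.exp_le_exp.2 hτ.1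
        rw [Real.exp_neg, Real.exp_log (by positivity), inv_div, div_le_iff₀ hS] at this
        linarith
      · have := Real.exp_le_one_iff.2 hτ0
        nlinarith
    · rw [pth_of_ge hS le_rfl hτ0]
      apply H2
      constructor
      · have := Real.exp_le_exp.2 (neg_le_neg hτ.2)
        rw [Real.exp_neg (Real.log _), Real.exp_log (by positivity), inv_div, div_le_iff₀ hS] at this
        linarith
      · have := Real.exp_le_one_iff.2 (by linarith : -τ ≤ 0)
        nlinarith
  · constructor
    · apply neg_le_neg
      apply Real.log_le_log (by positivity)
      gcongr
    · have l1 := Real.log_nonneg ((one_le_div ρpos).2 hrS.le)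
      have l2 := Real.log_nonneg ((one_le_div ρ2pos).2 h2.le)
      linarith
  · rw [← hSdef, E ρ1 ρ1pos h1.le, E ρ ρpos hrS.le, V1, V]; exact hinc
  · rw [← hSdef, E2, E ρ ρpos hrS.le, V2, V]; exact hu.trans_lt hinc

/-- (UNC2) -/
theorem unc2 {M : ℕ} (hM : Rel (GN X.a₀ X.s₀) (X.α M) X.β) {c x1 x2 : 𝕜} {r1 r2 : ℝ}
    (hx1 : ‖x1 - X.a₀‖ ≤ X.s₀) (hx2 : ‖x2 - X.a₀‖ ≤ X.s₀) (g1 : X.good x1 r1) (g2 : X.good x2 r2)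
    (p1 : (Pr.it X.f X.x M).pf x1 r1) (p2 : (Pr.it X.f X.x M).pf x2 r2)
    (q1 : X.y.pf x1 r1) (q2 : X.y.pf x2 r2)
    (e1 : (Pr.it X.f X.x M).A.eval x1 = c * (Pr.it X.f X.x M).B.eval x1)
    (e2 : (Pr.it X.f X.x M).A.eval x2 = c * (Pr.it X.f X.x M).B.eval x2) :
    ‖X.y.at' x1 - X.y.at' x2‖ ≤ max (GN x1 r1 (X.β - RatFunc.C (X.y.at' x1))) (GN x2 r2 (X.β - RatFunc.C (X.y.at' x2))) := by
  by_contra hcon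
  push Not at hcon
  obtain ⟨h1, h2⟩ := max_lt_iff.1 hcon
  rcases le_total (GN x2 r2 (X.α M - RatFunc.C c)) (GN x1 r1 (X.α M - RatFunc.C c)) with h | h
  · exact X.unc2_aux hM hx1 hx2 g1 g2 p1 q1 q2 e1 h h1 h2
  · exact X.unc2_aux hM hx2 hx1 g2 g1 p2 q2 q1 e2 h (by rwa [norm_sub_rev]) (by rwa [norm_sub_rev])

end Ctx
end Pf
end EQ

/-! ## Counting uncovered preimages -/
namespace EQ

section Unc
variable {𝕜 : Type*} [NontriviallyNormedField 𝕜] [IsUltrametricDist 𝕜] [IsAlgClosed 𝕜]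

theorem Pr.pf.surj {x : Pr 𝕜} {a : 𝕜} {s : ℝ} (h : x.pf a s) (hs : 0 < s) {b : 𝕜}
    (hb : ‖b - x.at' a‖ ≤ GN a s (x.rat - RatFunc.C (x.at' a))) :
    ∃ z, ‖a - z‖ ≤ s ∧ (x.A - C b * x.B).eval z = 0 := by
  by_contra hcon
  push Not at hcon
  have hZ : x.Z (cl a s) (b : OnePoint 𝕜) = 0 := by
    by_contra h0
    rw [Pr.Z_coe] at h0
    obtain ⟨r, h1, h2⟩ := (cnt_pos (x.l_coe_ne b)).1 (Nat.pos_of_ne_zero h0)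
    exact hcon r h2 h1
  have hc0 : x.A.eval a = x.at' a * x.B.eval a := by
    rw [Pr.at', div_mul_cancel₀]; exact h a (by simpa using hs.le)
  obtain ⟨t, h1, h2, h3, h4⟩ := ((x.slope a hs b).and (h.extend.and ((h.incr hs ⟨a, by simpa using hs.le, hc0⟩).and
    (self_mem_nhdsWithin : ∀ᶠ t in 𝓝[>] s, t ∈ Set.Ioi s)))).exists
  have ht : 0 < t := hs.trans h4
  rw [hZ, h.Z] at h1
  simp only [sub_self, zero_mul] at h1
  have e : GN a t (x.rat - RatFunc.C b) = GN a s (x.rat - RatFunc.C b) :=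
    Real.log_injOn_pos (x.GN_rat_pos a ht b) (x.GN_rat_pos a hs b) (by linarith)
  rw [h2.on_axis ht b, h.on_axis hs b, max_eq_right hb] at e
  have := le_max_right ‖b - x.at' a‖ (GN a t (x.rat - RatFunc.C (x.at' a)))
  linarith

theorem card_le_of_roots {P : 𝕜[X]} (hP : P ≠ 0) (S : Finset 𝕜) (r : 𝕜 → ℝ)
    (hd : ∀ x ∈ S, ∀ x' ∈ S, x ≠ x' → r x < ‖x - x'‖) (hz : ∀ x ∈ S, ∃ z, ‖x - z‖ ≤ r x ∧ P.eval z = 0) :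
    S.card ≤ P.natDegree := by
  choose! z h1 h2 using hz
  have hinj : Set.InjOn z S := by
    intro x hx x' hx' e
    by_contra hne
    have := dist_tri x (z x) x'
    have a1 := h1 x hx
    have a2 := h1 x' hx'
    rw [← e, norm_sub_rev] at a2
    have b1 := hd x hx x' hx' hne
    have b2 := hd x' hx' x hx (Ne.symm hne)
    rw [norm_sub_rev] at b2
    rcases le_max_iff.1 this with h | h <;> linarith
  calc S.card = (S.image z).card := (Finset.card_image_of_injOn hinj).symm
    _ ≤ P.roots.toFinset.card := by
      apply Finset.card_le_card
      intro w hw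
      obtain ⟨x, hx, rfl⟩ := Finset.mem_image.1 hw
      rw [Multiset.mem_toFinset, Polynomial.mem_roots hP]
      exact h2 x hx
    _ ≤ P.roots.card := Multiset.toFinset_card_le _
    _ ≤ _ := P.card_roots'

theorem exists_disjoint_cover (r : 𝕜 → ℝ) (U : Finset 𝕜) : ∃ T ⊆ U,
    (∀ x ∈ T, ∀ x' ∈ T, x ≠ x' → r x < ‖x - x'‖) ∧ ∀ x ∈ U, ∃ x' ∈ T, r x ≤ r x' ∧ ‖x' - x‖ ≤ r x' ∨ x = x' := by
  induction U using Finset.strongInduction with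
  | H U ih =>
    rcases U.eq_empty_or_nonempty with rfl | hne
    · exact ⟨∅, le_rfl, by simp, by simp⟩
    obtain ⟨m, hm, hmax⟩ := U.exists_max_image r hne
    set U' := (U.erase m).filter (fun x => r m < ‖m - x‖)
    have hU' : U' ⊂ U := by
      refine Finset.ssubset_iff_subset_ne.2 ⟨(Finset.filter_subset _ _).trans (Finset.erase_subset _ _), fun e => ?_⟩
      rw [← e] at hm
      exact Finset.notMem_erase m U (Finset.mem_of_mem_filter m hm)
    obtain ⟨T, hT, h1, h2⟩ := ih U' hU'
    have hTm : ∀ x ∈ T, r m < ‖m - x‖ := fun x hx => (Finset.mem_filter.1 (hT hx)).2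
    have hTU : ∀ x ∈ T, x ∈ U := fun x hx => hU'.1 (hT hx)
    refine ⟨insert m T, ?_, ?_, ?_⟩
    · intro x hx
      rcases Finset.mem_insert.1 hx with rfl | hx
      · exact hm
      · exact hTU x hx
    · intro x hx x' hx' hxx
      rcases Finset.mem_insert.1 hx with e | hxT
      · rcases Finset.mem_insert.1 hx' with e' | hxT'
        · exact absurd (e.trans e'.symm) hxx
        · rw [e]; exact hTm x' hxT'
      · rcases Finset.mem_insert.1 hx' with e' | hxT'
        · rw [norm_sub_rev, e']; exact (hmax x (hTU x hxT)).trans_lt (hTm x hxT)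
        · exact h1 x hxT x' hxT' hxx
    · intro x hx
      by_cases hxm : x = m
      · exact ⟨m, Finset.mem_insert_self _ _, Or.inr hxm⟩
      by_cases hd : r m < ‖m - x‖
      · obtain ⟨x', hx', h⟩ := h2 x (Finset.mem_filter.2 ⟨Finset.mem_erase.2 ⟨hxm, hx⟩, hd⟩)
        exact ⟨x', Finset.mem_insert_of_mem hx', h⟩
      · exact ⟨m, Finset.mem_insert_self _ _, Or.inl ⟨hmax x hx, not_lt.1 hd⟩⟩

theorem countP_le_sum {ι : Type*} (m : Multiset 𝕜) (p : 𝕜 → Prop) (T : Finset ι) (q : ι → 𝕜 → Prop)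
    (h : ∀ x ∈ m, p x → ∃ i ∈ T, q i x) : m.countP p ≤ ∑ i ∈ T, m.countP (q i) := by
  induction m using Multiset.induction_on with
  | empty => simp
  | cons a m ih =>
    have ih' := ih (fun x hx => h x (Multiset.mem_cons_of_mem hx))
    simp only [Multiset.countP_cons, Finset.sum_add_distrib]
    apply add_le_add ih'
    split_ifs with hp
    · obtain ⟨i, hi, hq⟩ := h a (Multiset.mem_cons_self a m) hp
      calc 1 = if q i a then 1 else 0 := by rw [if_pos hq]
        _ ≤ _ := Finset.single_le_sum (f := fun i => if q i a then 1 else 0) (fun _ _ => Nat.zero_le _) hi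
    · exact Nat.zero_le _

namespace Ctx
variable (X : Ctx 𝕜)

/-- (UNC) -/
theorem unc {M : ℕ} (hM : Rel (GN X.a₀ X.s₀) (X.α M) X.β) (c : 𝕜) (T : Finset 𝕜) (r : 𝕜 → ℝ)
    (hD : ∀ x ∈ T, ‖x - X.a₀‖ ≤ X.s₀) (hg : ∀ x ∈ T, X.good x (r x)) (hp : ∀ x ∈ T, (Pr.it X.f X.x M).pf x (r x))
    (he : ∀ x ∈ T, (Pr.it X.f X.x M).A.eval x = c * (Pr.it X.f X.x M).B.eval x)
    (hd : ∀ x ∈ T, ∀ x' ∈ T, x ≠ x' → r x < ‖x - x'‖) : T.card ≤ 2 * X.y.deg := by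
  have hsplit := Finset.card_filter_add_card_filter_not (s := T) (fun x => X.y.pf x (r x))
  have c1 : (T.filter (fun x => ¬ X.y.pf x (r x))).card ≤ X.y.deg := by
    refine (card_le_of_roots X.y.hB _ r ?_ ?_).trans (le_max_right _ _)
    · intro x hx x' hx' h
      exact hd x (Finset.mem_of_mem_filter x hx) x' (Finset.mem_of_mem_filter x' hx') h
    · intro x hx
      have := (Finset.mem_filter.1 hx).2
      rw [Pr.pf] at this
      push Not at this
      exact this
  have c2 : (T.filter (fun x => X.y.pf x (r x))).card ≤ X.y.deg := by
    set Q := T.filter (fun x => X.y.pf x (r x))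
    rcases Q.eq_empty_or_nonempty with h0 | hne
    · rw [h0]; simp
    obtain ⟨m, hm, hmin⟩ := Q.exists_min_image (fun x => GN x (r x) (X.β - RatFunc.C (X.y.at' x))) hne
    have hdeg : (X.y.A - C (X.y.at' m) * X.y.B).natDegree ≤ X.y.deg := by
      rw [← X.y.l_coe]; exact X.y.natDegree_l_le _
    refine (card_le_of_roots (X.y.l_coe_ne (X.y.at' m)) _ r ?_ ?_).trans hdeg
    · intro x hx x' hx' h
      exact hd x (Finset.mem_of_mem_filter x hx) x' (Finset.mem_of_mem_filter x' hx') h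
    · intro x hx
      obtain ⟨hxT, hxp⟩ := Finset.mem_filter.1 hx
      obtain ⟨hmT, hmp⟩ := Finset.mem_filter.1 hm
      apply hxp.surj (hg x hxT).1
      refine (X.unc2 hM (hD m hmT) (hD x hxT) (hg m hmT) (hg x hxT) (hp m hmT) (hp x hxT) hmp hxp (he m hmT) (he x hxT)).trans ?_
      exact max_le (hmin x hx) le_rfl
  omega

/-- OSC on good discs -/
theorem osc_good {ξ : 𝕜} {r : ℝ} (h : X.good ξ r) (hr : r < X.s₀) (M : ℕ) (q q' : OnePoint 𝕜) :
    (Pr.it X.f X.x M).Z (cl ξ r) q ≤ (Pr.it X.f X.x M).Z (cl ξ r) q' + X.y.deg := by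
  obtain ⟨n, hn, hu⟩ := X.exists_later (X.good_unif h) M
  refine Pr.osc X.f X.x X.y ξ h.1 hn.le ?_ (hu r ⟨le_rfl, hr.le⟩) q q'
  apply Eventually.frequently
  filter_upwards [Ioo_mem_nhdsGT hr] with t ht
  exact hu t ⟨ht.1.le, ht.2.le⟩

/-- count of uncovered preimages -/
theorem unc_count {M : ℕ} (hM : Rel (GN X.a₀ X.s₀) (X.α M) X.β) (c : 𝕜) :
    cnt (fun x => ‖x - X.a₀‖ ≤ X.s₀ ∧ (Pr.it X.f X.x M).pf x (X.rad x))
      ((Pr.it X.f X.x M).l (hc (c : OnePoint 𝕜))) ≤ 2 * X.y.deg * X.y.deg := by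
  set x := Pr.it X.f X.x M with hx
  have hne : x.l (hc (c : OnePoint 𝕜)) ≠ 0 := x.l_ne_zero (Pr.hc_ne_zero _)
  have hr : ∀ z, ‖z - X.a₀‖ ≤ X.s₀ → x.pf z (X.rad z) → ∃ r, X.rad z < r ∧ r < X.s₀ ∧ x.pf z r := by
    intro z h1 h2
    have a1 : ∀ᶠ t in 𝓝[>] (X.rad z), t ∈ Set.Ioo (X.rad z) X.s₀ := Ioo_mem_nhdsGT (X.rad_lt h1)
    obtain ⟨r, hr1, hr2⟩ := (a1.and h2.extend).exists
    exact ⟨r, hr1.1, hr1.2, hr2⟩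
  choose! r h1 h2 h3 using hr
  set U := (x.l (hc (c : OnePoint 𝕜))).roots.toFinset.filter (fun z => ‖z - X.a₀‖ ≤ X.s₀ ∧ x.pf z (X.rad z))
  have hU : ∀ z ∈ U, (‖z - X.a₀‖ ≤ X.s₀ ∧ x.pf z (X.rad z)) ∧ x.A.eval z = c * x.B.eval z := by
    intro z hz
    obtain ⟨a, b⟩ := Finset.mem_filter.1 hz
    refine ⟨b, ?_⟩
    have := (Polynomial.mem_roots hne).1 (Multiset.mem_toFinset.1 a)
    rw [Pr.l_coe] at this
    have : (x.A - C c * x.B).eval z = 0 := this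
    simp [sub_eq_zero] at this
    exact this
  obtain ⟨T, hT, hd, hcov⟩ := exists_disjoint_cover r U
  have hgood : ∀ z ∈ U, X.good z (r z) := fun z hz =>
    X.good_of_rad_lt (hU z hz).1.1 (h1 z (hU z hz).1.1 (hU z hz).1.2) (h2 z (hU z hz).1.1 (hU z hz).1.2).le
  have hcard : T.card ≤ 2 * X.y.deg := X.unc hM c T r (fun z hz => (hU z (hT hz)).1.1) (fun z hz => hgood z (hT hz))
    (fun z hz => h3 z (hU z (hT hz)).1.1 (hU z (hT hz)).1.2) (fun z hz => (hU z (hT hz)).2) hd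
  calc _ ≤ ∑ i ∈ T, cnt (cl i (r i)) (x.l (hc (c : OnePoint 𝕜))) := by
        apply countP_le_sum
        intro z hz hp
        have hzU : z ∈ U := Finset.mem_filter.2 ⟨Multiset.mem_toFinset.2 hz, hp⟩
        obtain ⟨i, hi, h⟩ := hcov z hzU
        refine ⟨i, hi, ?_⟩
        rcases h with h | rfl
        · exact h.2
        · show ‖z - z‖ ≤ _
          rw [sub_self, norm_zero]
          exact (hgood z hzU).1.le
    _ ≤ ∑ i ∈ T, X.y.deg := by
        apply Finset.sum_le_sum
        intro i hi
        obtain ⟨⟨a1, a2⟩, -⟩ := hU i (hT hi)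
        have := X.osc_good (hgood i (hT hi)) (h2 i a1 a2) M (c : OnePoint 𝕜) OnePoint.infty
        rw [(h3 i a1 a2).Z, zero_add] at this
        exact this
    _ = T.card * X.y.deg := by rw [Finset.sum_const, smul_eq_mul]
    _ ≤ _ := Nat.mul_le_mul_right _ hcard

end Ctx
end Unc
end EQ

/-! ## Directions at a leaf -/
namespace EQ

section Dir
variable {𝕜 : Type*} [NontriviallyNormedField 𝕜] [IsUltrametricDist 𝕜] [IsAlgClosed 𝕜]

theorem exists_gap_left (a : 𝕜) (s : ℝ) (P : 𝕜[X]) : ∀ᶠ t in 𝓝[<] s, cnt (cl a t) P = cnt (op a s) P := by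
  have h : ∀ᶠ t in 𝓝[<] s, ∀ r ∈ P.roots.toFinset, ‖a - r‖ < s → ‖a - r‖ ≤ t := by
    rw [Finset.eventually_all]
    intro r hr
    by_cases h : ‖a - r‖ < s
    · filter_upwards [Ioo_mem_nhdsLT h] with t ht _ using ht.1.le
    · exact Eventually.of_forall fun t h' => absurd h' h
  filter_upwards [h, self_mem_nhdsWithin] with t ht hts
  apply cnt_congr
  intro r hr
  constructor
  · intro h'
    exact lt_of_le_of_lt h' hts
  · intro h'
    exact ht r (Multiset.mem_toFinset.2 hr) h'

theorem left_slope (a : 𝕜) {s : ℝ} (hs : 0 < s) {P : 𝕜[X]} (hP : P ≠ 0) : ∀ᶠ t in 𝓝[<] s,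
    Real.log (gn a s P) - Real.log (gn a t P) = cnt (op a s) P * (Real.log s - Real.log t) := by
  filter_upwards [exists_gap_left a s P, Ioo_mem_nhdsLT hs] with t h1 h2
  have := log_gn_eq a h2.1 h2.2.le hP h1.symm
  rw [this, h1]

theorem count_ge (a : 𝕜) {s : ℝ} (hs : 0 < s) {U V : 𝕜[X]} (hU : U ≠ 0) (hV : V ≠ 0) (hS : U + V ≠ 0)
    (h1 : gn a s U ≤ gn a s (U + V)) (h2 : gn a s V ≤ gn a s (U + V)) :
    min (cnt (op a s) U) (cnt (op a s) V) ≤ cnt (op a s) (U + V) := by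
  obtain ⟨t, e1, e2, e3, ht⟩ := ((left_slope a hs hU).and ((left_slope a hs hV).and ((left_slope a hs hS).and
    (Ioo_mem_nhdsLT hs : ∀ᶠ t in 𝓝[<] s, t ∈ Set.Ioo 0 s)))).exists
  have ht0 : 0 < t := ht.1
  have hlog : Real.log t < Real.log s := Real.log_lt_log ht0 ht.2
  have l1 := Real.log_le_log (gn_pos a hs hU) h1
  have l2 := Real.log_le_log (gn_pos a hs hV) h2
  by_contra hcon
  push Not at hcon
  obtain ⟨c1, c2⟩ := lt_min_iff.1 hcon
  have c1' : (cnt (op a s) (U + V) : ℝ) < cnt (op a s) U := by exact_mod_cast c1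
  have c2' : (cnt (op a s) (U + V) : ℝ) < cnt (op a s) V := by exact_mod_cast c2
  have m1 := mul_lt_mul_of_pos_right c1' (sub_pos.2 hlog)
  have m2 := mul_lt_mul_of_pos_right c2' (sub_pos.2 hlog)
  rcases le_max_iff.1 (gn_add_le a ht0 U V) with h | h
  · have := Real.log_le_log (gn_pos a ht0 hS) h
    linarith
  · have := Real.log_le_log (gn_pos a ht0 hS) h
    linarith

theorem count_eq (a : 𝕜) {s : ℝ} (hs : 0 < s) {U V : 𝕜[X]} (hU : U ≠ 0) (hV : V ≠ 0)
    (h : gn a s (U - V) < gn a s U) : cnt (op a s) U = cnt (op a s) V := by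
  have ca : ∀ P : 𝕜[X], ContinuousAt (fun t => gn a t P) s := fun P => (continuousOn_gn a P).continuousAt (Ioi_mem_nhds hs)
  have eq : ∀ t, 0 < t → gn a t (U - V) < gn a t U → gn a t U = gn a t V := by
    intro t ht hlt
    apply le_antisymm
    · have : U = V + (U - V) := by ring
      have h2 := gn_add_le a ht V (U - V)
      rw [← this] at h2
      rcases le_max_iff.1 h2 with h | h
      · exact h
      · linarith
    · have : V = U - (U - V) := by ring
      have h2 := gn_sub_le a ht U (U - V)
      rw [← this, max_eq_left hlt.le] at h2
      exact h2
  have hh : ∀ᶠ t in 𝓝[<] s, gn a t (U - V) < gn a t U := nhdsWithin_le_nhds ((ca (U - V)).eventually_lt (ca U) h)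
  obtain ⟨t, e1, e2, e3, ht⟩ := ((left_slope a hs hU).and ((left_slope a hs hV).and (hh.and
    (Ioo_mem_nhdsLT hs : ∀ᶠ t in 𝓝[<] s, t ∈ Set.Ioo 0 s)))).exists
  rw [eq s hs h, eq t ht.1 e3, e2] at e1
  have hlog : Real.log t < Real.log s := Real.log_lt_log ht.1 ht.2
  have := mul_right_cancel₀ (sub_pos.2 hlog).ne' e1
  exact_mod_cast this.symm

/-- the norm on linear forms induced by a disc -/
noncomputable def Pr.nm (x : Pr 𝕜) (a : 𝕜) (s : ℝ) (v : 𝕜 × 𝕜) : ℝ := gn a s (x.l v)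

/-- same residue class -/
def Sim (N : 𝕜 × 𝕜 → ℝ) (q v : 𝕜 × 𝕜) : Prop := ∃ t : 𝕜, N (q - t • v) < N q

theorem Pr.Z_sim (x : Pr 𝕜) {ξ a : 𝕜} {s : ℝ} (hs : 0 < s) (ha : ‖ξ - a‖ ≤ s) {q v : OnePoint 𝕜}
    (h : Sim (x.nm ξ s) (hc q) (hc v)) : x.Z (op a s) q = x.Z (op a s) v := by
  obtain ⟨t, ht⟩ := h
  unfold Pr.nm at ht
  have ht0 : t ≠ 0 := by
    rintro rfl
    simp at ht
  have hU := x.l_ne_zero (Pr.hc_ne_zero q)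
  have hV := x.l_ne_zero (Pr.hc_ne_zero v)
  have e : x.l (hc q - t • hc v) = x.l (hc q) - C t * x.l (hc v) := by
    rw [sub_eq_add_neg, ← neg_smul, x.l_add, x.l_smul]; simp [sub_eq_add_neg]
  rw [e, gn_center hs ha, gn_center hs ha] at ht
  have := count_eq a hs hU (mul_ne_zero (C_ne_zero.2 ht0) hV) ht
  rw [cnt_C_mul _ ht0] at this
  exact this

namespace Ctx
variable (X : Ctx 𝕜)

/-- the n-th iterate as pair -/
noncomputable abbrev p (n : ℕ) : Pr 𝕜 := Pr.it X.f X.x n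

/-- OSC on the closed leaf disc -/
theorem osc_leaf {ξ : 𝕜} (hξ : ‖ξ - X.a₀‖ ≤ X.s₀) (M : ℕ) (q q' : OnePoint 𝕜) :
    (X.p M).Z (cl ξ (X.rad ξ)) q ≤ (X.p M).Z (cl ξ (X.rad ξ)) q' + X.y.deg := by
  obtain ⟨t, h1, h2, h3⟩ := ((exists_gap_cnt_cl ξ (X.rad ξ) ((X.p M).l (hc q))).and ((exists_gap_cnt_cl ξ (X.rad ξ) ((X.p M).l (hc q'))).and
    (Ioo_mem_nhdsGT (X.rad_lt hξ) : ∀ᶠ t in 𝓝[>] (X.rad ξ), t ∈ Set.Ioo (X.rad ξ) X.s₀))).exists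
  have := X.osc_good (X.good_of_rad_lt hξ h3.1 h3.2.le) h3.2 M q q'
  simp only [Pr.Z] at this ⊢
  rwa [h1, h2] at this

/-- bookkeeping of the loss at a leaf -/
def Loss (ξ : 𝕜) (n : ℕ) (b : ℝ) : Prop := ∃ (T : Finset 𝕜) (k : 𝕜 → ℕ),
  (∀ a ∈ T, ‖ξ - a‖ ≤ X.rad ξ) ∧ (∀ a ∈ T, ∀ a' ∈ T, a ≠ a' → X.rad ξ ≤ ‖a - a'‖) ∧
  (∀ a ∈ T, ∀ q, k a ≤ (X.p n).Z (op a (X.rad ξ)) q) ∧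
  ∀ q, ((X.p n).Z (cl ξ (X.rad ξ)) q : ℝ) ≤ ∑ a ∈ T, (k a : ℝ) + b

theorem loss_zero (ξ : 𝕜) : X.Loss ξ 0 X.x.deg := by
  refine ⟨∅, fun _ => 0, by simp, by simp, by simp, fun q => ?_⟩
  simp only [Finset.sum_empty, zero_add]
  exact_mod_cast (X.p 0).Z_le _ q

theorem sum_map_le (m : Multiset (OnePoint 𝕜)) (F : OnePoint 𝕜 → ℕ) (B : ℝ) (h : ∀ q ∈ m, (F q : ℝ) ≤ B) :
    (((m.map F).sum : ℕ) : ℝ) ≤ m.card * B := by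
  induction m using Multiset.induction_on with
  | empty => simp
  | cons a m ih =>
    have := ih fun q hq => h q (Multiset.mem_cons_of_mem hq)
    have h2 := h a (Multiset.mem_cons_self a m)
    simp only [Multiset.map_cons, Multiset.sum_cons, Multiset.card_cons]
    rw [Nat.cast_add, Nat.cast_add, Nat.cast_one]
    linarith

theorem le_sum_map (m : Multiset (OnePoint 𝕜)) (F : OnePoint 𝕜 → ℕ) (B : ℕ) (h : ∀ q ∈ m, B ≤ F q) :
    m.card * B ≤ (m.map F).sum := by
  induction m using Multiset.induction_on with
  | empty => simp
  | cons a m ih =>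
    have := ih fun q hq => h q (Multiset.mem_cons_of_mem hq)
    have h2 := h a (Multiset.mem_cons_self a m)
    simp only [Multiset.map_cons, Multiset.sum_cons, Multiset.card_cons]
    linarith

theorem loss_succ {ξ : 𝕜} {n : ℕ} {b : ℝ} (h : X.Loss ξ n b) : X.Loss ξ (n + 1) (X.f.deg * b) := by
  obtain ⟨T, k, h1, h2, h3, h4⟩ := h
  refine ⟨T, fun a => X.f.deg * k a, h1, h2, fun a ha q => ?_, fun q => ?_⟩
  · rw [p, Pr.it_succ, Pr.Z_comp]
    have := le_sum_map (X.f.pull (hc q)) (fun q => (X.p n).Z (op a (X.rad ξ)) q) (k a) (fun q _ => h3 a ha q)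
    rwa [Pr.card_pull] at this
  · rw [p, Pr.it_succ, Pr.Z_comp]
    have := sum_map_le (X.f.pull (hc q)) (fun q => (X.p n).Z (cl ξ (X.rad ξ)) q) _ (fun q _ => h4 q)
    rw [Pr.card_pull] at this
    refine this.trans (le_of_eq ?_)
    push_cast
    rw [← Finset.mul_sum]; ring

/-- non-total index -/
def NT (ξ : 𝕜) (n : ℕ) : Prop := ∃ v : OnePoint 𝕜, ∀ c : OnePoint 𝕜, ∃ q ∈ X.f.pull (hc c),
  Sim ((X.p n).nm ξ (X.rad ξ)) (hc q) (hc v)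

theorem exists_dirs (ξ : 𝕜) {s : ℝ} (hs : 0 < s) (T : Finset 𝕜) (hT : ∀ a ∈ T, ‖ξ - a‖ ≤ s)
    (hd : ∀ a ∈ T, ∀ a' ∈ T, a ≠ a' → s ≤ ‖a - a'‖) (W : Finset 𝕜) (hW : ∀ a ∈ W, ‖ξ - a‖ ≤ s) :
    ∃ T' : Finset 𝕜, T ⊆ T' ∧ (∀ a ∈ T', ‖ξ - a‖ ≤ s) ∧ (∀ a ∈ T', ∀ a' ∈ T', a ≠ a' → s ≤ ‖a - a'‖) ∧
      ∀ w ∈ W, ∃ a ∈ T', ‖a - w‖ < s := by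
  induction W using Finset.induction_on with
  | empty => exact ⟨T, le_rfl, hT, hd, by simp⟩
  | insert w W hw ih =>
    obtain ⟨T', a1, a2, a3, a4⟩ := ih fun a ha => hW a (Finset.mem_insert_of_mem ha)
    by_cases h : ∃ a ∈ T', ‖a - w‖ < s
    · refine ⟨T', a1, a2, a3, fun w' hw' => ?_⟩
      rcases Finset.mem_insert.1 hw' with rfl | h'
      · exact h
      · exact a4 w' h'
    · push Not at h
      refine ⟨insert w T', a1.trans (Finset.subset_insert _ _), ?_, ?_, ?_⟩
      · intro a ha
        rcases Finset.mem_insert.1 ha with rfl | h'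
        · exact hW _ (Finset.mem_insert_self _ _)
        · exact a2 a h'
      · intro a ha a' ha' hne
        rcases Finset.mem_insert.1 ha with e | h1
        · rcases Finset.mem_insert.1 ha' with e' | h2
          · exact absurd (e.trans e'.symm) hne
          · rw [e, norm_sub_rev]; exact h a' h2
        · rcases Finset.mem_insert.1 ha' with e' | h2
          · rw [e']; exact h a h1
          · exact a3 a h1 a' h2 hne
      · intro w' hw'
        rcases Finset.mem_insert.1 hw' with rfl | h'
        · exact ⟨w', Finset.mem_insert_self _ _, by simpa using hs⟩
        · obtain ⟨a, ha, h''⟩ := a4 w' h'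
          exact ⟨a, Finset.mem_insert_of_mem ha, h''⟩

theorem loss_nt {ξ : 𝕜} (hξ : ‖ξ - X.a₀‖ ≤ X.s₀) (h0 : 0 < X.rad ξ) {n : ℕ} {b : ℝ} (h : X.Loss ξ n b) (hnt : X.NT ξ n) :
    X.Loss ξ (n + 1) ((X.f.deg - 1) * b + X.y.deg) := by
  obtain ⟨T, k, h1, h2, h3, h4⟩ := h
  obtain ⟨v, hv⟩ := hnt
  set W := ((X.p n).l (hc v)).roots.toFinset.filter (fun z => ‖ξ - z‖ ≤ X.rad ξ)
  obtain ⟨T', a1, a2, a3, a4⟩ := exists_dirs ξ h0 T h1 h2 W (fun a ha => (Finset.mem_filter.1 ha).2)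
  set k0 : 𝕜 → ℕ := fun a => if a ∈ T then k a else 0
  have hk0 : ∀ a ∈ T', ∀ q, k0 a ≤ (X.p n).Z (op a (X.rad ξ)) q := by
    intro a ha q
    by_cases hT : a ∈ T
    · simp only [k0, if_pos hT]; exact h3 a hT q
    · simp [k0, hT]
  have hsum : ∑ a ∈ T', (k0 a : ℝ) = ∑ a ∈ T, (k a : ℝ) := by
    simp only [k0]
    push_cast
    rw [← Finset.sum_filter]
    apply Finset.sum_congr _ (fun _ _ => rfl)
    ext a; simp only [Finset.mem_filter]; exact ⟨fun h => h.2, fun h => ⟨a1 h, h⟩⟩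
  have hdpos := X.f.deg_pos
  have split : ∀ c, ∃ (q : OnePoint 𝕜) (m : Multiset (OnePoint 𝕜)), X.f.pull (hc c) = q ::ₘ m ∧ m.card = X.f.deg - 1 ∧
      Sim ((X.p n).nm ξ (X.rad ξ)) (hc q) (hc v) := by
    intro c
    obtain ⟨q, hq, hs⟩ := hv c
    obtain ⟨m, hm⟩ := Multiset.exists_cons_of_mem hq
    refine ⟨q, m, hm, ?_, hs⟩
    have := X.f.card_pull (hc c)
    rw [hm, Multiset.card_cons] at this
    omega
  have hd1 : ((X.f.deg - 1 : ℕ) : ℝ) = X.f.deg - 1 := by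
    rw [Nat.cast_sub hdpos]; simp
  refine ⟨T', fun a => (X.f.deg - 1) * k0 a + (X.p n).Z (op a (X.rad ξ)) v, a2, a3, fun a ha c => ?_, fun c => ?_⟩
  · obtain ⟨q, m, hm, hcard, hs⟩ := split c
    show (X.f.deg - 1) * k0 a + (X.p n).Z (op a (X.rad ξ)) v ≤ (X.f.comp (X.p n)).Z (op a (X.rad ξ)) c
    rw [Pr.Z_comp, hm, Multiset.map_cons, Multiset.sum_cons]
    have e := (X.p n).Z_sim h0 (a2 a ha) hs
    have := le_sum_map m (fun q => (X.p n).Z (op a (X.rad ξ)) q) (k0 a) (fun q _ => hk0 a ha q)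
    rw [hcard] at this
    rw [add_comm]
    exact add_le_add e.ge this
  · obtain ⟨q, m, hm, hcard, hs⟩ := split c
    have hstep : (X.p (n + 1)).Z (cl ξ (X.rad ξ)) c = (X.p n).Z (cl ξ (X.rad ξ)) q + (m.map fun q => (X.p n).Z (cl ξ (X.rad ξ)) q).sum := by
      show (X.f.comp (X.p n)).Z (cl ξ (X.rad ξ)) c = _
      rw [Pr.Z_comp, hm, Multiset.map_cons, Multiset.sum_cons]
    rw [hstep, Nat.cast_add]
    have := sum_map_le m (fun q => (X.p n).Z (cl ξ (X.rad ξ)) q) _ (fun q _ => h4 q)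
    rw [hcard, hd1] at this
    have o := X.osc_leaf hξ n q v
    have hle : (X.p n).Z (cl ξ (X.rad ξ)) v ≤ ∑ a ∈ T', (X.p n).Z (op a (X.rad ξ)) v := by
      apply countP_le_sum
      intro z hz hp
      obtain ⟨a, ha, h⟩ := a4 z (Finset.mem_filter.2 ⟨Multiset.mem_toFinset.2 hz, hp⟩)
      exact ⟨a, ha, h⟩
    have o' : ((X.p n).Z (cl ξ (X.rad ξ)) q : ℝ) ≤ ∑ a ∈ T', ((X.p n).Z (op a (X.rad ξ)) v : ℝ) + X.y.deg := by
      exact_mod_cast o.trans (Nat.add_le_add_right hle _)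
    simp only [Nat.cast_add, Nat.cast_mul]
    rw [Finset.sum_add_distrib, hd1, ← Finset.mul_sum, hsum]
    nlinarith [this, o']

theorem Loss.mono {X : Ctx 𝕜} {ξ : 𝕜} {n : ℕ} {b b' : ℝ} (h : X.Loss ξ n b) (hb : b ≤ b') : X.Loss ξ n b' := by
  obtain ⟨T, k, h1, h2, h3, h4⟩ := h
  exact ⟨T, k, h1, h2, h3, fun q => (h4 q).trans (by linarith)⟩

theorem loss_later {ξ : 𝕜} {n : ℕ} {u : ℝ} (h : X.Loss ξ n (u * X.f.deg ^ n)) {m : ℕ} (hm : n ≤ m) :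
    X.Loss ξ m (u * X.f.deg ^ m) := by
  induction m, hm using Nat.le_induction with
  | base => exact h
  | succ m hm ih =>
    refine (X.loss_succ ih).mono (le_of_eq ?_)
    rw [pow_succ]; ring

/-- infinitely many non-total indices: the loss is negligible -/
theorem loss_small {ξ : 𝕜} (hd : 1 < X.f.deg) (hξ : ‖ξ - X.a₀‖ ≤ X.s₀) (h0 : 0 < X.rad ξ) (hinf : ∀ N, ∃ n ≥ N, X.NT ξ n)
    {ε : ℝ} (hε : 0 < ε) : ∃ N, ∀ n ≥ N, X.Loss ξ n (ε * X.f.deg ^ n) := by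
  have hd' : (1 : ℝ) < X.f.deg := by exact_mod_cast hd
  have hd0 : (0 : ℝ) < X.f.deg := by linarith
  obtain ⟨N0, hN0⟩ : ∃ N0 : ℕ, ∀ n ≥ N0, (X.y.deg : ℝ) ≤ ε / 2 * X.f.deg ^ n := by
    have := (tendsto_pow_atTop_atTop_of_one_lt hd').eventually_ge_atTop (X.y.deg / (ε / 2))
    obtain ⟨N0, h⟩ := eventually_atTop.1 this
    refine ⟨N0, fun n hn => ?_⟩
    have := h n hn
    rw [div_le_iff₀ (by positivity)] at this
    linarith
  set η := ε / (2 * X.f.deg) with hη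
  have hηpos : 0 < η := by positivity
  have key : ∀ j : ℕ, ∃ N ≥ N0, X.Loss ξ N (max ε (X.x.deg - j * η) * X.f.deg ^ N) := by
    intro j
    induction j with
    | zero =>
      refine ⟨N0, le_rfl, X.loss_later (n := 0) ?_ (Nat.zero_le _)⟩
      refine (X.loss_zero ξ).mono ?_
      simp
    | succ j ih =>
      obtain ⟨N, hN, hL⟩ := ih
      obtain ⟨n, hn, hnt⟩ := hinf N
      set u := max ε (X.x.deg - j * η) with hu
      refine ⟨n + 1, by omega, ((X.loss_nt hξ h0 (X.loss_later hL hn) hnt).mono ?_)⟩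
      have h1 : ε ≤ u := le_max_left _ _
      have h2 : u - η ≤ max ε (X.x.deg - (j + 1 : ℕ) * η) := by
        push_cast
        rcases le_total ε (X.x.deg - j * η) with h | h
        · rw [hu, max_eq_right h]; refine le_trans ?_ (le_max_right _ _); linarith
        · rw [hu, max_eq_left h]; refine le_trans ?_ (le_max_left _ _); linarith
      have h3 := hN0 n (by omega)
      have hp : (0 : ℝ) < X.f.deg ^ n := by positivity
      have h4 : (X.f.deg - 1) * (u * X.f.deg ^ n) + X.y.deg ≤ (u - η) * X.f.deg ^ (n + 1) := by
        have : η * X.f.deg = ε / 2 := by rw [hη]; field_simp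
        rw [pow_succ]
        have e : (u - η) * ((X.f.deg : ℝ) ^ n * X.f.deg) = (u * X.f.deg - η * X.f.deg) * X.f.deg ^ n := by ring
        rw [e, this]
        nlinarith [mul_le_mul_of_nonneg_right h1 hp.le]
      exact h4.trans (mul_le_mul_of_nonneg_right h2 (by positivity))
  obtain ⟨j, hj⟩ := exists_nat_ge ((X.x.deg : ℝ) / η)
  obtain ⟨N, _, hN⟩ := key j
  refine ⟨N, fun n hn => ?_⟩
  have : max ε (X.x.deg - j * η) = ε := by
    apply max_eq_left
    rw [div_le_iff₀ hηpos] at hj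
    linarith
  rw [this] at hN
  exact X.loss_later hN hn

theorem sum_cnt_le (P : 𝕜[X]) (T : Finset 𝕜) (p : 𝕜 → 𝕜 → Prop) (r : 𝕜 → Prop) (h : ∀ a ∈ T, ∀ z, p a z → r z)
    (hd : ∀ a ∈ T, ∀ a' ∈ T, a ≠ a' → ∀ z, p a z → p a' z → False) : ∑ a ∈ T, cnt (p a) P ≤ cnt r P := by
  induction T using Finset.induction_on generalizing r with
  | empty => simp
  | insert a T ha ih =>
    rw [Finset.sum_insert ha]
    have h2 := ih (fun z => r z ∧ ¬ p a z) (fun b hb z hz => ⟨h b (Finset.mem_insert_of_mem hb) z hz, fun hz' =>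
      hd a (Finset.mem_insert_self _ _) b (Finset.mem_insert_of_mem hb) (fun e => ha (e ▸ hb)) z hz' hz⟩)
      (fun b hb b' hb' => hd b (Finset.mem_insert_of_mem hb) b' (Finset.mem_insert_of_mem hb'))
    have := cnt_add_of_disjoint (p := p a) (q := fun z => r z ∧ ¬ p a z) (r := r) (fun z h1 h2 => h2.2 h1)
      (h a (Finset.mem_insert_self _ _)) (fun z hz => hz.1) P
    omega

theorem diff_rat (x y : Pr 𝕜) : x.rat - y.rat = algebraMap _ (RatFunc 𝕜) (x.A * y.B - y.A * x.B) / algebraMap _ (RatFunc 𝕜) (x.B * y.B) := by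
  have h1 := x.hb
  have h2 := y.hb
  unfold Pr.rat
  rw [div_sub_div _ _ h1 h2, map_sub, map_mul, map_mul, map_mul]
  ring

theorem GN_diff (x y : Pr 𝕜) (a : 𝕜) {s : ℝ} (hs : 0 < s) :
    GN a s (x.rat - y.rat) = gn a s (x.A * y.B - y.A * x.B) / (gn a s x.B * gn a s y.B) := by
  rw [diff_rat, GN_div a hs _ (mul_ne_zero x.hB y.hB), gn_mul a hs]

/-- loss estimate for zeros -/
theorem loss_zeros {ξ : 𝕜} {n : ℕ} {b : ℝ} (h0 : 0 < X.rad ξ) (h : X.Loss ξ n b)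
    (hn : ¬ Rel (GN ξ (X.rad ξ)) (X.α n) X.β) (q : OnePoint 𝕜) :
    ((X.p n).Z (cl ξ (X.rad ξ)) q : ℝ) ≤ cnt (cl ξ (X.rad ξ)) ((X.p n).A * X.y.B - X.y.A * (X.p n).B) + b := by
  obtain ⟨T, k, h1, h2, h3, h4⟩ := h
  have hN := GN_nabs ξ h0
  set N := GN ξ (X.rad ξ) with hNdef
  obtain ⟨c, hc0⟩ := exists_dm hN (X.α n)
  have e1 : N (X.α n - RatFunc.C c) ≤ N (X.α n - X.β) := by
    rw [← hc0]
    by_contra hcon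
    push Not at hcon
    rw [hN.sub_rev] at hcon
    exact hn (Rel.symm hN hcon)
  have e2 : N (X.β - RatFunc.C c) ≤ N (X.α n - X.β) := by
    refine (hN.tri X.β (X.α n) _).trans (max_le ?_ e1)
    rw [hN.sub_rev]
  set x := X.p n with hx
  set S := x.A * X.y.B - X.y.A * x.B with hS
  set U := (x.A - C c * x.B) * X.y.B with hU
  set W := -((X.y.A - C c * X.y.B) * x.B) with hW
  have hadd : U + W = S := by rw [hU, hW, hS]; ring
  have hU0 : U ≠ 0 := mul_ne_zero (x.l_coe_ne c) X.y.hB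
  have hW0 : W ≠ 0 := neg_ne_zero.2 (mul_ne_zero (X.y.l_coe_ne c) x.hB)
  have hxB := gn_pos ξ h0 x.hB
  have hyB := gn_pos ξ h0 X.y.hB
  have f1 : gn ξ (X.rad ξ) U ≤ gn ξ (X.rad ξ) S := by
    have : GN ξ (X.rad ξ) (x.rat - RatFunc.C c) ≤ GN ξ (X.rad ξ) (x.rat - X.y.rat) := e1
    rw [GN_diff _ _ _ h0, Pr.GN_rat _ _ h0, div_le_div_iff₀ hxB (by positivity)] at this
    rw [hU, gn_mul _ h0]
    have h' : gn ξ (X.rad ξ) x.B * (gn ξ (X.rad ξ) (x.A - C c * x.B) * gn ξ (X.rad ξ) X.y.B) ≤ gn ξ (X.rad ξ) x.B * gn ξ (X.rad ξ) S := by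
      linarith
    exact le_of_mul_le_mul_left h' hxB
  have f2 : gn ξ (X.rad ξ) W ≤ gn ξ (X.rad ξ) S := by
    have : GN ξ (X.rad ξ) (X.y.rat - RatFunc.C c) ≤ GN ξ (X.rad ξ) (x.rat - X.y.rat) := e2
    rw [GN_diff _ _ _ h0, Pr.GN_rat _ _ h0, div_le_div_iff₀ hyB (by positivity)] at this
    rw [hW, gn_neg _ h0, gn_mul _ h0]
    have h' : gn ξ (X.rad ξ) X.y.B * (gn ξ (X.rad ξ) (X.y.A - C c * X.y.B) * gn ξ (X.rad ξ) x.B) ≤ gn ξ (X.rad ξ) X.y.B * gn ξ (X.rad ξ) S := by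
      linarith
    exact le_of_mul_le_mul_left h' hyB
  have hS0 : S ≠ 0 := by
    intro h
    rw [h, gn_zero] at f1
    exact absurd f1 (not_le.2 (gn_pos ξ h0 hU0))
  have hk : ∀ a ∈ T, k a ≤ cnt (op a (X.rad ξ)) S := by
    intro a ha
    rw [gn_center h0 (h1 a ha), gn_center h0 (h1 a ha)] at f1 f2
    have := count_ge a h0 hU0 hW0 (hadd ▸ hS0) (hadd ▸ f1) (hadd ▸ f2)
    rw [hadd] at this
    refine le_trans (le_min ?_ ?_) this
    · rw [hU, cnt_mul _ (x.l_coe_ne c) X.y.hB]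
      refine (h3 a ha (c : OnePoint 𝕜)).trans ?_
      rw [Pr.Z_coe]; exact Nat.le_add_right _ _
    · rw [hW, cnt_neg, cnt_mul _ (X.y.l_coe_ne c) x.hB]
      have := h3 a ha OnePoint.infty
      unfold Pr.Z at this
      rw [Pr.l, lin_infty, cnt_neg] at this
      exact this.trans (Nat.le_add_left _ _)
  have hsum : ∑ a ∈ T, cnt (op a (X.rad ξ)) S ≤ cnt (cl ξ (X.rad ξ)) S := by
    apply sum_cnt_le
    · intro a ha z hz
      exact (dist_tri ξ a z).trans (max_le (h1 a ha) hz.le)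
    · intro a ha a' ha' hne z hz hz'
      have := dist_tri a z a'
      rw [norm_sub_rev z] at this
      exact absurd (this.trans_lt (max_lt hz hz')) (not_lt.2 (h2 a ha a' ha' hne))
  have hfin : ∑ a ∈ T, (k a : ℝ) ≤ cnt (cl ξ (X.rad ξ)) S := by
    exact_mod_cast (Finset.sum_le_sum hk).trans hsum
  linarith [h4 q]

end Ctx
end Dir
end EQ

/-! ## Total leaves force a good norm -/
namespace EQ

section Total
variable {𝕜 : Type*} [NontriviallyNormedField 𝕜] [IsUltrametricDist 𝕜] [IsAlgClosed 𝕜]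

/-- wedge product -/
def wd (c v : 𝕜 × 𝕜) : 𝕜 := c.2 * v.1 - c.1 * v.2

/-- Moebius transformation as pair -/
noncomputable def Pr.mob (v w : 𝕜 × 𝕜) (h : wd v w ≠ 0) : Pr 𝕜 where
  A := C v.1 + C w.1 * X
  B := C v.2 + C w.2 * X
  cop := by
    refine ⟨C (w.2 * (v.1 * w.2 - v.2 * w.1)⁻¹), C (-w.1 * (v.1 * w.2 - v.2 * w.1)⁻¹), ?_⟩
    have h' : v.1 * w.2 - v.2 * w.1 ≠ 0 := by
      intro h2; apply h; unfold wd; linear_combination -h2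
    rw [← C_1, ← mul_inv_cancel₀ h']
    simp only [C_mul, C_sub, C_neg]; ring
  hB := by
    intro h0
    have h1 := congrArg (fun p => coeff p 0) h0
    have h2 := congrArg (fun p => coeff p 1) h0
    simp at h1 h2
    apply h; simp [wd, h1, h2]
  nc := by
    have hB : (C v.2 + C w.2 * X : 𝕜[X]) ≠ 0 := by
      intro h0
      have h1 := congrArg (fun p => coeff p 0) h0
      have h2 := congrArg (fun p => coeff p 1) h0
      simp at h1 h2
      apply h; simp [wd, h1, h2]
    intro c hc
    rw [div_eq_iff ((map_ne_zero_iff _ (RatFunc.algebraMap_injective 𝕜)).2 hB), ← RatFunc.algebraMap_C, ← map_mul] at hc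
    have hc' := RatFunc.algebraMap_injective 𝕜 hc
    have h1 := congrArg (fun p => coeff p 0) hc'
    have h2 := congrArg (fun p => coeff p 1) hc'
    simp at h1 h2
    apply h; simp only [wd, h1, h2]; ring

theorem exists_wd {v : 𝕜 × 𝕜} (hv : v ≠ 0) : ∃ w : 𝕜 × 𝕜, wd v w ≠ 0 := by
  by_cases h : v.2 = 0
  · refine ⟨(0, 1), ?_⟩
    have : v.1 ≠ 0 := fun h1 => hv (Prod.ext h1 h)
    simpa [wd, h] using this
  · exact ⟨(1, 0), by simpa [wd] using h⟩

theorem eval_l (x : Pr 𝕜) (c : 𝕜 × 𝕜) (z : 𝕜) : (x.l c).eval z = wd c (x.A.eval z, x.B.eval z) := by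
  simp [Pr.l, lin, wd]

theorem Pr.comp_l' (f : Pr 𝕜) {c : 𝕜 × 𝕜} (hc0 : c ≠ 0) : ∃ k : 𝕜, k ≠ 0 ∧ (∀ x : Pr 𝕜,
    (f.comp x).l c = C k * ((f.pull c).map fun q => x.l (hc q)).prod) ∧
    ∀ v : 𝕜 × 𝕜, v ≠ 0 → wd c (f.val v) = k * ((f.pull c).map fun q => wd (hc q) v).prod := by
  obtain ⟨k, hk, h⟩ := f.comp_l hc0
  refine ⟨k, hk, h, fun v hv => ?_⟩
  obtain ⟨w, hw⟩ := exists_wd hv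
  have := congrArg (eval 0) (h (Pr.mob v w hw))
  have e0 : ((Pr.mob v w hw).A.eval 0, (Pr.mob v w hw).B.eval 0) = v := by simp [Pr.mob]
  have e1 : ((f.comp (Pr.mob v w hw)).A.eval 0, (f.comp (Pr.mob v w hw)).B.eval 0) = f.val v := by
    conv_rhs => rw [← e0]
    simp only [Pr.comp, hm_eval, Pr.val, EQ.hv]
  rw [eval_l, e1, eval_mul, eval_C, eval_multiset_prod, Multiset.map_map] at this
  rw [this]
  congr 2
  apply Multiset.map_congr rfl
  intro q _
  rw [Function.comp_apply, eval_l, e0]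

theorem Pr.val_smul (f : Pr 𝕜) (t : 𝕜) (v : 𝕜 × 𝕜) : f.val (t • v) = t ^ f.deg • f.val v := by
  have : ∀ R : 𝕜[X], hv f.deg R (t • v) = t ^ f.deg * hv f.deg R v := by
    intro R
    unfold hv
    rw [Finset.mul_sum]
    apply Finset.sum_congr rfl
    intro i hi
    have hi' : i ≤ f.deg := Nat.lt_succ_iff.1 (Finset.mem_range.1 hi)
    simp only [Prod.smul_fst, Prod.smul_snd, smul_eq_mul, mul_pow]
    rw [← Nat.sub_add_cancel hi']
    simp only [Nat.add_sub_cancel, pow_add]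
    ring
  ext
  · simp [Pr.val, this]
  · simp [Pr.val, this]

theorem exists_hc {v : 𝕜 × 𝕜} (hv : v ≠ 0) : ∃ (t : 𝕜) (q : OnePoint 𝕜), t ≠ 0 ∧ v = t • hc q := by
  by_cases h : v.2 = 0
  · have : v.1 ≠ 0 := fun h1 => hv (Prod.ext h1 h)
    refine ⟨v.1, OnePoint.infty, this, ?_⟩
    ext <;> simp [h]
  · refine ⟨v.2, ((v.1 / v.2 : 𝕜) : OnePoint 𝕜), h, ?_⟩
    have : hc ((v.1 / v.2 : 𝕜) : OnePoint 𝕜) = (v.1 / v.2, 1) := rfl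
    rw [this]
    ext
    · simp; field_simp
    · simp

/-- orthonormalizable norm -/
structure Orth (N : 𝕜 × 𝕜 → ℝ) (u w : 𝕜 × 𝕜) : Prop where
  ind : wd u w ≠ 0
  eq : ∀ a b : 𝕜, N (a • u + b • w) = max ‖a‖ ‖b‖

theorem Orth.coord {N : 𝕜 × 𝕜 → ℝ} {u w : 𝕜 × 𝕜} (h : Orth N u w) (v : 𝕜 × 𝕜) : ∃ a b : 𝕜, v = a • u + b • w := by
  have h1 : u.2 * w.1 - u.1 * w.2 ≠ 0 := h.ind
  refine ⟨(w.1 * v.2 - w.2 * v.1) / (u.2 * w.1 - u.1 * w.2), (u.2 * v.1 - u.1 * v.2) / (u.2 * w.1 - u.1 * w.2), ?_⟩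
  have key : ∀ z : 𝕜, z = z * (u.2 * w.1 - u.1 * w.2) / (u.2 * w.1 - u.1 * w.2) := fun z => by rw [mul_div_assoc, div_self h1, mul_one]
  ext
  · simp only [Prod.fst_add, Prod.smul_fst, smul_eq_mul]
    conv_lhs => rw [key v.1]
    ring
  · simp only [Prod.snd_add, Prod.smul_snd, smul_eq_mul]
    conv_lhs => rw [key v.2]
    ring

theorem wd_basis (u w : 𝕜 × 𝕜) (a b a' b' : 𝕜) : wd (a • u + b • w) (a' • u + b' • w) = (a * b' - b * a') * wd u w := by
  simp [wd]; ring

theorem norm_sub_le_max' (a b : 𝕜) : ‖a - b‖ ≤ max ‖a‖ ‖b‖ := by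
  have := IsUltrametricDist.norm_add_le_max a (-b)
  rwa [norm_neg, ← sub_eq_add_neg] at this

theorem Orth.wd_le {N : 𝕜 × 𝕜 → ℝ} {u w : 𝕜 × 𝕜} (h : Orth N u w) (q v : 𝕜 × 𝕜) :
    ‖wd q v‖ ≤ ‖wd u w‖ * (N q * N v) := by
  obtain ⟨a, b, rfl⟩ := h.coord q
  obtain ⟨a', b', rfl⟩ := h.coord v
  rw [wd_basis, h.eq, h.eq, norm_mul, mul_comm]
  refine mul_le_mul_of_nonneg_left ?_ (norm_nonneg _)
  refine (norm_sub_le_max' _ _).trans (max_le ?_ ?_)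
  · rw [norm_mul]; exact mul_le_mul (le_max_left _ _) (le_max_right _ _) (norm_nonneg _) (le_max_of_le_left (norm_nonneg _))
  · rw [norm_mul]; exact mul_le_mul (le_max_right _ _) (le_max_left _ _) (norm_nonneg _) (le_max_of_le_left (norm_nonneg _))

theorem Orth.pos {N : 𝕜 × 𝕜 → ℝ} {u w : 𝕜 × 𝕜} (h : Orth N u w) {v : 𝕜 × 𝕜} (hv : v ≠ 0) : 0 < N v := by
  obtain ⟨a, b, rfl⟩ := h.coord v
  rw [h.eq]
  by_contra hcon
  push Not at hcon
  have h1 := norm_le_zero_iff.1 ((le_max_left _ _).trans hcon)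
  have h2 := norm_le_zero_iff.1 ((le_max_right _ _).trans hcon)
  apply hv; simp [h1, h2]

theorem Orth.smul {N : 𝕜 × 𝕜 → ℝ} {u w : 𝕜 × 𝕜} (h : Orth N u w) (t : 𝕜) (v : 𝕜 × 𝕜) : N (t • v) = ‖t‖ * N v := by
  obtain ⟨a, b, rfl⟩ := h.coord v
  rw [smul_add, smul_smul, smul_smul, h.eq, h.eq, norm_mul, norm_mul, mul_max_of_nonneg _ _ (norm_nonneg _)]

theorem Orth.wd_eq {N : 𝕜 × 𝕜 → ℝ} {u w : 𝕜 × 𝕜} (h : Orth N u w) {q v : 𝕜 × 𝕜} (hs : ¬ Sim N q v) (hv : v ≠ 0) :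
    ‖wd q v‖ = ‖wd u w‖ * (N q * N v) := by
  apply le_antisymm (h.wd_le q v)
  by_contra hcon
  push Not at hcon
  apply hs
  have hvp := h.pos hv
  obtain ⟨a, b, rfl⟩ := h.coord q
  obtain ⟨a', b', rfl⟩ := h.coord v
  rw [wd_basis, norm_mul, mul_comm] at hcon
  have hw : 0 < ‖wd u w‖ := norm_pos_iff.2 h.ind
  have hlt := lt_of_mul_lt_mul_left hcon hw.le
  rcases le_total ‖b'‖ ‖a'‖ with hab | hab
  · have hN : N (a' • u + b' • w) = ‖a'‖ := by rw [h.eq, max_eq_left hab]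
    rw [hN] at hlt hvp
    have ha' : a' ≠ 0 := norm_pos_iff.1 hvp
    refine ⟨a / a', ?_⟩
    have : a • u + b • w - (a / a') • (a' • u + b' • w) = (0 : 𝕜) • u + ((b * a' - a * b') / a') • w := by
      ext
      · simp; field_simp; ring
      · simp; field_simp; ring
    rw [this, h.eq, norm_zero, max_eq_right (norm_nonneg _), norm_div, div_lt_iff₀ hvp, norm_sub_rev]
    exact hlt
  · have hN : N (a' • u + b' • w) = ‖b'‖ := by rw [h.eq, max_eq_right hab]
    rw [hN] at hlt hvp
    have ha' : b' ≠ 0 := norm_pos_iff.1 hvp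
    refine ⟨b / b', ?_⟩
    have : a • u + b • w - (b / b') • (a' • u + b' • w) = ((a * b' - b * a') / b') • u + (0 : 𝕜) • w := by
      ext
      · simp; field_simp; ring
      · simp; field_simp; ring
    rw [this, h.eq, norm_zero, max_eq_left (norm_nonneg _), norm_div, div_lt_iff₀ hvp]
    exact hlt

theorem Orth.exists_eq {N : 𝕜 × 𝕜 → ℝ} {u w : 𝕜 × 𝕜} (h : Orth N u w) (v : 𝕜 × 𝕜) : ∃ c : 𝕜 × 𝕜, c ≠ 0 ∧
    ‖wd c v‖ = ‖wd u w‖ * (N c * N v) := by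
  have hu : u ≠ 0 := by rintro rfl; exact h.ind (by simp [wd])
  have hw : w ≠ 0 := by rintro rfl; exact h.ind (by simp [wd])
  have Nu : N u = 1 := by have := h.eq 1 0; simpa using this
  have Nw : N w = 1 := by have := h.eq 0 1; simpa using this
  obtain ⟨a, b, rfl⟩ := h.coord v
  rcases le_total ‖a‖ ‖b‖ with hab | hab
  · refine ⟨u, hu, ?_⟩
    have := wd_basis u w 1 0 a b
    simp only [one_smul, zero_smul, add_zero] at this
    rw [this, Nu, h.eq, max_eq_right hab, norm_mul]; simp; ring
  · refine ⟨w, hw, ?_⟩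
    have := wd_basis u w 0 1 a b
    simp only [one_smul, zero_smul, zero_add] at this
    rw [this, Nw, h.eq, max_eq_left hab, norm_mul]; simp; ring

theorem Pr.nm_smul (x : Pr 𝕜) (a : 𝕜) {s : ℝ} (hs : 0 < s) (t : 𝕜) (v : 𝕜 × 𝕜) : x.nm a s (t • v) = ‖t‖ * x.nm a s v := by
  unfold Pr.nm; rw [x.l_smul, gn_mul a hs, gn_C]

theorem Pr.nm_pos (x : Pr 𝕜) (a : 𝕜) {s : ℝ} (hs : 0 < s) {v : 𝕜 × 𝕜} (hv : v ≠ 0) : 0 < x.nm a s v :=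
  gn_pos a hs (x.l_ne_zero hv)

/-- diagonalization -/
theorem Pr.nm_diag (x : Pr 𝕜) (a : 𝕜) {s : ℝ} (hs : 0 < s) : ∃ c₀ : 𝕜, ∀ p q : 𝕜,
    x.nm a s (p • (c₀, 1) + q • (1, 0)) = max (‖p‖ * x.nm a s (c₀, 1)) (‖q‖ * x.nm a s (1, 0)) := by
  obtain ⟨c₀, h⟩ := gn_att' a hs x.A x.hB
  refine ⟨c₀, fun p q => ?_⟩
  have e1 : ∀ c : 𝕜, x.l (c, 1) = x.A - C c * x.B := fun c => by simp [Pr.l, lin]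
  have e2 : x.l ((1, 0) : 𝕜 × 𝕜) = - x.B := by simp [Pr.l, lin]
  by_cases hp : p = 0
  · subst hp
    rw [zero_smul, zero_add, x.nm_smul a hs, norm_zero, zero_mul, max_eq_right]
    exact mul_nonneg (norm_nonneg _) (gn_nonneg a hs _)
  · have : p • ((c₀, 1) : 𝕜 × 𝕜) + q • (1, 0) = p • (c₀ + q / p, 1) := by
      ext
      · simp; field_simp
      · simp
    rw [this, x.nm_smul a hs]
    unfold Pr.nm
    rw [e1, e1, e2, h, gn_neg a hs, mul_max_of_nonneg _ _ (norm_nonneg _)]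
    have e3 : c₀ - (c₀ + q / p) = - (q / p) := by ring
    rw [e3, norm_neg, norm_div]
    congr 1
    have : ‖p‖ ≠ 0 := norm_ne_zero_iff.2 hp
    field_simp

theorem Pr.nm_orth (x : Pr 𝕜) (a : 𝕜) {s : ℝ} (hs : 0 < s) (hsK : ∃ z : 𝕜, ‖z‖ = s) : ∃ u w, Orth (x.nm a s) u w := by
  obtain ⟨c₀, h⟩ := x.nm_diag a hs
  obtain ⟨z, hz⟩ := hsK
  have val : ∀ v : 𝕜 × 𝕜, v ≠ 0 → ∃ t : 𝕜, t ≠ 0 ∧ x.nm a s v = ‖t‖ := by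
    intro v hv
    obtain ⟨i, hi⟩ := exists_gn a s (x.l v)
    refine ⟨(taylor a (x.l v)).coeff i * z ^ i, ?_, ?_⟩
    · rw [← norm_pos_iff, norm_mul, norm_pow, hz, ← hi]; exact x.nm_pos a hs hv
    · rw [norm_mul, norm_pow, hz, ← hi]; rfl
  obtain ⟨t1, ht1, e1⟩ := val (c₀, 1) (by simp)
  obtain ⟨t2, ht2, e2⟩ := val (1, 0) (by simp)
  refine ⟨t1⁻¹ • (c₀, 1), t2⁻¹ • (1, 0), ?_, fun p q => ?_⟩
  · simp [wd, ht1, ht2]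
  · rw [smul_smul, smul_smul, h, e1, e2, norm_mul, norm_mul, norm_inv, norm_inv]
    have n1 : ‖t1‖ ≠ 0 := norm_ne_zero_iff.2 ht1
    have n2 : ‖t2‖ ≠ 0 := norm_ne_zero_iff.2 ht2
    congr 1
    · field_simp
    · field_simp

theorem Pr.nm_bound (x : Pr 𝕜) (a : 𝕜) {s : ℝ} (hs : 0 < s) : ∃ M : ℝ, ∀ v : 𝕜 × 𝕜, v ≠ 0 →
    |Real.log (x.nm a s v) - Real.log ‖v‖| ≤ M := by
  obtain ⟨c₀, h⟩ := x.nm_diag a hs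
  set n1 := x.nm a s (c₀, 1)
  set n2 := x.nm a s (1, 0)
  have h1 : 0 < n1 := x.nm_pos a hs (by simp)
  have h2 : 0 < n2 := x.nm_pos a hs (by simp)
  set C1 : ℝ := max n1 (max n2 (‖c₀‖ * n2)) with hC1
  set C2 : ℝ := max n1⁻¹ (max (‖c₀‖ / n1) n2⁻¹) with hC2
  have hC1p : 0 < C1 := lt_of_lt_of_le h1 (le_max_left _ _)
  have hC2p : 0 < C2 := lt_of_lt_of_le (inv_pos.2 h1) (le_max_left _ _)
  have up : ∀ v : 𝕜 × 𝕜, x.nm a s v ≤ C1 * ‖v‖ := by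
    intro v
    have e : v = v.2 • (c₀, 1) + (v.1 - c₀ * v.2) • (1, 0) := by ext <;> simp; ring
    have hv1 : ‖v.1‖ ≤ ‖v‖ := norm_fst_le v
    have hv2 : ‖v.2‖ ≤ ‖v‖ := norm_snd_le v
    conv_lhs => rw [e]
    rw [h]
    apply max_le
    · rw [mul_comm]; exact mul_le_mul (le_max_left _ _) hv2 (norm_nonneg _) hC1p.le
    · have := norm_sub_le_max' v.1 (c₀ * v.2)
      rcases le_max_iff.1 this with h' | h'
      · calc _ ≤ ‖v‖ * n2 := mul_le_mul_of_nonneg_right (h'.trans hv1) h2.le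
          _ ≤ _ := by rw [mul_comm]; exact mul_le_mul_of_nonneg_right (le_max_of_le_right (le_max_left _ _)) (norm_nonneg _)
      · rw [norm_mul] at h'
        calc _ ≤ (‖c₀‖ * ‖v‖) * n2 := mul_le_mul_of_nonneg_right (h'.trans (mul_le_mul_of_nonneg_left hv2 (norm_nonneg _))) h2.le
          _ = (‖c₀‖ * n2) * ‖v‖ := by ring
          _ ≤ _ := mul_le_mul_of_nonneg_right (le_max_of_le_right (le_max_right _ _)) (norm_nonneg _)
  have lo : ∀ v : 𝕜 × 𝕜, ‖v‖ ≤ C2 * x.nm a s v := by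
    intro v
    have e : v = v.2 • (c₀, 1) + (v.1 - c₀ * v.2) • (1, 0) := by ext <;> simp; ring
    have hh := h v.2 (v.1 - c₀ * v.2)
    rw [← e] at hh
    set Nv := x.nm a s v
    have hNv : 0 ≤ Nv := gn_nonneg a hs _
    have b1 : ‖v.2‖ ≤ n1⁻¹ * Nv := by
      have : ‖v.2‖ * n1 ≤ Nv := hh ▸ le_max_left _ _
      rw [inv_mul_eq_div, le_div_iff₀ h1]; exact this
    have b2 : ‖v.1 - c₀ * v.2‖ ≤ n2⁻¹ * Nv := by
      have : ‖v.1 - c₀ * v.2‖ * n2 ≤ Nv := hh ▸ le_max_right _ _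
      rw [inv_mul_eq_div, le_div_iff₀ h2]; exact this
    rw [Prod.norm_def]
    apply max_le
    · have : v.1 = (v.1 - c₀ * v.2) + c₀ * v.2 := by ring
      rw [this]
      refine (IsUltrametricDist.norm_add_le_max _ _).trans (max_le ?_ ?_)
      · exact b2.trans (mul_le_mul_of_nonneg_right (le_max_of_le_right (le_max_right _ _)) hNv)
      · rw [norm_mul]
        calc _ ≤ ‖c₀‖ * (n1⁻¹ * Nv) := mul_le_mul_of_nonneg_left b1 (norm_nonneg _)
          _ = (‖c₀‖ / n1) * Nv := by ring
          _ ≤ _ := mul_le_mul_of_nonneg_right (le_max_of_le_right (le_max_left _ _)) hNv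
    · exact b1.trans (mul_le_mul_of_nonneg_right (le_max_left _ _) hNv)
  refine ⟨max (Real.log C1) (Real.log C2), fun v hv => ?_⟩
  have hvp : 0 < ‖v‖ := norm_pos_iff.2 hv
  have hNp := x.nm_pos a hs hv
  have l1 := Real.log_le_log hNp (up v)
  have l2 := Real.log_le_log hvp (lo v)
  rw [Real.log_mul hC1p.ne' hvp.ne'] at l1
  rw [Real.log_mul hC2p.ne' hNp.ne'] at l2
  rw [abs_le]
  constructor
  · have := le_max_right (Real.log C1) (Real.log C2); linarith
  · have := le_max_left (Real.log C1) (Real.log C2); linarith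

/-- potential good reduction, norm form -/
def GoodNorm (f : Pr 𝕜) : Prop := ∃ (N : 𝕜 × 𝕜 → ℝ) (u w : 𝕜 × 𝕜), Orth N u w ∧ ∃ Λ : ℝ, 0 < Λ ∧
  ∀ v, v ≠ 0 → N (f.val v) = Λ * N v ^ f.deg

theorem norm_multiset_prod {ι : Type*} (m : Multiset ι) (F : ι → 𝕜) : ‖(m.map F).prod‖ = (m.map fun i => ‖F i‖).prod := by
  induction m using Multiset.induction_on with
  | empty => simp
  | cons a m ih => simp [ih]

theorem Pr.nm_comp (f x : Pr 𝕜) (a : 𝕜) {s : ℝ} (hs : 0 < s) (c : 𝕜 × 𝕜) (k : 𝕜)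
    (h : (f.comp x).l c = C k * ((f.pull c).map fun q => x.l (hc q)).prod) :
    (f.comp x).nm a s c = ‖k‖ * ((f.pull c).map fun q => x.nm a s (hc q)).prod := by
  unfold Pr.nm
  rw [h, gn_mul a hs, gn_C, gn_multiset_prod a hs, Multiset.map_map]
  rfl

theorem prod_map_mul_const {ι : Type*} (m : Multiset ι) (F : ι → ℝ) (b : ℝ) :
    (m.map fun i => b * F i).prod = b ^ m.card * (m.map F).prod := by
  rw [Multiset.prod_map_mul]; simp

theorem prod_map_le {ι : Type*} (m : Multiset ι) (F G : ι → ℝ) (h0 : ∀ i ∈ m, 0 ≤ F i) (h : ∀ i ∈ m, F i ≤ G i) :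
    (m.map F).prod ≤ (m.map G).prod := by
  induction m using Multiset.induction_on with
  | empty => simp
  | cons a m ih =>
    simp only [Multiset.map_cons, Multiset.prod_cons]
    have h1 := h0 a (Multiset.mem_cons_self a m)
    have h2 := h a (Multiset.mem_cons_self a m)
    refine mul_le_mul h2 (ih (fun i hi => h0 i (Multiset.mem_cons_of_mem hi)) (fun i hi => h i (Multiset.mem_cons_of_mem hi))) ?_ (h1.trans h2)
    apply Multiset.prod_nonneg
    intro y hy
    obtain ⟨i, hi, rfl⟩ := Multiset.mem_map.1 hy
    exact h0 i (Multiset.mem_cons_of_mem hi)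

/-- one step of a total index -/
theorem total_step (f x : Pr 𝕜) (a : 𝕜) {s : ℝ} (hs : 0 < s) {u w u' w' : 𝕜 × 𝕜} (h : Orth (x.nm a s) u w)
    (h' : Orth ((f.comp x).nm a s) u' w')
    (ht : ∀ v : OnePoint 𝕜, ∃ c : OnePoint 𝕜, ∀ q ∈ f.pull (hc c), ¬ Sim (x.nm a s) (hc q) (hc v)) :
    ∃ Λ : ℝ, 0 < Λ ∧ ∀ v, v ≠ 0 → (f.comp x).nm a s (f.val v) = Λ * x.nm a s v ^ f.deg := by
  have hw : 0 < ‖wd u w‖ := norm_pos_iff.2 h.ind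
  have hw' : 0 < ‖wd u' w'‖ := norm_pos_iff.2 h'.ind
  refine ⟨‖wd u w‖ ^ f.deg / ‖wd u' w'‖, by positivity, fun v hv => ?_⟩
  rw [div_mul_eq_mul_div, eq_div_iff hw'.ne']
  apply le_antisymm
  · obtain ⟨c, hc0, hceq⟩ := h'.exists_eq (f.val v)
    obtain ⟨k, hk, hk1, hk2⟩ := f.comp_l' hc0
    rw [hk2 v hv, norm_mul, norm_multiset_prod] at hceq
    have hle : (Multiset.map (fun q => ‖wd (hc q) v‖) (f.pull c)).prod ≤ (‖wd u w‖ * x.nm a s v) ^ f.deg * ((f.pull c).map fun q => x.nm a s (hc q)).prod := by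
      have e := prod_map_mul_const (f.pull c) (fun q => x.nm a s (hc q)) (‖wd u w‖ * x.nm a s v)
      rw [f.card_pull] at e
      rw [← e]
      apply prod_map_le
      · intro q _; exact norm_nonneg _
      · intro q _
        have := h.wd_le (hc q) v
        linarith
    have hNc := (f.comp x).nm_comp
    have e1 := Pr.nm_comp f x a hs c k (hk1 x)
    have hcp := (f.comp x).nm_pos a hs hc0
    have hle2 := mul_le_mul_of_nonneg_left hle (norm_nonneg k)
    rw [hceq] at hle2
    have : (f.comp x).nm a s c * ((f.comp x).nm a s (f.val v) * ‖wd u' w'‖) ≤ (f.comp x).nm a s c * (‖wd u w‖ ^ f.deg * x.nm a s v ^ f.deg) := by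
      calc _ = ‖wd u' w'‖ * ((f.comp x).nm a s c * (f.comp x).nm a s (f.val v)) := by ring
        _ ≤ _ := hle2
        _ = (‖k‖ * ((f.pull c).map fun q => x.nm a s (hc q)).prod) * (‖wd u w‖ ^ f.deg * x.nm a s v ^ f.deg) := by rw [mul_pow]; ring
        _ = _ := by rw [← e1]
    exact le_of_mul_le_mul_left this hcp
  · obtain ⟨t, q0, ht0, rfl⟩ := exists_hc hv
    obtain ⟨c, hcq⟩ := ht q0
    have hc0 := Pr.hc_ne_zero c
    obtain ⟨k, hk, hk1, hk2⟩ := f.comp_l' hc0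
    have hle := h'.wd_le (hc c) (f.val (t • hc q0))
    rw [hk2 _ hv, norm_mul, norm_multiset_prod] at hle
    have heq : (Multiset.map (fun q => ‖wd (hc q) (t • hc q0)‖) (f.pull (hc c))).prod = (‖wd u w‖ * x.nm a s (t • hc q0)) ^ f.deg * ((f.pull (hc c)).map fun q => x.nm a s (hc q)).prod := by
      have e := prod_map_mul_const (f.pull (hc c)) (fun q => x.nm a s (hc q)) (‖wd u w‖ * x.nm a s (t • hc q0))
      rw [f.card_pull] at e
      rw [← e]
      congr 1
      apply Multiset.map_congr rfl
      intro q hq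
      have e1 := h.wd_eq (hcq q hq) (Pr.hc_ne_zero q0)
      have e2 : wd (hc q) (t • hc q0) = t * wd (hc q) (hc q0) := by simp [wd]; ring
      rw [e2, norm_mul, e1, h.smul]; ring
    rw [heq] at hle
    have e1 := Pr.nm_comp f x a hs (hc c) k (hk1 x)
    have hcp := (f.comp x).nm_pos a hs hc0
    have : (f.comp x).nm a s (hc c) * (‖wd u w‖ ^ f.deg * x.nm a s (t • hc q0) ^ f.deg) ≤ (f.comp x).nm a s (hc c) * ((f.comp x).nm a s (f.val (t • hc q0)) * ‖wd u' w'‖) := by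
      calc _ = ‖k‖ * ((‖wd u w‖ * x.nm a s (t • hc q0)) ^ f.deg * ((f.pull (hc c)).map fun q => x.nm a s (hc q)).prod) := by
            rw [e1, mul_pow]; ring
        _ ≤ _ := hle
        _ = _ := by ring
    exact le_of_mul_le_mul_left this hcp

end Total
end EQ

/-! ## Loss at every leaf -/
namespace EQ

section Loss
variable {𝕜 : Type*} [NontriviallyNormedField 𝕜] [IsUltrametricDist 𝕜] [IsAlgClosed 𝕜]

theorem integ (a : 𝕜) {r s : ℝ} (hr : 0 < r) (hrs : r ≤ s) {P Q : 𝕜[X]} (hP : P ≠ 0) (hQ : Q ≠ 0) (e : ℝ)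
    (h : ∀ t ∈ Set.Ico r s, (cnt (cl a t) P : ℝ) ≤ cnt (cl a t) Q + e) :
    Real.log (gn a s P) - Real.log (gn a r P) ≤ Real.log (gn a s Q) - Real.log (gn a r Q) + e * (Real.log s - Real.log r) := by
  set φ : ℝ → ℝ := fun t => Real.log (gn a t P) - Real.log (gn a t Q) - e * Real.log t with hφ
  have clog : ∀ R : 𝕜[X], R ≠ 0 → ContinuousOn (fun t => Real.log (gn a t R)) (Set.Icc r s) := by
    intro R hR
    refine ContinuousOn.log ((continuousOn_gn a R).mono fun t ht => lt_of_lt_of_le hr ht.1) ?_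
    intro t ht
    exact (gn_pos a (lt_of_lt_of_le hr ht.1) hR).ne'
  have hcont : ContinuousOn φ (Set.Icc r s) := by
    refine ((clog P hP).sub (clog Q hQ)).sub (ContinuousOn.mul continuousOn_const (ContinuousOn.log continuousOn_id ?_))
    intro t ht
    exact (lt_of_lt_of_le hr ht.1).ne'
  have hcl : IsClosed ({t | φ t ≤ φ r} ∩ Set.Icc r s) := by
    have := hcont.preimage_isClosed_of_isClosed isClosed_Icc (isClosed_Iic (a := φ r))
    rw [Set.inter_comm]; exact this
  have key := hcl.Icc_subset_of_forall_mem_nhdsWithin (by show φ r ≤ φ r; exact le_rfl) (by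
    intro t ht
    have ht0 : 0 < t := lt_of_lt_of_le hr ht.2.1
    filter_upwards [exists_gap_cnt a t P, exists_gap_cnt a t Q, self_mem_nhdsWithin] with t' h1 h2 h3
    have h3' : t < t' := h3
    have e1 := log_gn_eq a ht0 h3'.le hP h1
    have e2 := log_gn_eq a ht0 h3'.le hQ h2
    have hl := Real.log_lt_log ht0 h3'
    have := h t ht.2
    have ht1 : φ t ≤ φ r := ht.1
    show φ t' ≤ φ r
    refine le_trans ?_ ht1
    simp only [hφ]
    nlinarith [mul_le_mul_of_nonneg_right this (sub_pos.2 hl).le])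
  have := key (Set.right_mem_Icc.2 hrs)
  have h2 : φ s ≤ φ r := this
  simp only [hφ] at h2
  linarith

namespace Ctx
variable (X : Ctx 𝕜)

theorem osc_upto {ξ : 𝕜} (hξ : ‖ξ - X.a₀‖ ≤ X.s₀) (M : ℕ) (q q' : OnePoint 𝕜) {t : ℝ} (ht : t ∈ Set.Ico (X.rad ξ) X.s₀) :
    (cnt (cl ξ t) ((X.p M).l (hc q)) : ℝ) ≤ cnt (cl ξ t) ((X.p M).l (hc q')) + X.y.deg := by
  rcases eq_or_lt_of_le ht.1 with h | h
  · rw [← h]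
    exact_mod_cast X.osc_leaf hξ M q q'
  · exact_mod_cast X.osc_good (X.good_of_rad_lt hξ h ht.2.le) ht.2 M q q'

theorem leaf_diff {ξ : 𝕜} (hξ : ‖ξ - X.a₀‖ ≤ X.s₀) (h0 : 0 < X.rad ξ) (M : ℕ) {v w : 𝕜 × 𝕜} (hv : v ≠ 0) (hw : w ≠ 0) :
    Real.log ((X.p M).nm ξ X.s₀ v) - Real.log ((X.p M).nm ξ (X.rad ξ) v) ≤
     Real.log ((X.p M).nm ξ X.s₀ w) - Real.log ((X.p M).nm ξ (X.rad ξ) w) + X.y.deg * (Real.log X.s₀ - Real.log (X.rad ξ)) := by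
  obtain ⟨t, q, ht, rfl⟩ := exists_hc hv
  obtain ⟨t', q', ht', rfl⟩ := exists_hc hw
  have := integ ξ h0 (X.rad_lt hξ).le ((X.p M).l_ne_zero (Pr.hc_ne_zero q)) ((X.p M).l_ne_zero (Pr.hc_ne_zero q')) X.y.deg
    (fun t ht => X.osc_upto hξ M q q' ht)
  have sc : ∀ (s : ℝ) (hs : 0 < s) (t : 𝕜) (ht : t ≠ 0) (q : OnePoint 𝕜), Real.log ((X.p M).nm ξ s (t • hc q)) = Real.log ‖t‖ + Real.log ((X.p M).nm ξ s (hc q)) := by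
    intro s hs t ht q
    rw [Pr.nm_smul _ _ hs, Real.log_mul (norm_ne_zero_iff.2 ht) ((X.p M).nm_pos ξ hs (Pr.hc_ne_zero q)).ne']
  rw [sc _ X.hs₀ t ht, sc _ X.hs₀ t' ht', sc _ h0 t ht, sc _ h0 t' ht']
  unfold Pr.nm
  linarith

/-- relative growth -/
noncomputable def Rr (ξ : 𝕜) (s : ℝ) (n : ℕ) (v w : 𝕜 × 𝕜) : ℝ :=
  Real.log ((X.p (n + 1)).nm ξ s v) - Real.log ((X.p n).nm ξ s v) - (Real.log ((X.p (n + 1)).nm ξ s w) - Real.log ((X.p n).nm ξ s w))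

theorem Rr_leaf {ξ : 𝕜} (hξ : ‖ξ - X.a₀‖ ≤ X.s₀) (h0 : 0 < X.rad ξ) (n : ℕ) {v w : 𝕜 × 𝕜} (hv : v ≠ 0) (hw : w ≠ 0) :
    X.Rr ξ (X.rad ξ) n v w ≤ X.Rr ξ X.s₀ n v w + 2 * X.y.deg * (Real.log X.s₀ - Real.log (X.rad ξ)) := by
  have h1 := X.leaf_diff hξ h0 (n + 1) hw hv
  have h2 := X.leaf_diff hξ h0 n hv hw
  unfold Rr
  linarith

theorem periodic : ∃ n₁ k : ℕ, 0 < k ∧ ∀ m ≥ n₁, Rel (GN X.a₀ X.s₀) (X.α (m + k)) (X.α m) := by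
  have hN := GN_nabs X.a₀ X.hs₀
  obtain ⟨n₁, _, h1⟩ := X.exists_later X.top 0
  obtain ⟨n₂, h12, h2⟩ := X.exists_later X.top n₁
  refine ⟨n₁, n₂ - n₁, by omega, fun m hm => ?_⟩
  have h : Rel (GN X.a₀ X.s₀) (X.α n₂) (X.α n₁) := Rel.trans hN h2 (Rel.symm hN h1)
  have e1 : m + (n₂ - n₁) = (m - n₁) + n₂ := by omega
  have e2 : m = (m - n₁) + n₁ := by omega
  rw [e1, X.α_add]
  conv_rhs => rw [e2, X.α_add]
  exact Rel.ev hN h (X.f.itr_NC _)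

theorem nm_rel {m m' : ℕ} (h : Rel (GN X.a₀ X.s₀) (X.α m') (X.α m)) : ∃ κ : ℝ, 0 < κ ∧
    ∀ v, (X.p m').nm X.a₀ X.s₀ v = κ * (X.p m).nm X.a₀ X.s₀ v := by
  have hN := GN_nabs X.a₀ X.hs₀
  have p1 := gn_pos X.a₀ X.hs₀ (X.p m').hB
  have p2 := gn_pos X.a₀ X.hs₀ (X.p m).hB
  refine ⟨gn X.a₀ X.s₀ (X.p m').B / gn X.a₀ X.s₀ (X.p m).B, by positivity, fun v => ?_⟩
  by_cases hv : v = 0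
  · subst hv; simp [Pr.nm, Pr.l_zero]
  obtain ⟨t, q, ht, rfl⟩ := exists_hc hv
  rw [Pr.nm_smul _ _ X.hs₀, Pr.nm_smul _ _ X.hs₀]
  suffices (X.p m').nm X.a₀ X.s₀ (hc q) = gn X.a₀ X.s₀ (X.p m').B / gn X.a₀ X.s₀ (X.p m).B * (X.p m).nm X.a₀ X.s₀ (hc q) by
    rw [this]; ring
  unfold Pr.nm
  induction q using OnePoint.rec with
  | infty =>
    rw [Pr.l, Pr.l, lin_infty, lin_infty, gn_neg _ X.hs₀, gn_neg _ X.hs₀]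
    field_simp
  | coe c =>
    rw [Pr.l_coe, Pr.l_coe]
    have : GN X.a₀ X.s₀ ((X.p m').rat - RatFunc.C c) = GN X.a₀ X.s₀ ((X.p m).rat - RatFunc.C c) := Rel.eq hN h c
    rw [Pr.GN_rat _ _ X.hs₀, Pr.GN_rat _ _ X.hs₀, div_eq_div_iff p1.ne' p2.ne'] at this
    field_simp
    linarith

theorem Rr_top_bound : ∃ n₁, ∃ M : ℝ, ∀ n ≥ n₁, ∀ v w : 𝕜 × 𝕜, v ≠ 0 → w ≠ 0 → X.Rr X.a₀ X.s₀ n v w ≤ M := by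
  obtain ⟨n₁, k, hk, hper⟩ := X.periodic
  have per : ∀ n ≥ n₁, ∀ v w : 𝕜 × 𝕜, v ≠ 0 → w ≠ 0 → X.Rr X.a₀ X.s₀ (n + k) v w = X.Rr X.a₀ X.s₀ n v w := by
    intro n hn v w hv hw
    obtain ⟨κ, hκ, e⟩ := X.nm_rel (hper n hn)
    obtain ⟨κ', hκ', e'⟩ := X.nm_rel (hper (n + 1) (by omega))
    unfold Rr
    rw [show n + k + 1 = n + 1 + k by omega, e, e, e', e',
      Real.log_mul hκ.ne' ((X.p n).nm_pos _ X.hs₀ hv).ne', Real.log_mul hκ.ne' ((X.p n).nm_pos _ X.hs₀ hw).ne',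
      Real.log_mul hκ'.ne' ((X.p (n + 1)).nm_pos _ X.hs₀ hv).ne', Real.log_mul hκ'.ne' ((X.p (n + 1)).nm_pos _ X.hs₀ hw).ne']
    ring
  have one : ∀ n, ∃ M : ℝ, ∀ v w : 𝕜 × 𝕜, v ≠ 0 → w ≠ 0 → X.Rr X.a₀ X.s₀ n v w ≤ M := by
    intro n
    obtain ⟨M1, h1⟩ := (X.p n).nm_bound X.a₀ X.hs₀
    obtain ⟨M2, h2⟩ := (X.p (n + 1)).nm_bound X.a₀ X.hs₀
    refine ⟨2 * M1 + 2 * M2, fun v w hv hw => ?_⟩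
    have a1 := abs_le.1 (h1 v hv)
    have a2 := abs_le.1 (h1 w hw)
    have a3 := abs_le.1 (h2 v hv)
    have a4 := abs_le.1 (h2 w hw)
    unfold Rr
    linarith [a1.1, a1.2, a2.1, a2.2, a3.1, a3.2, a4.1, a4.2]
  choose M hM using one
  refine ⟨n₁, ∑ i ∈ Finset.range (n₁ + k), |M i|, fun n hn v w hv hw => ?_⟩
  induction n using Nat.strong_induction_on with
  | _ n ih =>
    by_cases h : n < n₁ + k
    · refine (hM n v w hv hw).trans ((le_abs_self _).trans ?_)
      exact Finset.single_le_sum (f := fun i => |M i|) (fun i _ => abs_nonneg _) (Finset.mem_range.2 h)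
    · have := per (n - k) (by omega) v w hv hw
      rw [Nat.sub_add_cancel (by omega)] at this
      rw [this]
      exact ih (n - k) (by omega) (by omega)

theorem total_good {ξ : 𝕜} (hd : 1 < X.f.deg) (hξ : ‖ξ - X.a₀‖ ≤ X.s₀) (h0 : 0 < X.rad ξ) (hK : ∃ z : 𝕜, ‖z‖ = X.rad ξ)
    {n₀ : ℕ} (ht : ∀ n ≥ n₀, ¬ X.NT ξ n) : GoodNorm X.f := by
  obtain ⟨n₁, M, hM⟩ := X.Rr_top_bound
  set n₂ := max n₀ n₁
  set r := X.rad ξ with hr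
  have tot : ∀ n ≥ n₂, ∃ Λ : ℝ, 0 < Λ ∧ ∀ v, v ≠ 0 → (X.p (n + 1)).nm ξ r (X.f.val v) = Λ * (X.p n).nm ξ r v ^ X.f.deg := by
    intro n hn
    obtain ⟨u, w, h⟩ := (X.p n).nm_orth ξ h0 hK
    obtain ⟨u', w', h'⟩ := (X.p (n + 1)).nm_orth ξ h0 hK
    refine total_step X.f (X.p n) ξ h0 h h' ?_
    have := ht n (le_trans (le_max_left _ _) hn)
    unfold NT at this
    push Not at this
    exact this
  have bd : ∃ M' : ℝ, ∀ n ≥ n₂, ∀ v w : 𝕜 × 𝕜, v ≠ 0 → w ≠ 0 → X.Rr ξ r n v w ≤ M' := by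
    refine ⟨M + 2 * X.y.deg * (Real.log X.s₀ - Real.log (X.rad ξ)), fun n hn v w hv hw => ?_⟩
    have h1 := X.Rr_leaf hξ h0 n hv hw
    have h2 := hM n (le_trans (le_max_right _ _) hn) v w hv hw
    have h3 : X.Rr ξ X.s₀ n v w = X.Rr X.a₀ X.s₀ n v w := by
      unfold Rr Pr.nm
      rw [gn_center X.hs₀ hξ, gn_center X.hs₀ hξ, gn_center X.hs₀ hξ, gn_center X.hs₀ hξ]
    linarith
  obtain ⟨M', hM'⟩ := bd
  have step : ∀ n ≥ n₂, ∀ v w : 𝕜 × 𝕜, v ≠ 0 → w ≠ 0 → X.Rr ξ r (n + 1) (X.f.val v) (X.f.val w) = X.f.deg * X.Rr ξ r n v w := by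
    intro n hn v w hv hw
    obtain ⟨Λ, hΛ, e⟩ := tot n hn
    obtain ⟨Λ', hΛ', e'⟩ := tot (n + 1) (by omega)
    unfold Rr
    have p1 := (X.p n).nm_pos ξ h0 hv
    have p2 := (X.p n).nm_pos ξ h0 hw
    have p3 := (X.p (n + 1)).nm_pos ξ h0 hv
    have p4 := (X.p (n + 1)).nm_pos ξ h0 hw
    rw [e v hv, e w hw, e' v hv, e' w hw, Real.log_mul hΛ.ne' (pow_pos p1 _).ne', Real.log_mul hΛ.ne' (pow_pos p2 _).ne',
      Real.log_mul hΛ'.ne' (pow_pos p3 _).ne', Real.log_mul hΛ'.ne' (pow_pos p4 _).ne', Real.log_pow, Real.log_pow, Real.log_pow, Real.log_pow]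
    ring
  have it : ∀ j : ℕ, ∀ n ≥ n₂, ∀ v w : 𝕜 × 𝕜, v ≠ 0 → w ≠ 0 → X.f.deg ^ j * X.Rr ξ r n v w ≤ M' := by
    intro j
    induction j with
    | zero => intro n hn v w hv hw; simpa using hM' n hn v w hv hw
    | succ j ih =>
      intro n hn v w hv hw
      have := ih (n + 1) (by omega) _ _ (X.f.val_ne_zero hv) (X.f.val_ne_zero hw)
      rw [step n hn v w hv hw] at this
      rw [pow_succ]; linarith
  have hd' : (1 : ℝ) < X.f.deg := by exact_mod_cast hd
  have le0 : ∀ v w : 𝕜 × 𝕜, v ≠ 0 → w ≠ 0 → X.Rr ξ r n₂ v w ≤ 0 := by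
    intro v w hv hw
    by_contra hcon
    push Not at hcon
    obtain ⟨j, hj⟩ := ((tendsto_pow_atTop_atTop_of_one_lt hd').eventually_gt_atTop (M' / X.Rr ξ r n₂ v w)).exists
    rw [div_lt_iff₀ hcon] at hj
    linarith [it j n₂ le_rfl v w hv hw]
  obtain ⟨u, w, h⟩ := (X.p n₂).nm_orth ξ h0 hK
  obtain ⟨Λ, hΛ, e⟩ := tot n₂ le_rfl
  refine ⟨(X.p n₂).nm ξ r, u, w, h, ?_⟩
  have ne : ((1, 0) : 𝕜 × 𝕜) ≠ 0 := by simp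
  set lam := (X.p (n₂ + 1)).nm ξ r (1, 0) / (X.p n₂).nm ξ r (1, 0)
  have hlam : 0 < lam := div_pos ((X.p _).nm_pos ξ h0 ne) ((X.p _).nm_pos ξ h0 ne)
  have hprop : ∀ v : 𝕜 × 𝕜, v ≠ 0 → (X.p (n₂ + 1)).nm ξ r v = lam * (X.p n₂).nm ξ r v := by
    intro v hv
    have h1 := le0 v (1, 0) hv ne
    have h2 := le0 (1, 0) v ne hv
    unfold Rr at h1 h2
    have p1 := (X.p n₂).nm_pos ξ h0 hv
    have p3 := (X.p (n₂ + 1)).nm_pos ξ h0 hv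
    apply Real.log_injOn_pos (Set.mem_Ioi.2 p3) (Set.mem_Ioi.2 (mul_pos hlam p1))
    rw [Real.log_mul hlam.ne' p1.ne', Real.log_div ((X.p _).nm_pos ξ h0 ne).ne' ((X.p _).nm_pos ξ h0 ne).ne']
    linarith
  refine ⟨Λ / lam, by positivity, fun v hv => ?_⟩
  have := e v hv
  rw [hprop _ (X.f.val_ne_zero hv)] at this
  field_simp
  linarith

theorem loss_irr {ξ : 𝕜} (hξ : ‖ξ - X.a₀‖ ≤ X.s₀) (hK : ¬ ∃ z : 𝕜, ‖z‖ = X.rad ξ) (n : ℕ) : X.Loss ξ n X.y.deg := by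
  have hop : op ξ (X.rad ξ) = cl ξ (X.rad ξ) := by
    funext z
    apply propext
    constructor
    · exact fun h => le_of_lt h
    · exact fun h => lt_of_le_of_ne h fun h' => hK ⟨_, h'⟩
  set F : OnePoint 𝕜 → ℕ := fun q => (X.p n).Z (cl ξ (X.rad ξ)) q
  obtain ⟨q0, hq0⟩ : ∃ q0, ∀ q, F q0 ≤ F q := ⟨Function.argmin F, fun q => Function.argmin_le F q⟩
  refine ⟨{ξ}, fun _ => F q0, ?_, ?_, ?_, fun q => ?_⟩
  · simpa using X.rad_nonneg
  · intro a ha a' ha' hne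
    rw [Finset.mem_singleton] at ha ha'
    exact absurd (ha.trans ha'.symm) hne
  · intro a ha q
    rw [Finset.mem_singleton] at ha
    subst ha
    rw [hop]; exact hq0 q
  · simp only [Finset.sum_singleton]
    exact_mod_cast X.osc_leaf hξ n q q0

theorem loss_all (hd : 1 < X.f.deg) (hG : ¬ GoodNorm X.f) {ξ : 𝕜} (hξ : ‖ξ - X.a₀‖ ≤ X.s₀) (h0 : 0 < X.rad ξ)
    {ε : ℝ} (hε : 0 < ε) : ∃ N, ∀ n ≥ N, X.Loss ξ n (ε * X.f.deg ^ n) := by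
  by_cases hK : ∃ z : 𝕜, ‖z‖ = X.rad ξ
  · apply X.loss_small hd hξ h0 _ hε
    by_contra hcon
    push Not at hcon
    obtain ⟨N, hN⟩ := hcon
    exact hG (X.total_good hd hξ h0 hK hN)
  · have hd' : (1 : ℝ) < X.f.deg := by exact_mod_cast hd
    obtain ⟨N, hN⟩ := eventually_atTop.1 ((tendsto_pow_atTop_atTop_of_one_lt hd').eventually_ge_atTop (X.y.deg / ε))
    refine ⟨N, fun n hn => (X.loss_irr hξ hK n).mono ?_⟩
    have := hN n hn
    rw [div_le_iff₀ hε] at this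
    linarith

end Ctx
end Loss
end EQ

/-! ## The final count -/
namespace EQ

section Final
variable {𝕜 : Type*} [NontriviallyNormedField 𝕜] [IsUltrametricDist 𝕜] [IsAlgClosed 𝕜]

namespace Ctx
variable (X : Ctx 𝕜)

theorem unc_later {M : ℕ} (hM : Rel (GN X.a₀ X.s₀) (X.α M) X.β) (k : ℕ) (c : OnePoint 𝕜) :
    (X.p (M + k)).Z (fun x => ‖x - X.a₀‖ ≤ X.s₀ ∧ (X.p M).pf x (X.rad x)) c ≤ X.f.deg ^ k * (2 * X.y.deg * X.y.deg) := by
  obtain ⟨m, hm, h⟩ := Pr.Z_it X.f X.x M k c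
  have := h (fun x => ‖x - X.a₀‖ ≤ X.s₀ ∧ (X.p M).pf x (X.rad x))
  show (Pr.it X.f X.x (M + k)).Z _ c ≤ _
  rw [this, ← hm]
  have hb : ∀ q ∈ m, (Pr.it X.f X.x M).Z (fun x => ‖x - X.a₀‖ ≤ X.s₀ ∧ (X.p M).pf x (X.rad x)) q ≤ 2 * X.y.deg * X.y.deg := by
    intro q _
    induction q using OnePoint.rec with
    | coe c => exact X.unc_count hM c
    | infty =>
      have hne := (Pr.it X.f X.x M).l_ne_zero (Pr.hc_ne_zero OnePoint.infty)
      by_contra hcon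
      push Not at hcon
      obtain ⟨z, h0, hp⟩ := (cnt_pos hne).1 (lt_of_le_of_lt (Nat.zero_le _) hcon)
      have h1 := hp.2 z (by rw [sub_self, norm_zero]; exact X.rad_nonneg)
      apply h1
      have h2 : (lin (hc OnePoint.infty) (Pr.it X.f X.x M).A (Pr.it X.f X.x M).B).eval z = 0 := h0
      rw [lin_infty] at h2
      simpa using h2
  have := Multiset.sum_le_card_nsmul (m.map fun q => (Pr.it X.f X.x M).Z (fun x => ‖x - X.a₀‖ ≤ X.s₀ ∧ (X.p M).pf x (X.rad x)) q)
    (2 * X.y.deg * X.y.deg) (by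
      intro z hz
      obtain ⟨q, hq, rfl⟩ := Multiset.mem_map.1 hz
      exact hb q hq)
  simpa using this

/-- the weight -/
noncomputable def wt (ξ₁ r : 𝕜) : ℝ := Real.log (max ‖ξ₁ - r‖ X.s₀) - Real.log (max ‖ξ₁ - r‖ (X.rad ξ₁))

theorem wt_nonneg {ξ₁ : 𝕜} (h : ‖ξ₁ - X.a₀‖ ≤ X.s₀) (h0 : 0 < X.rad ξ₁) (r : 𝕜) : 0 ≤ X.wt ξ₁ r :=
  sub_nonneg.2 (Real.log_le_log (lt_max_of_lt_right h0) (max_le_max le_rfl (X.rad_lt h).le))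

theorem wt_le {ξ₁ : 𝕜} (h : ‖ξ₁ - X.a₀‖ ≤ X.s₀) (h0 : 0 < X.rad ξ₁) (r : 𝕜) :
    X.wt ξ₁ r ≤ Real.log X.s₀ - Real.log (X.rad ξ₁) := by
  unfold wt
  have hl := X.rad_lt h
  rcases le_total ‖ξ₁ - r‖ (X.rad ξ₁) with h1 | h1
  · rw [max_eq_right h1, max_eq_right (h1.trans hl.le)]
  · rw [max_eq_left h1]
    have := Real.log_le_log h0 h1
    rcases le_total ‖ξ₁ - r‖ X.s₀ with h2 | h2
    · rw [max_eq_right h2]; linarith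
    · rw [max_eq_left h2]
      have := Real.log_le_log h0 hl.le
      linarith

theorem wt_out {ξ₁ r : 𝕜} (h : ‖ξ₁ - X.a₀‖ ≤ X.s₀) (hr : ¬ ‖r - X.a₀‖ ≤ X.s₀) : X.wt ξ₁ r = 0 := by
  have : X.s₀ ≤ ‖ξ₁ - r‖ := by
    by_contra hcon
    push Not at hcon
    exact hr ((dist_tri r ξ₁ X.a₀).trans (max_le (by rw [norm_sub_rev]; exact hcon.le) h))
  unfold wt
  rw [max_eq_left this, max_eq_left ((X.rad_lt h).le.trans this), sub_self]

theorem wt_const {ξ₁ ξ r : 𝕜} (h : ‖ξ₁ - X.a₀‖ ≤ X.s₀) (hξ : ‖ξ - X.a₀‖ ≤ X.s₀) (hr : ‖ξ - r‖ ≤ X.rad ξ) :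
    X.wt ξ₁ r = X.wt ξ₁ ξ := by
  have hr' : ‖r - X.a₀‖ ≤ X.s₀ := X.mem_center hξ (hr.trans (X.rad_lt hξ).le)
  have d0 : ∀ z, ‖z - X.a₀‖ ≤ X.s₀ → ‖ξ₁ - z‖ ≤ X.s₀ := fun z hz =>
    (dist_tri ξ₁ X.a₀ z).trans (max_le h (by rwa [norm_sub_rev]))
  unfold wt
  rw [max_eq_right (d0 _ hr'), max_eq_right (d0 _ hξ)]
  congr 2
  rcases le_or_gt ‖ξ₁ - ξ‖ (X.rad ξ) with h1 | h1
  · have e := X.rad_eq hξ (by rw [norm_sub_rev]; exact h1 : ‖ξ - ξ₁‖ ≤ X.rad ξ)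
    rw [e, max_eq_right h1, max_eq_right ((dist_tri ξ₁ ξ r).trans (max_le h1 hr))]
  · have : ‖ξ₁ - r‖ = ‖ξ₁ - ξ‖ := by
      apply le_antisymm
      · exact (dist_tri ξ₁ ξ r).trans (max_le le_rfl (hr.trans h1.le))
      · have := dist_tri ξ₁ r ξ
        rcases le_max_iff.1 this with h2 | h2
        · exact h2
        · rw [norm_sub_rev] at hr
          exact absurd (h2.trans hr) (not_le.2 h1)
    rw [this]

theorem sum_map_ind (m : Multiset 𝕜) (T : Finset 𝕜) (w : 𝕜 → ℝ) (q : 𝕜 → 𝕜 → Prop) :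
    (m.map fun r => ∑ ξ ∈ T, if q ξ r then w ξ else 0).sum = ∑ ξ ∈ T, (m.countP (q ξ) : ℝ) * w ξ := by
  induction T using Finset.induction_on with
  | empty => simp
  | insert a T ha ih => simp only [Finset.sum_insert ha]; rw [Multiset.sum_map_add, ih, sum_ite_countP]

/-- comparing the weights of two polynomials -/
theorem wt_compare {ξ₁ : 𝕜} (h : ‖ξ₁ - X.a₀‖ ≤ X.s₀) (h0 : 0 < X.rad ξ₁) (L S : 𝕜[X]) (T : Finset 𝕜)
    (U : 𝕜 → Prop) (hT : ∀ ξ ∈ T, ‖ξ - X.a₀‖ ≤ X.s₀)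
    (hd : ∀ x ∈ T, ∀ x' ∈ T, x ≠ x' → X.rad x < ‖x - x'‖)
    (hcov : ∀ r ∈ L.roots, ‖r - X.a₀‖ ≤ X.s₀ → U r ∨ ∃ ξ ∈ T, ‖ξ - r‖ ≤ X.rad ξ) {u b : ℝ} (hu : (cnt U L : ℝ) ≤ u) (hb0 : 0 ≤ b)
    (hb : ∀ ξ ∈ T, (cnt (cl ξ (X.rad ξ)) L : ℝ) ≤ cnt (cl ξ (X.rad ξ)) S + b) :
    (L.roots.map (X.wt ξ₁)).sum ≤ (S.roots.map (X.wt ξ₁)).sum + (Real.log X.s₀ - Real.log (X.rad ξ₁)) * (u + T.card * b) := by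
  set Φ := Real.log X.s₀ - Real.log (X.rad ξ₁)
  have hΦ : 0 ≤ Φ := (X.wt_nonneg h h0 ξ₁).trans (X.wt_le h h0 ξ₁)
  have wn := X.wt_nonneg h h0
  have s1 : (L.roots.map (X.wt ξ₁)).sum ≤ (L.roots.map fun r => (if U r then Φ else 0) +
      ∑ ξ ∈ T, if cl ξ (X.rad ξ) r then X.wt ξ₁ ξ else 0).sum := by
    apply Multiset.sum_map_le_sum_map
    intro r hr
    have n1 : 0 ≤ ∑ ξ ∈ T, if cl ξ (X.rad ξ) r then X.wt ξ₁ ξ else 0 :=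
      Finset.sum_nonneg fun ξ _ => by split_ifs; exacts [wn _, le_rfl]
    have n2 : 0 ≤ (if U r then Φ else 0) := by split_ifs; exacts [hΦ, le_rfl]
    by_cases hr0 : ‖r - X.a₀‖ ≤ X.s₀
    · rcases hcov r hr hr0 with hU | ⟨ξ, hξ, hc⟩
      · rw [if_pos hU]; linarith [X.wt_le h h0 r]
      · have := Finset.single_le_sum (s := T) (f := fun ξ => if cl ξ (X.rad ξ) r then X.wt ξ₁ ξ else 0)
          (fun ξ _ => by split_ifs; exacts [wn _, le_rfl]) hξ
        rw [if_pos (show cl ξ (X.rad ξ) r from hc)] at this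
        rw [X.wt_const h (hT ξ hξ) hc]; linarith
    · rw [X.wt_out h hr0]; linarith
  have s2 : (S.roots.map fun r => ∑ ξ ∈ T, if cl ξ (X.rad ξ) r then X.wt ξ₁ ξ else 0).sum ≤ (S.roots.map (X.wt ξ₁)).sum := by
    apply Multiset.sum_map_le_sum_map
    intro r hr
    by_cases hex : ∃ ξ ∈ T, cl ξ (X.rad ξ) r
    · obtain ⟨ξ, hξ, hc⟩ := hex
      rw [Finset.sum_eq_single_of_mem ξ hξ, if_pos hc]
      · rw [X.wt_const h (hT ξ hξ) hc]
      · intro ξ' hξ' hne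
        rw [if_neg]
        intro hc'
        have c1 : ‖ξ - r‖ ≤ X.rad ξ := hc
        have c2 : ‖ξ' - r‖ ≤ X.rad ξ' := hc'
        have d1 := hd ξ hξ ξ' hξ' hne.symm
        have d2 := hd ξ' hξ' ξ hξ hne
        rw [norm_sub_rev] at d2
        have := dist_tri ξ r ξ'
        rw [norm_sub_rev r ξ'] at this
        rcases le_max_iff.1 this with h | h <;> linarith
    · rw [Finset.sum_eq_zero]
      · exact wn r
      · intro ξ hξ
        rw [if_neg fun hc => hex ⟨ξ, hξ, hc⟩]
  rw [Multiset.sum_map_add, sum_map_ind, sum_ite_countP] at s1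
  rw [sum_map_ind] at s2
  have s3 : ∑ ξ ∈ T, (L.roots.countP (cl ξ (X.rad ξ)) : ℝ) * X.wt ξ₁ ξ ≤
      ∑ ξ ∈ T, ((S.roots.countP (cl ξ (X.rad ξ)) : ℝ) * X.wt ξ₁ ξ + b * Φ) := by
    apply Finset.sum_le_sum
    intro ξ hξ
    have h1 : (L.roots.countP (cl ξ (X.rad ξ)) : ℝ) ≤ S.roots.countP (cl ξ (X.rad ξ)) + b := hb ξ hξ
    have h2 := mul_le_mul_of_nonneg_right h1 (wn ξ)
    have h3 := mul_le_mul_of_nonneg_left (X.wt_le h h0 ξ) hb0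
    linarith
  rw [Finset.sum_add_distrib, Finset.sum_const, nsmul_eq_mul] at s3
  have s4 : (L.roots.countP U : ℝ) * Φ ≤ u * Φ := mul_le_mul_of_nonneg_right hu hΦ
  linarith

theorem core_leaf (hd : 1 < X.f.deg) (hG : ¬ GoodNorm X.f) {ξ₁ : 𝕜} (h : ‖ξ₁ - X.a₀‖ ≤ X.s₀) (h0 : 0 < X.rad ξ₁)
    {η : ℝ} (hη : 0 < η) : ∀ᶠ n in (X.𝒰 : Filter ℕ), -η * X.f.deg ^ n < Real.log (GN X.a₀ X.s₀ (X.α n - X.β)) := by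
  set Φ := Real.log X.s₀ - Real.log (X.rad ξ₁) with hΦd
  have hΦ : 0 ≤ Φ := (X.wt_nonneg h h0 ξ₁).trans (X.wt_le h h0 ξ₁)
  have hd' : (1 : ℝ) < X.f.deg := by exact_mod_cast hd
  have hd0 : (0 : ℝ) < X.f.deg := by linarith
  set e : ℝ := 2 * X.y.deg * X.y.deg with he
  -- choose M
  have big := tendsto_pow_atTop_atTop_of_one_lt hd'
  have hM0 : ∀ᶠ n in (X.𝒰 : Filter ℕ), 4 * Φ * e / η ≤ (X.f.deg : ℝ) ^ n := X.le_top (big.eventually_ge_atTop (4 * Φ * e / η))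
  obtain ⟨M, hM1, hM⟩ := (hM0.and X.top).exists
  rw [div_le_iff₀ hη] at hM1
  -- leaves
  set U : Finset 𝕜 := (X.p M).B.roots.toFinset.filter (fun z => ‖z - X.a₀‖ ≤ X.s₀ ∧ 0 < X.rad z) with hUd
  obtain ⟨T, hTU, hdis, hcov⟩ := exists_disjoint_cover X.rad U
  have hT : ∀ ξ ∈ T, ‖ξ - X.a₀‖ ≤ X.s₀ ∧ 0 < X.rad ξ := fun ξ hξ => (Finset.mem_filter.1 (hTU hξ)).2
  set ε := η / (4 * (Φ * T.card + 1)) with hε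
  have hε0 : 0 < ε := by positivity
  have hεb : Φ * (T.card * ε) ≤ η / 4 := by
    rw [hε, ← mul_assoc, mul_div_assoc', div_le_div_iff₀ (by positivity) (by norm_num)]
    nlinarith
  have e1 : ∀ᶠ n in (X.𝒰 : Filter ℕ), ∀ ξ ∈ T, X.Loss ξ n (ε * X.f.deg ^ n) ∧ ¬ Rel (GN ξ (X.rad ξ)) (X.α n) X.β := by
    rw [Filter.eventually_all_finset]
    intro ξ hξ
    obtain ⟨N, hN⟩ := X.loss_all hd hG (hT ξ hξ).1 (hT ξ hξ).2 hε0
    have hN' : ∀ᶠ n in (X.𝒰 : Filter ℕ), X.Loss ξ n (ε * X.f.deg ^ n) := X.le_top ((eventually_ge_atTop N).mono hN)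
    refine hN'.and ?_
    exact Ultrafilter.eventually_not.2 (X.not_V_rad (hT ξ hξ).1 (hT ξ hξ).2)
  have e2 : ∀ᶠ n in (X.𝒰 : Filter ℕ), ¬ Rel (GN ξ₁ (X.rad ξ₁)) (X.α n) X.β :=
    Ultrafilter.eventually_not.2 (X.not_V_rad h h0)
  have hN0 := GN_nabs (𝕜 := 𝕜) X.a₀ X.hs₀
  have hN1 := GN_nabs (𝕜 := 𝕜) ξ₁ h0
  set δ₁ := dm (GN ξ₁ (X.rad ξ₁)) X.β
  set δ₀ := dm (GN X.a₀ X.s₀) X.β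
  have hδ₁ : 0 < δ₁ := dm_pos hN1 X.β_NC
  have hδ₀ : 0 < δ₀ := dm_pos hN0 X.β_NC
  set m₁ := max (GN ξ₁ (X.rad ξ₁) X.β) 1
  have hm₁ : 0 < m₁ := lt_max_of_lt_right one_pos
  set Cc := max 1 (m₁ / δ₁)
  have hCc : 0 < Cc := lt_max_of_lt_left one_pos
  set yb := Real.log (gn X.a₀ X.s₀ X.y.B) - Real.log (gn ξ₁ (X.rad ξ₁) X.y.B)
  have e3 : ∀ᶠ n in (X.𝒰 : Filter ℕ), (Real.log Cc - Real.log δ₀ + yb) / (η / 4) ≤ (X.f.deg : ℝ) ^ n :=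
    X.le_top (big.eventually_ge_atTop _)
  filter_upwards [e1, e2, e3, X.top, X.le_top (eventually_ge_atTop M)] with n h1 h2 h3 h4 h5
  rw [div_le_iff₀ (by positivity)] at h3
  obtain ⟨k, rfl⟩ := Nat.exists_eq_add_of_le h5
  set x := X.p (M + k) with hx
  -- choose c
  obtain ⟨c, hc1, hc2⟩ : ∃ c : 𝕜, ‖c‖ ≤ 1 ∧ ∀ z ∈ (X.p M).B.roots, (x.A - C c * x.B).eval z ≠ 0 := by
    have hinf : (Metric.closedBall (0 : 𝕜) 1).Infinite := by
      have := infinite_of_mem_nhds (0 : 𝕜) (Metric.closedBall_mem_nhds (0 : 𝕜) one_pos)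
      exact this
    obtain ⟨c, hc, hc'⟩ := hinf.exists_notMem_finset ((X.p M).B.roots.toFinset.image fun z => x.A.eval z / x.B.eval z)
    refine ⟨c, by simpa using hc, fun z hz h0 => hc' ?_⟩
    have hBz : x.B.eval z ≠ 0 := by
      intro hb
      simp [hb] at h0
      obtain ⟨u, w, huw⟩ := x.cop
      have := congrArg (eval z) huw
      simp [h0, hb] at this
    refine Finset.mem_image.2 ⟨z, Multiset.mem_toFinset.2 hz, ?_⟩
    rw [div_eq_iff hBz]
    simpa [sub_eq_zero] using h0
  set L := x.A - C c * x.B with hL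
  have hL0 : L ≠ 0 := x.l_coe_ne c
  set S := x.A * X.y.B - X.y.A * x.B with hS
  have hne : X.α (M + k) - X.β ≠ 0 := by
    intro h0
    rw [sub_eq_zero] at h0
    apply h2; rw [h0]; exact Rel.refl hN1 X.β_NC
  have gd : ∀ (a : 𝕜) {s : ℝ}, 0 < s → GN a s (X.α (M + k) - X.β) = gn a s S / (gn a s x.B * gn a s X.y.B) :=
    fun a s hs => GN_diff x X.y a hs
  have hS0 : S ≠ 0 := by
    intro h0
    apply hne
    apply hN0.eq_zero
    rw [gd _ X.hs₀, h0]; simp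
  have hcmp := X.wt_compare h h0 L S T (fun z => ‖z - X.a₀‖ ≤ X.s₀ ∧ (X.p M).pf z (X.rad z)) (fun ξ hξ => (hT ξ hξ).1) hdis
    (u := X.f.deg ^ k * e) (b := ε * X.f.deg ^ (M + k)) (by
      intro r hr hr0
      by_cases hp : (X.p M).pf r (X.rad r)
      · exact Or.inl ⟨hr0, hp⟩
      right
      rw [Pr.pf] at hp
      push Not at hp
      obtain ⟨ρ, hρ, hBρ⟩ := hp
      have hρr : ρ ∈ (X.p M).B.roots := (Polynomial.mem_roots (X.p M).hB).2 hBρ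
      have hre := X.rad_eq hr0 hρ
      rcases (X.rad_nonneg (ξ := r)).eq_or_lt with hz | hpos
      · rw [← hz] at hρ
        have : r = ρ := sub_eq_zero.1 (norm_le_zero_iff.1 hρ)
        exact absurd ((Polynomial.mem_roots hL0).1 hr) (by rw [this]; exact hc2 ρ hρr)
      · have hρU : ρ ∈ U := by
          rw [hUd, Finset.mem_filter]
          refine ⟨Multiset.mem_toFinset.2 hρr, X.mem_center hr0 (hρ.trans (X.rad_lt hr0).le), by rw [hre]; exact hpos⟩
        obtain ⟨ξ, hξ, hh⟩ := hcov ρ hρU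
        refine ⟨ξ, hξ, ?_⟩
        rcases hh with ⟨-, hh⟩ | rfl
        · have hr2 := X.rad_eq (hT ξ hξ).1 hh
          refine (dist_tri ξ ρ r).trans (max_le hh ?_)
          rw [norm_sub_rev, ← hr2, hre]; exact hρ
        · rw [norm_sub_rev, hre]; exact hρ) (by
      have := X.unc_later hM k (c : OnePoint 𝕜)
      unfold Pr.Z at this
      rw [Pr.l_coe] at this
      rw [he]
      exact_mod_cast this) (by positivity) (by
      intro ξ hξ
      have := X.loss_zeros (hT ξ hξ).2 (h1 ξ hξ).1 (h1 ξ hξ).2 (c : OnePoint 𝕜)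
      unfold Pr.Z at this
      rw [Pr.l_coe] at this
      exact this)
  have sL : Real.log (gn X.a₀ X.s₀ L) - Real.log (gn ξ₁ (X.rad ξ₁) L) = (L.roots.map (X.wt ξ₁)).sum := by
    rw [← gn_center X.hs₀ h L, log_gn_sub ξ₁ h0 X.hs₀ hL0]; rfl
  have sS : Real.log (gn X.a₀ X.s₀ S) - Real.log (gn ξ₁ (X.rad ξ₁) S) = (S.roots.map (X.wt ξ₁)).sum := by
    rw [← gn_center X.hs₀ h S, log_gn_sub ξ₁ h0 X.hs₀ hS0]; rfl
  rw [← sL, ← sS] at hcmp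
  have b0 := (gn_pos X.a₀ X.hs₀ x.hB).ne'
  have b1 := (gn_pos ξ₁ h0 x.hB).ne'
  have y0 := (gn_pos X.a₀ X.hs₀ X.y.hB).ne'
  have y1 := (gn_pos ξ₁ h0 X.y.hB).ne'
  have l1 : Real.log (GN X.a₀ X.s₀ (X.α (M + k) - X.β)) = Real.log (gn X.a₀ X.s₀ S) - (Real.log (gn X.a₀ X.s₀ x.B) + Real.log (gn X.a₀ X.s₀ X.y.B)) := by
    rw [gd _ X.hs₀, Real.log_div (gn_pos _ X.hs₀ hS0).ne' (mul_ne_zero b0 y0), Real.log_mul b0 y0]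
  have l2 : Real.log (GN ξ₁ (X.rad ξ₁) (X.α (M + k) - X.β)) = Real.log (gn ξ₁ (X.rad ξ₁) S) - (Real.log (gn ξ₁ (X.rad ξ₁) x.B) + Real.log (gn ξ₁ (X.rad ξ₁) X.y.B)) := by
    rw [gd _ h0, Real.log_div (gn_pos _ h0 hS0).ne' (mul_ne_zero b1 y1), Real.log_mul b1 y1]
  have l3 := x.log_GN_rat X.a₀ X.hs₀ c
  have l4 := x.log_GN_rat ξ₁ h0 c
  have l5 : Real.log δ₀ ≤ Real.log (GN X.a₀ X.s₀ (x.rat - RatFunc.C c)) := by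
    refine Real.log_le_log hδ₀ ?_
    have := h4.eq hN0 c
    refine le_trans (dm_le hN0 _ c) this.symm.le
  have l6 : Real.log (GN ξ₁ (X.rad ξ₁) (x.rat - RatFunc.C c)) ≤ Real.log Cc + Real.log (GN ξ₁ (X.rad ξ₁) (X.α (M + k) - X.β)) := by
    have hr : δ₁ ≤ GN ξ₁ (X.rad ξ₁) (X.α (M + k) - X.β) := not_lt.1 h2
    rw [← Real.log_mul hCc.ne' (hδ₁.trans_le hr).ne']
    refine Real.log_le_log (x.GN_rat_pos ξ₁ h0 c) ?_
    refine (hN1.tri (X.α (M + k)) X.β (RatFunc.C c)).trans (max_le ?_ ?_)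
    · exact le_mul_of_one_le_left (hδ₁.le.trans hr) (le_max_left _ _)
    · have t1 : GN ξ₁ (X.rad ξ₁) (X.β - RatFunc.C c) ≤ m₁ := by
        have t2 := hN1.tri X.β 0 (RatFunc.C c)
        rw [sub_zero, zero_sub] at t2
        refine t2.trans (max_le (le_max_left _ _) ?_)
        rw [← map_neg, hN1.map_C, norm_neg]
        exact hc1.trans (le_max_right _ _)
      calc _ ≤ m₁ := t1
        _ = m₁ / δ₁ * δ₁ := by field_simp
        _ ≤ Cc * GN ξ₁ (X.rad ξ₁) (X.α (M + k) - X.β) := by gcongr; exact le_max_right _ _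
  have p1 : Φ * (X.f.deg ^ k * e) ≤ η / 4 * X.f.deg ^ (M + k) := by
    rw [pow_add]
    have := mul_le_mul_of_nonneg_right hM1 (pow_pos hd0 k).le
    nlinarith
  have p2 : Φ * (T.card * (ε * X.f.deg ^ (M + k))) ≤ η / 4 * X.f.deg ^ (M + k) := by
    have := mul_le_mul_of_nonneg_right hεb (pow_pos hd0 (M + k)).le
    nlinarith
  have p3 : 0 < η / 4 * (X.f.deg : ℝ) ^ (M + k) := by positivity
  rw [mul_add] at hcmp
  linarith

/-- the core count -/
theorem core (hd : 1 < X.f.deg) (hG : ¬ GoodNorm X.f) {η : ℝ} (hη : 0 < η)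
    (hb : ∀ᶠ n in (X.𝒰 : Filter ℕ), Real.log (GN X.a₀ X.s₀ (X.α n - X.β)) ≤ -η * X.f.deg ^ n) :
    ∀ᶠ n in (X.𝒰 : Filter ℕ), ∀ c : 𝕜, (X.p n).Z (cl X.a₀ X.s₀) (c : OnePoint 𝕜) ≤ 2 * X.y.deg * X.y.deg := by
  have hno : ∀ ξ, ‖ξ - X.a₀‖ ≤ X.s₀ → X.rad ξ = 0 := by
    intro ξ h
    rcases (X.rad_nonneg (ξ := ξ)).eq_or_lt with h0 | h0
    · exact h0.symm
    · obtain ⟨n, h1, h2⟩ := (hb.and (X.core_leaf hd hG h h0 hη)).exists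
      linarith
  filter_upwards [X.top] with n hn c
  refine le_trans (le_of_eq ?_) (X.unc_count hn c)
  apply cnt_congr
  intro r hr
  set x := X.p n
  have hr0 := (Polynomial.mem_roots (x.l_ne_zero (Pr.hc_ne_zero _))).1 hr
  rw [Pr.l_coe] at hr0
  have hr1 : (x.A - C c * x.B).eval r = 0 := hr0
  show ‖X.a₀ - r‖ ≤ X.s₀ ↔ ‖r - X.a₀‖ ≤ X.s₀ ∧ x.pf r (X.rad r)
  rw [norm_sub_rev]
  refine ⟨fun h => ⟨h, ?_⟩, fun h => h.1⟩
  intro z hz hB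
  rw [hno r h] at hz
  have : r = z := sub_eq_zero.1 (norm_le_zero_iff.1 hz)
  subst this
  simp [hB] at hr1
  obtain ⟨u, w, huw⟩ := x.cop
  have := congrArg (eval r) huw
  simp [hr1, hB] at this

end Ctx
end Final
end EQ

/-! ## The estimate for moving targets -/
namespace EQ

section Est
variable {𝕜 : Type*} [NontriviallyNormedField 𝕜] [IsUltrametricDist 𝕜] [IsAlgClosed 𝕜]

theorem Pr.rat_eq {x y : Pr 𝕜} (h : x.rat = y.rat) : ∃ k : 𝕜, k ≠ 0 ∧ x.A = C k * y.A ∧ x.B = C k * y.B := by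
  unfold Pr.rat at h
  rw [div_eq_div_iff x.hb y.hb, ← map_mul, ← map_mul] at h
  have h' := RatFunc.algebraMap_injective 𝕜 h
  have d1 : x.B ∣ y.B := x.cop.symm.dvd_of_dvd_mul_left (h' ▸ Dvd.intro_left _ rfl)
  have d2 : y.B ∣ x.B := y.cop.symm.dvd_of_dvd_mul_left (h' ▸ Dvd.intro_left _ rfl)
  obtain ⟨u, hu⟩ := associated_of_dvd_dvd d2 d1
  obtain ⟨k, hk, e⟩ := Polynomial.isUnit_iff.1 u.isUnit
  refine ⟨k, hk.ne_zero, ?_, ?_⟩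
  · rw [← hu, ← e] at h'
    have : y.B * x.A = y.B * (C k * y.A) := by linear_combination h'
    exact mul_left_cancel₀ y.hB this
  · rw [← hu, ← e, mul_comm]

theorem Pr.rat_eq_l {x y : Pr 𝕜} (h : x.rat = y.rat) : ∃ k : 𝕜, k ≠ 0 ∧ ∀ c, x.l c = C k * y.l c := by
  obtain ⟨k, hk, h1, h2⟩ := Pr.rat_eq h
  refine ⟨k, hk, fun c => ?_⟩
  unfold Pr.l lin
  rw [h1, h2]; ring

theorem Pr.rat_eq_deg {x y : Pr 𝕜} (h : x.rat = y.rat) : x.deg = y.deg := by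
  obtain ⟨k, hk, h1, h2⟩ := Pr.rat_eq h
  unfold Pr.deg
  rw [h1, h2, natDegree_C_mul hk, natDegree_C_mul hk]

theorem Pr.rat_eq_Z {x y : Pr 𝕜} (h : x.rat = y.rat) (p : 𝕜 → Prop) (q : OnePoint 𝕜) : x.Z p q = y.Z p q := by
  obtain ⟨k, hk, h1⟩ := Pr.rat_eq_l h
  unfold Pr.Z
  rw [h1, cnt_C_mul _ hk]

/-- the identity -/
noncomputable def Pr.idp : Pr 𝕜 where
  A := X
  B := 1
  cop := isCoprime_one_right
  hB := one_ne_zero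
  nc := by
    intro c hc
    rw [map_one, div_one, ← RatFunc.algebraMap_C] at hc
    exact X_ne_C c (RatFunc.algebraMap_injective 𝕜 hc)

theorem Pr.idp_rat : (Pr.idp : Pr 𝕜).rat = RatFunc.X := by
  simp [Pr.rat, Pr.idp]

theorem Pr.idp_deg : (Pr.idp : Pr 𝕜).deg = 1 := by
  simp [Pr.deg, Pr.idp]

/-- inversion -/
noncomputable def Pr.inv (a : 𝕜) : Pr 𝕜 := Pr.mob (1, 0) (a, 1) (by simp [wd])

theorem Pr.inv_A (a : 𝕜) : (Pr.inv a).A = 1 + C a * X := by simp [Pr.inv, Pr.mob]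
theorem Pr.inv_B (a : 𝕜) : (Pr.inv a).B = X := by simp [Pr.inv, Pr.mob]
theorem Pr.inv_deg (a : 𝕜) : (Pr.inv a).deg = 1 := by
  unfold Pr.deg
  rw [Pr.inv_A, Pr.inv_B, natDegree_X]
  apply max_eq_right
  refine (natDegree_add_le _ _).trans (max_le (by simp) ?_)
  exact (natDegree_C_mul_le _ _).trans (by simp)

theorem Pr.GN_inv (a : 𝕜) {s : ℝ} (hs : 0 < s) (b : 𝕜) :
    GN 0 (1 / s) ((Pr.inv a).rat - RatFunc.C b) = max ‖b - a‖ s := by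
  have hs' : 0 < 1 / s := by positivity
  rw [Pr.GN_rat _ _ hs', Pr.inv_A, Pr.inv_B]
  have e1 : gn (0 : 𝕜) (1 / s) X = 1 / s := by
    have := gn_X_sub_C (0 : 𝕜) hs' 0
    rw [C_0, sub_zero, sub_self, norm_zero, max_eq_right hs'.le] at this
    exact this
  have e2 : gn (0 : 𝕜) (1 / s) (1 + C a * X - C b * X) = max 1 (‖b - a‖ / s) := by
    by_cases hba : b = a
    · subst hba; simp
    · have hne : b - a ≠ 0 := sub_ne_zero.2 hba
      have : (1 + C a * X - C b * X : 𝕜[X]) = C (-(b - a)) * (X - C ((b - a)⁻¹)) := by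
        rw [mul_sub, ← C_mul, neg_mul, mul_inv_cancel₀ hne]
        simp; ring
      rw [this, gn_mul _ hs', gn_C, gn_X_sub_C _ hs', norm_neg, zero_sub, norm_neg, norm_inv, mul_max_of_nonneg _ _ (norm_nonneg _)]
      rw [mul_inv_cancel₀ (norm_ne_zero_iff.2 hne), mul_one_div]
  rw [e1, e2, ← max_div_div_right hs'.le, max_comm]
  congr 1 <;> field_simp

theorem Pr.GN_ev_inv (a : 𝕜) {s : ℝ} (hs : 0 < s) (R : RatFunc 𝕜) :
    GN 0 (1 / s) (ev R (Pr.inv a).rat) = GN a s R :=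
  transfer (GN_nabs 0 (by positivity)) hs (Pr.GN_inv a hs) R

theorem Pr.total (F : Pr 𝕜) (a : 𝕜) {s : ℝ} (hs : 0 < s) (c : OnePoint 𝕜) :
    F.deg ≤ F.Z (cl a s) c + (F.comp (Pr.inv a)).Z (cl 0 (1 / s)) c := by
  rw [Pr.Z_comp]
  have hle : (F.l (hc c)).natDegree ≤ F.deg := F.natDegree_l_le _
  have h1 : ∀ b : 𝕜, (Pr.inv a).Z (cl 0 (1 / s)) (b : OnePoint 𝕜) ≥ if cl a s b then 0 else 1 := by
    intro b
    split_ifs with h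
    · exact Nat.zero_le _
    · have h' : s < ‖a - b‖ := not_le.1 h
      have hne : a - b ≠ 0 := norm_pos_iff.1 (hs.trans h')
      unfold Pr.Z
      apply Nat.succ_le_of_lt
      rw [cnt_pos (Pr.l_ne_zero _ (Pr.hc_ne_zero _))]
      refine ⟨-(a - b)⁻¹, ?_, ?_⟩
      · rw [Pr.l_coe, Pr.inv_A, Pr.inv_B]
        simp; field_simp; ring
      · show ‖0 - -(a - b)⁻¹‖ ≤ 1 / s
        rw [zero_sub, neg_neg, norm_inv, one_div]
        exact inv_anti₀ hs h'.le
  have h2 : 1 ≤ (Pr.inv a).Z (cl 0 (1 / s)) OnePoint.infty := by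
    unfold Pr.Z
    apply Nat.succ_le_of_lt
    rw [cnt_pos (Pr.l_ne_zero _ (Pr.hc_ne_zero _))]
    refine ⟨0, ?_, ?_⟩
    · show (lin _ _ _).eval 0 = 0
      rw [lin_infty, Pr.inv_B]; simp
    · show ‖(0 : 𝕜) - 0‖ ≤ 1 / s
      simp [hs.le]
  unfold Pr.pull proots
  rw [Multiset.map_add, Multiset.sum_add, Multiset.map_map, Multiset.map_replicate, Multiset.sum_replicate, smul_eq_mul]
  have h3 : ∀ m : Multiset 𝕜, m.card ≤ m.countP (cl a s) + (m.map ((fun q => (Pr.inv a).Z (cl 0 (1 / s)) q) ∘ fun a : 𝕜 => (a : OnePoint 𝕜))).sum := by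
    intro m
    induction m using Multiset.induction_on with
    | empty => simp
    | cons b m ih =>
      have := h1 b
      rw [Multiset.card_cons, Multiset.countP_cons, Multiset.map_cons, Multiset.sum_cons]
      simp only [Function.comp_apply] at ih ⊢
      split_ifs at this ⊢ <;> omega
  have h4 := h3 (F.l (hc c)).roots
  have h5 : (F.l (hc c)).roots.card = (F.l (hc c)).natDegree := (IsAlgClosed.splits _).natDegree_eq_card_roots.symm
  have h6 := Nat.mul_le_mul_left (F.deg - (F.l (hc c)).natDegree) h2
  unfold Pr.Z at h4 h6 ⊢
  unfold cnt at h4 h6 ⊢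
  omega

theorem core' (f x y : Pr 𝕜) (𝒰 : Ultrafilter ℕ) (le_top : (𝒰 : Filter ℕ) ≤ atTop) (a : 𝕜) {s : ℝ} (hs : 0 < s)
    (hd : 1 < f.deg) (hG : ¬ GoodNorm f) {η : ℝ} (hη : 0 < η)
    (hb : ∀ᶠ n in (𝒰 : Filter ℕ), 0 < GN a s ((Pr.it f x n).rat - y.rat) ∧ GN a s ((Pr.it f x n).rat - y.rat) ≤ Real.exp (-η * f.deg ^ n)) :
    ∀ᶠ n in (𝒰 : Filter ℕ), ∀ c : 𝕜, (Pr.it f x n).Z (cl a s) (c : OnePoint 𝕜) ≤ 2 * y.deg * y.deg := by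
  have hd' : (1 : ℝ) < f.deg := by exact_mod_cast hd
  have big := tendsto_pow_atTop_atTop_of_one_lt hd'
  have hdm := dm_pos (GN_nabs a hs) y.rat_NC
  have hsm : Tendsto (fun n : ℕ => Real.exp (-η * (f.deg : ℝ) ^ n)) atTop (𝓝 0) := by
    refine Real.tendsto_exp_atBot.comp ?_
    exact big.const_mul_atTop_of_neg (by linarith)
  have hsm' : ∀ᶠ n in (𝒰 : Filter ℕ), Real.exp (-η * (f.deg : ℝ) ^ n) < dm (GN a s) y.rat :=
    le_top (hsm.eventually_lt_const hdm)
  let X : Ctx 𝕜 :=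
    { f := f, x := x, y := y, 𝒰 := 𝒰, le_top := le_top, a₀ := a, s₀ := s, hs₀ := hs
      top := by
        filter_upwards [hb, hsm'] with n h1 h2
        exact h1.2.trans_lt h2 }
  refine X.core hd hG hη ?_
  filter_upwards [hb] with n hn
  exact (Real.log_le_iff_le_exp hn.1).2 hn.2

theorem est (f y : Pr 𝕜) (hd : 1 < f.deg) (hG : ¬ GoodNorm f) (a : 𝕜) {s : ℝ} (hs : 0 < s) {η : ℝ} (hη : 0 < η) :
    ∀ᶠ n in atTop, Real.exp (-η * f.deg ^ n) < GN a s ((Pr.it f Pr.idp n).rat - y.rat) := by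
  by_contra hcon
  have hfr : ∃ᶠ n in atTop, GN a s ((Pr.it f Pr.idp n).rat - y.rat) ≤ Real.exp (-η * f.deg ^ n) := by
    simpa only [Filter.Frequently, not_le] using hcon
  have hdN : Tendsto (fun n : ℕ => f.deg ^ n) atTop atTop := tendsto_pow_atTop_atTop_of_one_lt hd
  have hpos : ∀ᶠ n in atTop, 0 < GN a s ((Pr.it f Pr.idp n).rat - y.rat) := by
    filter_upwards [hdN.eventually_gt_atTop y.deg] with n hn
    refine lt_of_le_of_ne (GN_nonneg a hs _) fun h0 => ?_
    have := (GN_nabs a hs).eq_zero _ h0.symm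
    have := Pr.rat_eq_deg (sub_eq_zero.1 this)
    rw [Pr.it_deg, Pr.idp_deg, mul_one] at this
    omega
  have hfr' := hfr.and_eventually hpos
  have hne := frequently_iff_neBot.1 hfr'
  let 𝒰 : Ultrafilter ℕ := @Ultrafilter.of ℕ _ hne
  have hU := @Ultrafilter.of_le ℕ _ hne
  have le_top : (𝒰 : Filter ℕ) ≤ atTop := hU.trans inf_le_left
  have hb : ∀ᶠ n in (𝒰 : Filter ℕ), 0 < GN a s ((Pr.it f Pr.idp n).rat - y.rat) ∧ GN a s ((Pr.it f Pr.idp n).rat - y.rat) ≤ Real.exp (-η * f.deg ^ n) := by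
    have := (hU.trans inf_le_right) (mem_principal_self _)
    filter_upwards [this] with n hn
    exact ⟨hn.2, hn.1⟩
  have c1 := core' f Pr.idp y 𝒰 le_top a hs hd hG hη hb
  have hrat : ∀ n, (Pr.it f (Pr.inv a) n).rat = ((Pr.it f Pr.idp n).comp (Pr.inv a)).rat := by
    intro n
    rw [Pr.comp_rat, Pr.it_rat, Pr.it_rat, Pr.idp_rat, ev_id]
  have c2 := core' f (Pr.inv a) (y.comp (Pr.inv a)) 𝒰 le_top 0 (s := 1 / s) (by positivity) hd hG hη (by
    filter_upwards [hb] with n hn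
    have : GN 0 (1 / s) ((Pr.it f (Pr.inv a) n).rat - (y.comp (Pr.inv a)).rat) = GN a s ((Pr.it f Pr.idp n).rat - y.rat) := by
      rw [hrat, Pr.comp_rat, Pr.comp_rat, ← ev_sub (Pr.inv a).rat_NC, Pr.GN_ev_inv a hs]
    rw [this]; exact hn)
  have c3 : ∀ᶠ n in (𝒰 : Filter ℕ), 4 * y.deg * y.deg < f.deg ^ n := le_top (hdN.eventually_gt_atTop _)
  obtain ⟨n, h1, h2, h3⟩ := (c1.and (c2.and c3)).exists
  have := Pr.total (Pr.it f Pr.idp n) a hs ((0 : 𝕜) : OnePoint 𝕜)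
  rw [← Pr.rat_eq_Z (hrat n), Pr.it_deg, Pr.idp_deg] at this
  have h1' := h1 0
  have h2' := h2 0
  rw [Pr.comp_deg, Pr.inv_deg, mul_one] at h2'
  nlinarith

end Est
end EQ

namespace EQ
section growth
variable {𝕜 : Type*} [NontriviallyNormedField 𝕜] [IsUltrametricDist 𝕜] [IsAlgClosed 𝕜]

/-- size of the pair -/
noncomputable def Pr.sz (x : Pr 𝕜) (a : 𝕜) (s : ℝ) : ℝ := max (gn a s x.A) (gn a s x.B)

theorem Pr.sz_pos (x : Pr 𝕜) (a : 𝕜) {s : ℝ} (hs : 0 < s) : 0 < x.sz a s :=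
  lt_max_of_lt_right (gn_pos a hs x.hB)

theorem Pr.nm_le (x : Pr 𝕜) (a : 𝕜) {s : ℝ} (hs : 0 < s) (c : 𝕜 × 𝕜) : x.nm a s c ≤ ‖c‖ * x.sz a s := by
  unfold Pr.nm Pr.l lin
  refine (gn_sub_le a hs _ _).trans ?_
  rw [gn_mul a hs, gn_mul a hs, gn_C, gn_C]
  refine max_le ?_ ?_
  · exact mul_le_mul (norm_snd_le c) (le_max_left _ _) (gn_nonneg a hs _) (norm_nonneg _)
  · exact mul_le_mul (norm_fst_le c) (le_max_right _ _) (gn_nonneg a hs _) (norm_nonneg _)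

theorem Pr.sz_le_two (x : Pr 𝕜) (a : 𝕜) {s : ℝ} (hs : 0 < s) (c c' : 𝕜 × 𝕜) :
    ‖wd c c'‖ * x.sz a s ≤ max ‖c‖ ‖c'‖ * max (x.nm a s c) (x.nm a s c') := by
  have h1 : C (wd c c') * x.A = C c'.1 * x.l c - C c.1 * x.l c' := by
    simp only [wd, Pr.l, lin, C_sub, C_mul]; ring
  have h2 : C (wd c c') * x.B = C c'.2 * x.l c - C c.2 * x.l c' := by
    simp only [wd, Pr.l, lin, C_sub, C_mul]; ring
  have key : ∀ (t t' : 𝕜), ‖t‖ ≤ ‖c‖ → ‖t'‖ ≤ ‖c'‖ → gn a s (C t' * x.l c - C t * x.l c') ≤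
      max ‖c‖ ‖c'‖ * max (x.nm a s c) (x.nm a s c') := by
    intro t t' ht ht'
    refine (gn_sub_le a hs _ _).trans ?_
    rw [gn_mul a hs, gn_mul a hs, gn_C, gn_C]
    refine max_le ?_ ?_
    · exact mul_le_mul (ht'.trans (le_max_right _ _)) (le_max_left _ _) (gn_nonneg a hs _) (le_max_of_le_left (norm_nonneg _))
    · exact mul_le_mul (ht.trans (le_max_left _ _)) (le_max_right _ _) (gn_nonneg a hs _) (le_max_of_le_left (norm_nonneg _))
  unfold Pr.sz
  rw [mul_max_of_nonneg _ _ (norm_nonneg _), ← gn_C a s (wd c c'), ← gn_mul a hs, ← gn_mul a hs, h1, h2]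
  exact max_le (key _ _ (norm_fst_le c) (norm_fst_le c')) (key _ _ (norm_snd_le c) (norm_snd_le c'))

theorem wd_hc_ne {q q' : OnePoint 𝕜} (h : q ≠ q') : wd (hc q) (hc q') ≠ 0 := by
  intro h0; apply h
  apply Pr.hc_wedge
  unfold wd at h0
  linear_combination -h0

theorem wd_self (v : 𝕜 × 𝕜) : wd v v = 0 := by unfold wd; ring

theorem sep (S : Finset (OnePoint 𝕜)) : ∃ δ : ℝ, 0 < δ ∧ δ ≤ 1 ∧ ∀ q ∈ S, ∀ q' ∈ S, q ≠ q' →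
    ∀ (x : Pr 𝕜) (a : 𝕜) (s : ℝ), 0 < s → δ * x.sz a s ≤ max (x.nm a s (hc q)) (x.nm a s (hc q')) := by
  have h1 : ∀ p : OnePoint 𝕜 × OnePoint 𝕜, ∃ δ : ℝ, 0 < δ ∧ (p.1 ≠ p.2 →
    ∀ (x : Pr 𝕜) (a : 𝕜) (s : ℝ), 0 < s → δ * x.sz a s ≤ max (x.nm a s (hc p.1)) (x.nm a s (hc p.2))) := by
    intro p
    by_cases hp : p.1 = p.2
    · exact ⟨1, one_pos, fun h => absurd hp h⟩
    · have hw := norm_pos_iff.2 (wd_hc_ne hp)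
      have hM : 0 < max ‖hc p.1‖ ‖hc p.2‖ := lt_max_of_lt_left (norm_pos_iff.2 (Pr.hc_ne_zero _))
      refine ⟨‖wd (hc p.1) (hc p.2)‖ / max ‖hc p.1‖ ‖hc p.2‖, div_pos hw hM, fun _ x a s hs => ?_⟩
      have := x.sz_le_two a hs (hc p.1) (hc p.2)
      rw [div_mul_eq_mul_div, div_le_iff₀ hM]
      linarith [mul_comm (max ‖hc p.1‖ ‖hc p.2‖) (max (x.nm a s (hc p.1)) (x.nm a s (hc p.2)))]
  choose δ hδ using h1
  have : ∃ e : ℝ, 0 < e ∧ e ≤ 1 ∧ ∀ p ∈ S ×ˢ S, e ≤ δ p := by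
    induction (S ×ˢ S) using Finset.induction_on with
    | empty => exact ⟨1, one_pos, le_rfl, by simp⟩
    | insert p T _ ih =>
      obtain ⟨e, h1, h2, h3⟩ := ih
      refine ⟨min e (δ p), lt_min h1 (hδ p).1, (min_le_left _ _).trans h2, ?_⟩
      intro p' hp'
      rcases Finset.mem_insert.1 hp' with rfl | h
      · exact min_le_right _ _
      · exact (min_le_left _ _).trans (h3 _ h)
  obtain ⟨e, h1, h2, h3⟩ := this
  refine ⟨e, h1, h2, fun q hq q' hq' hne x a s hs => ?_⟩
  refine le_trans ?_ ((hδ (q, q')).2 hne x a s hs)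
  exact mul_le_mul_of_nonneg_right (h3 _ (Finset.mem_product.2 ⟨hq, hq'⟩)) (x.sz_pos a hs).le

theorem Pr.mem_pull (f : Pr 𝕜) {c : 𝕜 × 𝕜} (hc0 : c ≠ 0) (q : OnePoint 𝕜) :
    q ∈ f.pull c ↔ wd c (f.val (hc q)) = 0 := by
  obtain ⟨k, hk, -, h⟩ := f.comp_l' hc0
  rw [h _ (Pr.hc_ne_zero q)]
  constructor
  · intro hq
    rw [Multiset.prod_eq_zero, mul_zero]
    exact Multiset.mem_map.2 ⟨q, hq, wd_self _⟩
  · intro h0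
    have h1 := (mul_eq_zero.1 h0).resolve_left hk
    rw [Multiset.prod_eq_zero_iff] at h1
    obtain ⟨q', hq', h2⟩ := Multiset.mem_map.1 h1
    by_cases hne : q' = q
    · exact hne ▸ hq'
    · exact absurd h2 (wd_hc_ne hne)

theorem Pr.sz_eq (x : Pr 𝕜) (a : 𝕜) {s : ℝ} (hs : 0 < s) : x.sz a s = max (x.nm a s (0, 1)) (x.nm a s (1, 0)) := by
  unfold Pr.sz Pr.nm Pr.l lin
  simp [gn_neg a hs]

theorem prod_const_le {ι : Type*} (m : Multiset ι) (F : ι → ℝ) {b : ℝ} (hb : 0 ≤ b) (h : ∀ i ∈ m, b ≤ F i) :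
    b ^ m.card ≤ (m.map F).prod := by
  have := prod_map_le m (fun _ => b) F (fun _ _ => hb) h
  simpa using this

theorem Pr.growth_le (f : Pr 𝕜) : ∃ M : ℝ, 0 < M ∧ ∀ (x : Pr 𝕜) (a : 𝕜) (s : ℝ), 0 < s →
    (f.comp x).sz a s ≤ M * x.sz a s ^ f.deg := by
  have h1 : ∀ c : 𝕜 × 𝕜, c ≠ 0 → ∃ M : ℝ, 0 < M ∧ ∀ (x : Pr 𝕜) (a : 𝕜) (s : ℝ), 0 < s →
    (f.comp x).nm a s c ≤ M * x.sz a s ^ f.deg := by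
    intro c hc0
    obtain ⟨k, hk, h, -⟩ := f.comp_l' hc0
    refine ⟨‖k‖ * ((f.pull c).map fun q => ‖hc q‖).prod, mul_pos (norm_pos_iff.2 hk) ?_, ?_⟩
    · apply Multiset.prod_pos
      intro t ht
      obtain ⟨q, -, rfl⟩ := Multiset.mem_map.1 ht
      exact norm_pos_iff.2 (Pr.hc_ne_zero q)
    · intro x a s hs
      rw [Pr.nm_comp f x a hs c k (h x), mul_assoc]
      apply mul_le_mul_of_nonneg_left _ (norm_nonneg _)
      refine (prod_map_le _ _ (fun q => x.sz a s * ‖hc q‖) (fun q _ => gn_nonneg a hs _) (fun q _ => ?_)).trans ?_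
      · rw [mul_comm]; exact x.nm_le a hs _
      · rw [prod_map_mul_const, f.card_pull, mul_comm]
  obtain ⟨M1, hM1, H1⟩ := h1 (0, 1) (by simp)
  obtain ⟨M2, hM2, H2⟩ := h1 (1, 0) (by simp)
  refine ⟨max M1 M2, lt_max_of_lt_left hM1, fun x a s hs => ?_⟩
  rw [Pr.sz_eq _ a hs]
  have := pow_nonneg (x.sz_pos a hs).le f.deg
  exact max_le ((H1 x a s hs).trans (mul_le_mul_of_nonneg_right (le_max_left _ _) this))
    ((H2 x a s hs).trans (mul_le_mul_of_nonneg_right (le_max_right _ _) this))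

theorem Pr.growth_ge (f : Pr 𝕜) : ∃ M : ℝ, 0 < M ∧ ∀ (x : Pr 𝕜) (a : 𝕜) (s : ℝ), 0 < s →
    M * x.sz a s ^ f.deg ≤ (f.comp x).sz a s := by
  have e1 : ((0, 1) : 𝕜 × 𝕜) ≠ 0 := by simp
  have e2 : ((1, 0) : 𝕜 × 𝕜) ≠ 0 := by simp
  obtain ⟨k1, hk1, h1, -⟩ := f.comp_l' e1
  obtain ⟨k2, hk2, h2, -⟩ := f.comp_l' e2
  obtain ⟨δ, hδ, -, H⟩ := sep ((f.pull (0, 1)).toFinset ∪ (f.pull (1, 0)).toFinset)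
  have hm : 0 < min ‖k1‖ ‖k2‖ := lt_min (norm_pos_iff.2 hk1) (norm_pos_iff.2 hk2)
  refine ⟨min ‖k1‖ ‖k2‖ * δ ^ f.deg, mul_pos hm (pow_pos hδ _), fun x a s hs => ?_⟩
  have hb : 0 ≤ δ * x.sz a s := (mul_pos hδ (x.sz_pos a hs)).le
  rw [mul_assoc, ← mul_pow, Pr.sz_eq (f.comp x) a hs]
  by_cases hall : ∀ q ∈ f.pull (0, 1), δ * x.sz a s ≤ x.nm a s (hc q)
  · refine le_max_of_le_left ?_
    rw [Pr.nm_comp f x a hs _ k1 (h1 x)]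
    refine mul_le_mul (min_le_left _ _) ?_ (pow_nonneg hb _) (norm_nonneg _)
    rw [← f.card_pull (0, 1)]
    exact prod_const_le _ _ hb hall
  · push Not at hall
    obtain ⟨q, hq, hlt⟩ := hall
    refine le_max_of_le_right ?_
    rw [Pr.nm_comp f x a hs _ k2 (h2 x)]
    refine mul_le_mul (min_le_right _ _) ?_ (pow_nonneg hb _) (norm_nonneg _)
    conv_lhs => rw [← f.card_pull (1, 0)]
    refine prod_const_le _ _ hb fun q' hq' => ?_
    have hne : q ≠ q' := by
      rintro rfl
      rw [Pr.mem_pull f e1] at hq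
      rw [Pr.mem_pull f e2] at hq'
      apply f.val_ne_zero (Pr.hc_ne_zero q)
      simp [wd] at hq hq'
      exact Prod.ext hq hq'
    have := H q (by simp [hq]) q' (by simp [hq']) hne x a s hs
    rcases le_max_iff.1 this with h | h
    · exact absurd h (not_le.2 hlt)
    · exact h

/-- convergence of the escape rate -/
theorem Pr.escape (f x : Pr 𝕜) (hd : 1 < f.deg) (a : 𝕜) {s : ℝ} (hs : 0 < s) :
    ∃ h : ℝ, Tendsto (fun n => Real.log ((Pr.it f x n).sz a s) / (f.deg : ℝ) ^ n) atTop (𝓝 h) := by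
  obtain ⟨M1, hM1, H1⟩ := f.growth_ge
  obtain ⟨M2, hM2, H2⟩ := f.growth_le
  have hd' : (1 : ℝ) < f.deg := by exact_mod_cast hd
  have hd0 : (0 : ℝ) < f.deg := by linarith
  apply cauchySeq_tendsto_of_complete
  apply cauchySeq_of_le_geometric ((f.deg : ℝ)⁻¹) (max |Real.log M1| |Real.log M2|) (inv_lt_one_of_one_lt₀ hd')
  intro n
  set y := Pr.it f x n
  have hy := y.sz_pos a hs
  have hy' := (f.comp y).sz_pos a hs
  have l1 : Real.log M1 + f.deg * Real.log (y.sz a s) ≤ Real.log ((f.comp y).sz a s) := by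
    rw [← Real.log_pow, ← Real.log_mul hM1.ne' (pow_pos hy _).ne']
    exact Real.log_le_log (mul_pos hM1 (pow_pos hy _)) (H1 y a s hs)
  have l2 : Real.log ((f.comp y).sz a s) ≤ Real.log M2 + f.deg * Real.log (y.sz a s) := by
    rw [← Real.log_pow, ← Real.log_mul hM2.ne' (pow_pos hy _).ne']
    exact Real.log_le_log hy' (H2 y a s hs)
  have e : Pr.it f x (n + 1) = f.comp y := rfl
  rw [e, Real.dist_eq, abs_sub_comm]
  have e2 : Real.log ((f.comp y).sz a s) / (f.deg : ℝ) ^ (n + 1) - Real.log (y.sz a s) / (f.deg : ℝ) ^ n =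
    (Real.log ((f.comp y).sz a s) - f.deg * Real.log (y.sz a s)) / (f.deg : ℝ) ^ (n + 1) := by
    rw [pow_succ]; field_simp
  rw [e2, abs_div, abs_of_pos (pow_pos hd0 (n + 1)), inv_pow, ← div_eq_mul_inv]
  have h3 : |Real.log ((f.comp y).sz a s) - f.deg * Real.log (y.sz a s)| ≤ max |Real.log M1| |Real.log M2| := by
    rw [abs_le]
    constructor
    · have := neg_abs_le (Real.log M1)
      have := le_max_left |Real.log M1| |Real.log M2|
      linarith
    · have := le_abs_self (Real.log M2)
      have := le_max_right |Real.log M1| |Real.log M2|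
      linarith
  apply div_le_div₀ ((abs_nonneg _).trans h3) h3 (pow_pos hd0 n)
  exact pow_le_pow_right₀ hd'.le (Nat.le_succ n)

/-- uniform lower bound for the targets -/
theorem Pr.k_bound (f : Pr 𝕜) : ∃ κ : ℝ, 0 < κ ∧ ∀ (c : 𝕜 × 𝕜), c ≠ 0 → ∀ k : 𝕜,
    (∀ v : 𝕜 × 𝕜, v ≠ 0 → wd c (f.val v) = k * ((f.pull c).map fun q => wd (hc q) v).prod) →
    κ * ‖c‖ ≤ ‖k‖ * ((f.pull c).map fun q => ‖hc q‖).prod := by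
  have hw : ∀ q v : 𝕜 × 𝕜, ‖wd q v‖ ≤ ‖v‖ * ‖q‖ := by
    intro q v
    unfold wd
    refine (norm_sub_le_max' _ _).trans (max_le ?_ ?_)
    · rw [norm_mul, mul_comm]; exact mul_le_mul (norm_fst_le v) (norm_snd_le q) (norm_nonneg _) (norm_nonneg _)
    · rw [norm_mul, mul_comm]; exact mul_le_mul (norm_snd_le v) (norm_fst_le q) (norm_nonneg _) (norm_nonneg _)
  have hex : ∀ c : 𝕜 × 𝕜, c ≠ 0 → ∃ v : 𝕜 × 𝕜, v ≠ 0 ∧ wd c (f.val v) = 0 := by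
    intro c hc0
    have : 0 < (f.pull c).card := by rw [f.card_pull]; exact f.deg_pos
    obtain ⟨q, hq⟩ := Multiset.card_pos_iff_exists_mem.1 this
    exact ⟨hc q, Pr.hc_ne_zero q, (f.mem_pull hc0 q).1 hq⟩
  obtain ⟨v1, hv1, h1⟩ := hex (0, 1) (by simp)
  obtain ⟨v2, hv2, h2⟩ := hex (1, 0) (by simp)
  have n1 := f.val_ne_zero hv1
  have n2 := f.val_ne_zero hv2
  simp [wd] at h1 h2
  have n1' : (f.val v1).2 ≠ 0 := fun h => n1 (Prod.ext h1 h)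
  have n2' : (f.val v2).1 ≠ 0 := fun h => n2 (Prod.ext h h2)
  set T1 := ‖v1‖ ^ f.deg
  set T2 := ‖v2‖ ^ f.deg
  have hT1 : 0 < T1 := pow_pos (norm_pos_iff.2 hv1) _
  have hT2 : 0 < T2 := pow_pos (norm_pos_iff.2 hv2) _
  have p1 := norm_pos_iff.2 n1'
  have p2 := norm_pos_iff.2 n2'
  refine ⟨min (‖(f.val v1).2‖ / T1) (‖(f.val v2).1‖ / T2), lt_min (div_pos p1 hT1) (div_pos p2 hT2), ?_⟩
  intro c hc0 k h
  have gen : ∀ v : 𝕜 × 𝕜, v ≠ 0 → ‖wd c (f.val v)‖ ≤ ‖v‖ ^ f.deg * (‖k‖ * ((f.pull c).map fun q => ‖hc q‖).prod) := by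
    intro v hv
    rw [h v hv, norm_mul, norm_multiset_prod, mul_left_comm]
    apply mul_le_mul_of_nonneg_left _ (norm_nonneg _)
    refine (prod_map_le _ _ (fun q => ‖v‖ * ‖hc q‖) (fun q _ => norm_nonneg _) (fun q _ => hw _ _)).trans ?_
    rw [prod_map_mul_const, f.card_pull]
  rcases le_total ‖c.1‖ ‖c.2‖ with hle | hle
  · have hn : ‖c‖ = ‖c.2‖ := by rw [Prod.norm_def]; exact max_eq_right hle
    have := gen v2 hv2
    rw [wd, h2, mul_zero, sub_zero, norm_mul] at this
    refine (mul_le_mul_of_nonneg_right (min_le_right _ _) (norm_nonneg _)).trans ?_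
    rw [hn, div_mul_eq_mul_div, div_le_iff₀ hT2]
    linarith
  · have hn : ‖c‖ = ‖c.1‖ := by rw [Prod.norm_def]; exact max_eq_left hle
    have := gen v1 hv1
    rw [wd, h1, mul_zero, zero_sub, norm_neg, norm_mul] at this
    refine (mul_le_mul_of_nonneg_right (min_le_left _ _) (norm_nonneg _)).trans ?_
    rw [hn, div_mul_eq_mul_div, div_le_iff₀ hT1]
    linarith

theorem Pr.nm_lower (f x : Pr 𝕜) (hd : 1 < f.deg) (a : 𝕜) {s : ℝ} (hs : 0 < s) : ∃ M : ℝ, 0 ≤ M ∧ ∀ (j : ℕ) (c : 𝕜 × 𝕜),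
    c ≠ 0 → Real.exp (-M * f.deg ^ j) * ‖c‖ ≤ (Pr.it f x j).nm a s c := by
  obtain ⟨M0, hM0⟩ := x.nm_bound a hs
  obtain ⟨κ, hκ, H⟩ := f.k_bound
  have hd' : (2 : ℝ) ≤ f.deg := by exact_mod_cast hd
  -- L_j = exp (-(M0' + b) d^j + b), b = |log κ|
  set b := |Real.log κ|
  have hb : 0 ≤ b := abs_nonneg _
  have key : ∀ (j : ℕ) (c : 𝕜 × 𝕜), c ≠ 0 → Real.exp (-(|M0| + b) * f.deg ^ j + b) * ‖c‖ ≤ (Pr.it f x j).nm a s c := by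
    intro j
    induction j with
    | zero =>
      intro c hc0
      have h1 := (abs_le.1 (hM0 c hc0)).1
      have hp := x.nm_pos a hs hc0
      have hcp := norm_pos_iff.2 hc0
      rw [Pr.it_zero, ← Real.exp_log hcp, ← Real.exp_add, ← Real.exp_log hp]
      apply Real.exp_le_exp.2
      rw [pow_zero]
      have := le_abs_self M0
      linarith
    | succ j ih =>
      intro c hc0
      obtain ⟨k, hk, h1, h2⟩ := f.comp_l' hc0
      have e : Pr.it f x (j + 1) = f.comp (Pr.it f x j) := rfl
      rw [e, Pr.nm_comp f _ a hs c k (h1 _)]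
      set E := Real.exp (-(|M0| + b) * f.deg ^ j + b)
      have hE : 0 < E := Real.exp_pos _
      have h3 : E ^ f.deg * ((f.pull c).map fun q => ‖hc q‖).prod ≤ ((f.pull c).map fun q => (Pr.it f x j).nm a s (hc q)).prod := by
        rw [← f.card_pull c, ← prod_map_mul_const]
        exact prod_map_le _ _ _ (fun q _ => mul_nonneg hE.le (norm_nonneg _)) (fun q _ => ih _ (Pr.hc_ne_zero q))
      have h4 := H c hc0 k h2
      have h5 : Real.exp (-(|M0| + b) * f.deg ^ (j + 1) + b) ≤ E ^ f.deg * κ := by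
        have : E ^ f.deg * κ = Real.exp (f.deg * (-(|M0| + b) * f.deg ^ j + b) + Real.log κ) := by
          rw [Real.exp_add, Real.exp_log hκ, Real.exp_nat_mul]
        rw [this]
        apply Real.exp_le_exp.2
        have h6 := neg_abs_le (Real.log κ)
        have h7 : 2 * b ≤ f.deg * b := mul_le_mul_of_nonneg_right hd' hb
        have : (f.deg : ℝ) * (-(|M0| + b) * f.deg ^ j + b) = -(|M0| + b) * f.deg ^ (j + 1) + f.deg * b := by ring
        rw [this]
        have : -b ≤ Real.log κ := h6
        linarith
      calc _ ≤ E ^ f.deg * κ * ‖c‖ := mul_le_mul_of_nonneg_right h5 (norm_nonneg _)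
        _ = E ^ f.deg * (κ * ‖c‖) := by ring
        _ ≤ E ^ f.deg * (‖k‖ * ((f.pull c).map fun q => ‖hc q‖).prod) := mul_le_mul_of_nonneg_left h4 (pow_pos hE _).le
        _ = ‖k‖ * (E ^ f.deg * ((f.pull c).map fun q => ‖hc q‖).prod) := by ring
        _ ≤ _ := mul_le_mul_of_nonneg_left h3 (norm_nonneg _)
  refine ⟨|M0| + b, by positivity, fun j c hc0 => le_trans ?_ (key j c hc0)⟩
  apply mul_le_mul_of_nonneg_right _ (norm_nonneg _)
  apply Real.exp_le_exp.2
  linarith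

end growth
end EQ

namespace EQ
section ram
variable {𝕜 : Type*} [NontriviallyNormedField 𝕜] [IsUltrametricDist 𝕜] [IsAlgClosed 𝕜]

theorem wd_smul_right (c v : 𝕜 × 𝕜) (t : 𝕜) : wd c (t • v) = t * wd c v := by
  simp only [wd, Prod.smul_fst, Prod.smul_snd, smul_eq_mul]; ring
theorem wd_add_right (c v w : 𝕜 × 𝕜) : wd c (v + w) = wd c v + wd c w := by
  simp only [wd, Prod.fst_add, Prod.snd_add]; ring
theorem wd_smul_left (c v : 𝕜 × 𝕜) (t : 𝕜) : wd (t • c) v = t * wd c v := by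
  simp only [wd, Prod.smul_fst, Prod.smul_snd, smul_eq_mul]; ring
theorem wd_add_left (c c' v : 𝕜 × 𝕜) : wd (c + c') v = wd c v + wd c' v := by
  simp only [wd, Prod.fst_add, Prod.snd_add]; ring
theorem wd_comm (c v : 𝕜 × 𝕜) : wd c v = - wd v c := by simp only [wd]; ring

theorem wd_coord {u w : 𝕜 × 𝕜} (h : wd u w ≠ 0) (v : 𝕜 × 𝕜) :
    v = (wd v w / wd u w) • u + (wd u v / wd u w) • w := by
  have h' : u.2 * w.1 - u.1 * w.2 ≠ 0 := h
  refine Prod.ext ?_ ?_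
  · simp only [wd, Prod.fst_add, Prod.smul_fst, smul_eq_mul]; rw [div_mul_eq_mul_div, div_mul_eq_mul_div, ← add_div, eq_div_iff h']; ring
  · simp only [wd, Prod.snd_add, Prod.smul_snd, smul_eq_mul]; rw [div_mul_eq_mul_div, div_mul_eq_mul_div, ← add_div, eq_div_iff h']; ring

theorem wd_ext {u w : 𝕜 × 𝕜} (h : wd u w ≠ 0) {v v' : 𝕜 × 𝕜} (h1 : wd u v = wd u v') (h2 : wd w v = wd w v') : v = v' := by
  rw [wd_coord h v, wd_coord h v', h1, wd_comm v w, wd_comm v' w, h2]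

/-- the induced map on the projective line -/
theorem Pr.exists_pt (f : Pr 𝕜) (q : OnePoint 𝕜) : ∃ c : OnePoint 𝕜, ∀ c', q ∈ f.pull (hc c') ↔ c = c' := by
  obtain ⟨t, c, ht, h⟩ := exists_hc (f.val_ne_zero (Pr.hc_ne_zero q))
  refine ⟨c, fun c' => ?_⟩
  rw [f.mem_pull (Pr.hc_ne_zero c'), h, wd_smul_right]
  constructor
  · intro h0
    by_contra hne
    exact mul_ne_zero ht (wd_hc_ne (Ne.symm hne)) h0
  · rintro rfl
    rw [wd_self, mul_zero]

noncomputable def Pr.pt (f : Pr 𝕜) (q : OnePoint 𝕜) : OnePoint 𝕜 := (f.exists_pt q).choose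

theorem Pr.mem_pull_iff (f : Pr 𝕜) (q c : OnePoint 𝕜) : q ∈ f.pull (hc c) ↔ f.pt q = c :=
  (f.exists_pt q).choose_spec c

/-- local degree -/
noncomputable def Pr.e (f : Pr 𝕜) (q : OnePoint 𝕜) : ℕ := (f.pull (hc (f.pt q))).count q

theorem Pr.e_le (f : Pr 𝕜) (q : OnePoint 𝕜) : f.e q ≤ f.deg := by
  rw [← f.card_pull (hc (f.pt q))]; exact Multiset.count_le_card _ _

theorem Pr.e_eq (f : Pr 𝕜) {q : OnePoint 𝕜} (h : f.e q = f.deg) : f.pull (hc (f.pt q)) = Multiset.replicate f.deg q := by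
  rw [Multiset.eq_replicate]
  refine ⟨f.card_pull _, fun b hb => ?_⟩
  have : (f.pull (hc (f.pt q))).count q = (f.pull (hc (f.pt q))).card := by rw [f.card_pull]; exact h
  exact ((Multiset.count_eq_card.1 this) b hb).symm

theorem Pr.e_unique (f : Pr 𝕜) {q : OnePoint 𝕜} (h : f.e q = f.deg) {w : OnePoint 𝕜} (hw : f.pt w = f.pt q) : w = q := by
  have := (f.mem_pull_iff w (f.pt q)).2 hw
  rw [f.e_eq h] at this
  exact Multiset.eq_of_mem_replicate this

theorem Pr.exists_fixed (f : Pr 𝕜) (hd : 1 < f.deg) : ∃ (v : 𝕜 × 𝕜) (t : 𝕜), v ≠ 0 ∧ t ≠ 0 ∧ f.val v = t • v := by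
  suffices h : ∃ (v : 𝕜 × 𝕜) (t : 𝕜), v ≠ 0 ∧ f.val v = t • v by
    obtain ⟨v, t, hv, h⟩ := h
    refine ⟨v, t, hv, ?_, h⟩
    rintro rfl
    exact f.val_ne_zero hv (by rw [h, zero_smul])
  by_cases hdeg : (f.A - X * f.B).degree = 0
  · have hk := eq_C_of_degree_eq_zero hdeg
    set k := (f.A - X * f.B).coeff 0
    have hA : f.A = X * f.B + C k := by rw [← hk]; ring
    have hXB : (X * f.B).natDegree = f.B.natDegree + 1 := natDegree_X_mul f.hB
    have hAd : f.A.natDegree = f.B.natDegree + 1 := by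
      rw [hA, natDegree_add_C, hXB]
    have hde : f.deg = f.B.natDegree + 1 := by unfold Pr.deg; rw [hAd]; simp
    refine ⟨(1, 0), f.A.coeff f.deg, by simp, ?_⟩
    unfold Pr.val
    rw [hv_of_eq _ _ rfl, hv_of_eq _ _ rfl]
    have : f.B.coeff f.deg = 0 := coeff_eq_zero_of_natDegree_lt (by omega)
    simp [this]
  · obtain ⟨z, hz⟩ := IsAlgClosed.exists_root _ hdeg
    have hz' : f.A.eval z = z * f.B.eval z := by
      simp [IsRoot] at hz; linear_combination hz
    refine ⟨(z, 1), f.B.eval z, by simp, ?_⟩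
    unfold Pr.val
    rw [hv_of_ne (show f.A.natDegree ≤ f.deg from le_max_left _ _) (v := (z, 1)) (by simp), hv_of_ne (show f.B.natDegree ≤ f.deg from le_max_right _ _) (v := (z, 1)) (by simp)]
    simp [hz', mul_comm]

theorem goodNorm_of_additive (f : Pr 𝕜) (hd : 1 < f.deg) (hadd : ∀ v w, f.val (v + w) = f.val v + f.val w)
    (hpow : ∀ x y : 𝕜, (x + y) ^ f.deg = x ^ f.deg + y ^ f.deg) : GoodNorm f := by
  have hne0 : f.deg ≠ 0 := by omega
  have hscale : ∀ v : 𝕜 × 𝕜, ∀ t : 𝕜, t ≠ 0 → ∃ y : 𝕜, y ≠ 0 ∧ y ^ f.deg * t = y := by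
    intro v t ht
    obtain ⟨y, hy⟩ := IsAlgClosed.exists_pow_nat_eq t⁻¹ (n := f.deg - 1) (by omega)
    refine ⟨y, ?_, ?_⟩
    · rintro rfl
      rw [zero_pow (by omega)] at hy
      exact inv_ne_zero ht hy.symm
    · have : f.deg = (f.deg - 1) + 1 := by omega
      rw [this, pow_succ, hy]; field_simp
  obtain ⟨v0, t, hv0, ht, h0⟩ := f.exists_fixed hd
  obtain ⟨y0, hy0, hy0'⟩ := hscale v0 t ht
  obtain ⟨v1, hv1, hf1⟩ : ∃ v1, v1 ≠ 0 ∧ f.val v1 = v1 :=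
    ⟨y0 • v0, smul_ne_zero hy0 hv0, by rw [f.val_smul, h0, smul_smul, hy0']⟩
  obtain ⟨w, hw⟩ := exists_wd hv1
  obtain ⟨μ, lam, hFw⟩ : ∃ μ lam : 𝕜, f.val w = μ • v1 + lam • w := ⟨_, _, wd_coord hw _⟩
  have hlam : lam ≠ 0 := by
    rintro rfl
    obtain ⟨r, hr⟩ := IsAlgClosed.exists_pow_nat_eq (-μ) (n := f.deg) (by omega)
    have h2 : f.val (w + r • v1) = 0 := by
      rw [hadd, f.val_smul, hf1, hr, hFw]; simp
    refine f.val_ne_zero ?_ h2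
    intro h3
    apply hw
    have : w = -(r • v1) := eq_neg_of_add_eq_zero_left h3
    rw [this, ← neg_smul, wd_smul_right, wd_self, mul_zero]
  obtain ⟨y, hy, hy'⟩ := hscale w lam hlam
  obtain ⟨x, hx⟩ : ∃ x : 𝕜, x ^ f.deg - x + y ^ f.deg * μ = 0 := by
    have hdeg : (X ^ f.deg - X + C (y ^ f.deg * μ) : 𝕜[X]).degree ≠ 0 := by
      have e : (X ^ f.deg - X + C (y ^ f.deg * μ) : 𝕜[X]) = X ^ f.deg + (- X + C (y ^ f.deg * μ)) := by ring
      rw [e, degree_add_eq_left_of_degree_lt]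
      · rw [degree_X_pow]; exact_mod_cast hne0
      · rw [degree_X_pow]
        refine lt_of_le_of_lt (degree_add_le _ _) (max_lt ?_ ?_)
        · rw [degree_neg, degree_X]; exact_mod_cast hd
        · exact lt_of_le_of_lt degree_C_le (by exact_mod_cast (by omega : 0 < f.deg))
    obtain ⟨x, hx⟩ := IsAlgClosed.exists_root _ hdeg
    exact ⟨x, by simpa [IsRoot] using hx⟩
  obtain ⟨v2, hv2d⟩ : ∃ v2, v2 = x • v1 + y • w := ⟨_, rfl⟩
  have hf2 : f.val v2 = v2 := by
    rw [hv2d, hadd, f.val_smul, f.val_smul, hf1, hFw, smul_add, smul_smul, smul_smul, hy', ← add_assoc, ← add_smul]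
    congr 2
    linear_combination hx
  have hD : wd v1 v2 ≠ 0 := by
    rw [hv2d, wd_add_right, wd_smul_right, wd_smul_right, wd_self, mul_zero, zero_add]
    exact mul_ne_zero hy hw
  refine ⟨fun v => max ‖wd v v2 / wd v1 v2‖ ‖wd v1 v / wd v1 v2‖, v1, v2, ⟨hD, ?_⟩, 1, one_pos, ?_⟩
  · intro a b
    simp only [wd_add_left, wd_add_right, wd_smul_left, wd_smul_right, wd_self, mul_zero, add_zero, zero_add]
    rw [mul_div_assoc, mul_div_assoc, div_self hD, mul_one, mul_one]
  · intro v hv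
    obtain ⟨a, b, hab⟩ : ∃ a b : 𝕜, v = a • v1 + b • v2 := ⟨_, _, wd_coord hD _⟩
    have hab' : f.val v = a ^ f.deg • v1 + b ^ f.deg • v2 := by
      rw [hab, hadd, f.val_smul, f.val_smul, hf1, hf2]
    rw [hab', hab]
    simp only [wd_add_left, wd_add_right, wd_smul_left, wd_smul_right, wd_self, mul_zero, add_zero, zero_add]
    rw [mul_div_assoc, mul_div_assoc, mul_div_assoc, mul_div_assoc, div_self hD, mul_one, mul_one, mul_one, mul_one, one_mul, norm_pow, norm_pow]
    exact ((pow_left_monotoneOn (n := f.deg)).map_max (norm_nonneg a) (norm_nonneg b)).symm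

theorem three_ram (f : Pr 𝕜) (hd : 1 < f.deg) {q1 q2 q3 : OnePoint 𝕜} (h12 : q1 ≠ q2) (h13 : q1 ≠ q3) (h23 : q2 ≠ q3)
    (e1 : f.e q1 = f.deg) (e2 : f.e q2 = f.deg) (e3 : f.e q3 = f.deg) : GoodNorm f := by
  have hne0 : f.deg ≠ 0 := by omega
  have hv0 : f.val 0 = 0 := by
    have := f.val_smul 0 0
    rwa [zero_smul, zero_pow hne0, zero_smul] at this
  have gen : ∀ q, f.e q = f.deg → ∃ k : 𝕜, k ≠ 0 ∧ ∀ v, wd (hc (f.pt q)) (f.val v) = k * wd (hc q) v ^ f.deg := by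
    intro q hq
    obtain ⟨k, hk, -, h⟩ := f.comp_l' (Pr.hc_ne_zero (f.pt q))
    refine ⟨k, hk, fun v => ?_⟩
    by_cases hv : v = 0
    · subst hv
      rw [hv0]; simp [wd, hne0]
    · rw [h v hv, f.e_eq hq]; simp
  obtain ⟨k1, hk1, H1⟩ := gen q1 e1
  obtain ⟨k2, hk2, H2⟩ := gen q2 e2
  obtain ⟨k3, hk3, H3⟩ := gen q3 e3
  have c12 : f.pt q1 ≠ f.pt q2 := fun h => h12 (f.e_unique e2 h)
  have W := wd_hc_ne c12
  have D := wd_hc_ne h12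
  obtain ⟨α, β, hαβ⟩ : ∃ α β : 𝕜, hc (f.pt q3) = α • hc (f.pt q1) + β • hc (f.pt q2) := ⟨_, _, wd_coord W _⟩
  obtain ⟨γ, δ, hγδ⟩ : ∃ γ δ : 𝕜, hc q3 = γ • hc q1 + δ • hc q2 := ⟨_, _, wd_coord D _⟩
  have hγ : γ ≠ 0 := by
    rintro rfl
    apply wd_hc_ne h23
    rw [hγδ, zero_smul, zero_add, wd_smul_right, wd_self, mul_zero]
  have hδ : δ ≠ 0 := by
    rintro rfl
    apply wd_hc_ne h13
    rw [hγδ, zero_smul, add_zero, wd_smul_right, wd_self, mul_zero]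
  have rel : ∀ v, k3 * (γ * wd (hc q1) v + δ * wd (hc q2) v) ^ f.deg =
      α * (k1 * wd (hc q1) v ^ f.deg) + β * (k2 * wd (hc q2) v ^ f.deg) := by
    intro v
    have := H3 v
    rw [hαβ, wd_add_left, wd_smul_left, wd_smul_left, H1, H2, hγδ, wd_add_left, wd_smul_left, wd_smul_left] at this
    exact this.symm
  have r1 : α * k1 = k3 * γ ^ f.deg := by
    have := rel (hc q2)
    rw [wd_self, mul_zero, add_zero, zero_pow hne0, mul_zero, mul_zero, add_zero, mul_pow] at this
    have hp := pow_ne_zero f.deg D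
    apply mul_right_cancel₀ hp
    linear_combination -this
  have r2 : β * k2 = k3 * δ ^ f.deg := by
    have := rel (hc q1)
    rw [wd_self, mul_zero, zero_add, zero_pow hne0, mul_zero, mul_zero, zero_add, mul_pow] at this
    have hp := pow_ne_zero f.deg (wd_hc_ne h12.symm)
    apply mul_right_cancel₀ hp
    linear_combination -this
  have hpow : ∀ x y : 𝕜, (x + y) ^ f.deg = x ^ f.deg + y ^ f.deg := by
    intro x y
    have h21 := wd_hc_ne h12.symm
    have := rel ((x / (γ * wd (hc q1) (hc q2))) • hc q2 + (y / (δ * wd (hc q2) (hc q1))) • hc q1)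
    simp only [wd_add_right, wd_smul_right, wd_self, mul_zero, zero_add, add_zero] at this
    have s1 : x / (γ * wd (hc q1) (hc q2)) * wd (hc q1) (hc q2) = x / γ := by field_simp
    have s2 : y / (δ * wd (hc q2) (hc q1)) * wd (hc q2) (hc q1) = y / δ := by field_simp
    rw [s1, s2, mul_div_cancel₀ _ hγ, mul_div_cancel₀ _ hδ, ← mul_assoc, ← mul_assoc, r1, r2, mul_assoc, mul_assoc, ← mul_pow, ← mul_pow,
      mul_div_cancel₀ _ hγ, mul_div_cancel₀ _ hδ, ← mul_add] at this
    exact mul_left_cancel₀ hk3 this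
  refine goodNorm_of_additive f hd ?_ hpow
  intro v w
  apply wd_ext W
  · rw [wd_add_right, H1, H1, H1, wd_add_right, hpow, mul_add]
  · rw [wd_add_right, H2, H2, H2, wd_add_right, hpow, mul_add]

/-- iterated pullback -/
noncomputable def Pr.pullIt (f : Pr 𝕜) : ℕ → OnePoint 𝕜 → Multiset (OnePoint 𝕜)
  | 0, c => {c}
  | l + 1, c => (f.pull (hc c)).bind (fun q => f.pullIt l q)

theorem Pr.card_pullIt (f : Pr 𝕜) (l : ℕ) (c : OnePoint 𝕜) : (f.pullIt l c).card = f.deg ^ l := by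
  induction l generalizing c with
  | zero => simp [Pr.pullIt]
  | succ l ih =>
    simp only [Pr.pullIt, Multiset.card_bind]
    rw [Multiset.map_congr rfl (g := fun _ => f.deg ^ l) (fun q _ => by simp [ih])]
    rw [Multiset.map_const', Multiset.sum_replicate, f.card_pull, pow_succ, smul_eq_mul, mul_comm]

theorem Pr.it_l (f : Pr 𝕜) (l : ℕ) (c : OnePoint 𝕜) : ∃ k : 𝕜, k ≠ 0 ∧ ∀ (x : Pr 𝕜) (j : ℕ),
    (Pr.it f x (l + j)).l (hc c) = C k * ((f.pullIt l c).map fun q => (Pr.it f x j).l (hc q)).prod := by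
  induction l generalizing c with
  | zero => exact ⟨1, one_ne_zero, fun x j => by simp [Pr.pullIt]⟩
  | succ l ih =>
    choose k hk H using ih
    obtain ⟨k0, hk0, h0, -⟩ := f.comp_l' (Pr.hc_ne_zero c)
    refine ⟨k0 * ((f.pull (hc c)).map k).prod, mul_ne_zero hk0 ?_, ?_⟩
    · rw [Ne, Multiset.prod_eq_zero_iff, Multiset.mem_map]
      rintro ⟨q, -, hq⟩
      exact hk q hq
    · intro x j
      have e : Pr.it f x (l + 1 + j) = f.comp (Pr.it f x (l + j)) := by
        rw [show l + 1 + j = (l + j) + 1 by ring]; rfl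
      rw [e, h0]
      simp only [Pr.pullIt, Multiset.map_bind, Multiset.prod_bind]
      rw [Multiset.map_congr rfl (fun q _ => H q x j), Multiset.prod_map_mul, C_mul, mul_assoc]
      congr 2
      rw [map_multiset_prod, Multiset.map_map]; rfl

theorem Pr.mem_pullIt (f : Pr 𝕜) (l : ℕ) (b c : OnePoint 𝕜) : b ∈ f.pullIt l c ↔ (f.pt)^[l] b = c := by
  induction l generalizing c with
  | zero => simp [Pr.pullIt]
  | succ l ih =>
    simp only [Pr.pullIt, Multiset.mem_bind, ih, f.mem_pull_iff, Function.iterate_succ_apply']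
    constructor
    · rintro ⟨q, h1, rfl⟩; exact h1
    · intro h; exact ⟨_, h, rfl⟩

theorem Pr.count_pullIt (f : Pr 𝕜) (l : ℕ) (b : OnePoint 𝕜) :
    (f.pullIt l ((f.pt)^[l] b)).count b = ∏ i ∈ Finset.range l, f.e ((f.pt)^[i] b) := by
  induction l with
  | zero => simp [Pr.pullIt]
  | succ l ih =>
    simp only [Pr.pullIt, Multiset.count_bind]
    rw [Multiset.sum_map_eq_nsmul_single ((f.pt)^[l] b), ih, Finset.prod_range_succ, smul_eq_mul, mul_comm, Function.iterate_succ_apply']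
    · rfl
    · intro q hq _
      rw [Multiset.count_eq_zero, f.mem_pullIt]
      exact fun h => hq h.symm

theorem Pr.not_three (f : Pr 𝕜) (hd : 1 < f.deg) (hG : ¬ GoodNorm f) {c y : OnePoint 𝕜}
    (hE : ¬ Set.Finite {b | ∃ n : ℕ, (f.pt)^[n] b = c}) {k : ℕ} (hk : (f.pt)^[k + 2] y = c)
    (h0 : f.e y = f.deg) (h1 : f.e (f.pt y) = f.deg) (h2 : f.e (f.pt (f.pt y)) = f.deg) : False := by
  have gen : ∀ Z : Set (OnePoint 𝕜), Z.Finite → (∀ z ∈ Z, f.pt z ∈ Z) → (∀ z ∈ Z, ∃ z' ∈ Z, f.pt z' = z ∧ f.e z' = f.deg) →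
      f.pt (f.pt y) ∈ Z → False := by
    intro Z hZ hfw hbw hy
    have hcZ : c ∈ Z := by
      rw [← hk, Function.iterate_add_apply]
      have : (f.pt)^[2] y = f.pt (f.pt y) := rfl
      rw [this]
      clear hk
      induction k with
      | zero => exact hy
      | succ k ih => rw [Function.iterate_succ_apply']; exact hfw _ ih
    apply hE
    apply hZ.subset
    rintro b ⟨n, hn⟩
    have : ∀ n b, (f.pt)^[n] b ∈ Z → b ∈ Z := by
      intro n
      induction n with
      | zero => intro b hb; exact hb
      | succ n ih =>
        intro b hb
        apply ih
        rw [Function.iterate_succ_apply'] at hb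
        obtain ⟨z', hz', h3, h4⟩ := hbw _ hb
        rw [f.e_unique h4 h3.symm]; exact hz'
    exact this n b (by rw [hn]; exact hcZ)
  by_cases a1 : y = f.pt y
  · refine gen {y} (Set.finite_singleton _) ?_ ?_ ?_
    · rintro z rfl; exact a1.symm
    · rintro z rfl; exact ⟨z, rfl, a1.symm, h0⟩
    · rw [← a1, ← a1]; rfl
  by_cases a2 : f.pt y = f.pt (f.pt y)
  · refine gen {f.pt y} (Set.finite_singleton _) ?_ ?_ ?_
    · rintro z rfl; exact a2.symm
    · rintro z rfl; exact ⟨f.pt y, rfl, a2.symm, h1⟩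
    · exact a2.symm
  by_cases a3 : y = f.pt (f.pt y)
  · refine gen {y, f.pt y} (Set.toFinite _) ?_ ?_ ?_
    · rintro z (rfl | rfl)
      · right; rfl
      · left; exact a3.symm
    · rintro z (rfl | rfl)
      · exact ⟨f.pt z, Or.inr rfl, a3.symm, h1⟩
      · exact ⟨y, Or.inl rfl, rfl, h0⟩
    · left; exact a3.symm
  exact hG (three_ram f hd a1 a3 a2 h0 h1 h2)

theorem Pr.mult_bound (f : Pr 𝕜) (hd : 1 < f.deg) (hG : ¬ GoodNorm f) {c : OnePoint 𝕜}
    (hE : ¬ Set.Finite {b | ∃ n : ℕ, (f.pt)^[n] b = c}) {ε : ℝ} (hε : 0 < ε) :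
    ∃ l : ℕ, ∀ b, ((f.pullIt l c).count b : ℝ) ≤ ε * f.deg ^ l := by
  have hd0 : (0 : ℝ) < f.deg := by exact_mod_cast (by omega : 0 < f.deg)
  have step : ∀ (m : ℕ) (b : OnePoint 𝕜), (∃ k, (f.pt)^[k + 3 * m] b = c) →
      (∏ i ∈ Finset.range (3 * m), f.e ((f.pt)^[i] b)) ≤ ((f.deg - 1) * f.deg * f.deg) ^ m := by
    intro m b
    induction m with
    | zero => simp
    | succ m ih =>
      rintro ⟨k, hk⟩
      have ih' := ih ⟨k + 3, by rw [← hk]; congr 1; ring⟩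
      rw [show 3 * (m + 1) = 3 * m + 1 + 1 + 1 by ring, Finset.prod_range_succ, Finset.prod_range_succ, Finset.prod_range_succ,
        mul_assoc, mul_assoc, pow_succ]
      apply Nat.mul_le_mul ih'
      simp only [Function.iterate_succ_apply']
      set y := (f.pt)^[3 * m] b
      have b0 := f.e_le y
      have b1 := f.e_le (f.pt y)
      have b2 := f.e_le (f.pt (f.pt y))
      by_cases g0 : f.e y = f.deg
      · by_cases g1 : f.e (f.pt y) = f.deg
        · by_cases g2 : f.e (f.pt (f.pt y)) = f.deg
          · exfalso
            refine f.not_three hd hG hE (k := k + 1) ?_ g0 g1 g2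
            rw [← hk, ← Function.iterate_add_apply]; congr 1; ring
          · have : f.e (f.pt (f.pt y)) ≤ f.deg - 1 := by omega
            calc _ ≤ f.deg * (f.deg * (f.deg - 1)) := Nat.mul_le_mul b0 (Nat.mul_le_mul b1 this)
              _ = _ := by ring
        · have : f.e (f.pt y) ≤ f.deg - 1 := by omega
          calc _ ≤ f.deg * ((f.deg - 1) * f.deg) := Nat.mul_le_mul b0 (Nat.mul_le_mul this b2)
            _ = _ := by ring
      · have : f.e y ≤ f.deg - 1 := by omega
        calc _ ≤ (f.deg - 1) * (f.deg * f.deg) := Nat.mul_le_mul this (Nat.mul_le_mul b1 b2)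
          _ = _ := by ring
  have hr : ((f.deg - 1 : ℕ) : ℝ) / f.deg < 1 := by
    rw [div_lt_one hd0]; exact_mod_cast (by omega : f.deg - 1 < f.deg)
  obtain ⟨m, hm⟩ := exists_pow_lt_of_lt_one hε hr
  refine ⟨3 * m, fun b => ?_⟩
  by_cases hb : b ∈ f.pullIt (3 * m) c
  · have hb' := (f.mem_pullIt _ _ _).1 hb
    have h1 := step m b ⟨0, by rw [zero_add]; exact hb'⟩
    have h2 := f.count_pullIt (3 * m) b
    rw [hb'] at h2
    rw [h2]
    calc ((∏ i ∈ Finset.range (3 * m), f.e ((f.pt)^[i] b) : ℕ) : ℝ) ≤ (((f.deg - 1) * f.deg * f.deg) ^ m : ℕ) := by exact_mod_cast h1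
      _ = (((f.deg - 1 : ℕ) : ℝ) / f.deg) ^ m * f.deg ^ (3 * m) := by
        rw [pow_mul, div_pow, div_mul_eq_mul_div, ← mul_pow, ← div_pow]
        push_cast
        congr 1
        field_simp
      _ ≤ _ := mul_le_mul_of_nonneg_right hm.le (by positivity)
  · rw [Multiset.count_eq_zero.2 hb]; simp; positivity

end ram
end EQ

namespace EQ
section lim
variable {𝕜 : Type*} [NontriviallyNormedField 𝕜] [IsUltrametricDist 𝕜] [IsAlgClosed 𝕜]

theorem tendsto_of_bounds {u : ℕ → ℝ} {h : ℝ} (hup : ∀ η : ℝ, 0 < η → ∀ᶠ n in atTop, u n ≤ h + η)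
    (hlo : ∀ η : ℝ, 0 < η → ∀ᶠ n in atTop, h - η ≤ u n) : Tendsto u atTop (𝓝 h) := by
  rw [Metric.tendsto_nhds]
  intro ε hε
  filter_upwards [hup (ε / 2) (by linarith), hlo (ε / 2) (by linarith)] with n h1 h2
  rw [Real.dist_eq, abs_lt]; constructor <;> linarith

theorem ev_const_le {d : ℕ} (hd : 1 < d) (c : ℝ) {η : ℝ} (hη : 0 < η) : ∀ᶠ n : ℕ in atTop, c ≤ η * (d : ℝ) ^ n := by
  have h := (tendsto_pow_atTop_atTop_of_one_lt (show (1 : ℝ) < d by exact_mod_cast hd)).const_mul_atTop hη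
  exact h.eventually_ge_atTop c

theorem upper_aux {d : ℕ} (hd : 1 < d) {z w : ℕ → ℝ} {h C : ℝ} (hC : 0 < C)
    (hz : ∀ n, 0 < z n) (hh : Tendsto (fun n => Real.log (z n) / (d : ℝ) ^ n) atTop (𝓝 h))
    (hw : ∀ᶠ n in atTop, 0 < w n ∧ w n ≤ C * z n) {η : ℝ} (hη : 0 < η) :
    ∀ᶠ n in atTop, Real.log (w n) / (d : ℝ) ^ n ≤ h + η := by
  filter_upwards [hw, hh.eventually (gt_mem_nhds (show h < h + η / 2 by linarith)), ev_const_le hd (Real.log C) (show 0 < η / 2 by linarith)] with n h1 h2 h3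
  have hp : (0 : ℝ) < (d : ℝ) ^ n := by positivity
  have h4 : Real.log (w n) ≤ Real.log C + Real.log (z n) := by
    rw [← Real.log_mul hC.ne' (hz n).ne']; exact Real.log_le_log h1.1 h1.2
  rw [div_lt_iff₀ hp] at h2
  rw [div_le_iff₀ hp]; linarith

theorem Pr.gn_S_le (x y : Pr 𝕜) (a : 𝕜) {s : ℝ} (hs : 0 < s) :
    gn a s (x.A * y.B - y.A * x.B) ≤ y.sz a s * x.sz a s := by
  refine (gn_sub_le a hs _ _).trans ?_
  rw [gn_mul a hs, gn_mul a hs]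
  have := gn_nonneg a hs
  refine max_le ?_ ?_
  · rw [mul_comm]
    exact mul_le_mul (le_max_right _ _) (le_max_left _ _) (this _) ((this _).trans (le_max_left _ _))
  · exact mul_le_mul (le_max_left _ _) (le_max_right _ _) (this _) ((this _).trans (le_max_left _ _))

theorem Pr.lim_eq (f y : Pr 𝕜) (hd : 1 < f.deg) (hG : ¬ GoodNorm f) (a : 𝕜) {s : ℝ} (hs : 0 < s) {h : ℝ}
    (hh : Tendsto (fun n => Real.log ((Pr.it f Pr.idp n).sz a s) / (f.deg : ℝ) ^ n) atTop (𝓝 h)) :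
    (∀ᶠ n in atTop, (Pr.it f Pr.idp n).A * y.B - y.A * (Pr.it f Pr.idp n).B ≠ 0) ∧
    Tendsto (fun n => Real.log (gn a s ((Pr.it f Pr.idp n).A * y.B - y.A * (Pr.it f Pr.idp n).B)) / (f.deg : ℝ) ^ n) atTop (𝓝 h) := by
  have key : ∀ η : ℝ, 0 < η → ∀ᶠ n in atTop, Real.exp (-η * f.deg ^ n) * (gn a s (Pr.it f Pr.idp n).B * gn a s y.B) <
      gn a s ((Pr.it f Pr.idp n).A * y.B - y.A * (Pr.it f Pr.idp n).B) := by
    intro η hη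
    filter_upwards [est f y hd hG a hs hη] with n hn
    rw [Ctx.GN_diff _ _ _ hs, lt_div_iff₀ (mul_pos (gn_pos a hs (Pr.hB _)) (gn_pos a hs y.hB))] at hn
    exact hn
  have hpos : ∀ᶠ n in atTop, 0 < gn a s ((Pr.it f Pr.idp n).A * y.B - y.A * (Pr.it f Pr.idp n).B) := by
    filter_upwards [key 1 one_pos] with n hn
    exact lt_of_le_of_lt (mul_nonneg (Real.exp_pos _).le (mul_nonneg (gn_nonneg a hs _) (gn_nonneg a hs _))) hn
  refine ⟨?_, tendsto_of_bounds ?_ ?_⟩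
  · filter_upwards [hpos] with n hn h0
    rw [h0, gn_zero] at hn; exact lt_irrefl _ hn
  · intro η hη
    refine upper_aux hd (y.sz_pos a hs) (fun n => (Pr.it f Pr.idp n).sz_pos a hs) hh ?_ hη
    filter_upwards [hpos] with n hn
    exact ⟨hn, Pr.gn_S_le _ _ _ hs⟩
  · intro η hη
    have hyB : 0 < gn a s y.B := gn_pos a hs y.hB
    set M : ℝ := max 1 (gn a s y.A / gn a s y.B) / gn a s y.B with hM
    have hMpos : 0 < M := div_pos (lt_of_lt_of_le one_pos (le_max_left _ _)) hyB
    filter_upwards [hpos, key (η / 3) (by linarith), hh.eventually (lt_mem_nhds (show h - η / 3 < h by linarith)),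
      ev_const_le hd (Real.log M) (show 0 < η / 3 by linarith)] with n h1 h2 h3 h4
    set x := Pr.it f Pr.idp n
    set S := gn a s (x.A * y.B - y.A * x.B)
    have hp : (0 : ℝ) < (f.deg : ℝ) ^ n := by positivity
    set E := Real.exp (η / 3 * f.deg ^ n) with hE
    have hEpos : 0 < E := Real.exp_pos _
    have hE1 : 1 ≤ E := Real.one_le_exp (by positivity)
    have h2' : gn a s x.B * gn a s y.B ≤ E * S := by
      have e : Real.exp (-(η / 3) * f.deg ^ n) = E⁻¹ := by rw [hE, ← Real.exp_neg]; congr 1; ring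
      rw [e] at h2
      have := mul_le_mul_of_nonneg_left h2.le hEpos.le
      rwa [← mul_assoc, mul_inv_cancel₀ hEpos.ne', one_mul] at this
    have hA : gn a s x.A * gn a s y.B ≤ max S (gn a s y.A / gn a s y.B * (E * S)) := by
      rw [← gn_mul a hs, show x.A * y.B = (x.A * y.B - y.A * x.B) + y.A * x.B by ring]
      refine (gn_add_le a hs _ _).trans (max_le_max le_rfl ?_)
      rw [gn_mul a hs, div_mul_eq_mul_div, le_div_iff₀ hyB, mul_assoc]
      exact mul_le_mul_of_nonneg_left h2' (gn_nonneg a hs _)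
    have hES : 0 < E * S := mul_pos hEpos h1
    have hSE : S ≤ E * S := le_mul_of_one_le_left h1.le hE1
    have hmain : x.sz a s ≤ M * (E * S) := by
      rw [hM, div_mul_eq_mul_div, le_div_iff₀ hyB]
      unfold Pr.sz
      rw [max_mul_of_nonneg _ _ hyB.le]
      have m1 : E * S ≤ max 1 (gn a s y.A / gn a s y.B) * (E * S) := le_mul_of_one_le_left hES.le (le_max_left _ _)
      refine max_le (hA.trans (max_le (hSE.trans m1) (mul_le_mul_of_nonneg_right (le_max_right _ _) hES.le))) (h2'.trans m1)
    have h5 := Real.log_le_log (x.sz_pos a hs) hmain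
    rw [Real.log_mul hMpos.ne' hES.ne', Real.log_mul hEpos.ne' h1.ne', hE, Real.log_exp] at h5
    rw [lt_div_iff₀ hp] at h3
    rw [le_div_iff₀ hp]
    linarith

theorem sum_bad {ι : Type*} (m : Multiset ι) (F : ι → ℝ) (b : ι) {A T : ℝ} 
    (hF : ∀ q ∈ m, A - (if q = b then T else 0) ≤ F q) : m.card * A - m.count b * T ≤ (m.map F).sum := by
  induction m using Multiset.induction_on with
  | empty => simp
  | cons q m ih =>
    have h1 := ih (fun q' hq' => hF q' (Multiset.mem_cons_of_mem hq'))
    have h2 := hF q (Multiset.mem_cons_self q m)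
    rw [Multiset.map_cons, Multiset.sum_cons, Multiset.card_cons, Multiset.count_cons]
    by_cases hq : q = b
    · rw [if_pos hq] at h2
      rw [if_pos hq.symm]; push_cast; linarith
    · rw [if_neg hq] at h2
      rw [if_neg (Ne.symm hq)]; push_cast; linarith

theorem log_prod_map {ι : Type*} (m : Multiset ι) (F : ι → ℝ) (hF : ∀ q ∈ m, 0 < F q) :
    Real.log (m.map F).prod = (m.map fun q => Real.log (F q)).sum := by
  induction m using Multiset.induction_on with
  | empty => simp
  | cons q m ih =>
    have h1 : ∀ q' ∈ m, 0 < F q' := fun q' hq' => hF q' (Multiset.mem_cons_of_mem hq')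
    have h2 := hF q (Multiset.mem_cons_self q m)
    rw [Multiset.map_cons, Multiset.prod_cons, Multiset.map_cons, Multiset.sum_cons, ← ih h1, Real.log_mul h2.ne']
    apply ne_of_gt
    exact Multiset.prod_pos (by simpa using h1)

theorem one_le_norm_hc (q : OnePoint 𝕜) : 1 ≤ ‖hc q‖ := by
  induction q using OnePoint.rec with
  | infty => simp
  | coe z => 
    rw [Prod.norm_def]
    refine le_max_of_le_right ?_
    show (1 : ℝ) ≤ ‖(1 : 𝕜)‖
    simp

theorem Pr.lim_pull (f : Pr 𝕜) (hd : 1 < f.deg) (hG : ¬ GoodNorm f) {c : OnePoint 𝕜}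
    (hE : ¬ Set.Finite {b | ∃ n : ℕ, (f.pt)^[n] b = c}) (a : 𝕜) {s : ℝ} (hs : 0 < s) {h : ℝ}
    (hh : Tendsto (fun n => Real.log ((Pr.it f Pr.idp n).sz a s) / (f.deg : ℝ) ^ n) atTop (𝓝 h)) :
    Tendsto (fun n => Real.log (gn a s ((Pr.it f Pr.idp n).l (hc c))) / (f.deg : ℝ) ^ n) atTop (𝓝 h) := by
  have npos : ∀ n q, 0 < (Pr.it f Pr.idp n).nm a s (hc q) := fun n q => gn_pos a hs (Pr.l_ne_zero _ (hc_ne_zero q))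
  have zpos : ∀ n, 0 < (Pr.it f Pr.idp n).sz a s := fun n => Pr.sz_pos _ a hs
  refine tendsto_of_bounds ?_ ?_
  · intro η hη
    refine upper_aux hd (C := ‖hc c‖) (lt_of_lt_of_le one_pos (one_le_norm_hc c)) zpos hh ?_ hη
    exact Eventually.of_forall fun n => ⟨npos n c, Pr.nm_le _ _ hs _⟩
  · intro η hη
    obtain ⟨M, hM0, hM⟩ := f.nm_lower Pr.idp hd a hs
    obtain ⟨B0, hB0⟩ := hh.bddAbove_range
    obtain ⟨B, hB, hBz⟩ : ∃ B : ℝ, 0 ≤ B ∧ ∀ j, Real.log ((Pr.it f Pr.idp j).sz a s) ≤ B * (f.deg : ℝ) ^ j := by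
      refine ⟨max B0 0, le_max_right _ _, fun j => ?_⟩
      have h1 : _ ≤ B0 := hB0 ⟨j, rfl⟩
      have hp : (0 : ℝ) < (f.deg : ℝ) ^ j := by positivity
      rw [← div_le_iff₀ hp]
      exact h1.trans (le_max_left _ _)
    obtain ⟨l, hl⟩ := f.mult_bound hd hG hE (ε := η / (3 * (B + M + 1))) (by positivity)
    obtain ⟨k, hk, hkl⟩ := f.it_l l c
    obtain ⟨δ, hδ, hδ1, hsep⟩ := sep (f.pullIt l c).toFinset
    have hkp : 0 < ‖k‖ := norm_pos_iff.2 hk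
    have lower : ∀ j : ℕ, Real.log ‖k‖ + (f.deg : ℝ) ^ l * (Real.log δ + Real.log ((Pr.it f Pr.idp j).sz a s))
        - η / 3 * (f.deg : ℝ) ^ (l + j) ≤ Real.log ((Pr.it f Pr.idp (l + j)).nm a s (hc c)) := by
      intro j
      obtain ⟨q0, hq0⟩ : ∃ q0, ∀ q ∈ f.pullIt l c, q ≠ q0 → δ * (Pr.it f Pr.idp j).sz a s ≤ (Pr.it f Pr.idp j).nm a s (hc q) := by
        by_cases hall : ∀ q ∈ f.pullIt l c, δ * (Pr.it f Pr.idp j).sz a s ≤ (Pr.it f Pr.idp j).nm a s (hc q)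
        · exact ⟨OnePoint.infty, fun q hq _ => hall q hq⟩
        · push Not at hall
          obtain ⟨q0, hq0, hlt⟩ := hall
          refine ⟨q0, fun q hq hne => ?_⟩
          have := hsep q (Multiset.mem_toFinset.2 hq) q0 (Multiset.mem_toFinset.2 hq0) hne (Pr.it f Pr.idp j) a s hs
          rcases le_max_iff.1 this with h1 | h1
          · exact h1
          · linarith
      have e1 : (Pr.it f Pr.idp (l + j)).nm a s (hc c) = ‖k‖ * ((f.pullIt l c).map fun q => (Pr.it f Pr.idp j).nm a s (hc q)).prod := by
        unfold Pr.nm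
        rw [hkl, gn_mul a hs, gn_C, gn_multiset_prod a hs, Multiset.map_map]; rfl
      have ppos : 0 < ((f.pullIt l c).map fun q => (Pr.it f Pr.idp j).nm a s (hc q)).prod :=
        Multiset.prod_pos (by
          intro r hr
          obtain ⟨q, _, rfl⟩ := Multiset.mem_map.1 hr
          exact npos j q)
      rw [e1, Real.log_mul hkp.ne' ppos.ne', log_prod_map _ _ (fun q _ => npos j q)]
      have hs1 := sum_bad (f.pullIt l c) (fun q => Real.log ((Pr.it f Pr.idp j).nm a s (hc q))) q0
        (A := Real.log δ + Real.log ((Pr.it f Pr.idp j).sz a s)) (T := (B + M) * (f.deg : ℝ) ^ j) (by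
          intro q hq
          by_cases hqq : q = q0
          · rw [if_pos hqq]
            have h1 := hM j (hc q) (hc_ne_zero q)
            have h2 : Real.exp (-M * f.deg ^ j) ≤ (Pr.it f Pr.idp j).nm a s (hc q) :=
              le_trans (le_mul_of_one_le_right (Real.exp_pos _).le (one_le_norm_hc q)) h1
            have h3 := Real.log_le_log (Real.exp_pos _) h2
            rw [Real.log_exp] at h3
            have h4 := hBz j
            have h5 := Real.log_nonpos hδ.le hδ1
            linarith
          · rw [if_neg hqq, sub_zero, ← Real.log_mul hδ.ne' (zpos j).ne']
            exact Real.log_le_log (mul_pos hδ (zpos j)) (hq0 q hq hqq))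
      rw [Pr.card_pullIt] at hs1
      push_cast at hs1
      have h6 : ((f.pullIt l c).count q0 : ℝ) * ((B + M) * (f.deg : ℝ) ^ j) ≤ η / 3 * (f.deg : ℝ) ^ (l + j) := by
        have h7 := mul_le_mul_of_nonneg_right (hl q0) (show 0 ≤ (B + M) * (f.deg : ℝ) ^ j by positivity)
        refine h7.trans ?_
        have h8 : η / (3 * (B + M + 1)) * (B + M) ≤ η / 3 := by
          rw [div_mul_eq_mul_div, div_le_div_iff₀ (by positivity) (by positivity)]
          nlinarith
        calc η / (3 * (B + M + 1)) * (f.deg : ℝ) ^ l * ((B + M) * (f.deg : ℝ) ^ j) = η / (3 * (B + M + 1)) * (B + M) * (f.deg : ℝ) ^ (l + j) := by ring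
          _ ≤ _ := mul_le_mul_of_nonneg_right h8 (by positivity)
      linarith
    have fin : ∀ᶠ j in atTop, h - η ≤ Real.log ((Pr.it f Pr.idp (l + j)).nm a s (hc c)) / (f.deg : ℝ) ^ (l + j) := by
      filter_upwards [hh.eventually (lt_mem_nhds (show h - η / 3 < h by linarith)),
        ev_const_le hd (-(Real.log ‖k‖ + (f.deg : ℝ) ^ l * Real.log δ)) (show 0 < η / 3 by linarith)] with j h1 h2
      have hp : (0 : ℝ) < (f.deg : ℝ) ^ j := by positivity
      have hpl : (1 : ℝ) ≤ (f.deg : ℝ) ^ l := one_le_pow₀ (by exact_mod_cast hd.le)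
      have h3 := lower j
      rw [lt_div_iff₀ hp] at h1
      rw [le_div_iff₀ (by positivity)]
      have h4 := mul_le_mul_of_nonneg_left h1.le (show (0 : ℝ) ≤ (f.deg : ℝ) ^ l by positivity)
      have h5 : η / 3 * (f.deg : ℝ) ^ j ≤ η / 3 * (f.deg : ℝ) ^ (l + j) := by
        rw [pow_add]
        have : (f.deg : ℝ) ^ j ≤ (f.deg : ℝ) ^ l * (f.deg : ℝ) ^ j := le_mul_of_one_le_left hp.le hpl
        exact mul_le_mul_of_nonneg_left this (by linarith)
      rw [show (f.deg : ℝ) ^ l * ((h - η / 3) * (f.deg : ℝ) ^ j) = (h - η / 3) * (f.deg : ℝ) ^ (l + j) by ring] at h4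
      linarith
    obtain ⟨N, hN⟩ := eventually_atTop.1 fin
    refine eventually_atTop.2 ⟨l + N, fun n hn => ?_⟩
    obtain ⟨j, rfl⟩ := Nat.exists_eq_add_of_le (show l ≤ n by omega)
    exact hN j (by omega)

end lim
end EQ

section berk
variable (K : Type*) [NontriviallyNormedField K] [IsAlgClosed K] [CompleteSpace K] [IsUltrametricDist K]
/-! ### Partial progress: topology of the Berkovich line -/

theorem BerkA1.ext_toFun {x y : BerkA1 K} (h : x.toFun = y.toFun) : x = y := by
  cases x; cases y; simp_all

theorem BerkA1.injective_toFun : Function.Injective (BerkA1.toFun (K := K)) :=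
  fun _ _ h => BerkA1.ext_toFun K h

theorem BerkA1.map_one (x : BerkA1 K) : x.toFun 1 = 1 := by
  have := x.restricts' 1
  simpa using this

theorem BerkA1.map_pow (x : BerkA1 K) (p : K[X]) (n : ℕ) : x.toFun (p ^ n) = x.toFun p ^ n := by
  induction n with
  | zero => simpa using x.map_one
  | succ n ih => rw [pow_succ, x.map_mul', ih, pow_succ]

/-- A point is bounded by the coefficients and its value at the coordinate. -/
theorem BerkA1.le_sum (x : BerkA1 K) (p : K[X]) :
    x.toFun p ≤ ∑ i ∈ Finset.range (p.natDegree + 1), ‖p.coeff i‖ * x.toFun X ^ i := by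
  have h0 : x.toFun 0 = 0 := by simpa using x.restricts' 0
  have key : ∀ s : Finset ℕ, x.toFun (∑ i ∈ s, C (p.coeff i) * X ^ i)
      ≤ ∑ i ∈ s, ‖p.coeff i‖ * x.toFun X ^ i := by
    intro s
    induction s using Finset.induction_on with
    | empty => simp [h0]
    | insert a s ha ih =>
      rw [Finset.sum_insert ha, Finset.sum_insert ha]
      refine (x.add_le' _ _).trans (add_le_add ?_ ih)
      rw [x.map_mul', x.restricts', x.map_pow]
  conv_lhs => rw [p.as_sum_range_C_mul_X_pow]
  exact key _

theorem BerkA1.isEmbedding : IsEmbedding (BerkA1.toFun (K := K)) :=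
  ⟨⟨rfl⟩, BerkA1.injective_toFun K⟩

instance : T2Space (BerkA1 K) := (BerkA1.isEmbedding K).t2Space

theorem BerkA1.continuous_eval (p : K[X]) : Continuous fun x : BerkA1 K => x.toFun p :=
  (continuous_apply p).comp (BerkA1.isEmbedding K).continuous

/-- The Berkovich closed discs around the origin are compact (Tychonoff). -/
theorem BerkA1.isCompact_ball (R : ℝ) : IsCompact {x : BerkA1 K | x.toFun X ≤ R} := by
  rw [(BerkA1.isEmbedding K).isCompact_iff]
  have hc : IsCompact (Set.pi Set.univ fun p : K[X] => Set.Icc (0 : ℝ)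
      (∑ i ∈ Finset.range (p.natDegree + 1), ‖p.coeff i‖ * R ^ i)) :=
    isCompact_univ_pi fun _ => isCompact_Icc
  let T : Set (K[X] → ℝ) := {v | (∀ p, 0 ≤ v p) ∧ (∀ p q, v (p * q) = v p * v q) ∧
    (∀ p q, v (p + q) ≤ v p + v q) ∧ (∀ c : K, v (C c) = ‖c‖) ∧ v X ≤ R}
  have hT : IsClosed T := by
    simp only [T, Set.setOf_and, Set.setOf_forall]
    refine ((isClosed_iInter fun p => ?_).inter ((isClosed_iInter fun p => isClosed_iInter
      fun q => ?_).inter ((isClosed_iInter fun p => isClosed_iInter fun q => ?_).inter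
      ((isClosed_iInter fun c => ?_).inter ?_))))
    · exact isClosed_le continuous_const (continuous_apply p)
    · exact isClosed_eq (continuous_apply _) ((continuous_apply p).mul (continuous_apply q))
    · exact isClosed_le (continuous_apply _) ((continuous_apply p).add (continuous_apply q))
    · exact isClosed_eq (continuous_apply _) continuous_const
    · exact isClosed_le (continuous_apply _) continuous_const
  refine (hc.inter_right hT).of_isClosed_subset ?_ ?_
  · have : BerkA1.toFun '' {x : BerkA1 K | x.toFun X ≤ R} = T := by
      ext v
      constructor
      · rintro ⟨x, hx, rfl⟩
        exact ⟨x.nonneg', x.map_mul', x.add_le', x.restricts', hx⟩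
      · rintro ⟨h1, h2, h3, h4, h5⟩
        exact ⟨⟨v, h1, h2, h3, h4⟩, h5, rfl⟩
    rw [this]; exact hT
  · rintro _ ⟨x, hx, rfl⟩
    refine ⟨fun p _ => ⟨x.nonneg' p, (x.le_sum K p).trans ?_⟩,
      x.nonneg', x.map_mul', x.add_le', x.restricts', hx⟩
    refine Finset.sum_le_sum fun i _ => ?_
    exact mul_le_mul_of_nonneg_left (pow_le_pow_left₀ (x.nonneg' X) hx i) (norm_nonneg _)

instance : LocallyCompactSpace (BerkA1 K) := by
  have : WeaklyLocallyCompactSpace (BerkA1 K) := ⟨fun x =>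
    ⟨_, BerkA1.isCompact_ball K (x.toFun X + 1),
      Filter.mem_of_superset ((isOpen_lt (BerkA1.continuous_eval K X)
        (continuous_const (y := x.toFun X + 1))).mem_nhds (by simp))
        (fun y hy => by
          have h : y.toFun X < x.toFun X + 1 := hy
          exact h.le)⟩⟩
  infer_instance

end berk

namespace EQ
section red
variable {𝕜 : Type*} [NontriviallyNormedField 𝕜] [IsUltrametricDist 𝕜] [IsAlgClosed 𝕜]

theorem Pr.val_coe (f : Pr 𝕜) (z : 𝕜) : f.val (z, 1) = (f.A.eval z, f.B.eval z) := by
  unfold Pr.val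
  rw [hv_of_ne (show f.A.natDegree ≤ f.deg from le_max_left _ _) (v := (z, 1)) (by simp),
    hv_of_ne (show f.B.natDegree ≤ f.deg from le_max_right _ _) (v := (z, 1)) (by simp)]
  simp

theorem Pr.val_inf (f : Pr 𝕜) : f.val (1, 0) = f.lead := by
  unfold Pr.val
  rw [hv_of_eq _ _ rfl, hv_of_eq _ _ rfl]
  simp [Pr.lead]

theorem Pr.val_comp (f x : Pr 𝕜) (q : OnePoint 𝕜) : (f.comp x).val (hc q) = f.val (x.val (hc q)) := by
  induction q using OnePoint.rec with
  | infty => rw [hc_infty, Pr.val_inf, Pr.val_inf, Pr.comp_lead]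
  | coe z =>
    show (f.comp x).val (z, 1) = f.val (x.val (z, 1))
    rw [Pr.val_coe, Pr.val_coe]
    show ((hm f.deg f.A x.A x.B).eval z, (hm f.deg f.B x.A x.B).eval z) = _
    rw [hm_eval, hm_eval]; rfl

theorem mob_deg (v w : 𝕜 × 𝕜) (h : wd v w ≠ 0) : (Pr.mob v w h).deg = 1 := by
  apply le_antisymm
  · refine max_le ?_ ?_
    · refine (natDegree_add_le _ _).trans (max_le ?_ ?_)
      · simp
      · exact (natDegree_C_mul_le _ _).trans natDegree_X_le
    · refine (natDegree_add_le _ _).trans (max_le ?_ ?_)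
      · simp
      · exact (natDegree_C_mul_le _ _).trans natDegree_X_le
  · exact Pr.deg_pos _

theorem mob_val (v w : 𝕜 × 𝕜) (h : wd v w ≠ 0) (z : 𝕜 × 𝕜) : (Pr.mob v w h).val z = z.2 • v + z.1 • w := by
  unfold Pr.val hv
  rw [mob_deg]
  refine Prod.ext ?_ ?_
  · simp [Finset.sum_range_succ, Pr.mob, coeff_C, coeff_X]; ring
  · simp [Finset.sum_range_succ, Pr.mob, coeff_C, coeff_X]; ring

theorem gn_le_of_eval {P : 𝕜[X]} {L : ℝ} {d : ℕ} (hL : 0 < L) (h : ∀ z : 𝕜, ‖P.eval z‖ ≤ L * max ‖z‖ 1 ^ d) :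
    gn 0 1 P ≤ L := by
  have key : ∀ᶠ t in 𝓝[>] (1 : ℝ), gn 0 1 P ≤ L * t ^ d := by
    filter_upwards [exists_gap (0 : 𝕜) 1 P, self_mem_nhdsWithin] with t ht ht1
    obtain ⟨z, hz1, hzt⟩ := exists_norm_between (𝕜 := 𝕜) zero_le_one ht1
    have e : ‖P.eval z‖ = gn 0 ‖z‖ P := by
      rw [gn_eq_prod 0 (by linarith) P]
      conv_lhs => rw [(IsAlgClosed.splits P).eq_prod_roots]
      rw [eval_mul, eval_C, norm_mul, eval_multiset_prod, Multiset.map_map, norm_multiset_prod]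
      congr 2
      refine Multiset.map_congr rfl fun r hr => ?_
      have hr' := ht r hr
      simp only [zero_sub, norm_neg, Function.comp, eval_sub, eval_X, eval_C] at hr' ⊢
      by_cases h1 : ‖r‖ ≤ 1
      · rw [max_eq_right (by linarith), sub_eq_add_neg, IsUltrametricDist.norm_add_eq_max_of_norm_ne_norm, norm_neg, max_eq_left (by linarith)]
        rw [norm_neg]; exact ne_of_gt (by linarith)
      · have h2 : t ≤ ‖r‖ := by
          by_contra h3; exact h1 (hr'.1 (by linarith))
        rw [max_eq_left (by linarith), sub_eq_add_neg, IsUltrametricDist.norm_add_eq_max_of_norm_ne_norm, norm_neg, max_eq_right (by linarith)]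
        rw [norm_neg]; exact ne_of_lt (by linarith)
    calc gn 0 1 P ≤ gn 0 ‖z‖ P := gn_mono _ one_pos hz1.le P
      _ = ‖P.eval z‖ := e.symm
      _ ≤ L * max ‖z‖ 1 ^ d := h z
      _ ≤ L * t ^ d := by rw [max_eq_left hz1.le]; gcongr
  have lim : Tendsto (fun t : ℝ => L * t ^ d) (𝓝[>] 1) (𝓝 (L * 1 ^ d)) := 
    ((continuous_const.mul (continuous_pow d)).tendsto 1).mono_left nhdsWithin_le_nhds
  rw [one_pow, mul_one] at lim
  exact ge_of_tendsto lim key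

theorem coeff_le_of_eval {P : 𝕜[X]} {L : ℝ} {d : ℕ} (hL : 0 < L) (h : ∀ z : 𝕜, ‖P.eval z‖ ≤ L * max ‖z‖ 1 ^ d) (i : ℕ) :
    ‖P.coeff i‖ ≤ L := by
  have := (le_gn 0 one_pos P i).trans (gn_le_of_eval hL h)
  simpa using this

end red

section red2
variable {K : Type*} [NontriviallyNormedField K] [IsAlgClosed K] [CompleteSpace K] [IsUltrametricDist K]

theorem rdeg_rat (x : Pr K) : rdeg K x.rat = x.deg :=
  Pr.rat_eq_deg (x := Pr.of x.rat x.rat_NC) (Pr.of_rat _ _)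

theorem norm_root_le (p : Polynomial (intRing K)) (hp : p.Monic) {z : K} (hz : (toK K p).eval z = 0) : ‖z‖ ≤ 1 := by
  by_contra hcon
  push Not at hcon
  have hn : (toK K p).natDegree = p.natDegree := hp.natDegree_map _
  have hm : (toK K p).Monic := hp.map _
  rw [hm.as_sum, eval_add, eval_pow, eval_X, eval_finset_sum, add_eq_zero_iff_eq_neg] at hz
  by_cases h0 : (toK K p).natDegree = 0
  · rw [h0] at hz; simp at hz
  have h1 : ‖∑ i ∈ Finset.range (toK K p).natDegree, eval z (C ((toK K p).coeff i) * X ^ i)‖ ≤ ‖z‖ ^ ((toK K p).natDegree - 1) := by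
    refine IsUltrametricDist.norm_sum_le_of_forall_le_of_nonneg (by positivity) fun i hi => ?_
    rw [eval_mul, eval_C, eval_pow, eval_X, norm_mul, norm_pow]
    have h2 : ‖(toK K p).coeff i‖ ≤ 1 := by
      unfold toK; rw [coeff_map]; exact (p.coeff i).2
    have h3 : ‖z‖ ^ i ≤ ‖z‖ ^ ((toK K p).natDegree - 1) := pow_le_pow_right₀ hcon.le (by have := Finset.mem_range.1 hi; omega)
    calc _ ≤ 1 * ‖z‖ ^ i := by gcongr
      _ ≤ _ := by rw [one_mul]; exact h3
  have h4 := congrArg norm hz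
  rw [norm_neg, norm_pow] at h4
  rw [← h4] at h1
  have h5 : ‖z‖ ^ ((toK K p).natDegree - 1) < ‖z‖ ^ (toK K p).natDegree := pow_lt_pow_right₀ hcon (by omega)
  linarith

theorem mem_maxIdeal (x : intRing K) : x ∈ maxIdeal K ↔ ‖(x : K)‖ < 1 := Iff.rfl

theorem maxIdeal_isMaximal : (maxIdeal K).IsMaximal := by
  rw [Ideal.isMaximal_iff]
  refine ⟨by rw [mem_maxIdeal]; simp, fun J x hJ hx hxJ => ?_⟩
  rw [mem_maxIdeal] at hx
  have h1 : ‖(x : K)‖ = 1 := le_antisymm x.2 (not_lt.1 hx)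
  have h2 : (x : K) ≠ 0 := by rw [← norm_pos_iff, h1]; exact one_pos
  have h3 : (⟨(x : K)⁻¹, by show ‖(x : K)⁻¹‖ ≤ 1; rw [norm_inv, h1, inv_one]⟩ : intRing K) * x ∈ J := J.mul_mem_left _ hxJ
  convert h3
  apply Subtype.ext
  simp [h2]

/-- a common zero of the reductions lifts to an integral point where both values are small -/
theorem exists_common (P Q : Polynomial (intRing K)) (h0 : redPoly K P ≠ 0 ∨ redPoly K Q ≠ 0)
    (h : ¬ IsCoprime (redPoly K P) (redPoly K Q)) :
    ∃ z : K, ‖z‖ ≤ 1 ∧ ‖(toK K P).eval z‖ < 1 ∧ ‖(toK K Q).eval z‖ < 1 := by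
  haveI := maxIdeal_isMaximal (K := K)
  letI : Field (residueRing K) := Ideal.Quotient.field (maxIdeal K)
  obtain ⟨p, hpm, hpd, hpP, hpQ⟩ : ∃ p : Polynomial (residueRing K), p.Monic ∧ p.natDegree ≠ 0 ∧ p ∣ redPoly K P ∧ p ∣ redPoly K Q := by
    have h1 : ∃ p : Polynomial (residueRing K), Irreducible p ∧ p ∣ redPoly K P ∧ p ∣ redPoly K Q := by
      by_contra hcon
      push Not at hcon
      refine h (isCoprime_of_irreducible_dvd ?_ fun p hp h1 h2 => hcon p hp h1 h2)
      rintro ⟨h1, h2⟩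
      rcases h0 with h0 | h0
      · exact h0 h1
      · exact h0 h2
    obtain ⟨p, hp, h1, h2⟩ := h1
    have hlc : p.leadingCoeff ≠ 0 := leadingCoeff_ne_zero.2 hp.ne_zero
    have hu : IsUnit (C p.leadingCoeff⁻¹) := isUnit_C.2 (isUnit_iff_ne_zero.2 (inv_ne_zero hlc))
    refine ⟨p * C p.leadingCoeff⁻¹, monic_mul_leadingCoeff_inv hp.ne_zero, ?_, ?_, ?_⟩
    · rw [natDegree_mul_C (inv_ne_zero hlc)]
      exact hp.natDegree_pos.ne'
    · exact (hu.mul_right_dvd).2 h1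
    · exact (hu.mul_right_dvd).2 h2
  have hlift : p ∈ Polynomial.lifts (Ideal.Quotient.mk (maxIdeal K)) := by
    rw [Polynomial.mem_lifts] 
    exact Polynomial.map_surjective _ Ideal.Quotient.mk_surjective p
  obtain ⟨p', hp'1, hp'2, hp'3⟩ := Polynomial.lifts_and_natDegree_eq_and_monic hlift hpm
  have hdeg : (toK K p').degree ≠ 0 := by
    have e : (toK K p').natDegree = p.natDegree := by
      rw [← hp'2]; exact hp'3.natDegree_map _
    intro h1
    rw [natDegree_eq_of_degree_eq_some h1] at e
    exact hpd e.symm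
  obtain ⟨z, hz⟩ := IsAlgClosed.exists_root _ hdeg
  have hz1 := norm_root_le p' hp'3 hz
  have hz0 : p'.eval (⟨z, hz1⟩ : intRing K) = 0 := by
    apply Subtype.ext
    have : (toK K p').eval ((intRing K).subtype ⟨z, hz1⟩) = (intRing K).subtype (p'.eval ⟨z, hz1⟩) := eval_map_apply _ _
    exact this.symm.trans hz
  have main : ∀ R : Polynomial (intRing K), p ∣ redPoly K R → ‖(toK K R).eval z‖ < 1 := by
    rintro R ⟨q, hq⟩
    have h1 : (redPoly K R).eval (Ideal.Quotient.mk (maxIdeal K) ⟨z, hz1⟩) = Ideal.Quotient.mk (maxIdeal K) (R.eval ⟨z, hz1⟩) := eval_map_apply _ _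
    have h2 : p.eval (Ideal.Quotient.mk (maxIdeal K) ⟨z, hz1⟩) = 0 := by
      rw [← hp'1, eval_map_apply, hz0, map_zero]
    rw [hq, eval_mul, h2, zero_mul] at h1
    have h3 := Ideal.Quotient.eq_zero_iff_mem.1 h1.symm
    rw [mem_maxIdeal] at h3
    have h4 : (toK K R).eval ((intRing K).subtype ⟨z, hz1⟩) = (intRing K).subtype (R.eval ⟨z, hz1⟩) := eval_map_apply _ _
    have h5 : (toK K R).eval z = ((R.eval (⟨z, hz1⟩ : intRing K) : intRing K) : K) := h4
    rw [h5]; exact h3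
  exact ⟨z, hz1, main P hpP, main Q hpQ⟩

theorem norm_prod_eq (v : K × K) : ‖v‖ = max ‖v.1‖ ‖v.2‖ := rfl

theorem not_goodNorm (f : RatFunc K) (hf : NC f) (hN : NoPotentiallyGoodReductions K f) : ¬ GoodNorm (Pr.of f hf) := by
  rintro ⟨N, u, w, hO, Λ, hΛ, hfN⟩
  set F := Pr.of f hf with hF
  have hD := hO.ind
  have hDp : 0 < ‖wd u w‖ := norm_pos_iff.2 hD
  have hD1 : wd w u ≠ 0 := by rw [wd_comm]; exact neg_ne_zero.2 hD
  have hD2 : wd (w.1, -u.1) (-w.2, u.2) ≠ 0 := by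
    have : wd (w.1, -u.1) (-w.2, u.2) = - wd u w := by simp only [wd]; ring
    rw [this]; exact neg_ne_zero.2 hD
  set ψ := Pr.mob w u hD1 with hψ
  set φ := Pr.mob (w.1, -u.1) (-w.2, u.2) hD2 with hφ
  set H := (φ.comp F).comp ψ with hH
  have hφv : ∀ v, φ.val v = (wd v w, wd u v) := by
    intro v
    rw [hφ, mob_val]
    refine Prod.ext ?_ ?_
    · simp [wd]; ring
    · simp [wd]; ring
  have hφN : ∀ v, ‖φ.val v‖ = ‖wd u w‖ * N v := by
    intro v
    rw [hφv, norm_prod_eq]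
    conv_rhs => rw [wd_coord hD v, hO.eq, norm_div, norm_div, max_div_div_right hDp.le, mul_div_cancel₀ _ hDp.ne']
  have hψN : ∀ v, N (ψ.val v) = ‖v‖ := by
    intro v
    rw [hψ, mob_val, add_comm, hO.eq, norm_prod_eq]
  have hHdeg : H.deg = F.deg := by
    rw [hH, Pr.comp_deg, Pr.comp_deg, hφ, hψ, mob_deg, mob_deg]; ring
  have hψne : ∀ q, ψ.val (hc q) ≠ 0 := fun q => ψ.val_ne_zero (Pr.hc_ne_zero q)
  have hL : 0 < ‖wd u w‖ * Λ := mul_pos hDp hΛ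
  obtain ⟨L, hLd⟩ : ∃ L, L = ‖wd u w‖ * Λ := ⟨_, rfl⟩
  rw [← hLd] at hL
  have hHval : ∀ q : OnePoint K, ‖H.val (hc q)‖ = L * ‖hc q‖ ^ F.deg := by
    intro q
    rw [hH, Pr.val_comp]
    obtain ⟨t, q', ht, hq'⟩ := exists_hc (hψne q)
    have : (φ.comp F).val (ψ.val (hc q)) = φ.val (F.val (ψ.val (hc q))) := by
      rw [hq', Pr.val_smul, Pr.val_comp, Pr.val_smul F, Pr.val_smul φ, Pr.comp_deg, hφ, mob_deg, one_mul, pow_one]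
    rw [this, hφN, hfN _ (hψne q), hψN, hLd, mul_assoc]
  have hHz : ∀ z : K, max ‖H.A.eval z‖ ‖H.B.eval z‖ = L * max ‖z‖ 1 ^ F.deg := by
    intro z
    have h1 := hHval (z : OnePoint K)
    have h2 : H.val (hc (z : OnePoint K)) = (H.A.eval z, H.B.eval z) := Pr.val_coe H z
    have h3 : ‖hc (z : OnePoint K)‖ = max ‖z‖ 1 := by
      show max ‖z‖ ‖(1 : K)‖ = _
      rw [norm_one]
    rw [h2, h3] at h1
    exact h1
  have hHi : max ‖H.A.coeff H.deg‖ ‖H.B.coeff H.deg‖ = L := by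
    have h1 := hHval OnePoint.infty
    have h3 : ‖hc (OnePoint.infty : OnePoint K)‖ = 1 := by simp
    rw [h3, one_pow, mul_one, hc_infty, Pr.val_inf] at h1
    exact h1
  have cA : ∀ i, ‖H.A.coeff i‖ ≤ L := coeff_le_of_eval hL fun z => by rw [← hHz]; exact le_max_left _ _
  have cB : ∀ i, ‖H.B.coeff i‖ ≤ L := coeff_le_of_eval hL fun z => by rw [← hHz]; exact le_max_right _ _
  obtain ⟨κ, hκ⟩ : ∃ κ : K, ‖κ‖ = L := by
    rcases max_choice ‖H.A.coeff H.deg‖ ‖H.B.coeff H.deg‖ with h | h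
    · exact ⟨_, h.symm.trans hHi⟩
    · exact ⟨_, h.symm.trans hHi⟩
  have hκ0 : κ ≠ 0 := by rw [← norm_pos_iff, hκ]; exact hL
  have lift : ∀ R : K[X], (∀ i, ‖R.coeff i‖ ≤ L) → ∃ P : Polynomial (intRing K), toK K P = C κ⁻¹ * R := by
    intro R hR
    have h1 : ((C κ⁻¹ * R).coeffs : Set K) ⊆ intRing K := by
      intro c hc1
      obtain ⟨i, _, hi⟩ := Polynomial.mem_coeffs_iff.1 hc1
      show ‖c‖ ≤ 1
      rw [hi, coeff_C_mul, norm_mul, norm_inv, hκ, inv_mul_le_iff₀ hL, mul_one]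
      exact hR i
    exact ⟨(C κ⁻¹ * R).toSubring (intRing K) h1, Polynomial.map_toSubring _ _ _⟩
  obtain ⟨P, hP⟩ := lift H.A cA
  obtain ⟨Q, hQ⟩ := lift H.B cB
  have hCκ : (C κ⁻¹ : K[X]) ≠ 0 := C_ne_zero.2 (inv_ne_zero hκ0)
  have hCu : IsUnit (C κ⁻¹ : K[X]) := isUnit_C.2 (isUnit_iff_ne_zero.2 (inv_ne_zero hκ0))
  have pc : ∀ (R : K[X]) (P : Polynomial (intRing K)), toK K P = C κ⁻¹ * R → ∀ i, ‖(P.coeff i : K)‖ = ‖R.coeff i‖ / L := by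
    intro R P hP i
    have : (P.coeff i : K) = (toK K P).coeff i := by unfold toK; rw [coeff_map]; rfl
    rw [this, hP, coeff_C_mul, norm_mul, norm_inv, hκ]; field_simp
  have hnorm : ‖(P.coeff H.deg : K)‖ = 1 ∨ ‖(Q.coeff H.deg : K)‖ = 1 := by
    rw [pc _ _ hP, pc _ _ hQ]
    rcases max_choice ‖H.A.coeff H.deg‖ ‖H.B.coeff H.deg‖ with h | h
    · left; rw [← h, hHi, div_self hL.ne']
    · right; rw [← h, hHi, div_self hL.ne']
  have hlift : IsNormalizedLift K (rcomp K (rcomp K φ.rat f) ψ.rat) P Q := by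
    have e : rcomp K (rcomp K φ.rat f) ψ.rat = H.rat := by
      rw [hH, Pr.comp_rat, Pr.comp_rat, hF, Pr.of_rat]; rfl
    rw [e]
    refine ⟨?_, ?_, ?_, ?_, H.deg, hnorm⟩
    · rw [hQ]; exact mul_ne_zero hCκ H.hB
    · rw [hP, hQ]; exact (isCoprime_mul_unit_left hCu _ _).2 H.cop
    · rw [hP, hQ, natDegree_C_mul (inv_ne_zero hκ0), natDegree_C_mul (inv_ne_zero hκ0), rdeg_rat]; rfl
    · rw [hP, hQ, map_mul, map_mul]
      unfold Pr.rat
      have := H.hb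
      field_simp
  have hinv : rcomp K φ.rat ψ.rat = RatFunc.X := by
    have e : rcomp K φ.rat ψ.rat = (φ.comp ψ).rat := (Pr.comp_rat _ _).symm
    rw [e]
    have hA : (φ.comp ψ).A = C (wd u w) * X := by
      show hm φ.deg φ.A ψ.A ψ.B = _
      rw [hφ, mob_deg, hψ]
      simp [hm, Finset.sum_range_succ, Pr.mob, coeff_C, coeff_X, wd]; ring
    have hB : (φ.comp ψ).B = C (wd u w) := by
      show hm φ.deg φ.B ψ.A ψ.B = _
      rw [hφ, mob_deg, hψ]
      simp [hm, Finset.sum_range_succ, Pr.mob, coeff_C, coeff_X, wd]; ring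
    unfold Pr.rat
    rw [hA, hB, map_mul, RatFunc.algebraMap_X]
    have : (algebraMap K[X] (RatFunc K)) (C (wd u w)) ≠ 0 :=
      (map_ne_zero_iff _ (RatFunc.algebraMap_injective K)).2 (C_ne_zero.2 hD)
    field_simp
  have hdrop := hN φ.rat ψ.rat (by rw [rdeg_rat, hφ, mob_deg]) (by rw [rdeg_rat, hψ, mob_deg]) hinv P Q hlift
  have hd' : rdeg K f = H.deg := by rw [hHdeg]; rfl
  rw [hd'] at hdrop
  have nz : ∀ P : Polynomial (intRing K), ‖(P.coeff H.deg : K)‖ = 1 → (redPoly K P).coeff H.deg ≠ 0 := by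
    intro P hP h1
    unfold redPoly at h1
    rw [coeff_map] at h1
    have := Ideal.Quotient.eq_zero_iff_mem.1 h1
    rw [mem_maxIdeal, hP] at this
    exact lt_irrefl _ this
  rcases hdrop with hdrop | ⟨h1, h2⟩
  · obtain ⟨z, hz, hz1, hz2⟩ := exists_common P Q (by
      rcases hnorm with h | h
      · left; intro h0; apply nz P h; rw [h0, coeff_zero]
      · right; intro h0; apply nz Q h; rw [h0, coeff_zero]) hdrop
    rw [hP, eval_mul, eval_C, norm_mul, norm_inv, hκ, inv_mul_lt_iff₀ hL, mul_one] at hz1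
    rw [hQ, eval_mul, eval_C, norm_mul, norm_inv, hκ, inv_mul_lt_iff₀ hL, mul_one] at hz2
    have h3 := hHz z
    rw [max_eq_right hz, one_pow, mul_one] at h3
    have h4 := max_lt hz1 hz2
    rw [h3] at h4
    exact lt_irrefl _ h4
  · rcases hnorm with h | h
    · exact nz P h (coeff_eq_zero_of_natDegree_lt h1)
    · exact nz Q h (coeff_eq_zero_of_natDegree_lt h2)

end red2
end EQ

namespace EQ
section interval

/-- Truncated logarithm on the extended half-line. -/
noncomputable def lr (r R : ℝ) (hr : 0 < r) : C(ENNReal, ℝ) where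
  toFun u := Real.log (max r (ENNReal.truncateToReal (ENNReal.ofReal R) u))
  continuous_toFun := by
    refine Continuous.log ?_ (fun u => (lt_of_lt_of_le hr (le_max_left _ _)).ne')
    exact continuous_const.max (ENNReal.continuous_truncateToReal ENNReal.ofReal_ne_top)

theorem lr_ofReal {r R : ℝ} (hr : 0 < r) (hR : r ≤ R) {v : ℝ} (hv : 0 ≤ v) :
    lr r R hr (ENNReal.ofReal v) = Real.log (max r (min R v)) := by
  show Real.log (max r (min (ENNReal.ofReal R) (ENNReal.ofReal v)).toReal) = _
  rw [← ENNReal.ofReal_min, ENNReal.toReal_ofReal (le_min (hr.le.trans hR) hv)]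

theorem lr_top {r R : ℝ} (hr : 0 < r) (hR : r ≤ R) :
    lr r R hr ⊤ = Real.log R := by
  show Real.log (max r (min (ENNReal.ofReal R) ⊤).toReal) = _
  rw [min_eq_left le_top, ENNReal.toReal_ofReal (hr.le.trans hR), max_eq_right hR]

theorem lr_le {r R : ℝ} (hr : 0 < r) (hR : r ≤ R) {u : ENNReal} (hu : u ≤ ENNReal.ofReal r) :
    lr r R hr u = Real.log r := by
  have hu' : u ≠ ⊤ := ne_top_of_le_ne_top ENNReal.ofReal_ne_top hu
  rw [← ENNReal.ofReal_toReal hu', lr_ofReal hr hR ENNReal.toReal_nonneg]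
  have : u.toReal ≤ r := ENNReal.toReal_le_of_le_ofReal hr.le hu
  rw [max_eq_left ((min_le_right _ _).trans this)]

theorem lr_ge {r R : ℝ} (hr : 0 < r) (hR : r ≤ R) {u : ENNReal} (hu : ENNReal.ofReal R ≤ u) :
    lr r R hr u = Real.log R := by
  show Real.log (max r (min (ENNReal.ofReal R) u).toReal) = _
  rw [min_eq_left hu, ENNReal.toReal_ofReal (hr.le.trans hR), max_eq_right hR]

theorem lr_mem {r R : ℝ} (hr : 0 < r) (hR : r ≤ R) (u : ENNReal) :
    Real.log r ≤ lr r R hr u ∧ lr r R hr u ≤ Real.log R := by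
  show Real.log r ≤ Real.log _ ∧ Real.log _ ≤ Real.log R
  constructor
  · exact Real.log_le_log hr (le_max_left _ _)
  · refine Real.log_le_log (lt_of_lt_of_le hr (le_max_left _ _)) (max_le hR ?_)
    have := ENNReal.truncateToReal_le (t := ENNReal.ofReal R) ENNReal.ofReal_ne_top (x := u)
    rwa [ENNReal.toReal_ofReal (hr.le.trans hR)] at this

theorem exists_ramp (S : Submodule ℝ C(ENNReal, ℝ)) (h1 : (1 : C(ENNReal, ℝ)) ∈ S)
    (hS : ∀ (r R : ℝ) (hr : 0 < r), r < R → lr r R hr ∈ S) {p q : ENNReal} (hp : 0 < p)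
    (hpq : p < q) (hq : q < ⊤) :
    ∃ ρ ∈ S, (∀ u ≤ p, ρ u = 0) ∧ (∀ u, q ≤ u → ρ u = 1) ∧ ∀ u, 0 ≤ ρ u ∧ ρ u ≤ 1 := by
  have hp' : 0 < p.toReal := ENNReal.toReal_pos hp.ne' (hpq.trans hq).ne
  have hlt : p.toReal < q.toReal := (ENNReal.toReal_lt_toReal (hpq.trans hq).ne hq.ne).2 hpq
  have hl : 0 < Real.log q.toReal - Real.log p.toReal := by
    have := Real.log_lt_log hp' hlt; linarith
  refine ⟨(Real.log q.toReal - Real.log p.toReal)⁻¹ •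
    (lr p.toReal q.toReal hp' - Real.log p.toReal • (1 : C(ENNReal, ℝ))),
    S.smul_mem _ (S.sub_mem (hS _ _ _ hlt) (S.smul_mem _ h1)), ?_, ?_, ?_⟩
  · intro u hu
    have := lr_le hp' hlt.le (u := u) (by rwa [ENNReal.ofReal_toReal (hpq.trans hq).ne])
    simp [this]
  · intro u hu
    have := lr_ge hp' hlt.le (u := u) (by rwa [ENNReal.ofReal_toReal hq.ne])
    simp [this, hl.ne']
  · intro u
    obtain ⟨h1, h2⟩ := lr_mem hp' hlt.le u
    simp only [ContinuousMap.smul_apply, ContinuousMap.sub_apply, ContinuousMap.one_apply,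
      smul_eq_mul, mul_one]
    constructor
    · exact mul_nonneg (inv_nonneg.2 hl.le) (by linarith)
    · rw [inv_mul_le_iff₀ hl]; linarith

/-- The truncated logarithms span a dense subspace of `C([0,∞])`. -/
theorem lr_dense (S : Submodule ℝ C(ENNReal, ℝ)) (hc : IsClosed (S : Set C(ENNReal, ℝ)))
    (h1 : (1 : C(ENNReal, ℝ)) ∈ S)
    (hS : ∀ (r R : ℝ) (hr : 0 < r), r < R → lr r R hr ∈ S) : S = ⊤ := by
  rw [eq_top_iff]
  intro χ _
  show χ ∈ (S : Set C(ENNReal, ℝ))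
  rw [← hc.closure_eq, Metric.mem_closure_iff]
  intro ε0 hε0
  obtain ⟨ε, hε, rfl⟩ : ∃ ε > 0, 4 * ε = ε0 := ⟨ε0 / 4, by positivity, by ring⟩
  have hnb : ∀ s : ENNReal, {u | |χ u - χ s| < ε / 4} ∈ 𝓝 s := by
    intro s
    have := χ.continuous.continuousAt (x := s) (Metric.ball_mem_nhds (χ s) (show 0 < ε / 4 by positivity))
    simpa [Metric.ball, Real.dist_eq] using this
  let B : Set ENNReal := {p | 0 < p ∧ p < ⊤ ∧ ∃ g ∈ S, (∀ u, p ≤ u → g u = χ p) ∧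
    ∀ u, |g u - χ (min u p)| ≤ ε}
  have hext : ∀ p ∈ B, ∀ q, p < q → q < ⊤ → (∀ u, p ≤ u → u ≤ q → |χ u - χ p| ≤ ε / 2) → q ∈ B := by
    rintro p ⟨hp0, hpt, g, hg, hg1, hg2⟩ q hpq hqt hosc
    obtain ⟨ρ, hρ, hρ0, hρ1, hρ2⟩ := exists_ramp S h1 hS hp0 hpq hqt
    refine ⟨hp0.trans hpq, hqt, g + (χ q - χ p) • ρ, S.add_mem hg (S.smul_mem _ hρ), ?_, ?_⟩
    · intro u hu
      simp [hg1 u (hpq.le.trans hu), hρ1 u hu]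
    · intro u
      simp only [ContinuousMap.add_apply, ContinuousMap.smul_apply, smul_eq_mul]
      rcases le_total u p with h | h
      · have := hg2 u
        rw [min_eq_left h] at this
        rw [hρ0 u h, min_eq_left (h.trans hpq.le)]; simpa using this
      · rw [hg1 u h]
        have hv := hosc (min u q) (le_min h hpq.le) (min_le_right _ _)
        have hq := hosc q hpq.le le_rfl
        obtain ⟨r0, r1⟩ := hρ2 u
        have : |(χ q - χ p) * ρ u| ≤ ε / 2 := by
          rw [abs_mul, abs_of_nonneg r0]
          nlinarith [abs_nonneg (χ q - χ p)]
        rw [abs_le] at *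
        constructor <;> linarith
  have hne : B.Nonempty := by
    obtain ⟨q, hq, hsub⟩ := exists_Ico_subset_of_mem_nhds (hnb 0) ⟨⊤, by simp⟩
    obtain ⟨p, hp, hpq⟩ := exists_between hq
    refine ⟨p, hp, hpq.trans_le le_top, χ p • 1, S.smul_mem _ h1, by simp, fun u => ?_⟩
    have e1 := hsub ⟨hp.le, hpq⟩
    have e2 := hsub (a := min u p) ⟨by simp, (min_le_right _ _).trans_lt hpq⟩
    simp only [Set.mem_setOf_eq, ContinuousMap.smul_apply, ContinuousMap.one_apply, smul_eq_mul,
      mul_one] at *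
    rw [abs_lt] at e1 e2
    rw [abs_le]; constructor <;> linarith
  set s := sSup B with hs
  have hs0 : 0 < s := by
    obtain ⟨p, hp⟩ := hne
    exact lt_of_lt_of_le hp.1 (le_sSup hp)
  obtain ⟨l, hl, hsubl⟩ := exists_Ioc_subset_of_mem_nhds (hnb s) ⟨0, hs0⟩
  obtain ⟨p, hpB, hlp⟩ := exists_lt_of_lt_csSup hne hl
  have hps : p ≤ s := le_sSup hpB
  have hst : s = ⊤ := by
    by_contra hst
    obtain ⟨r, hr, hsubr⟩ := exists_Ico_subset_of_mem_nhds (hnb s) ⟨⊤, lt_top_iff_ne_top.2 hst⟩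
    obtain ⟨q, hsq, hqr⟩ := exists_between hr
    have : q ∈ B := by
      refine hext p hpB q (hps.trans_lt hsq) (hqr.trans_le le_top) fun u hu huq => ?_
      have e1 := hsubl ⟨hlp, hps⟩
      have e2 : |χ u - χ s| < ε / 4 := by
        rcases le_total u s with h | h
        · exact hsubl ⟨hlp.trans_le hu, h⟩
        · exact hsubr ⟨h, huq.trans_lt hqr⟩
      simp only [Set.mem_setOf_eq] at e1
      rw [abs_lt] at e1 e2
      rw [abs_le]; constructor <;> linarith
    exact absurd (le_sSup this) (not_le.2 hsq)
  obtain ⟨hp0, hpt, g, hg, hg1, hg2⟩ := hpB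
  refine ⟨g, hg, lt_of_le_of_lt ((ContinuousMap.dist_le (show 0 ≤ 2 * ε by positivity)).2 fun u => ?_)
    (by linarith : 2 * ε < 4 * ε)⟩
  rw [Real.dist_eq]
  have e := hg2 u
  rcases le_total u p with h | h
  · rw [min_eq_left h] at e
    rw [abs_le] at *; constructor <;> linarith
  · rw [min_eq_right h] at e
    have e1 := hsubl ⟨hlp, hps⟩
    have e2 := hsubl (a := u) ⟨hlp.trans_le h, hst ▸ le_top⟩
    simp only [Set.mem_setOf_eq] at e1 e2
    rw [abs_lt] at e1 e2
    rw [abs_le] at *; constructor <;> linarith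

end interval
end EQ

namespace EQ
section berk2
variable {K : Type*} [NontriviallyNormedField K] [IsAlgClosed K] [CompleteSpace K] [IsUltrametricDist K]

theorem toFun_zero (x : BerkA1 K) : x.toFun 0 = 0 := by simpa using x.restricts' 0

theorem toFun_natCast_le (x : BerkA1 K) (n : ℕ) : x.toFun (n : K[X]) ≤ 1 := by
  have := x.restricts' (n : K)
  rw [Polynomial.C_eq_natCast] at this
  rw [this]; exact IsUltrametricDist.norm_natCast_le_one K n

theorem toFun_sum_le (x : BerkA1 K) {ι : Type*} (s : Finset ι) (F : ι → K[X]) :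
    x.toFun (∑ i ∈ s, F i) ≤ ∑ i ∈ s, x.toFun (F i) := by
  induction s using Finset.induction_on with
  | empty => simp [toFun_zero]
  | insert a s ha ih =>
    rw [Finset.sum_insert ha, Finset.sum_insert ha]
    exact (x.add_le' _ _).trans (add_le_add le_rfl ih)

/-- Points of the Berkovich line are automatically ultrametric. -/
theorem toFun_add_le_max (x : BerkA1 K) (p q : K[X]) :
    x.toFun (p + q) ≤ max (x.toFun p) (x.toFun q) := by
  set M := max (x.toFun p) (x.toFun q) with hM
  have hM0 : 0 ≤ M := (x.nonneg' p).trans (le_max_left _ _)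
  have key : ∀ n : ℕ, x.toFun (p + q) ^ n ≤ (n + 1 : ℝ) * M ^ n := by
    intro n
    rw [← x.map_pow, add_pow]
    refine (toFun_sum_le x _ _).trans ?_
    have : ∀ m ∈ Finset.range (n + 1), x.toFun (p ^ m * q ^ (n - m) * (n.choose m : K[X])) ≤ M ^ n := by
      intro m hm
      have hm' : m ≤ n := Nat.lt_succ_iff.1 (Finset.mem_range.1 hm)
      rw [x.map_mul', x.map_mul', x.map_pow, x.map_pow]
      have h1 : x.toFun p ^ m ≤ M ^ m := pow_le_pow_left₀ (x.nonneg' _) (le_max_left _ _) _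
      have h2 : x.toFun q ^ (n - m) ≤ M ^ (n - m) :=
        pow_le_pow_left₀ (x.nonneg' _) (le_max_right _ _) _
      calc x.toFun p ^ m * x.toFun q ^ (n - m) * x.toFun (n.choose m : K[X])
          ≤ M ^ m * M ^ (n - m) * 1 := by
            refine mul_le_mul (mul_le_mul h1 h2 (pow_nonneg (x.nonneg' _) _) (by positivity))
              (toFun_natCast_le x _) (x.nonneg' _) (by positivity)
        _ = M ^ n := by rw [mul_one, ← pow_add, Nat.add_sub_cancel' hm']
    refine (Finset.sum_le_sum this).trans ?_
    simp
  by_contra hlt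
  push Not at hlt
  have hpos : 0 < x.toFun (p + q) := hM0.trans_lt hlt
  set c := M / x.toFun (p + q) with hc
  have hc0 : 0 ≤ c := by positivity
  have hc1 : c < 1 := (div_lt_one hpos).2 hlt
  have h2 : ∀ n : ℕ, (1 : ℝ) ≤ n * c ^ n + c ^ n := by
    intro n
    have := key n
    rw [hc, div_pow]
    have hp : 0 < x.toFun (p + q) ^ n := by positivity
    rw [← sub_nonneg]
    have e : (n * (M ^ n / x.toFun (p + q) ^ n) + M ^ n / x.toFun (p + q) ^ n) - 1
      = ((n + 1) * M ^ n - x.toFun (p + q) ^ n) / x.toFun (p + q) ^ n := by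
      field_simp
    rw [e]; exact div_nonneg (by linarith) hp.le
  have h3 : Tendsto (fun n : ℕ => (n : ℝ) * c ^ n + c ^ n) atTop (𝓝 (0 + 0)) :=
    (tendsto_self_mul_const_pow_of_lt_one hc0 hc1).add (tendsto_pow_atTop_nhds_zero_of_lt_one hc0 hc1)
  have := ge_of_tendsto' h3 h2
  norm_num at this

/-- Distance of a Berkovich point from the classical point `a`. -/
noncomputable def tdist (a : K) : C(BerkP1 K, ENNReal) where
  toFun := fun x => Option.elim x ⊤ (fun x : BerkA1 K => ENNReal.ofReal (x.toFun (X - C a)))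
  continuous_toFun := by
    rw [OnePoint.continuous_iff]
    constructor
    · show Tendsto (fun x : BerkA1 K => ENNReal.ofReal (x.toFun (X - C a))) _ (𝓝 ⊤)
      rw [ENNReal.tendsto_nhds_top_iff_nnreal]
      intro r
      have hK := BerkA1.isCompact_ball K (r + ‖a‖)
      refine Filter.mem_of_superset (hK.compl_mem_coclosedCompact_of_isClosed hK.isClosed) ?_
      intro x hx
      simp only [Set.mem_compl_iff, Set.mem_setOf_eq, not_le] at hx
      have h1 : x.toFun X ≤ x.toFun (X - C a) + ‖a‖ := by
        have := x.add_le' (X - C a) (C a)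
        rwa [sub_add_cancel, x.restricts'] at this
      simp only [Set.mem_setOf_eq]
      rw [← ENNReal.ofReal_coe_nnreal]
      exact (ENNReal.ofReal_lt_ofReal_iff_of_nonneg r.coe_nonneg).2 (by linarith)
    · exact ENNReal.continuous_ofReal.comp (BerkA1.continuous_eval K _)

theorem tdist_infty (a : K) : tdist a (OnePoint.infty : BerkP1 K) = ⊤ := rfl

theorem tdist_coe (a : K) (x : BerkA1 K) :
    tdist a (x : BerkP1 K) = ENNReal.ofReal (x.toFun (X - C a)) := rfl

theorem tdist_iota_infty (a : K) : tdist a (iota K OnePoint.infty) = ⊤ := rfl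

theorem tdist_iota_coe (a z : K) : tdist a (iota K (z : OnePoint K)) = ENNReal.ofReal ‖z - a‖ := by
  show ENNReal.ofReal ‖(X - C a).eval z‖ = _
  simp

theorem tdist_max (a b : K) (x : BerkP1 K) :
    tdist a x ≤ max (tdist b x) (ENNReal.ofReal ‖a - b‖) := by
  induction x using OnePoint.rec with
  | infty => simp [tdist_infty]
  | coe x =>
    rw [tdist_coe, tdist_coe, ← ENNReal.ofReal_max]
    refine ENNReal.ofReal_le_ofReal ?_
    have := toFun_add_le_max x (X - C b) (C (b - a))
    rw [x.restricts', norm_sub_rev] at this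
    convert this using 2
    rw [C_sub]; ring

theorem tdist_max' (a b : K) (x : BerkP1 K) :
    ENNReal.ofReal ‖a - b‖ ≤ max (tdist a x) (tdist b x) := by
  induction x using OnePoint.rec with
  | infty => simp [tdist_infty]
  | coe x =>
    rw [tdist_coe, tdist_coe, ← ENNReal.ofReal_max]
    refine ENNReal.ofReal_le_ofReal ?_
    have := toFun_add_le_max x (X - C a) (C (-1) * (X - C b))
    rw [x.map_mul', x.restricts'] at this
    have e : (X - C a + C (-1) * (X - C b) : K[X]) = C (b - a) := by
      rw [C_sub, C_neg, C_1]; ring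
    rw [e, x.restricts', norm_sub_rev] at this
    simpa using this

theorem tdist_mul (χ₁ χ₂ : ENNReal → ℝ) (a b : K) (x : BerkP1 K) :
    χ₁ (tdist a x) * χ₂ (tdist b x) =
      χ₁ (max (tdist a x) (ENNReal.ofReal ‖a - b‖)) * χ₂ (max (tdist a x) (ENNReal.ofReal ‖a - b‖))
      + χ₂ (ENNReal.ofReal ‖a - b‖) * (χ₁ (min (tdist a x) (ENNReal.ofReal ‖a - b‖))
        - χ₁ (ENNReal.ofReal ‖a - b‖))
      + χ₁ (ENNReal.ofReal ‖a - b‖) * (χ₂ (min (tdist b x) (ENNReal.ofReal ‖a - b‖))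
        - χ₂ (ENNReal.ofReal ‖a - b‖)) := by
  have h1 := tdist_max a b x
  have h2 := tdist_max b a x
  have h3 := tdist_max' a b x
  rw [norm_sub_rev] at h2
  set R := ENNReal.ofReal ‖a - b‖
  set u := tdist a x
  set v := tdist b x
  rcases lt_or_ge R u with h | h
  · have hv : u ≤ v := by
      rcases le_max_iff.1 h1 with h' | h'
      · exact h'
      · exact absurd h' (not_le.2 h)
    have hv' : v ≤ u := by
      rcases le_max_iff.1 h2 with h' | h'
      · exact h'
      · exact h'.trans h.le
    have e : u = v := le_antisymm hv hv'
    rw [← e, max_eq_left h.le, min_eq_right h.le]; ring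
  · have hv : v ≤ R := h2.trans (max_le h le_rfl)
    rw [max_eq_right h, min_eq_left h, min_eq_left hv]
    rcases le_max_iff.1 h3 with h' | h'
    · rw [le_antisymm h h']; ring
    · rw [le_antisymm hv h']; ring

theorem tdist_separates {x y : BerkP1 K} (h : ∀ a : K, tdist a x = tdist a y) : x = y := by
  induction x using OnePoint.rec with
  | infty =>
    induction y using OnePoint.rec with
    | infty => rfl
    | coe y => have := h 0; rw [tdist_infty, tdist_coe] at this; simp at this
  | coe x =>
    induction y using OnePoint.rec with
    | infty => have := h 0; rw [tdist_infty, tdist_coe] at this; simp at this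
    | coe y =>
      congr 1
      apply BerkA1.ext_toFun
      have h' : ∀ a : K, x.toFun (X - C a) = y.toFun (X - C a) := by
        intro a
        have := h a
        rw [tdist_coe, tdist_coe] at this
        exact (ENNReal.ofReal_eq_ofReal_iff (x.nonneg' _) (y.nonneg' _)).1 this
      have hm : ∀ m : Multiset K, x.toFun (m.map fun a => X - C a).prod =
          y.toFun (m.map fun a => X - C a).prod := by
        intro m
        induction m using Multiset.induction_on with
        | empty => simp [BerkA1.map_one]
        | cons a m ih => simp only [Multiset.map_cons, Multiset.prod_cons, BerkA1.map_mul', ih, h' a]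
      funext p
      rw [(IsAlgClosed.splits p).eq_prod_roots, x.map_mul', y.map_mul', x.restricts', y.restricts', hm]

/-- The linear span of functions of one distance. -/
noncomputable def tspan (K : Type*) [NontriviallyNormedField K] [IsAlgClosed K] [CompleteSpace K]
    [IsUltrametricDist K] : Submodule ℝ C(BerkP1 K, ℝ) :=
  Submodule.span ℝ {φ | ∃ (a : K) (χ : C(ENNReal, ℝ)), φ = χ.comp (tdist a)}

theorem comp_mem_tspan (a : K) (χ : C(ENNReal, ℝ)) : χ.comp (tdist a) ∈ tspan K :=
  Submodule.subset_span ⟨a, χ, rfl⟩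

theorem tspan_one : (1 : C(BerkP1 K, ℝ)) ∈ tspan K := by
  have := comp_mem_tspan (0 : K) 1
  exact this

theorem tspan_mul {φ ψ : C(BerkP1 K, ℝ)} (hφ : φ ∈ tspan K) (hψ : ψ ∈ tspan K) : φ * ψ ∈ tspan K := by
  have : ∀ φ ∈ tspan K, ∀ ψ ∈ tspan K, φ * ψ ∈ tspan K := by
    intro φ hφ ψ hψ
    refine Submodule.span_induction₂ (p := fun φ ψ _ _ => φ * ψ ∈ tspan K) ?_ ?_ ?_ ?_ ?_ ?_ ?_ hφ hψ
    · rintro _ _ ⟨a, χ₁, rfl⟩ ⟨b, χ₂, rfl⟩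
      set R := ENNReal.ofReal ‖a - b‖ with hR
      let mx : C(ENNReal, ENNReal) := ⟨fun u => max u R, by fun_prop⟩
      let mn : C(ENNReal, ENNReal) := ⟨fun u => min u R, by fun_prop⟩
      have e : χ₁.comp (tdist a) * χ₂.comp (tdist b) =
          ((χ₁ * χ₂).comp mx).comp (tdist a)
          + χ₂ R • ((χ₁.comp mn).comp (tdist a) - χ₁ R • 1)
          + χ₁ R • ((χ₂.comp mn).comp (tdist b) - χ₂ R • 1) := by
        ext x
        have := tdist_mul χ₁ χ₂ a b x
        rw [← hR] at this
        simpa [mx, mn] using this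
      rw [e]
      exact add_mem (add_mem (comp_mem_tspan _ _) (Submodule.smul_mem _ _ (sub_mem (comp_mem_tspan _ _)
        (Submodule.smul_mem _ _ tspan_one)))) (Submodule.smul_mem _ _ (sub_mem (comp_mem_tspan _ _)
        (Submodule.smul_mem _ _ tspan_one)))
    · intro y _; rw [zero_mul]; exact zero_mem _
    · intro y _; rw [mul_zero]; exact zero_mem _
    · intro x y z _ _ _ h1 h2; rw [add_mul]; exact add_mem h1 h2
    · intro x y z _ _ _ h1 h2; rw [mul_add]; exact add_mem h1 h2
    · intro r x y _ _ h; rw [smul_mul_assoc]; exact Submodule.smul_mem _ _ h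
    · intro r x y _ _ h; rw [mul_smul_comm]; exact Submodule.smul_mem _ _ h
  exact this φ hφ ψ hψ

/-- A closed subspace of `C(P¹)` containing the constants and the truncated logarithmic
potentials of classical points is everything. -/
theorem potentials_dense (S : Submodule ℝ C(BerkP1 K, ℝ)) (hc : IsClosed (S : Set C(BerkP1 K, ℝ)))
    (h1 : (1 : C(BerkP1 K, ℝ)) ∈ S)
    (hS : ∀ (a : K) (r R : ℝ) (hr : 0 < r), r < R → (lr r R hr).comp (tdist a) ∈ S) : S = ⊤ := by
  have hle : tspan K ≤ S := by
    refine Submodule.span_le.2 ?_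
    rintro _ ⟨a, χ, rfl⟩
    let L : C(ENNReal, ℝ) →ₐ[ℝ] C(BerkP1 K, ℝ) := ContinuousMap.compRightAlgHom ℝ ℝ (tdist a)
    have hL : Continuous L := ContinuousMap.compRightAlgHom_continuous ℝ ℝ (tdist a)
    have : S.comap L.toLinearMap = ⊤ := by
      refine lr_dense _ ?_ ?_ ?_
      · exact hc.preimage hL
      · show L 1 ∈ S
        rw [map_one]; exact h1
      · intro r R hr hrR
        exact hS a r R hr hrR
    have h2 : χ ∈ S.comap L.toLinearMap := by rw [this]; trivial
    exact h2
  let A : Subalgebra ℝ C(BerkP1 K, ℝ) := (tspan K).toSubalgebra tspan_one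
    (fun x y hx hy => tspan_mul hx hy)
  have hsep : A.SeparatesPoints := by
    intro x y hxy
    have : ∃ a : K, tdist a x ≠ tdist a y := by
      by_contra hcon
      push Not at hcon
      exact hxy (tdist_separates hcon)
    obtain ⟨a, ha⟩ := this
    let χ : C(ENNReal, ℝ) := ⟨fun u => (ENNReal.orderIsoUnitIntervalBirational u : ℝ),
      continuous_subtype_val.comp ENNReal.orderIsoUnitIntervalBirational.toHomeomorph.continuous⟩
    refine ⟨_, ⟨χ.comp (tdist a), comp_mem_tspan a χ, rfl⟩, ?_⟩
    intro he
    exact ha (ENNReal.orderIsoUnitIntervalBirational.injective (Subtype.ext he))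
  have htop := ContinuousMap.subalgebra_topologicalClosure_eq_top_of_separatesPoints A hsep
  rw [eq_top_iff]
  intro φ _
  have : φ ∈ A.topologicalClosure := by rw [htop]; trivial
  exact closure_minimal (s := (A : Set C(BerkP1 K, ℝ))) hle hc this

end berk2
end EQ

namespace EQ
section equi
variable {K : Type*} [NontriviallyNormedField K] [IsAlgClosed K] [CompleteSpace K] [IsUltrametricDist K]

/-- sum of a test function over a finite multiset of classical points -/
noncomputable def msum (m : Multiset (OnePoint K)) (φ : C(BerkP1 K, ℝ)) : ℝ :=
  (m.map fun q => φ (iota K q)).sum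

/-- average of a test function over a finite multiset of classical points -/
noncomputable def av (m : Multiset (OnePoint K)) (φ : C(BerkP1 K, ℝ)) : ℝ := msum m φ / m.card

theorem av_add (m : Multiset (OnePoint K)) (φ ψ : C(BerkP1 K, ℝ)) : av m (φ + ψ) = av m φ + av m ψ := by
  simp [av, msum, add_div]

theorem av_smul (m : Multiset (OnePoint K)) (c : ℝ) (φ : C(BerkP1 K, ℝ)) : av m (c • φ) = c * av m φ := by
  simp [av, msum, Multiset.sum_map_mul_left, mul_div_assoc]

theorem av_one {m : Multiset (OnePoint K)} (hm : 0 < m.card) : av m 1 = 1 := by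
  have : (m.card : ℝ) ≠ 0 := by exact_mod_cast hm.ne'
  simp [av, msum, this]

theorem av_zero (m : Multiset (OnePoint K)) : av m 0 = 0 := by simp [av, msum]

theorem av_mono (m : Multiset (OnePoint K)) {φ ψ : C(BerkP1 K, ℝ)} (h : φ ≤ ψ) : av m φ ≤ av m ψ := by
  refine div_le_div_of_nonneg_right ?_ (Nat.cast_nonneg _)
  exact Multiset.sum_map_le_sum_map _ _ fun q _ => h _

theorem abs_av_le (m : Multiset (OnePoint K)) {φ : C(BerkP1 K, ℝ)} : |av m φ| ≤ ‖φ‖ := by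
  by_cases hm : 0 < m.card
  · rw [abs_le]
    have h1 : φ ≤ ‖φ‖ • (1 : C(BerkP1 K, ℝ)) := fun x => by
      simpa using (le_abs_self _).trans (φ.norm_coe_le_norm x)
    have h2 : (-‖φ‖) • (1 : C(BerkP1 K, ℝ)) ≤ φ := fun x => by
      simpa using (abs_le.1 (φ.norm_coe_le_norm x)).1
    have e1 := av_mono m h1
    have e2 := av_mono m h2
    rw [av_smul, av_one hm, mul_one] at e1 e2
    exact ⟨e2, e1⟩
  · have : m.card = 0 := by omega
    simp [av, this]

theorem exists_lim (m : ℕ → Multiset (OnePoint K)) (φ : C(BerkP1 K, ℝ)) :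
    ∃ L, Tendsto (fun n => av (m n) φ) (hyperfilter ℕ : Filter ℕ) (𝓝 L) := by
  have h := (isCompact_Icc (a := -‖φ‖) (b := ‖φ‖)).ultrafilter_le_nhds
    ((hyperfilter ℕ).map fun n => av (m n) φ) (by
      rw [le_principal_iff]
      show ∀ᶠ n in (hyperfilter ℕ : Filter ℕ), av (m n) φ ∈ Set.Icc (-‖φ‖) ‖φ‖
      exact Filter.Eventually.of_forall fun n => abs_le.1 (abs_av_le (m n)))
  obtain ⟨L, _, hL⟩ := h
  exact ⟨L, hL⟩

/-- the limit functional along a nonprincipal ultrafilter -/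
noncomputable def ulim (m : ℕ → Multiset (OnePoint K)) (φ : C(BerkP1 K, ℝ)) : ℝ := (exists_lim m φ).choose

theorem ulim_spec (m : ℕ → Multiset (OnePoint K)) (φ : C(BerkP1 K, ℝ)) :
    Tendsto (fun n => av (m n) φ) (hyperfilter ℕ : Filter ℕ) (𝓝 (ulim m φ)) := (exists_lim m φ).choose_spec

theorem ulim_eq {m : ℕ → Multiset (OnePoint K)} {φ : C(BerkP1 K, ℝ)} {L : ℝ}
    (h : Tendsto (fun n => av (m n) φ) (hyperfilter ℕ : Filter ℕ) (𝓝 L)) : ulim m φ = L :=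
  tendsto_nhds_unique (ulim_spec m φ) h

theorem ulim_eq' {m : ℕ → Multiset (OnePoint K)} {φ : C(BerkP1 K, ℝ)} {L : ℝ}
    (h : Tendsto (fun n => av (m n) φ) atTop (𝓝 L)) : ulim m φ = L :=
  ulim_eq (h.mono_left (Nat.hyperfilter_le_atTop))

theorem ulim_add (m : ℕ → Multiset (OnePoint K)) (φ ψ : C(BerkP1 K, ℝ)) :
    ulim m (φ + ψ) = ulim m φ + ulim m ψ :=
  ulim_eq (by simpa only [av_add] using (ulim_spec m φ).add (ulim_spec m ψ))

theorem ulim_smul (m : ℕ → Multiset (OnePoint K)) (c : ℝ) (φ : C(BerkP1 K, ℝ)) :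
    ulim m (c • φ) = c * ulim m φ :=
  ulim_eq (by simpa only [av_smul] using (ulim_spec m φ).const_mul c)

theorem ulim_mono (m : ℕ → Multiset (OnePoint K)) {φ ψ : C(BerkP1 K, ℝ)} (h : φ ≤ ψ) :
    ulim m φ ≤ ulim m ψ :=
  le_of_tendsto_of_tendsto' (ulim_spec m φ) (ulim_spec m ψ) fun n => av_mono _ h

theorem abs_ulim_le (m : ℕ → Multiset (OnePoint K)) (φ : C(BerkP1 K, ℝ)) : |ulim m φ| ≤ ‖φ‖ :=
  le_of_tendsto' (ulim_spec m φ).abs fun n => abs_av_le _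

/-- a sequence of multisets whose averages of truncated potentials converge to given values -/
def PConv (h : K → ℝ → ℝ) (m : ℕ → Multiset (OnePoint K)) : Prop :=
  (∀ᶠ n in atTop, 0 < (m n).card) ∧ ∀ (a : K) (r R : ℝ) (hr : 0 < r), r < R →
    Tendsto (fun n => av (m n) ((lr r R hr).comp (tdist a))) atTop (𝓝 (h a r - h a R + Real.log R))

theorem PConv.tendsto {h : K → ℝ → ℝ} {m₀ m : ℕ → Multiset (OnePoint K)} (h₀ : PConv h m₀)
    (hm : PConv h m) (φ : C(BerkP1 K, ℝ)) : Tendsto (fun n => av (m n) φ) atTop (𝓝 (ulim m₀ φ)) := by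
  let S : Submodule ℝ C(BerkP1 K, ℝ) :=
    { carrier := {φ | Tendsto (fun n => av (m n) φ) atTop (𝓝 (ulim m₀ φ))}
      zero_mem' := by
        show Tendsto (fun n => av (m n) 0) atTop (𝓝 (ulim m₀ 0))
        have : ulim m₀ 0 = 0 := ulim_eq (by simp only [av_zero]; exact tendsto_const_nhds)
        rw [this]; simp only [av_zero]; exact tendsto_const_nhds
      add_mem' := by
        intro φ ψ hφ hψ
        show Tendsto (fun n => av (m n) (φ + ψ)) atTop (𝓝 (ulim m₀ (φ + ψ)))
        rw [ulim_add]; simp only [av_add]; exact Tendsto.add hφ hψ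
      smul_mem' := by
        intro c φ hφ
        show Tendsto (fun n => av (m n) (c • φ)) atTop (𝓝 (ulim m₀ (c • φ)))
        rw [ulim_smul]; simp only [av_smul]; exact Tendsto.const_mul c hφ }
  have hS : S = ⊤ := by
    refine potentials_dense S ?_ ?_ ?_
    · refine isClosed_of_closure_subset fun φ hφ => ?_
      show Tendsto (fun n => av (m n) φ) atTop (𝓝 (ulim m₀ φ))
      rw [Metric.tendsto_atTop]
      intro ε hε
      obtain ⟨ψ, hψ, hd⟩ := Metric.mem_closure_iff.1 hφ (ε / 3) (by positivity)
      have hψ' : Tendsto (fun n => av (m n) ψ) atTop (𝓝 (ulim m₀ ψ)) := hψ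
      obtain ⟨N, hN⟩ := Metric.tendsto_atTop.1 hψ' (ε / 3) (by positivity)
      refine ⟨N, fun n hn => ?_⟩
      have e0 := hN n hn
      rw [dist_eq_norm] at hd
      have e : φ = (φ - ψ) + ψ := by abel
      have e1 : |av (m n) (φ - ψ)| < ε / 3 := (abs_av_le _).trans_lt hd
      have e2 : |ulim m₀ (φ - ψ)| < ε / 3 := (abs_ulim_le _ _).trans_lt hd
      rw [e, av_add, ulim_add, Real.dist_eq]
      rw [Real.dist_eq] at e0
      rw [abs_lt] at *
      constructor <;> linarith
    · show Tendsto (fun n => av (m n) 1) atTop (𝓝 (ulim m₀ 1))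
      have : ulim m₀ 1 = 1 := by
        refine ulim_eq' (tendsto_const_nhds.congr' ?_)
        filter_upwards [h₀.1] with n hn
        rw [av_one hn]
      rw [this]
      refine tendsto_const_nhds.congr' ?_
      filter_upwards [hm.1] with n hn
      rw [av_one hn]
    · intro a r R hr hrR
      show Tendsto (fun n => av (m n) _) atTop (𝓝 (ulim m₀ _))
      rw [ulim_eq' (h₀.2 a r R hr hrR)]
      exact hm.2 a r R hr hrR
  have : φ ∈ S := by rw [hS]; trivial
  exact this

/-- Existence of the common limit measure. -/
theorem exists_measure {h : K → ℝ → ℝ} {m₀ : ℕ → Multiset (OnePoint K)} (h₀ : PConv h m₀) :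
    ∃ μ : Measure (BerkP1 K), IsProbabilityMeasure μ ∧ μ.Regular ∧
      ∀ m, PConv h m → ∀ φ : C(BerkP1 K, ℝ), Tendsto (fun n => av (m n) φ) atTop (𝓝 (∫ x, φ x ∂μ)) := by
  let Λ : CompactlySupportedContinuousMap (BerkP1 K) ℝ →ₚ[ℝ] ℝ :=
  { toFun g := ulim m₀ g.toContinuousMap
    map_add' g g' := ulim_add m₀ _ _
    map_smul' c g := ulim_smul m₀ _ _
    monotone' g g' hgg' := ulim_mono m₀ hgg' }
  have hintg : ∀ φ : C(BerkP1 K, ℝ), ∫ x, φ x ∂(RealRMK.rieszMeasure Λ) = ulim m₀ φ := by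
    intro φ
    let g' : CompactlySupportedContinuousMap (BerkP1 K) ℝ :=
    { toFun := φ
      hasCompactSupport' := HasCompactSupport.of_compactSpace _ }
    have := RealRMK.integral_rieszMeasure Λ g'
    exact this
  refine ⟨RealRMK.rieszMeasure Λ, ?_, by infer_instance, fun m hm φ => ?_⟩
  · have h1 := hintg 1
    have : ulim m₀ 1 = 1 := by
      refine ulim_eq' (tendsto_const_nhds.congr' ?_)
      filter_upwards [h₀.1] with n hn
      rw [av_one hn]
    rw [this] at h1
    simp only [ContinuousMap.one_apply, integral_const, smul_eq_mul, mul_one] at h1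
    refine ⟨?_⟩
    rw [Measure.real, ENNReal.toReal_eq_one_iff] at h1
    exact h1
  · rw [hintg]; exact h₀.tendsto hm φ

theorem msum_proots {D : ℕ} {P : K[X]} (hP : P ≠ 0) (hD : P.natDegree ≤ D) (a : K) {r R : ℝ}
    (hr : 0 < r) (hR : r < R) : msum (proots D P) ((lr r R hr).comp (tdist a)) =
      Real.log (gn a r P) - Real.log (gn a R P) + D * Real.log R := by
  have hcard : P.roots.card = P.natDegree := (IsAlgClosed.splits P).natDegree_eq_card_roots.symm
  rw [log_gn_sub a (hr.trans hR) hr hP]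
  unfold msum proots
  rw [Multiset.map_add, Multiset.sum_add, Multiset.map_map, Multiset.map_replicate,
    Multiset.sum_replicate]
  have e : ∀ z : K, ((fun q => ((lr r R hr).comp (tdist a)) (iota K q)) ∘ fun z : K => (z : OnePoint K)) z
      = (Real.log (max ‖a - z‖ r) - Real.log (max ‖a - z‖ R)) + Real.log R := by
    intro z
    show lr r R hr (tdist a (iota K (z : OnePoint K))) = _
    rw [tdist_iota_coe, lr_ofReal hr hR.le (norm_nonneg _), norm_sub_rev]
    rcases le_total ‖a - z‖ R with h | h
    · rw [min_eq_right h, max_eq_right h, max_comm]; ring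
    · rw [min_eq_left h, max_eq_left h, max_eq_right hR.le, max_eq_left (hR.le.trans h)]; ring
  rw [Multiset.map_congr rfl fun z _ => e z, Multiset.sum_map_add]
  have e2 : ((lr r R hr).comp (tdist a)) (iota K OnePoint.infty) = Real.log R := by
    show lr r R hr (tdist a (iota K OnePoint.infty)) = _
    rw [tdist_iota_infty, lr_top hr hR.le]
  rw [e2]
  simp only [Multiset.map_const', Multiset.sum_replicate, hcard, nsmul_eq_mul]
  rw [Nat.cast_sub hD]; ring

/-- Potential-theoretic convergence criterion for zero multisets. -/
theorem pconv_of {h : K → ℝ → ℝ} {d : ℕ} (hd : 1 < d) (P : ℕ → K[X]) (D : ℕ → ℕ) (e : ℕ)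
    (hP : ∀ᶠ n in atTop, P n ≠ 0) (hD : ∀ n, (P n).natDegree ≤ D n) (hDe : ∀ n, D n = d ^ n + e)
    (hlim : ∀ (a : K) (s : ℝ), 0 < s →
      Tendsto (fun n => Real.log (gn a s (P n)) / (d : ℝ) ^ n) atTop (𝓝 (h a s))) :
    PConv h fun n => proots (D n) (P n) := by
  have hcard : ∀ n, (proots (D n) (P n)).card = D n := fun n => card_proots (hD n)
  have hpos : ∀ n, 0 < D n := fun n => by rw [hDe]; have := pow_pos (show 0 < d by omega) n; omega
  refine ⟨Eventually.of_forall fun n => by rw [hcard]; exact hpos n, fun a r R hr hR => ?_⟩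
  have hratio : Tendsto (fun n => (d : ℝ) ^ n / (D n : ℝ)) atTop (𝓝 1) := by
    have h1 : Tendsto (fun n : ℕ => 1 + (e : ℝ) * ((d : ℝ) ^ n)⁻¹) atTop (𝓝 (1 + e * 0)) := by
      refine tendsto_const_nhds.add (Tendsto.const_mul _ ?_)
      exact (tendsto_pow_atTop_atTop_of_one_lt (by exact_mod_cast hd)).inv_tendsto_atTop
    have h2 := h1.inv₀ (by simp)
    simp only [mul_zero, add_zero, inv_one] at h2
    refine h2.congr fun n => ?_
    have : (0 : ℝ) < (d : ℝ) ^ n := pow_pos (by exact_mod_cast (show 0 < d by omega)) n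
    have h3 : (0 : ℝ) < D n := by exact_mod_cast hpos n
    rw [hDe] at h3 ⊢
    push_cast at h3 ⊢
    field_simp
  have hT := (hratio.mul ((hlim a r hr).sub (hlim a R (hr.trans hR)))).add_const (Real.log R)
  rw [one_mul] at hT
  refine hT.congr' ?_
  filter_upwards [hP] with n hn
  show _ = msum _ _ / _
  rw [hcard, msum_proots hn (hD n) a hr hR]
  have : (0 : ℝ) < (d : ℝ) ^ n := pow_pos (by exact_mod_cast (show 0 < d by omega)) n
  have h3 : (0 : ℝ) < D n := by exact_mod_cast hpos n
  field_simp

end equi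
end EQ

namespace EQ
section assembly
variable {K : Type*} [NontriviallyNormedField K] [IsAlgClosed K] [CompleteSpace K] [IsUltrametricDist K]

/-- counting measure of a multiset of classical points -/
noncomputable def mmeas (m : Multiset (OnePoint K)) : Measure (BerkP1 K) :=
  Measure.sum fun a : OnePoint K => (m.count a : ENNReal) • Measure.dirac (iota K a)

theorem mmeas_zero : mmeas (0 : Multiset (OnePoint K)) = 0 := by
  ext s hs
  simp [mmeas]

theorem mmeas_cons (b : OnePoint K) (m : Multiset (OnePoint K)) :
    mmeas (b ::ₘ m) = Measure.dirac (iota K b) + mmeas m := by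
  ext s hs
  rw [mmeas, mmeas, Measure.sum_apply _ hs, Measure.add_apply, Measure.sum_apply _ hs]
  have : ∀ a : OnePoint K, (((b ::ₘ m).count a : ENNReal) • Measure.dirac (iota K a)) s
      = (if a = b then Measure.dirac (iota K b) s else 0)
        + ((m.count a : ENNReal) • Measure.dirac (iota K a)) s := by
    intro a
    rw [Multiset.count_cons]
    by_cases h : a = b
    · subst h
      rw [if_pos rfl, if_pos rfl, Measure.smul_apply, Measure.smul_apply, smul_eq_mul, smul_eq_mul]
      push_cast; ring
    · rw [if_neg h, if_neg h]; simp
  rw [tsum_congr this, ENNReal.tsum_add, tsum_ite_eq]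

theorem mmeas_int (m : Multiset (OnePoint K)) (φ : C(BerkP1 K, ℝ)) :
    Integrable φ (mmeas m) ∧ ∫ x, φ x ∂(mmeas m) = msum m φ := by
  induction m using Multiset.induction_on with
  | empty => rw [mmeas_zero]; simp [msum]
  | cons b m ih =>
    have hi : Integrable φ (Measure.dirac (iota K b)) := by
      refine integrable_dirac ?_
      exact enorm_lt_top
    rw [mmeas_cons]
    refine ⟨hi.add_measure ih.1, ?_⟩
    rw [integral_add_measure hi ih.1, ih.2, integral_dirac]
    simp [msum]

theorem mmeas_av {m : Multiset (OnePoint K)} {c : ENNReal} (hc : c = m.card) (φ : C(BerkP1 K, ℝ)) :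
    ∫ x, φ x ∂(c⁻¹ • mmeas m) = av m φ := by
  rw [integral_smul_measure, (mmeas_int m φ).2, hc, av, ENNReal.toReal_inv, ENNReal.toReal_natCast,
    smul_eq_mul]
  ring

theorem count_proots_coe (d : ℕ) (P : K[X]) (z : K) : (proots d P).count (z : OnePoint K) = P.rootMultiplicity z := by
  rw [proots, Multiset.count_add, Multiset.count_replicate,
    if_neg (OnePoint.infty_ne_coe z), add_zero,
    Multiset.count_map_eq_count' _ _ OnePoint.coe_injective, count_roots]

theorem count_proots_infty (d : ℕ) (P : K[X]) : (proots d P).count OnePoint.infty = d - P.natDegree := by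
  rw [proots, Multiset.count_add, Multiset.count_replicate_self]
  simp [Multiset.count_eq_zero]

theorem proots_C_mul {k : K} (hk : k ≠ 0) (d : ℕ) (P : K[X]) : proots d (C k * P) = proots d P := by
  rw [proots, proots, roots_C_mul _ hk, natDegree_C_mul hk]

theorem eqMeasure_eq (f g : RatFunc K) :
    eqMeasure K f g = mmeas (proots (rdeg K f + rdeg K g) (eqPoly K f g)) := by
  unfold eqMeasure mmeas
  congr 1
  funext a
  congr 2
  induction a using OnePoint.rec with
  | infty => rw [count_proots_infty]; rfl
  | coe z => rw [count_proots_coe]; rfl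

theorem rdeg_C (x : K) : rdeg K (RatFunc.C x) = 0 := by simp [rdeg]

theorem NC_of_rdeg {f : RatFunc K} (h : 0 < rdeg K f) : NC f := by
  rintro c rfl
  rw [rdeg_C] at h
  exact lt_irrefl _ h

theorem pullMeasure_eq (f : RatFunc K) (hf : NC f) (c : OnePoint K) :
    pullMeasure K f c = mmeas ((Pr.of f hf).pull (hc c)) := by
  induction c using OnePoint.rec with
  | infty =>
    have e : (Pr.of f hf).pull (hc OnePoint.infty) = proots (rdeg K f) f.denom := by
      show proots (rdeg K f) (lin (hc OnePoint.infty) f.num f.denom) = _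
      rw [lin_infty, show -f.denom = C (-1) * f.denom by simp, proots_C_mul (by simp)]
    rw [e]
    unfold pullMeasure mmeas
    congr 1
    funext a
    congr 2
    induction a using OnePoint.rec with
    | infty => rw [count_proots_infty]; rfl
    | coe z => rw [count_proots_coe]; rfl
  | coe x =>
    have e1 : pullMeasure K f (x : OnePoint K) = eqMeasure K f (RatFunc.C x) := rfl
    have e : (Pr.of f hf).pull (hc (x : OnePoint K)) =
        proots (rdeg K f + rdeg K (RatFunc.C x)) (eqPoly K f (RatFunc.C x)) := by
      show proots (rdeg K f) (C 1 * f.num - C x * f.denom) = _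
      rw [rdeg_C, add_zero]
      simp [eqPoly]
    rw [e1, eqMeasure_eq, e]

theorem riter_eq (f : RatFunc K) (hf : NC f) (n : ℕ) :
    riter K f n = (Pr.it (Pr.of f hf) Pr.idp n).rat := by
  induction n with
  | zero => exact Pr.idp_rat.symm
  | succ n ih =>
    show rcomp K f (riter K f n) = ((Pr.of f hf).comp (Pr.it (Pr.of f hf) Pr.idp n)).rat
    rw [Pr.comp_rat, Pr.of_rat, ih]; rfl

theorem rdeg_riter (f : RatFunc K) (hf : NC f) (n : ℕ) : rdeg K (riter K f n) = rdeg K f ^ n := by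
  rw [riter_eq f hf, rdeg_rat, Pr.it_deg, Pr.idp_deg, mul_one]; rfl

theorem riter_NC (f : RatFunc K) (hf : NC f) (n : ℕ) : NC (riter K f n) := by
  rw [riter_eq f hf]; exact Pr.rat_NC _

theorem evalP1_eq (f : RatFunc K) (hf : NC f) : evalP1 K f = (Pr.of f hf).pt := by
  funext q
  symm
  rw [← Pr.mem_pull_iff, Pr.mem_pull _ (Pr.hc_ne_zero _)]
  induction q using OnePoint.rec with
  | infty =>
    rw [hc_infty, Pr.val_inf]
    show wd (hc (if f.denom.natDegree < f.num.natDegree then OnePoint.infty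
      else ((f.num.coeff f.denom.natDegree / f.denom.leadingCoeff : K) : OnePoint K)))
      (f.num.coeff (max f.num.natDegree f.denom.natDegree),
        f.denom.coeff (max f.num.natDegree f.denom.natDegree)) = 0
    by_cases h : f.denom.natDegree < f.num.natDegree
    · rw [if_pos h, hc_infty, max_eq_left h.le]
      simp [wd, coeff_eq_zero_of_natDegree_lt h]
    · rw [if_neg h, max_eq_right (not_lt.1 h)]
      have hne : f.denom.leadingCoeff ≠ 0 := by simp [f.denom_ne_zero]
      show 1 * f.num.coeff f.denom.natDegree
        - (f.num.coeff f.denom.natDegree / f.denom.leadingCoeff) * f.denom.leadingCoeff = 0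
      field_simp
      ring
  | coe z =>
    rw [show hc (z : OnePoint K) = (z, 1) from rfl, Pr.val_coe]
    show wd (hc (if f.denom.eval z = 0 then OnePoint.infty
      else ((f.num.eval z / f.denom.eval z : K) : OnePoint K))) (f.num.eval z, f.denom.eval z) = 0
    by_cases h : f.denom.eval z = 0
    · rw [if_pos h, hc_infty]
      simp [wd, h]
    · rw [if_neg h]
      show 1 * f.num.eval z - (f.num.eval z / f.denom.eval z) * f.denom.eval z = 0
      field_simp
      ring

theorem natDegree_eq_le (x y : Pr K) : (x.A * y.B - y.A * x.B).natDegree ≤ x.deg + y.deg := by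
  refine (natDegree_sub_le _ _).trans (max_le ?_ ?_)
  · exact natDegree_mul_le.trans (add_le_add (le_max_left _ _) (le_max_right _ _))
  · rw [mul_comm]
    exact natDegree_mul_le.trans (add_le_add (le_max_right _ _) (le_max_left _ _))

theorem main_thm (f g : RatFunc K)
    (hd : 1 < rdeg K f) (hf : NoPotentiallyGoodReductions K f) (hg : 0 < rdeg K g) :
    ∃ μ : Measure (BerkP1 K), IsProbabilityMeasure μ ∧ μ.Regular ∧
      (∀ a : OnePoint K, a ∉ exceptionalSet K f →
        WeakTendsto K
          (fun m => (((rdeg K f : ENNReal)) ^ m)⁻¹ • pullMeasure K (riter K f m) a) μ) ∧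
      WeakTendsto K
        (fun n => (((rdeg K f : ENNReal)) ^ n + (rdeg K g : ENNReal))⁻¹ •
          eqMeasure K (riter K f n) g) μ := by
  have hfN : NC f := NC_of_rdeg (by omega)
  have hgN : NC g := NC_of_rdeg hg
  set F := Pr.of f hfN with hF
  set G := Pr.of g hgN with hG
  have hFd : F.deg = rdeg K f := rfl
  have hGd : G.deg = rdeg K g := rfl
  have hd' : 1 < F.deg := hd
  have hgood : ¬ GoodNorm F := not_goodNorm f hfN hf
  have hdeg : ∀ n, (Pr.it F Pr.idp n).deg = F.deg ^ n := fun n => by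
    rw [Pr.it_deg, Pr.idp_deg, mul_one]
  have hesc := fun (a : K) (s : ℝ) (hs : 0 < s) => Pr.escape F Pr.idp hd' a hs
  let h : K → ℝ → ℝ := fun a s => if hs : 0 < s then (hesc a s hs).choose else 0
  have hh : ∀ (a : K) (s : ℝ), 0 < s →
      Tendsto (fun n => Real.log ((Pr.it F Pr.idp n).sz a s) / (F.deg : ℝ) ^ n) atTop (𝓝 (h a s)) := by
    intro a s hs
    simp only [h, dif_pos hs]
    exact (hesc a s hs).choose_spec
  -- the moving target sequence
  have hE : PConv h fun n => proots (F.deg ^ n + G.deg)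
      ((Pr.it F Pr.idp n).A * G.B - G.A * (Pr.it F Pr.idp n).B) := by
    refine pconv_of hd' _ _ G.deg ?_ ?_ (fun n => rfl) ?_
    · exact (Pr.lim_eq F G hd' hgood 0 one_pos (hh 0 1 one_pos)).1
    · intro n
      rw [← hdeg n]; exact natDegree_eq_le _ _
    · intro a s hs
      exact (Pr.lim_eq F G hd' hgood a hs (hh a s hs)).2
  obtain ⟨μ, hμ1, hμ2, hμ⟩ := exists_measure hE
  refine ⟨μ, hμ1, hμ2, fun c hc' => ?_, ?_⟩
  · intro φ
    have hP : PConv h fun n => proots (F.deg ^ n) ((Pr.it F Pr.idp n).l (hc c)) := by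
      refine pconv_of hd' _ _ 0 (Eventually.of_forall fun n => Pr.l_ne_zero _ (Pr.hc_ne_zero c)) ?_
        (fun n => by simp) ?_
      · intro n
        rw [← hdeg n]; exact Pr.natDegree_l_le _ _
      · intro a s hs
        refine Pr.lim_pull F hd' hgood ?_ a hs (hh a s hs)
        rw [exceptionalSet, Set.mem_setOf_eq, evalP1_eq f hfN] at hc'
        exact hc'
    refine (hμ _ hP φ).congr fun n => ?_
    have e : pullMeasure K (riter K f n) c = mmeas (proots (F.deg ^ n) ((Pr.it F Pr.idp n).l (hc c))) := by
      rw [pullMeasure_eq _ (riter_NC f hfN n)]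
      congr 1
      have hr : (Pr.of (riter K f n) (riter_NC f hfN n)).rat = (Pr.it F Pr.idp n).rat := by
        rw [Pr.of_rat, riter_eq f hfN]
      obtain ⟨k, hk, hl⟩ := Pr.rat_eq_l hr
      rw [Pr.pull, hl, proots_C_mul hk, Pr.rat_eq_deg hr, hdeg]
    beta_reduce
    rw [e]
    symm
    refine mmeas_av ?_ φ
    rw [card_proots (by rw [← hdeg n]; exact Pr.natDegree_l_le _ _), hFd]
    push_cast; rfl
  · intro φ
    refine (hμ _ hE φ).congr fun n => ?_
    have e : eqMeasure K (riter K f n) g = mmeas (proots (F.deg ^ n + G.deg)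
      ((Pr.it F Pr.idp n).A * G.B - G.A * (Pr.it F Pr.idp n).B)) := by
      rw [eqMeasure_eq]
      congr 1
      have hr : (Pr.of (riter K f n) (riter_NC f hfN n)).rat = (Pr.it F Pr.idp n).rat := by
        rw [Pr.of_rat, riter_eq f hfN]
      obtain ⟨k, hk, hA, hB⟩ := Pr.rat_eq hr
      have e2 : eqPoly K (riter K f n) g =
          C k * ((Pr.it F Pr.idp n).A * G.B - G.A * (Pr.it F Pr.idp n).B) := by
        have hA' : (riter K f n).num = _ := hA
        have hB' : (riter K f n).denom = _ := hB
        show (riter K f n).num * G.B - G.A * (riter K f n).denom = _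
        rw [hA', hB']; ring
      rw [e2, proots_C_mul hk, rdeg_riter f hfN, hFd, hGd]
    beta_reduce
    rw [e]
    symm
    refine mmeas_av ?_ φ
    rw [card_proots (by rw [← hdeg n]; exact natDegree_eq_le _ _), hFd, hGd]
    push_cast; rfl

end assembly
end EQ

/-- **Theorem B** (equidistribution towards the equilibrium measure, for moving targets).
If `f` has degree `d > 1` and no potentially good reductions and `g` has degree `> 0`, then
there is a Radon probability measure `μ_f` on `P^1_Berk(K)` (the equilibrium measure) such
that (i) for every non-exceptional `a`, `d^{-m} (f^m)^* δ_a → μ_f` weakly, and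
(ii) `[fⁿ = g]/(dⁿ + deg g) → μ_f` weakly. -/
theorem equidistribution_moving_targets (f g : RatFunc K)
    (hd : 1 < rdeg K f) (hf : NoPotentiallyGoodReductions K f) (hg : 0 < rdeg K g) :
    ∃ μ : Measure (BerkP1 K), IsProbabilityMeasure μ ∧ μ.Regular ∧
      (∀ a : OnePoint K, a ∉ exceptionalSet K f →
        WeakTendsto K
          (fun m => (((rdeg K f : ENNReal)) ^ m)⁻¹ • pullMeasure K (riter K f m) a) μ) ∧
      WeakTendsto K
        (fun n => (((rdeg K f : ENNReal)) ^ n + (rdeg K g : ENNReal))⁻¹ •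
          eqMeasure K (riter K f n) g) μ := by
  exact EQ.main_thm f g hd hf hg
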